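/- Let k be a field and let G be a finite group acting on the rational function field k(x1,x2,x3) by purely monomial k-automorphisms. Then the fixed field k(x1,x2,x3)^G is k-rational. -/

import Mathlib

open MvPolynomial

noncomputable section

/-- A field extension `K` of `k` is `k`-rational if it is isomorphic, as a `k`-algebra,
to a rational function field `k(x₁, …, xₙ)` in finitely many variables. -/
def IsRational (k K : Type*) [Field k] [Field K] [Algebra k K] : Prop :=
  ∃ n : ℕ, Nonempty (K ≃ₐ[k] FractionRing (MvPolynomial (Fin n) k))

namespace Monomial3

open IntermediateField Polynomial

variable {k L : Type*} [Field k] [Field L] [Algebra k L]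

/-- The part of the fixed field of `H` inside `K` is generated by `n` elements over `k`. -/
def FixGen (H : Subgroup (L ≃ₐ[k] L)) (K : IntermediateField k L) (n : ℕ) : Prop :=
  ∃ f : Fin n → L, fixedField H ⊓ K = adjoin k (Set.range f)

/-- `K` is mapped to itself by every element of `H`. -/
def Stable (H : Subgroup (L ≃ₐ[k] L)) (K : IntermediateField k L) : Prop :=
  ∀ h ∈ H, ∀ a ∈ K, h a ∈ K

theorem stable_adjoin {H : Subgroup (L ≃ₐ[k] L)} {S : Set L}
    (hS : ∀ h ∈ H, ∀ a ∈ S, h a ∈ adjoin k S) : Stable H (adjoin k S) := by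
  intro h hh a ha
  have : adjoin k S ≤ (adjoin k S).comap (h : L →ₐ[k] L) := by
    rw [adjoin_le_iff]
    intro s hs
    exact hS h hh s hs
  exact this ha

/-- The restriction of an automorphism to a stable intermediate field. -/
def restr {K : IntermediateField k L} (h : L ≃ₐ[k] L) (hK : ∀ a ∈ K, h a ∈ K) : K →+* K :=
  ((h : L →+* L).comp K.val.toRingHom).codRestrict K.toSubfield.toSubring (fun a => hK a a.2)

theorem exists_fraction {K : IntermediateField k L} {x y : L}
    (hy : y ∈ adjoin k (insert x (K : Set L))) :
    ∃ p q : K[X], y = Polynomial.aeval x p / Polynomial.aeval x q ∧ (y ≠ 0 → Polynomial.aeval x q ≠ 0) := by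
  have h : y ∈ (adjoin K {x}).restrictScalars k := by
    rw [restrictScalars_adjoin]
    rwa [Set.union_singleton]
  rw [mem_restrictScalars, mem_adjoin_simple_iff] at h
  obtain ⟨p, q, h⟩ := h
  refine ⟨p, q, h, fun h0 hq => h0 ?_⟩
  rw [h, hq, div_zero]

theorem aeval_mem {K : IntermediateField k L} {x : L} (p : K[X]) :
    Polynomial.aeval x p ∈ adjoin k (insert x (K : Set L)) := by
  have : Polynomial.aeval x p ∈ (adjoin K {x}).restrictScalars k := by
    rw [mem_restrictScalars, mem_adjoin_simple_iff]
    exact ⟨p, 1, by simp⟩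
  rw [restrictScalars_adjoin] at this
  rwa [Set.union_singleton] at this

theorem exists_poly_image {K : IntermediateField k L} {x a b : L} {h : L ≃ₐ[k] L}
    (hK : ∀ a ∈ K, h a ∈ K) (ha : a ∈ K) (hb : b ∈ K) (hx : h x = a * x + b) (p : K[X]) :
    ∃ p' : K[X], p'.natDegree ≤ p.natDegree ∧ Polynomial.aeval x p' = h (Polynomial.aeval x p) := by
  refine ⟨(p.map (restr h hK)).comp (Polynomial.C (⟨a, ha⟩ : K) * Polynomial.X + Polynomial.C (⟨b, hb⟩ : K)), ?_, ?_⟩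
  · rw [natDegree_comp]
    calc _ ≤ p.natDegree * 1 := Nat.mul_le_mul natDegree_map_le natDegree_linear_le
      _ = _ := mul_one _
  · have e : ∀ q : K[X], h (Polynomial.aeval x q) =
        Polynomial.eval₂ ((h : L →+* L).comp (algebraMap K L)) (h x) q := fun q =>
      Polynomial.hom_eval₂ q (algebraMap K L) (h : L →+* L) x
    rw [e, Polynomial.aeval_comp, Polynomial.aeval_def, Polynomial.eval₂_map]
    congr 1
    simp only [map_add, map_mul, Polynomial.aeval_X, Polynomial.aeval_C]
    exact hx.symm

theorem fixGen_affine {H : Subgroup (L ≃ₐ[k] L)} [Finite H] {K : IntermediateField k L} {x : L}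
    {n : ℕ} (hK : Stable H K) (hx : Transcendental K x) (hn : FixGen H K n)
    (hH : ∀ h ∈ H, ∃ a ∈ K, ∃ b ∈ K, h x = a * x + b) :
    FixGen H (adjoin k (insert x (K : Set L))) (n + 1) := by
  classical
  have := Fintype.ofFinite H
  obtain ⟨f, hf⟩ := hn
  set F := fixedField H with hF
  have hmemF : ∀ y, y ∈ F ↔ ∀ h ∈ H, h y = y := fun y => mem_fixedField_iff H y
  have hinj : Function.Injective (Polynomial.aeval x : K[X] →ₐ[K] L) := transcendental_iff_injective.mp hx
  have himg : ∀ h ∈ H, ∀ p : K[X], ∃ p' : K[X], p'.natDegree ≤ p.natDegree ∧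
      Polynomial.aeval x p' = h (Polynomial.aeval x p) := by
    intro h hh p
    obtain ⟨a, ha, b, hb, e⟩ := hH h hh
    exact exists_poly_image (hK h hh) ha hb e p
  obtain ⟨θ, hθF, hθ⟩ : ∃ θ ∈ F ⊓ adjoin k (insert x (K : Set L)), ∀ p : K[X], Polynomial.aeval x p ∈ F →
      Polynomial.aeval x p ∈ adjoin k (insert θ ((F ⊓ K : IntermediateField k L) : Set L)) := by
    by_cases hex : ∃ d, ∃ p : K[X], Polynomial.aeval x p ∈ F ∧ 0 < p.natDegree ∧ p.natDegree = d
    · obtain ⟨p0, hp0, hpos, hd⟩ := Nat.find_spec hex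
      have hmin : ∀ p : K[X], Polynomial.aeval x p ∈ F → 0 < p.natDegree → p0.natDegree ≤ p.natDegree := by
        intro p h1 h2
        rw [hd]
        exact Nat.find_min' hex ⟨p, h1, h2, rfl⟩
      refine ⟨Polynomial.aeval x p0, ⟨hp0, aeval_mem p0⟩, ?_⟩
      have hp0ne : p0 ≠ 0 := by
        rintro rfl
        simp at hpos
      have hconst : ∀ p : K[X], Polynomial.aeval x p ∈ F → p.natDegree = 0 →
          Polynomial.aeval x p ∈ adjoin k (insert (Polynomial.aeval x p0) ((F ⊓ K : IntermediateField k L) : Set L)) := by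
        intro p hp h0
        apply subset_adjoin
        right
        refine ⟨hp, ?_⟩
        rw [eq_C_of_natDegree_eq_zero h0, Polynomial.aeval_C]
        exact (p.coeff 0).2
      intro p
      induction hN : p.natDegree using Nat.strong_induction_on generalizing p with
      | _ N ih =>
      intro hp
      by_cases h0 : p.natDegree = 0
      · exact hconst p hp h0
      have hle := hmin p hp (Nat.pos_of_ne_zero h0)
      have hdiv : p = p0 * (p / p0) + p % p0 := (EuclideanDomain.div_add_mod p p0).symm
      have hr : (p % p0).natDegree < p0.natDegree := natDegree_mod_lt _ hpos.ne'
      have hq : Polynomial.aeval x (p / p0) ∈ F := by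
        rw [hmemF]
        intro h hh
        obtain ⟨q', -, hq'⟩ := himg h hh (p / p0)
        obtain ⟨r', hr'd, hr'⟩ := himg h hh (p % p0)
        have e1 : Polynomial.aeval x (p0 * q' + r') = Polynomial.aeval x (p0 * (p / p0) + p % p0) := by
          rw [← hdiv, map_add, map_mul, hq', hr', ← (hmemF _).1 hp h hh]
          conv_rhs => rw [hdiv]
          rw [map_add, map_mul, map_add, map_mul, (hmemF _).1 hp0 h hh]
        have e2 : p0 * (q' - p / p0) = p % p0 - r' := by
          linear_combination hinj e1
        have e3 : q' - p / p0 = 0 := by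
          by_contra hne
          have h1 := congrArg natDegree e2
          rw [natDegree_mul hp0ne hne] at h1
          have h2 := natDegree_sub_le (p % p0) r'
          have : max (p % p0).natDegree r'.natDegree < p0.natDegree :=
            max_lt hr (hr'd.trans_lt hr)
          omega
        rw [← hq', sub_eq_zero.mp e3]
      have hrF : Polynomial.aeval x (p % p0) ∈ F := by
        have : Polynomial.aeval x (p % p0) = Polynomial.aeval x p - Polynomial.aeval x p0 * Polynomial.aeval x (p / p0) := by
          have := congrArg (Polynomial.aeval x) hdiv
          rw [map_add, map_mul] at this
          rw [this]
          ring
        rw [this]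
        exact F.sub_mem hp (F.mul_mem hp0 hq)
      have hr0 : (p % p0).natDegree = 0 := by
        by_contra hne
        exact absurd (hmin _ hrF (Nat.pos_of_ne_zero hne)) (by omega)
      have hqd : (p / p0).natDegree < N := by
        rw [← hN]
        have : p.natDegree = p0.natDegree + (p / p0).natDegree ∨ (p / p0) = 0 := by
          by_cases hz : p / p0 = 0
          · exact Or.inr hz
          left
          rw [← natDegree_mul hp0ne hz]
          conv_lhs => rw [hdiv]
          apply natDegree_add_eq_left_of_natDegree_lt
          rw [natDegree_mul hp0ne hz]
          omega
        rcases this with h | h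
        · omega
        · rw [h, natDegree_zero]
          omega
      rw [hdiv, map_add, map_mul]
      exact add_mem (mul_mem (subset_adjoin _ _ (Set.mem_insert _ _)) (ih _ hqd _ rfl hq))
        (hconst _ hrF hr0)
    · push Not at hex
      refine ⟨0, zero_mem _, ?_⟩
      intro p hp
      have h0 : p.natDegree = 0 := by
        by_contra hne
        exact hex _ p hp (Nat.pos_of_ne_zero hne) rfl
      apply subset_adjoin
      right
      refine ⟨hp, ?_⟩
      rw [eq_C_of_natDegree_eq_zero h0, Polynomial.aeval_C]
      exact (p.coeff 0).2
  refine ⟨Fin.cons θ f, ?_⟩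
  rw [Fin.range_cons]
  have hadj : adjoin k (insert θ (Set.range f)) =
      adjoin k (insert θ ((F ⊓ K : IntermediateField k L) : Set L)) := by
    rw [hf, adjoin_insert_adjoin]
  rw [hadj]
  apply le_antisymm
  · rintro y ⟨hyF, hyK⟩
    by_cases hy0 : y = 0
    · rw [hy0]; exact zero_mem _
    obtain ⟨p, q, e, hq⟩ := exists_fraction hyK
    replace hq := hq hy0
    choose q' _ hq' using fun h : H => himg h.1 h.2 q
    set d : K[X] := ∏ h : H, q' h with hd
    have hdF : Polynomial.aeval x d ∈ F := by
      rw [hmemF]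
      intro g hg
      rw [hd, map_prod, map_prod]
      simp only [hq']
      exact Fintype.prod_equiv (Equiv.mulLeft (⟨g, hg⟩ : H)) _ _ (fun _ => rfl)
    set m : K[X] := ∏ h ∈ Finset.univ.erase (1 : H), q' h with hm
    have hqd : Polynomial.aeval x d = Polynomial.aeval x q * Polynomial.aeval x m := by
      rw [hd, hm, ← Finset.mul_prod_erase Finset.univ _ (Finset.mem_univ (1 : H)), map_mul, hq']
      simp
    have hd0 : Polynomial.aeval x d ≠ 0 := by
      rw [hd, map_prod]
      refine Finset.prod_ne_zero_iff.mpr fun h _ => ?_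
      rw [hq']
      simpa using hq
    have hm0 : Polynomial.aeval x m ≠ 0 := by
      intro h0
      rw [h0, mul_zero] at hqd
      exact hd0 hqd
    have e' : Polynomial.aeval x (p * m) = y * Polynomial.aeval x d := by
      rw [e, hqd, map_mul]
      field_simp
    have : y = Polynomial.aeval x (p * m) / Polynomial.aeval x d := by
      rw [e']; field_simp
    rw [this]
    exact div_mem (hθ _ (by rw [e']; exact mul_mem hyF hdF)) (hθ _ hdF)
  · rw [adjoin_le_iff, Set.insert_subset_iff]
    refine ⟨hθF, ?_⟩
    rintro y ⟨hy1, hy2⟩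
    exact ⟨hy1, subset_adjoin _ _ (Or.inr hy2)⟩

theorem fixGen_affine_adjoin {H : Subgroup (L ≃ₐ[k] L)} [Finite H] {S : Set L} {x : L}
    {n : ℕ} (hK : Stable H (adjoin k S)) (hx : Transcendental (adjoin k S) x)
    (hn : FixGen H (adjoin k S) n)
    (hH : ∀ h ∈ H, ∃ a ∈ adjoin k S, ∃ b ∈ adjoin k S, h x = a * x + b) :
    FixGen H (adjoin k (insert x S)) (n + 1) := by
  rw [← adjoin_insert_adjoin]
  exact fixGen_affine hK hx hn hH

theorem fixGen_simple (H : Subgroup (L ≃ₐ[k] L)) {x : L} (hx : Transcendental k x) :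
    FixGen H (adjoin k {x}) 1 := by
  set E := fixedField H ⊓ adjoin k {x} with hE
  let φ : RatFunc k →ₐ[k] L := (adjoin k {x}).val.comp
    (RatFunc.algEquivOfTranscendental x hx : RatFunc k →ₐ[k] adjoin k {x})
  have hr : E ≤ φ.fieldRange := by
    intro y hy
    obtain ⟨z, hz⟩ := (RatFunc.algEquivOfTranscendental x hx).surjective ⟨y, hy.2⟩
    exact ⟨z, by simp [φ, hz]⟩
  refine ⟨fun _ => φ (RatFunc.Luroth.generator (E.comap φ)), ?_⟩
  have h1 := map_comap_eq_self hr
  rw [RatFunc.Luroth.eq_adjoin_generator (E := E.comap φ), adjoin_map, Set.image_singleton] at h1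
  rw [Set.range_const]
  exact h1.symm

theorem isAlgebraic_of_le {A B : IntermediateField k L} (h : A ≤ B) {y : L}
    (hy : IsAlgebraic A y) : IsAlgebraic B y := by
  obtain ⟨p, hp, he⟩ := hy
  refine ⟨p.map (inclusion h).toRingHom, ?_, ?_⟩
  · exact (Polynomial.map_ne_zero_iff (inclusion h).injective).mpr hp
  · rw [Polynomial.aeval_def, Polynomial.eval₂_map]
    exact he

theorem isAlgebraic_trans_adjoin {S T : Set L} (hS : ∀ s ∈ S, IsAlgebraic (adjoin k T) s) {y : L}
    (hy : IsAlgebraic (adjoin k S) y) : IsAlgebraic (adjoin k T) y := by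
  let B := adjoin (adjoin k T) S
  have : Algebra.IsAlgebraic (adjoin k T) B := isAlgebraic_adjoin fun x hx => (hS x hx).isIntegral
  have hle : adjoin k S ≤ B.restrictScalars k := by
    rw [adjoin_le_iff]
    exact subset_adjoin (adjoin k T) S
  have h2 : IsAlgebraic B y := isAlgebraic_of_le hle hy
  exact h2.restrictScalars (adjoin k T)

/-- `L` is algebraic over `k(S)`. -/
def Spans (k : Type*) {L : Type*} [Field k] [Field L] [Algebra k L] (S : Set L) : Prop :=
  ∀ y : L, IsAlgebraic (adjoin k S) y

theorem Spans.trans {S T : Set L} (hS : Spans k S) (hT : ∀ s ∈ S, IsAlgebraic (adjoin k T) s) :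
    Spans k T := fun y => isAlgebraic_trans_adjoin hT (hS y)

theorem isAlgebraic_of_mem {A : IntermediateField k L} {y : L} (hy : y ∈ A) : IsAlgebraic A y :=
  isAlgebraic_algebraMap (⟨y, hy⟩ : A)

theorem isAlgebraic_subalgebra {S : Set L} (hS : Spans k S) :
    Algebra.IsAlgebraic (Algebra.adjoin k S) L := by
  have : Algebra.IsAlgebraic (adjoin k S) L := ⟨hS⟩
  open scoped algebraAdjoinAdjoin in
  exact (IsFractionRing.comap_isAlgebraic_iff (A := Algebra.adjoin k S) (K := adjoin k S)
    (C := L)).mpr this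

theorem Spans.card_le {S : Set L} (hS : Spans k S) : Algebra.trdeg k L ≤ Cardinal.mk S := by
  have := isAlgebraic_subalgebra hS
  exact Algebra.IsAlgebraic.trdeg_le_cardinalMk k S

theorem range_vec3 {α : Type*} (a b c : α) : Set.range ![a, b, c] = {a, b, c} := by
  ext x
  simp [eq_comm]
  tauto

theorem Spans.algebraicIndependent {a b c : L} (htr : 3 ≤ Algebra.trdeg k L)
    (h : Spans k {a, b, c}) : AlgebraicIndependent k ![a, b, c] := by
  have : Algebra.IsAlgebraic (Algebra.adjoin k (Set.range ![a, b, c])) L := by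
    rw [range_vec3]
    exact isAlgebraic_subalgebra h
  refine (Algebra.IsAlgebraic.isTranscendenceBasis_of_lift_le_trdeg_of_finite k ![a, b, c] ?_).1
  simpa using htr

theorem not_spans_pair (htr : 3 ≤ Algebra.trdeg k L) (a b : L) : ¬ Spans k ({a, b} : Set L) := by
  intro h
  have h1 := h.card_le
  have h2 : Cardinal.mk ({a, b} : Set L) ≤ 2 := by
    have := Cardinal.mk_insert_le (s := ({b} : Set L)) (a := a)
    rw [Cardinal.mk_singleton] at this
    simpa [one_add_one_eq_two] using this
  have := (htr.trans h1).trans h2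
  norm_num at this

theorem Spans.transcendental_fst {a b c : L} (htr : 3 ≤ Algebra.trdeg k L)
    (h : Spans k {a, b, c}) : Transcendental (adjoin k {b, c}) a := by
  intro ha
  refine not_spans_pair htr b c (h.trans ?_)
  rintro s (rfl | hs)
  · exact ha
  · exact isAlgebraic_of_mem (subset_adjoin _ _ hs)

theorem Spans.transcendental_snd {a b c : L} (htr : 3 ≤ Algebra.trdeg k L)
    (h : Spans k {a, b, c}) : Transcendental (adjoin k {c}) b := by
  intro hb
  have : Spans k {b, a, c} := by rwa [Set.insert_comm]
  refine this.transcendental_fst htr (isAlgebraic_of_le (adjoin.mono _ _ _ ?_) hb)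
  simp

theorem Spans.transcendental_thd {a b c : L} (htr : 3 ≤ Algebra.trdeg k L)
    (h : Spans k {a, b, c}) : Transcendental k c := by
  intro hb
  have : Spans k {c, a, b} := by
    have e : ({c, a, b} : Set L) = {a, b, c} := by
      ext x; simp only [Set.mem_insert_iff, Set.mem_singleton_iff]; tauto
    rwa [e]
  exact this.transcendental_fst htr (hb.tower_top _)

theorem aeval_ne_zero {ι R : Type*} [CommRing R] [Algebra k R] {v : ι → L}
    (hv : AlgebraicIndependent k v) (p : MvPolynomial ι k) (pt : ι → R)
    (h : MvPolynomial.aeval pt p ≠ 0) : MvPolynomial.aeval v p ≠ 0 := by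
  intro h0
  have : p = 0 := hv (by rw [h0, map_zero])
  simp [this] at h

theorem isAlgebraic_fixed {H : Subgroup (L ≃ₐ[k] L)} [Finite H] {K : IntermediateField k L}
    (hK : Stable H K) {x : L} (hx : x ∈ K) :
    IsAlgebraic (fixedField H ⊓ K : IntermediateField k L) x := by
  classical
  have := Fintype.ofFinite H
  let P : L[X] := ∏ h : H, (Polynomial.X - Polynomial.C (h.1 x))
  have hinv : ∀ g : H, P.map (g.1 : L →+* L) = P := by
    intro g
    simp only [P, Polynomial.map_prod, Polynomial.map_sub, Polynomial.map_X, Polynomial.map_C]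
    exact Fintype.prod_equiv (Equiv.mulLeft g) _ _ (fun _ => rfl)
  have hlift : P ∈ Polynomial.lifts (algebraMap K L) := by
    refine Subsemiring.prod_mem _ fun h _ => ?_
    rw [Polynomial.mem_lifts]
    exact ⟨Polynomial.X - Polynomial.C ⟨h.1 x, hK h.1 h.2 x hx⟩, by simp⟩
  have hmem : ∀ n, P.coeff n ∈ (fixedField H ⊓ K : IntermediateField k L) := by
    intro n
    constructor
    · refine (mem_fixedField_iff H _).mpr fun g hg => ?_
      conv_rhs => rw [← hinv ⟨g, hg⟩]
      rw [Polynomial.coeff_map]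
      rfl
    · obtain ⟨y, hy⟩ := (Polynomial.lifts_iff_coeff_lifts P).mp hlift n
      rw [← hy]
      exact y.2
  have hP : P ∈ Polynomial.lifts
      (algebraMap (fixedField H ⊓ K : IntermediateField k L) L) := by
    rw [Polynomial.lifts_iff_coeff_lifts]
    exact fun n => ⟨⟨_, hmem n⟩, rfl⟩
  obtain ⟨q, hq⟩ := (Polynomial.mem_lifts P).mp hP
  refine ⟨q, ?_, ?_⟩
  · rintro rfl
    have h0 : P ≠ 0 := (Polynomial.monic_prod_of_monic _ _
      fun h _ => Polynomial.monic_X_sub_C _).ne_zero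
    simp at hq
    exact h0 hq.symm
  · rw [Polynomial.aeval_def, ← Polynomial.eval_map, hq, Polynomial.eval_prod]
    exact Finset.prod_eq_zero (Finset.mem_univ (1 : H)) (by simp)

theorem spans_of_fixedField_le {H : Subgroup (L ≃ₐ[k] L)} [Finite H] {S : Set L}
    (h : fixedField H ≤ adjoin k S) : Spans k S := by
  intro y
  have := isAlgebraic_fixed (H := H) (K := ⊤) (fun _ _ _ _ => trivial) (x := y) trivial
  exact isAlgebraic_of_le (inf_le_left.trans h) this

theorem isRational_of_fixGen {H : Subgroup (L ≃ₐ[k] L)} [Finite H]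
    (htr : 3 ≤ Algebra.trdeg k L) (h : FixGen H ⊤ 3) : IsRational k (fixedField H) := by
  obtain ⟨f, hf⟩ := h
  rw [inf_top_eq] at hf
  have hs := spans_of_fixedField_le hf.le
  have e : f = ![f 0, f 1, f 2] := by
    ext i; fin_cases i <;> rfl
  have hi : AlgebraicIndependent k f := by
    rw [e] at hs ⊢
    rw [range_vec3] at hs
    exact hs.algebraicIndependent htr
  exact ⟨3, ⟨(equivOfEq hf).trans hi.aevalEquivField.symm⟩⟩

theorem mem_of_fixed {E : IntermediateField k L} {α y : L}
    (hy : y ∈ adjoin k (insert α (E : Set L))) (p : E[X]) (hp : p ≠ 0)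
    (hα : Polynomial.aeval α p = 0) (s : Finset (L ≃ₐ[k] L)) (hs : p.natDegree ≤ s.card)
    (hsE : ∀ h ∈ s, ∀ e ∈ E, h e = e) (hsy : ∀ h ∈ s, h y = y)
    (hinj : ∀ g ∈ s, ∀ h ∈ s, g α = h α → g = h) : y ∈ E := by
  classical
  have hα_int : IsIntegral E α := IsAlgebraic.isIntegral ⟨p, hp, hα⟩
  have hy' : y ∈ (adjoin E {α}).restrictScalars k := by
    rw [restrictScalars_adjoin, Set.union_singleton]
    exact hy
  rw [mem_restrictScalars] at hy'
  obtain ⟨q, hqd, hq⟩ : ∃ q : E[X], q.natDegree < p.natDegree ∧ Polynomial.aeval α q = y := by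
    have hpd : p.natDegree ≠ 0 := by
      intro h0
      rw [Polynomial.eq_C_of_natDegree_eq_zero h0, Polynomial.aeval_C] at hα
      apply hp
      rw [Polynomial.eq_C_of_natDegree_eq_zero h0]
      have : p.coeff 0 = 0 := (map_eq_zero (algebraMap E L)).mp hα
      rw [this, map_zero]
    have h1 : y ∈ Algebra.adjoin E {α} := by
      rw [← adjoin_simple_toSubalgebra_of_isAlgebraic hα_int.isAlgebraic]
      exact hy'
    rw [Algebra.adjoin_singleton_eq_range_aeval] at h1
    obtain ⟨r, hr⟩ := h1
    refine ⟨r % p, Polynomial.natDegree_mod_lt _ hpd, ?_⟩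
    have h2 := congrArg (Polynomial.aeval α) (EuclideanDomain.div_add_mod r p)
    rw [map_add, map_mul, hα, zero_mul, zero_add] at h2
    rw [h2]
    exact hr
  set Q : L[X] := q.map (algebraMap E L) - Polynomial.C y with hQ
  have hroot : ∀ h ∈ s, Q.IsRoot (h α) := by
    intro h hh
    have e1 : h (Polynomial.aeval α q) =
        Polynomial.eval₂ ((h : L →+* L).comp (algebraMap E L)) (h α) q :=
      Polynomial.hom_eval₂ q (algebraMap E L) (h : L →+* L) α
    have e2 : (h : L →+* L).comp (algebraMap E L) = algebraMap E L := by
      ext e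
      exact hsE h hh e e.2
    rw [e2, hq, hsy h hh] at e1
    simp [hQ, Polynomial.IsRoot, Polynomial.eval_map, ← e1]
  have hQ0 : Q = 0 := by
    by_contra hne
    have hsub : (s.image fun h => h α) ⊆ Q.roots.toFinset := by
      intro z hz
      obtain ⟨h, hh, rfl⟩ := Finset.mem_image.mp hz
      rw [Multiset.mem_toFinset, Polynomial.mem_roots hne]
      exact hroot h hh
    have h1 := Finset.card_le_card hsub
    rw [Finset.card_image_of_injOn (fun g hg h hh e => hinj g hg h hh e)] at h1
    have h2 := Q.roots.toFinset_card_le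
    have h3 := Q.card_roots'
    have h4 : Q.natDegree ≤ q.natDegree := by
      rw [hQ]
      refine (Polynomial.natDegree_sub_le _ _).trans ?_
      simp
    omega
  have : y = q.coeff 0 := by
    have := congrArg (fun P => Polynomial.coeff P 0) hQ0
    simp [hQ] at this
    exact (sub_eq_zero.mp this).symm
  rw [this]
  exact (q.coeff 0).2

theorem fixes_adjoin {S : Set L} {h : L ≃ₐ[k] L} (hS : ∀ s ∈ S, h s = s) :
    ∀ e ∈ adjoin k S, h e = e := by
  have : adjoin k S ≤ fixedField (Subgroup.zpowers h) := by
    rw [adjoin_le_iff]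
    intro s hs
    refine (mem_fixedField_iff _ _).mpr fun g hg => ?_
    have : Subgroup.zpowers h ≤ MulAction.stabilizer (L ≃ₐ[k] L) s := by
      rw [Subgroup.zpowers_le]
      exact hS s hs
    exact this hg
  intro e he
  exact (mem_fixedField_iff _ _).mp (this he) h (Subgroup.mem_zpowers h)

theorem mem_of_fixed_quadratic {S : Set L} {α y c d : L} {h : L ≃ₐ[k] L}
    (hy : y ∈ adjoin k (insert α S)) (hc : c ∈ adjoin k S) (hd : d ∈ adjoin k S)
    (hα : α ^ 2 = c * α + d) (hS : ∀ s ∈ S, h s = s) (hne : h α ≠ α) (hhy : h y = y) :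
    y ∈ adjoin k S := by
  classical
  have hE := fixes_adjoin hS
  rw [← adjoin_insert_adjoin] at hy
  have hne' : (1 : L ≃ₐ[k] L) ≠ h := by
    rintro rfl
    exact hne rfl
  have hdeg : ((Polynomial.X ^ 2 - Polynomial.C (⟨c, hc⟩ : adjoin k S) * Polynomial.X
      - Polynomial.C (⟨d, hd⟩ : adjoin k S)) : (adjoin k S)[X]).natDegree = 2 := by
    compute_degree!
  refine mem_of_fixed hy (Polynomial.X ^ 2 - Polynomial.C (⟨c, hc⟩ : adjoin k S) * Polynomial.X
    - Polynomial.C (⟨d, hd⟩ : adjoin k S)) ?_ ?_ {1, h} ?_ ?_ ?_ ?_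
  · intro h0
    rw [h0, Polynomial.natDegree_zero] at hdeg
    omega
  · simp only [map_sub, map_pow, map_mul, Polynomial.aeval_X, Polynomial.aeval_C]
    change α ^ 2 - c * α - d = 0
    rw [hα]; ring
  · rw [hdeg, Finset.card_pair hne']
  · intro g hg e he
    simp only [Finset.mem_insert, Finset.mem_singleton] at hg
    rcases hg with rfl | rfl
    · rfl
    · exact hE e he
  · intro g hg
    simp only [Finset.mem_insert, Finset.mem_singleton] at hg
    rcases hg with rfl | rfl
    · rfl
    · exact hhy
  · intro g hg g' hg' e
    simp only [Finset.mem_insert, Finset.mem_singleton] at hg hg'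
    rcases hg with rfl | rfl <;> rcases hg' with rfl | rfl
    · rfl
    · exact absurd e.symm hne
    · exact absurd e hne
    · rfl

/-- `h` sends `x` to an affine function of `x` with coefficients in `k(S)`. -/
def Affine (h : L ≃ₐ[k] L) (S : Set L) (x : L) : Prop :=
  ∃ a ∈ adjoin k S, ∃ b ∈ adjoin k S, h x = a * x + b

theorem Affine.mem {h : L ≃ₐ[k] L} {S : Set L} {x : L} (hx : Affine h S x) :
    h x ∈ adjoin k (insert x S) := by
  obtain ⟨a, ha, b, hb, e⟩ := hx
  have hle : adjoin k S ≤ adjoin k (insert x S) := adjoin.mono _ _ _ (Set.subset_insert _ _)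
  rw [e]
  exact add_mem (mul_mem (hle ha) (subset_adjoin _ _ (Set.mem_insert _ _))) (hle hb)

theorem stable_insert {H : Subgroup (L ≃ₐ[k] L)} {S : Set L} {x : L} (hS : Stable H (adjoin k S))
    (hx : ∀ h ∈ H, h x ∈ adjoin k (insert x S)) : Stable H (adjoin k (insert x S)) := by
  apply stable_adjoin
  rintro h hh a (rfl | ha)
  · exact hx h hh
  · exact adjoin.mono _ _ _ (Set.subset_insert _ _) (hS h hh a (subset_adjoin _ _ ha))

theorem stable_singleton {H : Subgroup (L ≃ₐ[k] L)} {x : L}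
    (hx : ∀ h ∈ H, h x ∈ adjoin k {x}) : Stable H (adjoin k {x}) := by
  apply stable_adjoin
  rintro h hh a rfl
  exact hx h hh

theorem fixGen_three {H : Subgroup (L ≃ₐ[k] L)} [Finite H] (htr : 3 ≤ Algebra.trdeg k L)
    {a b c : L} (hle : fixedField H ≤ adjoin k {a, b, c})
    (hc : ∀ h ∈ H, h c ∈ adjoin k {c}) (hb : ∀ h ∈ H, Affine h {c} b)
    (ha : ∀ h ∈ H, Affine h {b, c} a) : FixGen H ⊤ 3 := by
  have hs := spans_of_fixedField_le hle
  have s1 := stable_singleton hc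
  have g1 := fixGen_simple H (hs.transcendental_thd htr)
  have g2 := fixGen_affine_adjoin s1 (hs.transcendental_snd htr) g1 hb
  have s2 := stable_insert s1 fun h hh => (hb h hh).mem
  obtain ⟨f, hf⟩ := fixGen_affine_adjoin s2 (hs.transcendental_fst htr) g2 ha
  refine ⟨f, ?_⟩
  rw [← hf, inf_top_eq, inf_eq_left.mpr hle]

theorem fixGen_two {H : Subgroup (L ≃ₐ[k] L)} [Finite H] (htr : 3 ≤ Algebra.trdeg k L)
    {x y z b c : L} (hs : Spans k {x, y, z}) (hK : Stable H (adjoin k {y, z}))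
    (hbc : adjoin k {b, c} ≤ adjoin k {y, z})
    (hle : fixedField H ⊓ adjoin k {y, z} ≤ adjoin k {b, c})
    (hc : ∀ h ∈ H, h c ∈ adjoin k {c}) (hb : ∀ h ∈ H, Affine h {c} b) :
    FixGen H (adjoin k {y, z}) 2 := by
  have hs' : Spans k {x, b, c} := by
    refine hs.trans ?_
    have key : ∀ s ∈ adjoin k {y, z}, IsAlgebraic (adjoin k {x, b, c}) s := by
      intro s hs
      refine isAlgebraic_of_le (hle.trans (adjoin.mono _ _ _ ?_)) (isAlgebraic_fixed hK hs)
      exact Set.subset_insert _ _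
    rintro s (rfl | hs)
    · exact isAlgebraic_of_mem (subset_adjoin _ _ (Set.mem_insert _ _))
    · exact key s (subset_adjoin _ _ hs)
  have g1 := fixGen_simple H (hs'.transcendental_thd htr)
  obtain ⟨f, hf⟩ := fixGen_affine_adjoin (stable_singleton hc) (hs'.transcendental_snd htr) g1 hb
  refine ⟨f, ?_⟩
  rw [← hf]
  exact le_antisymm (le_inf inf_le_left hle) (inf_le_inf_left _ hbc)

theorem fixGen_step {H : Subgroup (L ≃ₐ[k] L)} [Finite H] (htr : 3 ≤ Algebra.trdeg k L)
    {x y z : L} (hs : fixedField H ≤ adjoin k {x, y, z}) (hK : Stable H (adjoin k {y, z}))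
    (h2 : FixGen H (adjoin k {y, z}) 2) (hx : ∀ h ∈ H, Affine h {y, z} x) : FixGen H ⊤ 3 := by
  obtain ⟨f, hf⟩ :=
    fixGen_affine_adjoin hK ((spans_of_fixedField_le hs).transcendental_fst htr) h2 hx
  refine ⟨f, ?_⟩
  rw [← hf, inf_top_eq, inf_eq_left.mpr hs]

/-- Ratios and differences of three elements permuted up to a common factor `c`. -/
theorem diff_mem {y : Fin 3 → L} (n12 : y 1 - y 2 ≠ 0) {h : L ≃ₐ[k] L} {σ : Fin 3 → Fin 3} {c : L}
    (hc : c ≠ 0) (e : ∀ i j, h (y i - y j) = c * (y (σ i) - y (σ j))) :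
    h ((y 0 - y 2) / (y 1 - y 2)) ∈ adjoin k {(y 0 - y 2) / (y 1 - y 2)} ∧
    (∃ v ∈ adjoin k {(y 0 - y 2) / (y 1 - y 2)}, h (y 1 - y 2) = v * (c * (y 1 - y 2))) ∧
    ∀ i j, ∃ u ∈ adjoin k {(y 0 - y 2) / (y 1 - y 2)}, y i - y j = u * (y 1 - y 2) := by
  set s := y 1 - y 2 with hsdef
  set t := (y 0 - y 2) / s with ht
  have e1 : y 1 = y 2 + s := by rw [hsdef]; ring
  have e0 : y 0 = y 2 + t * s := by rw [ht]; field_simp; ring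
  have key : ∀ i j : Fin 3, ∃ u ∈ adjoin k {t}, y i - y j = u * s := by
    have ht' : t ∈ adjoin k {t} := subset_adjoin _ _ rfl
    have h1 := one_mem (adjoin k {t})
    have h0 := zero_mem (adjoin k {t})
    intro i j
    fin_cases i <;> fin_cases j
    · exact ⟨0, h0, by simp⟩
    · exact ⟨t - 1, sub_mem ht' h1, by simp only [Fin.mk_zero, Fin.mk_one]; rw [e1, e0]; ring⟩
    · exact ⟨t, ht', by simp only [Fin.zero_eta, Fin.reduceFinMk]; rw [e0]; ring⟩
    · exact ⟨1 - t, sub_mem h1 ht', by simp only [Fin.mk_one, Fin.zero_eta]; rw [e1, e0]; ring⟩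
    · exact ⟨0, h0, by simp⟩
    · exact ⟨1, h1, by simp only [Fin.mk_one, Fin.reduceFinMk]; rw [e1]; ring⟩
    · exact ⟨-t, neg_mem ht', by simp only [Fin.zero_eta, Fin.reduceFinMk]; rw [e0]; ring⟩
    · exact ⟨-1, neg_mem h1, by simp only [Fin.mk_one, Fin.reduceFinMk]; rw [e1]; ring⟩
    · exact ⟨0, h0, by simp⟩
  refine ⟨?_, ?_, key⟩
  · obtain ⟨u, hu, e'⟩ := key (σ 0) (σ 2)
    obtain ⟨v, hv, e''⟩ := key (σ 1) (σ 2)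
    rw [ht, map_div₀, e, hsdef, e, e', e'', mul_div_mul_left _ _ hc, mul_div_mul_right _ _ n12]
    exact div_mem hu hv
  · obtain ⟨v, hv, e''⟩ := key (σ 1) (σ 2)
    refine ⟨v, hv, ?_⟩
    rw [hsdef, e, e'']
    ring

/-- Three coordinates permuted by `H` up to a common affine substitution over `k`. -/
theorem fixGen_of_perm_affine {H : Subgroup (L ≃ₐ[k] L)} [Finite H] (htr : 3 ≤ Algebra.trdeg k L)
    {y : Fin 3 → L} (hle : fixedField H ≤ adjoin k {y 0, y 1, y 2})
    (hy : ∀ h ∈ H, ∃ (σ : Equiv.Perm (Fin 3)) (c d : k),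
      ∀ i, h (y i) = algebraMap k L c * y (σ i) + algebraMap k L d) : FixGen H ⊤ 3 := by
  have hs := spans_of_fixedField_le hle
  have hi := hs.algebraicIndependent htr
  have n12 : y 1 - y 2 ≠ 0 := by
    have := aeval_ne_zero hi (X 1 - X 2) (![0, 1, 0] : Fin 3 → k) (by simp)
    simpa using this
  have hd : ∀ h ∈ H, ∃ (σ : Equiv.Perm (Fin 3)) (c d : k), algebraMap k L c ≠ 0 ∧
      (∀ i, h (y i) = algebraMap k L c * y (σ i) + algebraMap k L d) ∧
      ∀ i j, h (y i - y j) = algebraMap k L c * (y (σ i) - y (σ j)) := by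
    intro h hh
    obtain ⟨σ, c, d, e⟩ := hy h hh
    have e' : ∀ i j, h (y i - y j) = algebraMap k L c * (y (σ i) - y (σ j)) := fun i j => by
      rw [map_sub, e, e]; ring
    refine ⟨σ, c, d, fun h0 => n12 ?_, e, e'⟩
    have := e' 1 2
    rwa [h0, zero_mul, map_eq_zero] at this
  set s := y 1 - y 2 with hsdef
  set t := (y 0 - y 2) / s with ht
  have e1 : y 1 = y 2 + s := by rw [hsdef]; ring
  have e0 : y 0 = y 2 + t * s := by rw [ht]; field_simp; ring
  refine fixGen_three htr (a := y 2) (b := s) (c := t) ?_ ?_ ?_ ?_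
  · refine hle.trans ?_
    rw [adjoin_le_iff]
    have m2 : y 2 ∈ adjoin k {y 2, s, t} := subset_adjoin _ _ (by simp)
    have ms : s ∈ adjoin k {y 2, s, t} := subset_adjoin _ _ (by simp)
    have mt : t ∈ adjoin k {y 2, s, t} := subset_adjoin _ _ (by simp)
    rintro z (rfl | rfl | rfl)
    · rw [e0]; exact add_mem m2 (mul_mem mt ms)
    · rw [e1]; exact add_mem m2 ms
    · exact m2
  · intro h hh
    obtain ⟨σ, c, d, hc, -, e⟩ := hd h hh
    exact (diff_mem n12 hc e).1
  · intro h hh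
    obtain ⟨σ, c, d, hc, -, e⟩ := hd h hh
    obtain ⟨v, hv, e'⟩ := (diff_mem n12 hc e).2.1
    exact ⟨v * algebraMap k L c, mul_mem hv (_root_.algebraMap_mem _ _), 0, zero_mem _, by
      rw [hsdef, e']; ring⟩
  · intro h hh
    obtain ⟨σ, c, d, hc, e, e'⟩ := hd h hh
    obtain ⟨u, hu, e''⟩ := (diff_mem n12 hc e').2.2 (σ 2) 2
    have hle' : adjoin k {t} ≤ adjoin k {s, t} := adjoin.mono _ _ _ (Set.subset_insert _ _)
    refine ⟨algebraMap k L c, _root_.algebraMap_mem _ _, algebraMap k L c * (u * s) + algebraMap k L d,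
      add_mem (mul_mem (_root_.algebraMap_mem _ _) (mul_mem (hle' hu) (subset_adjoin _ _ (by simp))))
        (_root_.algebraMap_mem _ _), ?_⟩
    rw [e]
    linear_combination algebraMap k L c * e''

/-- The reflection `t ↦ 1 - t` if `b` is true, the identity otherwise. -/
def refl (b : Bool) (t : L) : L := if b then 1 - t else t

theorem map_refl (h : L ≃ₐ[k] L) (b : Bool) (t : L) : h (refl b t) = refl b (h t) := by
  cases b <;> simp [refl]

theorem refl_refl (b c : Bool) (t : L) : refl b (refl c t) = refl (xor b c) t := by
  cases b <;> cases c <;> simp [refl]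

theorem refl_mem {K : IntermediateField k L} (b : Bool) {t : L} (ht : t ∈ K) : refl b t ∈ K := by
  cases b
  · exact ht
  · exact sub_mem (one_mem _) ht

theorem refl_eq_two (b : Bool) :
    ∃ c ∈ (⊥ : IntermediateField k L), c * c = 1 ∧
      ∀ t : L, 2 * refl b t - 1 = c * (2 * t - 1) := by
  cases b
  · exact ⟨1, one_mem _, by ring, fun t => by simp [refl]⟩
  · exact ⟨-1, neg_mem (one_mem _), by ring, fun t => by simp [refl]; ring⟩

theorem refl_char_two (h2 : (2 : L) = 0) (b : Bool) :
    ∃ c ∈ (⊥ : IntermediateField k L), ∀ t : L, refl b t = t + c := by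
  cases b
  · exact ⟨0, zero_mem _, fun t => by simp [refl]⟩
  · exact ⟨1, one_mem _, fun t => by
      simp only [refl, if_true]; linear_combination (-t) * h2⟩

theorem adjoin_congr {S T : Set L} (h1 : ∀ s ∈ S, s ∈ adjoin k T) (h2 : ∀ t ∈ T, t ∈ adjoin k S) :
    adjoin k S = adjoin k T :=
  le_antisymm (adjoin_le_iff.mpr h1) (adjoin_le_iff.mpr h2)

theorem fixGen_two_refl {H : Subgroup (L ≃ₐ[k] L)} [Finite H] (htr : 3 ≤ Algebra.trdeg k L)
    {x p q : L} (hs : Spans k {x, p, q})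
    (hH : ∀ h ∈ H, ∃ e e' : Bool, (h p = refl e p ∧ h q = refl e' q) ∨
      (h p = refl e q ∧ h q = refl e' p)) : FixGen H (adjoin k {p, q}) 2 := by
  have mp : p ∈ adjoin k {p, q} := subset_adjoin _ _ (by simp)
  have mq : q ∈ adjoin k {p, q} := subset_adjoin _ _ (by simp)
  have hK : Stable H (adjoin k {p, q}) := by
    apply stable_adjoin
    intro h hh a ha
    obtain ⟨e, e', ⟨h1, h2⟩ | ⟨h1, h2⟩⟩ := hH h hh <;> rcases ha with rfl | rfl <;>
      simp only [h1, h2] <;> apply refl_mem <;> assumption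
  have hi := hs.algebraicIndependent htr
  by_cases h2 : (2 : L) = 0
  · set c := p + q with hc
    have mc : c ∈ adjoin k {p, q} := add_mem mp mq
    have mq' : q ∈ adjoin k {q, c} := subset_adjoin _ _ (by simp)
    have mc' : c ∈ adjoin k {q, c} := subset_adjoin _ _ (by simp)
    have mc1 : c ∈ adjoin k {c} := subset_adjoin _ _ (by simp)
    have mp' : p ∈ adjoin k {q, c} := by
      rw [show p = c - q by rw [hc]; ring]; exact sub_mem mc' mq'
    have hb : ∀ {S : Set L} {c : L}, c ∈ (⊥ : IntermediateField k L) → c ∈ adjoin k S :=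
      fun h => bot_le (a := adjoin k _) h
    refine fixGen_two htr hs hK (b := q) (c := c) ?_ ?_ ?_ ?_
    · rw [adjoin_le_iff]
      rintro s (rfl | rfl) <;> assumption
    · refine inf_le_right.trans ?_
      rw [adjoin_le_iff]
      rintro s (rfl | rfl) <;> assumption
    · intro h hh
      obtain ⟨e, e', h'⟩ := hH h hh
      obtain ⟨u, hu, eu⟩ := refl_char_two (k := k) h2 e
      obtain ⟨v, hv, ev⟩ := refl_char_two (k := k) h2 e'
      have : h c = c + (u + v) := by
        rcases h' with ⟨h1, h3⟩ | ⟨h1, h3⟩ <;>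
        rw [hc, map_add, h1, h3, eu, ev] <;> ring
      rw [this]
      exact add_mem mc1 (add_mem (hb hu) (hb hv))
    · intro h hh
      obtain ⟨e, e', h'⟩ := hH h hh
      obtain ⟨v, hv, ev⟩ := refl_char_two (k := k) h2 e'
      rcases h' with ⟨h1, h3⟩ | ⟨h1, h3⟩
      · exact ⟨1, one_mem _, v, hb hv, by rw [h3, ev, one_mul]⟩
      · refine ⟨1, one_mem _, c + v, add_mem mc1 (hb hv), ?_⟩
        rw [h3, ev, hc]; linear_combination (-q) * h2
  · have hP : 2 * p - 1 ≠ 0 := by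
      have := aeval_ne_zero hi (2 * X 1 - 1) (![0, 0, 0] : Fin 3 → k) (by simp)
      simpa using this
    have hQ : 2 * q - 1 ≠ 0 := by
      have := aeval_ne_zero hi (2 * X 2 - 1) (![0, 0, 0] : Fin 3 → k) (by simp)
      simpa using this
    set b := 2 * q - 1 with hbdef
    set c := (2 * p - 1) / b with hc
    have hcb : c * b = 2 * p - 1 := by rw [hc]; field_simp
    have hb : ∀ {S : Set L} {c : L}, c ∈ (⊥ : IntermediateField k L) → c ∈ adjoin k S :=
      fun h => bot_le (a := adjoin k _) h
    have m2 : ∀ {S : Set L}, (2 : L) ∈ adjoin k S := fun {S} => ofNat_mem _ 2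
    have m1 : ∀ {S : Set L}, (1 : L) ∈ adjoin k S := fun {S} => one_mem _
    have mb : b ∈ adjoin k {p, q} := sub_mem (mul_mem m2 mq) m1
    have mc : c ∈ adjoin k {p, q} := div_mem (sub_mem (mul_mem m2 mp) m1) mb
    have mb' : b ∈ adjoin k {b, c} := subset_adjoin _ _ (by simp)
    have mc' : c ∈ adjoin k {b, c} := subset_adjoin _ _ (by simp)
    have mc1 : c ∈ adjoin k {c} := subset_adjoin _ _ (by simp)
    have mq' : q ∈ adjoin k {b, c} := by
      rw [show q = (b + 1) / 2 by rw [hbdef]; field_simp; ring]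
      exact div_mem (add_mem mb' m1) m2
    have mp' : p ∈ adjoin k {b, c} := by
      rw [show p = (c * b + 1) / 2 by rw [hcb]; field_simp; ring]
      exact div_mem (add_mem (mul_mem mc' mb') m1) m2
    refine fixGen_two htr hs hK (b := b) (c := c) ?_ ?_ ?_ ?_
    · rw [adjoin_le_iff]
      rintro s (rfl | rfl) <;> assumption
    · refine inf_le_right.trans ?_
      rw [adjoin_le_iff]
      rintro s (rfl | rfl) <;> assumption
    · intro h hh
      obtain ⟨e, e', h'⟩ := hH h hh
      obtain ⟨u, hu, hu2, eu⟩ := refl_eq_two (k := k) (L := L) e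
      obtain ⟨v, hv, hv2, ev⟩ := refl_eq_two (k := k) (L := L) e'
      have hv0 : v ≠ 0 := by rintro rfl; simp at hv2
      rcases h' with ⟨h1, h3⟩ | ⟨h1, h3⟩
      · have : h c = u / v * c := by
          rw [hc, hbdef, map_div₀, map_sub, map_sub, map_mul, map_mul, h1, h3, map_ofNat, map_one,
            eu, ev]
          field_simp
        rw [this]
        exact mul_mem (div_mem (hb hu) (hb hv)) mc1
      · have : h c = u / v / c := by
          rw [hc, hbdef, map_div₀, map_sub, map_sub, map_mul, map_mul, h1, h3, map_ofNat, map_one,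
            eu, ev]
          field_simp
        rw [this]
        exact div_mem (div_mem (hb hu) (hb hv)) mc1
    · intro h hh
      obtain ⟨e, e', h'⟩ := hH h hh
      obtain ⟨v, hv, hv2, ev⟩ := refl_eq_two (k := k) (L := L) e'
      rcases h' with ⟨h1, h3⟩ | ⟨h1, h3⟩
      · refine ⟨v, hb hv, 0, zero_mem _, ?_⟩
        rw [hbdef, map_sub, map_mul, h3, map_ofNat, map_one, ev, add_zero]
      · refine ⟨v * c, mul_mem (hb hv) mc1, 0, zero_mem _, ?_⟩
        rw [hbdef, map_sub, map_mul, h3, map_ofNat, map_one, ev, mul_assoc, ← hbdef, hcb, add_zero]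

/-- `h` permutes the `z i` up to reflections. -/
def ActRefl (h : L ≃ₐ[k] L) (z : Fin 3 → L) (w : Equiv.Perm (Fin 3) × (Fin 3 → Bool)) : Prop :=
  ∀ i, h (z i) = refl (w.2 i) (z (w.1 i))

theorem mem_adjoin_triple {x y z : L} : x ∈ adjoin k {x, y, z} ∧ y ∈ adjoin k {x, y, z} ∧
    z ∈ adjoin k {x, y, z} :=
  ⟨subset_adjoin _ _ (by simp), subset_adjoin _ _ (by simp), subset_adjoin _ _ (by simp)⟩

theorem fixGen_of_flips {H : Subgroup (L ≃ₐ[k] L)} [Finite H] (htr : 3 ≤ Algebra.trdeg k L)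
    {z : Fin 3 → L} (hz : fixedField H ≤ adjoin k {z 0, z 1, z 2})
    (hH : ∀ h ∈ H, ∃ w, ActRefl h z w)
    (hf : ∀ i, ∃ h ∈ H, h (z i) = 1 - z i ∧ ∀ j, j ≠ i → h (z j) = z j) : FixGen H ⊤ 3 := by
  have hi := (spans_of_fixedField_le hz).algebraicIndependent htr
  have hne : ∀ i, 1 - z i ≠ z i := by
    have : 1 - z 0 - z 0 ≠ 0 := by
      have := aeval_ne_zero hi (1 - X 0 - X 0) (![0, 0, 0] : Fin 3 → k) (by simp)
      simpa using this
    have : 1 - z 1 - z 1 ≠ 0 := by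
      have := aeval_ne_zero hi (1 - X 1 - X 1) (![0, 0, 0] : Fin 3 → k) (by simp)
      simpa using this
    have : 1 - z 2 - z 2 ≠ 0 := by
      have := aeval_ne_zero hi (1 - X 2 - X 2) (![0, 0, 0] : Fin 3 → k) (by simp)
      simpa using this
    intro i
    rw [ne_eq, ← sub_eq_zero]
    fin_cases i <;> assumption
  set y : Fin 3 → L := fun i => z i * (1 - z i) with hy
  have hyr : ∀ h ∈ H, ∀ w, ActRefl h z w → ∀ i, h (y i) = y (w.1 i) := by
    intro h hh w hw i
    simp only [hy, map_mul, map_sub, map_one, hw i]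
    cases w.2 i <;> simp [refl]
    ring
  refine fixGen_of_perm_affine htr (y := y) ?_ fun h hh => ?_
  · intro a ha
    have fix : ∀ h ∈ H, h a = a := fun h hh => ha ⟨h, hh⟩
    obtain ⟨g0, m0, e0, f0⟩ := hf 0
    obtain ⟨g1, m1, e1, f1⟩ := hf 1
    obtain ⟨g2, m2, e2, f2⟩ := hf 2
    have hsq : ∀ {K : IntermediateField k L} i, y i ∈ K →
      ∃ c ∈ K, ∃ d ∈ K, z i ^ 2 = c * z i + d := fun i hi =>
      ⟨1, one_mem _, -y i, neg_mem hi, by simp only [hy]; ring⟩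
    have hfy : ∀ g ∈ H, ∀ i, (∀ j, j ≠ i → g (z j) = z j) → g (z i) = 1 - z i →
        ∀ j, g (y j) = y j := by
      intro g _ i h1 h2 j
      by_cases hj : j = i
      · subst hj; simp only [hy, map_mul, map_sub, map_one, h2]; ring
      · simp only [hy, map_mul, map_sub, map_one, h1 j hj]
    have a1 : a ∈ adjoin k {z 1, z 2, y 0} := by
      obtain ⟨c, hc, d, hd, e⟩ := hsq 0 (mem_adjoin_triple (k := k) (x := z 1) (y := z 2)).2.2
      refine mem_of_fixed_quadratic (h := g0) (α := z 0) ?_ hc hd e ?_ (e0 ▸ hne 0) (fix g0 m0)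
      · refine adjoin.mono _ _ _ ?_ (hz ha)
        intro s; simp only [Set.mem_insert_iff, Set.mem_singleton_iff]; tauto
      · rintro s (rfl | rfl | rfl)
        · exact f0 1 (by decide)
        · exact f0 2 (by decide)
        · exact hfy g0 m0 0 f0 e0 0
    have a2 : a ∈ adjoin k {z 2, y 0, y 1} := by
      obtain ⟨c, hc, d, hd, e⟩ := hsq 1 (mem_adjoin_triple (k := k) (x := z 2) (y := y 0)).2.2
      refine mem_of_fixed_quadratic (h := g1) (α := z 1) ?_ hc hd e ?_ (e1 ▸ hne 1) (fix g1 m1)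
      · refine adjoin.mono _ _ _ ?_ a1
        intro s; simp only [Set.mem_insert_iff, Set.mem_singleton_iff]; tauto
      · rintro s (rfl | rfl | rfl)
        · exact f1 2 (by decide)
        · exact hfy g1 m1 1 f1 e1 0
        · exact hfy g1 m1 1 f1 e1 1
    obtain ⟨c, hc, d, hd, e⟩ := hsq 2 (mem_adjoin_triple (k := k) (x := y 0) (y := y 1)).2.2
    refine mem_of_fixed_quadratic (h := g2) (α := z 2) ?_ hc hd e ?_ (e2 ▸ hne 2) (fix g2 m2)
    · refine adjoin.mono _ _ _ ?_ a2
      intro s; simp only [Set.mem_insert_iff, Set.mem_singleton_iff]; tauto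
    · rintro s (rfl | rfl | rfl) <;> exact hfy g2 m2 2 f2 e2 _
  · obtain ⟨w, hw⟩ := hH h hh
    exact ⟨w.1, 1, 0, fun i => by rw [hyr h hh w hw i]; simp⟩

/-- `h` reflects all the `z j` except `z i`. -/
def PairFlip (h : L ≃ₐ[k] L) (z : Fin 3 → L) (i : Fin 3) : Prop :=
  h (z i) = z i ∧ ∀ j, j ≠ i → h (z j) = 1 - z j

theorem fixGen_of_pairFlips_two {H : Subgroup (L ≃ₐ[k] L)} [Finite H] (htr : 3 ≤ Algebra.trdeg k L)
    {z : Fin 3 → L} (hz : fixedField H ≤ adjoin k {z 0, z 1, z 2})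
    (hH : ∀ h ∈ H, ∃ w, ActRefl h z w) (h2 : (2 : L) ≠ 0)
    (hf : ∀ i, ∃ h ∈ H, PairFlip h z i) : FixGen H ⊤ 3 := by
  have hi := (spans_of_fixedField_le hz).algebraicIndependent htr
  set p : Fin 3 → L := fun i => 2 * z i - 1 with hp
  have p0 : ∀ i, p i ≠ 0 := by
    have : p 0 ≠ 0 := by
      have := aeval_ne_zero hi (2 * X 0 - 1) (![0, 0, 0] : Fin 3 → k) (by simp)
      simpa using this
    have : p 1 ≠ 0 := by
      have := aeval_ne_zero hi (2 * X 1 - 1) (![0, 0, 0] : Fin 3 → k) (by simp)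
      simpa using this
    have : p 2 ≠ 0 := by
      have := aeval_ne_zero hi (2 * X 2 - 1) (![0, 0, 0] : Fin 3 → k) (by simp)
      simpa using this
    intro i
    fin_cases i <;> assumption
  have hpn : ∀ i, - p i ≠ p i := fun i h => by
    have : 2 * p i = 0 := by linear_combination -h
    simp [h2, p0 i] at this
  have hpz : ∀ i, z i = (p i + 1) / 2 := fun i => by simp only [hp]; field_simp; ring
  have zmem : ∀ {K : IntermediateField k L} i, p i ∈ K → z i ∈ K := fun i hi => by
    rw [hpz]; exact div_mem (add_mem hi (one_mem _)) (ofNat_mem _ 2)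
  set u : Fin 3 → L := fun i => p 0 * p 1 * p 2 / p i ^ 2 with hu
  have q0 := p0 0
  have q1 := p0 1
  have q2 := p0 2
  have hprod : ∀ g : Equiv.Perm (Fin 3), p (g 0) * p (g 1) * p (g 2) = p 0 * p 1 * p 2 := by
    intro g
    have := Equiv.prod_comp g p
    simpa [Fin.prod_univ_three] using this
  have hfp : ∀ g ∈ H, ∀ i, PairFlip g z i → g (p i) = p i ∧ ∀ j, j ≠ i → g (p j) = - p j := by
    intro g _ i h
    refine ⟨by simp only [hp, map_sub, map_mul, map_ofNat, map_one, h.1], fun j hj => ?_⟩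
    simp only [hp, map_sub, map_mul, map_ofNat, map_one, h.2 j hj]
    ring
  have hfu : ∀ g ∈ H, ∀ i, PairFlip g z i → ∀ j, g (u j) = u j := by
    intro g hg i h
    obtain ⟨h1, h3⟩ := hfp g hg i h
    have hc : ∀ j, g (p j) ^ 2 = p j ^ 2 := fun j => by
      by_cases hj : j = i
      · rw [hj, h1]
      · rw [h3 j hj]; ring
    have hP : g (p 0) * g (p 1) * g (p 2) = p 0 * p 1 * p 2 := by
      fin_cases i <;> simp only [Fin.zero_eta, Fin.mk_one, Fin.reduceFinMk] at h1 h3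
      · rw [h1, h3 1 (by decide), h3 2 (by decide)]; ring
      · rw [h1, h3 0 (by decide), h3 2 (by decide)]; ring
      · rw [h1, h3 0 (by decide), h3 1 (by decide)]; ring
    intro j
    simp only [hu, map_div₀, map_mul, map_pow, hc, hP]
  refine fixGen_of_perm_affine htr (y := u) ?_ fun h hh => ?_
  · intro a ha
    have fix : ∀ h ∈ H, h a = a := fun h hh => ha ⟨h, hh⟩
    obtain ⟨g0, m0, f0⟩ := hf 0
    obtain ⟨g1, m1, f1⟩ := hf 1
    obtain ⟨g2, m2, f2⟩ := hf 2
    have e0 : p 0 ^ 2 = 0 * p 0 + u 1 * u 2 := by simp only [hu]; field_simp; ring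
    have e1 : p 1 ^ 2 = 0 * p 1 + u 0 * u 2 := by simp only [hu]; field_simp; ring
    have e2 : p 2 = p 0 * p 1 / u 2 := by simp only [hu]; field_simp
    have a1 : a ∈ adjoin k {p 1, u 0, u 1, u 2} := by
      have n1 : u 1 ∈ adjoin k {p 1, u 0, u 1, u 2} := subset_adjoin _ _ (by simp)
      have n2 : u 2 ∈ adjoin k {p 1, u 0, u 1, u 2} := subset_adjoin _ _ (by simp)
      refine mem_of_fixed_quadratic (h := g1) (α := p 0) ?_ (zero_mem _) (mul_mem n1 n2) e0 ?_
        ((hfp g1 m1 1 f1).2 0 (by decide) ▸ hpn 0) (fix g1 m1)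
      · refine (adjoin_le_iff.mpr ?_ : adjoin k {z 0, z 1, z 2} ≤ _) (hz ha)
        have l0 : p 0 ∈ adjoin k {p 0, p 1, u 0, u 1, u 2} := subset_adjoin _ _ (by simp)
        have l1 : p 1 ∈ adjoin k {p 0, p 1, u 0, u 1, u 2} := subset_adjoin _ _ (by simp)
        have l2 : u 2 ∈ adjoin k {p 0, p 1, u 0, u 1, u 2} := subset_adjoin _ _ (by simp)
        rintro s (rfl | rfl | rfl)
        · exact zmem 0 l0
        · exact zmem 1 l1
        · refine zmem 2 ?_
          rw [e2]
          exact div_mem (mul_mem l0 l1) l2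
      · rintro s (rfl | rfl | rfl | rfl)
        · exact (hfp g1 m1 1 f1).1
        all_goals exact hfu g1 m1 1 f1 _
    obtain ⟨n0, n1, n2⟩ := mem_adjoin_triple (k := k) (x := u 0) (y := u 1) (z := u 2)
    refine mem_of_fixed_quadratic (h := g2) (α := p 1) a1 (zero_mem _) (mul_mem n0 n2) e1 ?_
        ((hfp g2 m2 2 f2).2 1 (by decide) ▸ hpn 1) (fix g2 m2)
    rintro s (rfl | rfl | rfl) <;> exact hfu g2 m2 2 f2 _
  · obtain ⟨w, hw⟩ := hH h hh
    have : ∀ i, ∃ c : k, c ^ 2 = 1 ∧ h (p i) = algebraMap k L c * p (w.1 i) := by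
      intro i
      simp only [hp, map_sub, map_mul, map_ofNat, map_one, hw i]
      cases w.2 i
      · exact ⟨1, by simp, by simp [refl]⟩
      · exact ⟨-1, by simp, by simp [refl]; ring⟩
    choose c hc hcp using this
    refine ⟨w.1, c 0 * c 1 * c 2, 0, fun i => ?_⟩
    simp only [hu, map_div₀, map_mul, map_pow, hcp, mul_pow, map_zero, add_zero]
    rw [← map_pow, hc, RingHom.map_one, one_mul, ← hprod w.1]
    ring

theorem fixGen_of_pairFlips_char_two {H : Subgroup (L ≃ₐ[k] L)} [Finite H]
    (htr : 3 ≤ Algebra.trdeg k L)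
    {z : Fin 3 → L} (hz : fixedField H ≤ adjoin k {z 0, z 1, z 2})
    (hH : ∀ h ∈ H, ∃ w, ActRefl h z w) (h2 : (2 : L) = 0)
    (hf : ∀ i, ∃ h ∈ H, PairFlip h z i) : FixGen H ⊤ 3 := by
  have hne : ∀ i, 1 - z i ≠ z i := fun i h => by
    have : (1 : L) = 0 := by linear_combination h + z i * h2
    exact one_ne_zero this
  set y : Fin 3 → L := fun i => z i ^ 2 + z i with hy
  set s := z 0 + z 1 + z 2 with hs
  have hr : ∀ b (t : L), refl b t ^ 2 + refl b t = t ^ 2 + t := by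
    intro b t
    cases b
    · rfl
    · simp only [refl, if_true]; linear_combination (1 - 2 * t) * h2
  have hyr : ∀ h ∈ H, ∀ w, ActRefl h z w → ∀ i, h (y i) = y (w.1 i) := by
    intro h hh w hw i
    simp only [hy, map_add, map_pow, hw i, hr]
  have hyf : ∀ (g : L ≃ₐ[k] L) i, PairFlip g z i → ∀ j, g (y j) = y j := by
    intro g i h j
    by_cases hj : j = i
    · simp only [hy, map_add, map_pow, hj, h.1]
    · simp only [hy, map_add, map_pow, h.2 j hj]; exact hr true (z j)
  have hsf : ∀ (g : L ≃ₐ[k] L) i, PairFlip g z i → g s = s := by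
    intro g i h
    simp only [hs, map_add]
    obtain ⟨h1, h3⟩ := h
    fin_cases i <;> simp only [Fin.zero_eta, Fin.mk_one, Fin.reduceFinMk] at h1 h3
    · rw [h1, h3 1 (by decide), h3 2 (by decide)]; linear_combination (1 - z 1 - z 2) * h2
    · rw [h1, h3 0 (by decide), h3 2 (by decide)]; linear_combination (1 - z 0 - z 2) * h2
    · rw [h1, h3 0 (by decide), h3 1 (by decide)]; linear_combination (1 - z 0 - z 1) * h2
  have hle : fixedField H ≤ adjoin k {s, y 1 - y 2, y 0 - y 2} := by
    intro a ha
    have fix : ∀ h ∈ H, h a = a := fun h hh => ha ⟨h, hh⟩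
    obtain ⟨g0, m0, f0⟩ := hf 0
    obtain ⟨g1, m1, f1⟩ := hf 1
    obtain ⟨g2, m2, f2⟩ := hf 2
    obtain ⟨t1, t2, t3⟩ := mem_adjoin_triple (k := k) (x := s) (y := y 1 - y 2) (z := y 0 - y 2)
    have y2 : y 2 = s ^ 2 + s + (y 1 - y 2) + (y 0 - y 2) := by
      simp only [hs, hy]
      linear_combination (-z 0 ^ 2 - z 1 ^ 2 - z 0 - z 1 + z 2 ^ 2 + z 2 -z 2 ^2 - z 2 + z 2 ^ 2 + z 2
        - z 0 * z 1 - z 0 * z 2 - z 1 * z 2) * h2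
    have y2m : y 2 ∈ adjoin k {s, y 1 - y 2, y 0 - y 2} := by
      have := add_mem (add_mem (add_mem (pow_mem t1 2) t1) t2) t3
      rwa [← y2] at this
    have y0m : y 0 ∈ adjoin k {s, y 1 - y 2, y 0 - y 2} := by
      have := add_mem t3 y2m; rwa [sub_add_cancel] at this
    have y1m : y 1 ∈ adjoin k {s, y 1 - y 2, y 0 - y 2} := by
      have := add_mem t2 y2m; rwa [sub_add_cancel] at this
    have hsq : ∀ i, z i ^ 2 = -1 * z i + y i := fun i => by simp only [hy]; ring
    have hd : ∀ (g : L ≃ₐ[k] L) i, PairFlip g z i → ∀ j l, g (y j - y l) = y j - y l := fun g i h j l => by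
      rw [map_sub, hyf g i h, hyf g i h]
    have a1 : a ∈ adjoin k (insert (z 1) {s, y 1 - y 2, y 0 - y 2}) := by
      have hle := adjoin.mono k _ _ (Set.subset_insert (z 1) {s, y 1 - y 2, y 0 - y 2})
      refine mem_of_fixed_quadratic (h := g1) (α := z 0) ?_ (neg_mem (one_mem _)) (hle y0m)
        (hsq 0) ?_ (f1.2 0 (by decide) ▸ hne 0) (fix g1 m1)
      · refine (adjoin_le_iff.mpr ?_ : adjoin k {z 0, z 1, z 2} ≤ _) (hz ha)
        have l0 : z 0 ∈ adjoin k (insert (z 0) (insert (z 1) {s, y 1 - y 2, y 0 - y 2})) :=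
          subset_adjoin _ _ (by simp)
        have l1 : z 1 ∈ adjoin k (insert (z 0) (insert (z 1) {s, y 1 - y 2, y 0 - y 2})) :=
          subset_adjoin _ _ (by simp)
        have l2 : s ∈ adjoin k (insert (z 0) (insert (z 1) {s, y 1 - y 2, y 0 - y 2})) :=
          subset_adjoin _ _ (by simp)
        rintro x (rfl | rfl | rfl)
        · exact l0
        · exact l1
        · rw [show z 2 = s - z 0 - z 1 by rw [hs]; ring]
          exact sub_mem (sub_mem l2 l0) l1
      · rintro s (rfl | rfl | rfl | rfl)
        · exact f1.1
        · exact hsf g1 1 f1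
        all_goals exact hd g1 1 f1 _ _
    refine mem_of_fixed_quadratic (h := g2) (α := z 1) a1 (neg_mem (one_mem _)) y1m
        (hsq 1) ?_ (f2.2 1 (by decide) ▸ hne 1) (fix g2 m2)
    rintro s (rfl | rfl | rfl)
    · exact hsf g2 2 f2
    all_goals exact hd g2 2 f2 _ _
  have hi := (spans_of_fixedField_le hle).algebraicIndependent htr
  have n12 : y 1 - y 2 ≠ 0 := by
    have := hi.ne_zero 1
    simpa using this
  have key : ∀ h ∈ H, ∃ σ : Fin 3 → Fin 3, ∀ i j, h (y i - y j) = 1 * (y (σ i) - y (σ j)) := by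
    intro h hh
    obtain ⟨w, hw⟩ := hH h hh
    exact ⟨w.1, fun i j => by rw [map_sub, hyr h hh w hw, hyr h hh w hw, one_mul]⟩
  refine fixGen_three htr (a := s) (b := y 1 - y 2) (c := (y 0 - y 2) / (y 1 - y 2)) ?_ ?_ ?_ ?_
  · refine hle.trans (adjoin_le_iff.mpr ?_)
    obtain ⟨t1, t2, t3⟩ := mem_adjoin_triple (k := k) (x := s) (y := y 1 - y 2)
      (z := (y 0 - y 2) / (y 1 - y 2))
    rintro x (rfl | rfl | rfl)
    · exact t1
    · exact t2
    · have := mul_mem t3 t2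
      rwa [div_mul_cancel₀ _ n12] at this
  · intro h hh
    obtain ⟨σ, e⟩ := key h hh
    exact (diff_mem n12 one_ne_zero e).1
  · intro h hh
    obtain ⟨σ, e⟩ := key h hh
    obtain ⟨v, hv, e'⟩ := (diff_mem n12 one_ne_zero e).2.1
    exact ⟨v, hv, 0, zero_mem _, by rw [e']; ring⟩
  · intro h hh
    obtain ⟨w, hw⟩ := hH h hh
    have := fun i => refl_char_two (k := k) h2 (w.2 i)
    choose c hc hcr using this
    have hsum : z (w.1 0) + z (w.1 1) + z (w.1 2) = s := by
      have := Equiv.sum_comp w.1 z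
      simpa [Fin.sum_univ_three] using this
    refine ⟨1, one_mem _, c 0 + c 1 + c 2, ?_, ?_⟩
    · exact bot_le (a := adjoin k _) (add_mem (add_mem (hc 0) (hc 1)) (hc 2))
    · rw [show h s = h (z 0) + h (z 1) + h (z 2) by rw [hs, map_add, map_add],
        hw, hw, hw, hcr, hcr, hcr, ← hsum]; ring

/-- Signed permutations of three letters. -/
abbrev SPerm := Equiv.Perm (Fin 3) × (Fin 3 → Bool)

/-- The product of signed permutations. -/
def SPerm.comp (a b : SPerm) : SPerm := (a.1 * b.1, fun i => xor (b.2 i) (a.2 (b.1 i)))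

/-- Powers of a signed permutation. -/
def SPerm.npow (a : SPerm) : ℕ → SPerm
  | 0 => (1, fun _ => false)
  | n + 1 => a.comp (a.npow n)

theorem actRefl_comp {g h : L ≃ₐ[k] L} {z : Fin 3 → L} {a b : SPerm} (hg : ActRefl g z a)
    (hh : ActRefl h z b) : ActRefl (g * h) z (a.comp b) := by
  intro i
  rw [AlgEquiv.mul_apply, hh i, map_refl, hg, refl_refl]
  rfl

/-- A set of signed permutations closed under composition. -/
def SPerm.Closed (S : Set SPerm) : Prop :=
  (1, fun _ => false) ∈ S ∧ ∀ a ∈ S, ∀ b ∈ S, a.comp b ∈ S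

theorem SPerm.Closed.npow {S : Set SPerm} (hS : SPerm.Closed S) {a : SPerm} (ha : a ∈ S) (n : ℕ) :
    a.npow n ∈ S := by
  induction n with
  | zero => exact hS.1
  | succ n ih => exact hS.2 _ ha _ ih

/-- The signed permutations of the `z i` realised by `H`. -/
def sperms (H : Subgroup (L ≃ₐ[k] L)) (z : Fin 3 → L) : Set SPerm := {w | ∃ h ∈ H, ActRefl h z w}

theorem closed_sperms (H : Subgroup (L ≃ₐ[k] L)) (z : Fin 3 → L) : SPerm.Closed (sperms H z) :=
  ⟨⟨1, one_mem _, fun i => by simp [refl]⟩, fun a ⟨g, hg, hga⟩ b ⟨h, hh, hhb⟩ =>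
    ⟨g * h, mul_mem hg hh, actRefl_comp hga hhb⟩⟩

theorem fixGen_of_fixed_coord {H : Subgroup (L ≃ₐ[k] L)} [Finite H] (htr : 3 ≤ Algebra.trdeg k L)
    {x p q : L} (hle : fixedField H ≤ adjoin k {x, p, q}) (hx : ∀ h ∈ H, ∃ e, h x = refl e x)
    (hpq : ∀ h ∈ H, ∃ e e' : Bool, (h p = refl e p ∧ h q = refl e' q) ∨
      (h p = refl e q ∧ h q = refl e' p)) : FixGen H ⊤ 3 := by
  refine fixGen_step htr hle ?_ (fixGen_two_refl htr (spans_of_fixedField_le hle) hpq) ?_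
  · apply stable_adjoin
    have mp : p ∈ adjoin k {p, q} := subset_adjoin _ _ (by simp)
    have mq : q ∈ adjoin k {p, q} := subset_adjoin _ _ (by simp)
    intro h hh a ha
    obtain ⟨e, e', ⟨h1, h2⟩ | ⟨h1, h2⟩⟩ := hpq h hh <;> rcases ha with rfl | rfl <;>
      simp only [h1, h2] <;> apply refl_mem <;> assumption
  · intro h hh
    obtain ⟨e, he⟩ := hx h hh
    cases e
    · exact ⟨1, one_mem _, 0, zero_mem _, by rw [he]; simp [refl]⟩
    · exact ⟨-1, neg_mem (one_mem _), 1, one_mem _, by rw [he]; simp [refl]; ring⟩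

theorem exists_three_cycle (a b c : Equiv.Perm (Fin 3)) (ha : a 0 ≠ 0) (hb : b 1 ≠ 1)
    (hc : c 2 ≠ 2) : ∃ w ∈ [a, b, c, a * b, a * c, b * c], ∀ i, w i ≠ i := by
  revert a b c
  decide +kernel

theorem exists_normalization (c : SPerm) (hc : ∀ i, c.1 i ≠ i) :
    ∃ f : Fin 3 → Bool, ∃ d, ∀ i, xor (f i) (xor (c.2 i) (f (c.1 i))) = d := by
  obtain ⟨a, e⟩ := c
  revert a e
  decide +kernel

theorem exists_pure (a : Equiv.Perm (Fin 3)) (d : Bool) (g : SPerm) (ha : ∀ i, a i ≠ i)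
    (hg : ∃ i j, g.2 i ≠ g.2 j) : ∃ m ≤ 2, ∃ n ≤ 2, ∃ l ≤ 2,
      let w := (g.npow m).comp ((SPerm.npow (a, fun _ => d) n).comp
        ((g.npow m).comp (SPerm.npow (a, fun _ => d) l)))
      w.1 = 1 ∧ ∃ i j, w.2 i ≠ w.2 j := by
  obtain ⟨b, e⟩ := g
  revert a d b e
  decide +kernel

theorem flips_of_pure (a : Equiv.Perm (Fin 3)) (d : Bool) (e : Fin 3 → Bool) (ha : ∀ i, a i ≠ i)
    (hg : ∃ i j, e i ≠ e j) :
    let v : ℕ → SPerm := fun n => (SPerm.npow (a, fun _ => d) n).comp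
      (SPerm.comp (1, e) (SPerm.npow (a, fun _ => d) (6 - n)))
    (∀ i, ∃ n ≤ 2, v n = (1, fun j => decide (j = i))) ∨
    (∀ i, ∃ n ≤ 2, v n = (1, fun j => decide (j ≠ i))) := by
  revert a d e
  decide +kernel

theorem fixGen_of_const_sign {H : Subgroup (L ≃ₐ[k] L)} [Finite H] (htr : 3 ≤ Algebra.trdeg k L)
    {z : Fin 3 → L} (hz : fixedField H ≤ adjoin k {z 0, z 1, z 2})
    (hH : ∀ h ∈ H, ∃ w, ActRefl h z w) (hw : ∀ w ∈ sperms H z, ∀ i j, w.2 i = w.2 j) :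
    FixGen H ⊤ 3 := by
  refine fixGen_of_perm_affine htr hz fun h hh => ?_
  obtain ⟨w, e⟩ := hH h hh
  have hc := hw w ⟨h, hh, e⟩
  cases h0 : w.2 0
  · exact ⟨w.1, 1, 0, fun i => by rw [e i, hc i 0, h0]; simp [refl]⟩
  · exact ⟨w.1, -1, 1, fun i => by rw [e i, hc i 0, h0]; simp [refl]; ring⟩

theorem perm_three (a : Equiv.Perm (Fin 3)) :
    (a 0 = 0 → a 1 = 1 ∧ a 2 = 2 ∨ a 1 = 2 ∧ a 2 = 1) ∧
    (a 1 = 1 → a 0 = 0 ∧ a 2 = 2 ∨ a 0 = 2 ∧ a 2 = 0) ∧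
    (a 2 = 2 → a 0 = 0 ∧ a 1 = 1 ∨ a 0 = 1 ∧ a 1 = 0) := by
  revert a
  decide

theorem fixGen_of_actRefl {H : Subgroup (L ≃ₐ[k] L)} [Finite H] (htr : 3 ≤ Algebra.trdeg k L)
    {z : Fin 3 → L} (hz : fixedField H ≤ adjoin k {z 0, z 1, z 2})
    (hH : ∀ h ∈ H, ∃ w, ActRefl h z w) : FixGen H ⊤ 3 := by
  by_cases hfix : ∃ i, ∀ w ∈ sperms H z, w.1 i = i
  · obtain ⟨i, hi⟩ := hfix
    have key : ∀ h ∈ H, ∃ w, ActRefl h z w ∧ w.1 i = i := fun h hh => by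
      obtain ⟨w, hw⟩ := hH h hh
      exact ⟨w, hw, hi w ⟨h, hh, hw⟩⟩
    have hx : ∀ h ∈ H, ∃ e, h (z i) = refl e (z i) := fun h hh => by
      obtain ⟨w, hw, e⟩ := key h hh
      exact ⟨w.2 i, by rw [hw i, e]⟩
    have hpq : ∀ p q : Fin 3, (∀ a : Equiv.Perm (Fin 3), a i = i →
        a p = p ∧ a q = q ∨ a p = q ∧ a q = p) → ∀ h ∈ H, ∃ e e' : Bool,
        (h (z p) = refl e (z p) ∧ h (z q) = refl e' (z q)) ∨
        (h (z p) = refl e (z q) ∧ h (z q) = refl e' (z p)) := fun p q hpq h hh => by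
      obtain ⟨w, hw, e⟩ := key h hh
      refine ⟨w.2 p, w.2 q, ?_⟩
      rcases hpq w.1 e with ⟨h1, h2⟩ | ⟨h1, h2⟩
      · left; rw [hw, hw, h1, h2]; exact ⟨rfl, rfl⟩
      · right; rw [hw, hw, h1, h2]; exact ⟨rfl, rfl⟩
    have hset : ∀ {s t : Set L}, s ⊆ t → fixedField H ≤ adjoin k s → fixedField H ≤ adjoin k t :=
      fun hst h => h.trans (adjoin.mono _ _ _ hst)
    fin_cases i
    · exact fixGen_of_fixed_coord htr hz hx (hpq 1 2 fun a => (perm_three a).1)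
    · refine fixGen_of_fixed_coord htr (hset ?_ hz) hx (hpq 0 2 fun a => (perm_three a).2.1)
      rintro s (rfl | rfl | rfl) <;> simp
    · refine fixGen_of_fixed_coord htr (hset ?_ hz) hx (hpq 0 1 fun a => (perm_three a).2.2)
      rintro s (rfl | rfl | rfl) <;> simp
  · push Not at hfix
    have hcl := closed_sperms H z
    obtain ⟨c, hcS, hc⟩ : ∃ c ∈ sperms H z, ∀ i, c.1 i ≠ i := by
      obtain ⟨a, ha, ha'⟩ := hfix 0
      obtain ⟨b, hb, hb'⟩ := hfix 1
      obtain ⟨c, hc, hc'⟩ := hfix 2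
      obtain ⟨w, hw, hw'⟩ := exists_three_cycle a.1 b.1 c.1 ha' hb' hc'
      simp only [List.mem_cons, List.not_mem_nil, or_false] at hw
      rcases hw with rfl | rfl | rfl | rfl | rfl | rfl
      · exact ⟨a, ha, hw'⟩
      · exact ⟨b, hb, hw'⟩
      · exact ⟨c, hc, hw'⟩
      · exact ⟨_, hcl.2 _ ha _ hb, hw'⟩
      · exact ⟨_, hcl.2 _ ha _ hc, hw'⟩
      · exact ⟨_, hcl.2 _ hb _ hc, hw'⟩
    obtain ⟨f, d, hf⟩ := exists_normalization c hc
    set z' : Fin 3 → L := fun i => refl (f i) (z i) with hz'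
    have hzz : ∀ i, z i = refl (f i) (z' i) := fun i => by
      simp only [hz', refl_refl]; simp [refl]
    have conv : ∀ h w, ActRefl (k := k) h z w →
        ActRefl h z' (w.1, fun i => xor (f i) (xor (w.2 i) (f (w.1 i)))) := fun h w hw i => by
      change h (refl (f i) (z i)) = _
      rw [map_refl, hw i, hzz (w.1 i), refl_refl, refl_refl, Bool.xor_assoc]
    have hz2 : fixedField H ≤ adjoin k {z' 0, z' 1, z' 2} := by
      refine hz.trans (adjoin_le_iff.mpr ?_)
      rintro s (rfl | rfl | rfl) <;> rw [hzz] <;> apply refl_mem <;>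
        exact subset_adjoin _ _ (by simp)
    have hH' : ∀ h ∈ H, ∃ w, ActRefl h z' w := fun h hh => by
      obtain ⟨w, hw⟩ := hH h hh
      exact ⟨_, conv h w hw⟩
    have hcS' : (c.1, fun _ => d) ∈ sperms H z' := by
      obtain ⟨h, hh, e⟩ := hcS
      refine ⟨h, hh, ?_⟩
      have := conv h c e
      simpa only [hf] using this
    have hcl' := closed_sperms H z'
    by_cases hnc : ∃ g ∈ sperms H z', ∃ i j, g.2 i ≠ g.2 j
    · obtain ⟨g, hg, hg'⟩ := hnc
      obtain ⟨m, -, n, -, l, -, hw1, hw2⟩ := exists_pure c.1 d g hc hg'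
      have hwS := hcl'.2 _ (hcl'.npow hg m) _ (hcl'.2 _ (hcl'.npow hcS' n) _
        (hcl'.2 _ (hcl'.npow hg m) _ (hcl'.npow hcS' l)))
      set w := (g.npow m).comp ((SPerm.npow (c.1, fun _ => d) n).comp
        ((g.npow m).comp (SPerm.npow (c.1, fun _ => d) l)))
      obtain ⟨w1, w2⟩ := w
      obtain rfl : w1 = 1 := hw1
      have hv : ∀ n, (SPerm.npow (c.1, fun _ => d) n).comp
          (SPerm.comp (1, w2) (SPerm.npow (c.1, fun _ => d) (6 - n))) ∈ sperms H z' := fun n =>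
        hcl'.2 _ (hcl'.npow hcS' n) _ (hcl'.2 _ hwS _ (hcl'.npow hcS' (6 - n)))
      rcases flips_of_pure c.1 d w2 hc hw2 with h | h
      · refine fixGen_of_flips htr hz2 hH' fun i => ?_
        obtain ⟨n, -, e⟩ := h i
        have hvn := hv n
        dsimp only at e
        rw [e] at hvn
        obtain ⟨h, hh, e'⟩ := hvn
        refine ⟨h, hh, ?_, fun j hj => ?_⟩
        · rw [e' i]; simp [refl]
        · rw [e' j]; simp [refl, hj]
      · have hp : ∀ i, ∃ h ∈ H, PairFlip h z' i := fun i => by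
          obtain ⟨n, -, e⟩ := h i
          have hvn := hv n
          dsimp only at e
          rw [e] at hvn
          obtain ⟨h, hh, e'⟩ := hvn
          refine ⟨h, hh, ?_, fun j hj => ?_⟩
          · rw [e' i]; simp [refl]
          · rw [e' j]; simp [refl, hj]
        by_cases h2 : (2 : L) = 0
        · exact fixGen_of_pairFlips_char_two htr hz2 hH' h2 hp
        · exact fixGen_of_pairFlips_two htr hz2 hH' h2 hp
    · push Not at hnc
      exact fixGen_of_const_sign htr hz2 hH' hnc

/-- The elements of a finite group `W` related to an element of `H` by a multiplicative
relation. -/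
def realized {W : Type*} [Group W] [Finite W] (H : Subgroup (L ≃ₐ[k] L))
    (R : (L ≃ₐ[k] L) → W → Prop) (h1 : R 1 1)
    (hmul : ∀ g h a b, R g a → R h b → R (g * h) (a * b)) : Subgroup W where
  carrier := {w | ∃ h ∈ H, R h w}
  one_mem' := ⟨1, one_mem _, h1⟩
  mul_mem' := fun ⟨g, hg, hga⟩ ⟨h, hh, hhb⟩ => ⟨g * h, mul_mem hg hh, hmul _ _ _ _ hga hhb⟩
  inv_mem' := fun {a} ⟨g, hg, hga⟩ => by
    have key : ∀ n : ℕ, R (g ^ n) (a ^ n) := fun n => by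
      induction n with
      | zero => simpa using h1
      | succ n ih => rw [pow_succ, pow_succ]; exact hmul _ _ _ _ ih hga
    refine ⟨g ^ (orderOf a - 1), pow_mem hg _, ?_⟩
    have : a⁻¹ = a ^ (orderOf a - 1) := by
      rw [inv_eq_iff_mul_eq_one, ← pow_succ', Nat.sub_add_cancel (orderOf_pos a), pow_orderOf_eq_one]
    rw [this]
    exact key _

/-- `h` permutes the `x i` up to simultaneous inversion. -/
def ActInv {n : ℕ} (x : Fin n → L) (h : L ≃ₐ[k] L) (w : Equiv.Perm (Fin n) × ℤˣ) : Prop :=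
  ∀ i, h (x i) = x (w.1 i) ^ (w.2 : ℤ)

theorem actInv_one {n : ℕ} (x : Fin n → L) : ActInv (k := k) x 1 1 := fun i => by simp

theorem actInv_mul {n : ℕ} (x : Fin n → L) (g h : L ≃ₐ[k] L) (a b : Equiv.Perm (Fin n) × ℤˣ)
    (hg : ActInv x g a) (hh : ActInv x h b) : ActInv x (g * h) (a * b) := fun i => by
  rw [AlgEquiv.mul_apply, hh i, map_zpow₀, hg, ← zpow_mul]
  rfl

/-- The group of pairs (permutation, sign) by which `H` acts on the `x i`. -/
def invGroup {n : ℕ} (H : Subgroup (L ≃ₐ[k] L)) (x : Fin n → L) :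
    Subgroup (Equiv.Perm (Fin n) × ℤˣ) :=
  realized H (ActInv x) (actInv_one x) (actInv_mul x)

/-- The coordinate `1 / (1 + x)`, in which inversion becomes `t ↦ 1 - t`. -/
def cay (x : L) : L := (1 + x)⁻¹

theorem cay_inv {x : L} (h0 : x ≠ 0) (h1 : 1 + x ≠ 0) : cay x⁻¹ = 1 - cay x := by
  rw [cay, cay, show 1 + x⁻¹ = (1 + x) / x by field_simp; ring, inv_div, eq_sub_iff_add_eq,
    ← one_div, ← add_div, add_comm, div_self h1]

theorem cay_zpow {x : L} (h0 : x ≠ 0) (h1 : 1 + x ≠ 0) (s : ℤˣ) :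
    ∃ e, cay (x ^ (s : ℤ)) = refl e (cay x) := by
  rcases Int.units_eq_one_or s with rfl | rfl
  · exact ⟨false, by simp [refl]⟩
  · exact ⟨true, by simp [refl, cay_inv h0 h1]⟩

theorem map_cay (h : L ≃ₐ[k] L) (x : L) : h (cay x) = cay (h x) := by
  simp [cay]

theorem cay_mem {K : IntermediateField k L} {x : L} : cay x ∈ K ↔ x ∈ K := by
  unfold cay
  rw [inv_mem_iff]
  refine ⟨fun h => ?_, fun h => add_mem (one_mem _) h⟩
  have := sub_mem h (one_mem K)
  rwa [add_sub_cancel_left] at this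

theorem fixGen_two_of_projective {H : Subgroup (L ≃ₐ[k] L)} [Finite H]
    (htr : 3 ≤ Algebra.trdeg k L) {z p q : L} (hs : Spans k {z, p, q})
    (hK : Stable H (adjoin k {p, q})) {y : Fin 3 → L} (n12 : y 1 - y 2 ≠ 0) (n2 : y 2 ≠ 0)
    (m0 : y 0 / y 2 ∈ adjoin k {p, q}) (m1 : y 1 / y 2 ∈ adjoin k {p, q})
    (hle : fixedField H ⊓ adjoin k {p, q} ≤ adjoin k {y 0 / y 2, y 1 / y 2})
    (hy : ∀ h ∈ H, ∃ (σ : Fin 3 → Fin 3) (c : L), c ≠ 0 ∧ ∀ i, h (y i) = c * y (σ i)) :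
    FixGen H (adjoin k {p, q}) 2 := by
  have hd : ∀ h ∈ H, ∃ (σ : Fin 3 → Fin 3) (c : L), c ≠ 0 ∧ (∀ i, h (y i) = c * y (σ i)) ∧
      ∀ i j, h (y i - y j) = c * (y (σ i) - y (σ j)) := by
    intro h hh
    obtain ⟨σ, c, hc, e⟩ := hy h hh
    exact ⟨σ, c, hc, e, fun i j => by rw [map_sub, e, e]; ring⟩
  refine fixGen_two htr hs hK (b := y 2 / (y 1 - y 2)) (c := (y 0 - y 2) / (y 1 - y 2)) ?_ ?_ ?_ ?_
  · rw [adjoin_le_iff]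
    rintro s (rfl | rfl)
    · rw [show y 2 / (y 1 - y 2) = (y 1 / y 2 - 1)⁻¹ by field_simp]
      exact inv_mem (sub_mem m1 (one_mem _))
    · rw [show (y 0 - y 2) / (y 1 - y 2) = (y 0 / y 2 - 1) / (y 1 / y 2 - 1) by field_simp]
      exact div_mem (sub_mem m0 (one_mem _)) (sub_mem m1 (one_mem _))
  · refine hle.trans ?_
    rw [adjoin_le_iff]
    have mb : y 2 / (y 1 - y 2) ∈ adjoin k {y 2 / (y 1 - y 2), (y 0 - y 2) / (y 1 - y 2)} :=
      subset_adjoin _ _ (by simp)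
    have mt : (y 0 - y 2) / (y 1 - y 2) ∈
      adjoin k {y 2 / (y 1 - y 2), (y 0 - y 2) / (y 1 - y 2)} := subset_adjoin _ _ (by simp)
    rintro s (rfl | rfl)
    · rw [show y 0 / y 2 =
        ((y 0 - y 2) / (y 1 - y 2) + y 2 / (y 1 - y 2)) / (y 2 / (y 1 - y 2)) by
          field_simp; ring]
      exact div_mem (add_mem mt mb) mb
    · rw [show y 1 / y 2 = (1 + y 2 / (y 1 - y 2)) / (y 2 / (y 1 - y 2)) by field_simp; ring]
      exact div_mem (add_mem (one_mem _) mb) mb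
  · intro h hh
    obtain ⟨σ, c, hc, e, e'⟩ := hd h hh
    exact (diff_mem n12 hc e').1
  · intro h hh
    obtain ⟨σ, c, hc, e, e'⟩ := hd h hh
    obtain ⟨-, ⟨v, hv, ev⟩, h3⟩ := diff_mem n12 hc e'
    obtain ⟨u, hu, eu⟩ := h3 (σ 2) 2
    refine ⟨v⁻¹, inv_mem hv, u / v, div_mem hu hv, ?_⟩
    have : h (y 2) = (y 2 / (y 1 - y 2) + u) * (c * (y 1 - y 2)) := by
      rw [e 2]
      field_simp
      linear_combination eu
    rw [map_div₀, ev, this, mul_div_mul_right _ _ (mul_ne_zero hc n12)]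
    ring

set_option synthInstance.maxSize 1000 in
set_option synthInstance.maxHeartbeats 200000 in
theorem sign_dichotomy : ∀ c v w : Equiv.Perm (Fin 3) × ℤˣ, (∀ i, c.1 i ≠ i) → v.2 ≠ 1 →
    w.2 ≠ Equiv.Perm.sign w.1 →
    ∃ a b : Fin 2, ∃ i : Fin 6, v ^ a.val * w ^ b.val * c ^ i.val = (1, -1) := by
  decide +kernel

theorem perm_three_cases (a : Equiv.Perm (Fin 3)) :
    (Equiv.Perm.sign a = 1 ∧ (a 0 = 0 ∧ a 1 = 1 ∧ a 2 = 2 ∨ a 0 = 1 ∧ a 1 = 2 ∧ a 2 = 0 ∨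
      a 0 = 2 ∧ a 1 = 0 ∧ a 2 = 1)) ∨
    (Equiv.Perm.sign a = -1 ∧ (a 0 = 0 ∧ a 1 = 2 ∧ a 2 = 1 ∨ a 0 = 2 ∧ a 1 = 1 ∧ a 2 = 0 ∨
      a 0 = 1 ∧ a 1 = 0 ∧ a 2 = 2)) := by
  revert a
  decide +kernel

section
variable {H : Subgroup (L ≃ₐ[k] L)} {x : Fin 3 → L} {z : L}

theorem hex_two_mem {K : IntermediateField k L} (hprod : x 0 * x 1 * x 2 = 1) (h0 : x 0 ∈ K)
    (h1 : x 1 ∈ K) : ∀ i, x i ∈ K := by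
  have e : x 2 = (x 0 * x 1)⁻¹ := (inv_eq_of_mul_eq_one_right hprod).symm
  intro i
  fin_cases i
  · exact h0
  · exact h1
  · exact e ▸ inv_mem (mul_mem h0 h1)

theorem hex_stable (hprod : x 0 * x 1 * x 2 = 1) (hx : ∀ h ∈ H, ∃ w, ActInv x h w) :
    Stable H (adjoin k {x 0, x 1}) := by
  have hm := hex_two_mem (k := k) hprod (subset_adjoin k {x 0, x 1} (by simp))
    (subset_adjoin _ _ (by simp))
  apply stable_adjoin
  intro h hh a ha
  obtain ⟨w, hw⟩ := hx h hh
  rcases ha with rfl | rfl <;> rw [hw] <;> exact zpow_mem (hm _) _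

theorem hex_ne_zero (hprod : x 0 * x 1 * x 2 = 1) (i : Fin 3) : x i ≠ 0 := by
  intro h
  fin_cases i <;> simp_all

theorem hex_fixGen_sign [Finite H] (htr : 3 ≤ Algebra.trdeg k L) (hprod : x 0 * x 1 * x 2 = 1)
    (hz : Spans k {z, x 0, x 1}) (hx : ∀ h ∈ H, ∃ w, ActInv x h w ∧ w.2 = Equiv.Perm.sign w.1) :
    FixGen H (adjoin k {x 0, x 1}) 2 := by
  have hi := hz.algebraicIndependent htr
  have x0 := hex_ne_zero hprod 0
  have x1 := hex_ne_zero hprod 1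
  have x2 := hex_ne_zero hprod 2
  have e2 : x 2 = (x 0 * x 1)⁻¹ := (inv_eq_of_mul_eq_one_right hprod).symm
  have n1 : x 0 - 1 ≠ 0 := by
    have := aeval_ne_zero hi (X 1 - 1) (![0, 0, 0] : Fin 3 → k) (by simp)
    simpa using this
  have m0 : x 0 ∈ adjoin k {x 0, x 1} := subset_adjoin _ _ (by simp)
  have m1 : x 1 ∈ adjoin k {x 0, x 1} := subset_adjoin _ _ (by simp)
  refine fixGen_two_of_projective htr hz (hex_stable hprod fun h hh => ?_)
    (y := ![(x 1)⁻¹, x 0, 1]) (by simpa using n1) (by simp) (by simpa using m1)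
    (by simpa using m0) ?_ fun h hh => ?_
  · obtain ⟨w, hw, -⟩ := hx h hh
    exact ⟨w, hw⟩
  · refine inf_le_right.trans (adjoin_le_iff.mpr ?_)
    rintro s (rfl | rfl)
    · exact subset_adjoin _ _ (by simp)
    · exact inv_mem_iff.mp (subset_adjoin _ _ (by simp))
  · obtain ⟨w, hw, e⟩ := hx h hh
    have hy : ∀ j, (![(x 1)⁻¹, x 0, 1] : Fin 3 → L) j ≠ 0 := by
      intro j; fin_cases j <;> simp [x0, x1]
    refine ⟨w.1, ((![(x 1)⁻¹, x 0, 1] : Fin 3 → L) (w.1 2))⁻¹, inv_ne_zero (hy _), fun i => ?_⟩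
    have w0 := hw 0
    have w1 := hw 1
    rw [e] at w0 w1
    rcases perm_three_cases w.1 with ⟨s, h⟩ | ⟨s, h⟩ <;> rw [s] at w0 w1 <;>
      rcases h with ⟨h0, h1, h2⟩ | ⟨h0, h1, h2⟩ | ⟨h0, h1, h2⟩ <;> rw [h0] at w0 <;>
      rw [h1] at w1 <;> fin_cases i <;> simp [w0, w1, h0, h1, h2, e2] <;> field_simp

theorem hex_fixGen_perm (hprod : x 0 * x 1 * x 2 = 1) (n01 : x 0 ≠ x 1) (n02 : x 0 ≠ x 2)
    (n12 : x 1 ≠ x 2) (hx : ∀ h ∈ H, ∃ w, ActInv x h w ∧ w.2 = 1)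
    {c d : L ≃ₐ[k] L} (hc : c ∈ H) (hd : d ∈ H) (c0 : c (x 0) = x 1) (c1 : c (x 1) = x 2)
    (d0 : d (x 0) = x 0) (d1 : d (x 1) = x 2) :
    FixGen H (adjoin k {x 0, x 1}) 2 := by
  classical
  have x0 := hex_ne_zero hprod 0
  have x1 := hex_ne_zero hprod 1
  have x2 := hex_ne_zero hprod 2
  have m0 : x 0 ∈ adjoin k {x 0, x 1} := subset_adjoin _ _ (by simp)
  have m1 : x 1 ∈ adjoin k {x 0, x 1} := subset_adjoin _ _ (by simp)
  have hm := hex_two_mem (k := k) hprod m0 m1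
  set e1 := x 0 + x 1 + x 2 with he1
  set e2 := x 0 * x 1 + x 0 * x 2 + x 1 * x 2 with he2
  have hfix : ∀ h ∈ H, h e1 = e1 ∧ h e2 = e2 := by
    intro h hh
    obtain ⟨w, hw, e⟩ := hx h hh
    have hw' : ∀ i, h (x i) = x (w.1 i) := fun i => by rw [hw i, e]; simp
    rcases perm_three_cases w.1 with ⟨s, h⟩ | ⟨s, h⟩ <;>
      rcases h with ⟨h0, h1, h2⟩ | ⟨h0, h1, h2⟩ | ⟨h0, h1, h2⟩ <;>
      refine ⟨?_, ?_⟩ <;>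
      simp only [he1, he2, map_add, map_mul, hw', h0, h1, h2] <;> ring
  refine ⟨![e1, e2], ?_⟩
  have hr : Set.range ![e1, e2] = {e1, e2} := by
    ext s; simp; exact or_comm
  rw [hr]
  apply le_antisymm
  · rintro a ⟨ha, haK⟩
    have fix : ∀ h ∈ H, h a = a := fun h hh => ha ⟨h, hh⟩
    have a1 : a ∈ adjoin k (insert (x 0) {e1, e2}) := by
      obtain ⟨t0, t1, t2⟩ := mem_adjoin_triple (k := k) (x := x 0) (y := e1) (z := e2)
      refine mem_of_fixed_quadratic (h := d) (α := x 1) (c := e1 - x 0) (d := -(x 0)⁻¹) ?_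
        (sub_mem t1 t0) (neg_mem (inv_mem t0)) ?_ ?_ (d1 ▸ n12.symm) (fix d hd)
      · refine adjoin.mono _ _ _ ?_ haK
        rintro s (rfl | rfl) <;> simp
      · rw [he1]; field_simp
        linear_combination -hprod
      · rintro s (rfl | rfl | rfl)
        · exact d0
        · exact (hfix d hd).1
        · exact (hfix d hd).2
    have t1 : e1 ∈ adjoin k {e1, e2} := subset_adjoin _ _ (by simp)
    have t2 : e2 ∈ adjoin k {e1, e2} := subset_adjoin _ _ (by simp)
    have c2 : c (x 2) = x 0 := by
      have := (hfix c hc).1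
      rw [he1, map_add, map_add, c0, c1] at this
      linear_combination this
    have hdeg : ((Polynomial.X ^ 3 - Polynomial.C (⟨e1, t1⟩ : adjoin k {e1, e2}) *
        Polynomial.X ^ 2 + Polynomial.C (⟨e2, t2⟩ : adjoin k {e1, e2}) * Polynomial.X - 1) :
        (adjoin k {e1, e2})[X]).natDegree = 3 := by
      compute_degree!
    have p1 : (1 : L ≃ₐ[k] L) (x 0) = x 0 := rfl
    have p3 : (c * c) (x 0) = x 2 := by rw [AlgEquiv.mul_apply, c0, c1]
    have q12 : (1 : L ≃ₐ[k] L) ≠ c := by rintro rfl; exact n01 c0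
    have q13 : (1 : L ≃ₐ[k] L) ≠ c * c := by
      intro h; rw [← h] at p3; exact n02 p3
    have q23 : c ≠ c * c := by
      intro h; rw [← h] at p3; exact n12 (c0 ▸ p3)
    have hE : ∀ h ∈ H, ∀ e ∈ adjoin k {e1, e2}, h e = e := fun h hh => fixes_adjoin <| by
      rintro s (rfl | rfl)
      · exact (hfix h hh).1
      · exact (hfix h hh).2
    rw [← adjoin_insert_adjoin] at a1
    refine mem_of_fixed a1 (Polynomial.X ^ 3 - Polynomial.C (⟨e1, t1⟩ : adjoin k {e1, e2}) *
        Polynomial.X ^ 2 + Polynomial.C (⟨e2, t2⟩ : adjoin k {e1, e2}) * Polynomial.X - 1)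
      ?_ ?_ {1, c, c * c} ?_ ?_ ?_ ?_
    · intro h0
      rw [h0, Polynomial.natDegree_zero] at hdeg
      omega
    · simp only [map_sub, map_add, map_pow, map_mul, Polynomial.aeval_X, Polynomial.aeval_C,
        map_one]
      change x 0 ^ 3 - e1 * x 0 ^ 2 + e2 * x 0 - 1 = 0
      rw [he1, he2]
      linear_combination hprod
    · rw [hdeg, Finset.card_eq_three.mpr ⟨1, c, c * c, q12, q13, q23, rfl⟩]
    · intro g hg
      simp only [Finset.mem_insert, Finset.mem_singleton] at hg
      rcases hg with rfl | rfl | rfl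
      · exact fun _ _ => rfl
      · exact hE _ hc
      · exact hE _ (mul_mem hc hc)
    · intro g hg
      simp only [Finset.mem_insert, Finset.mem_singleton] at hg
      rcases hg with rfl | rfl | rfl
      · rfl
      · exact fix _ hc
      · exact fix _ (mul_mem hc hc)
    · intro g hg g' hg' e
      simp only [Finset.mem_insert, Finset.mem_singleton] at hg hg'
      rcases hg with rfl | rfl | rfl <;> rcases hg' with rfl | rfl | rfl <;>
        simp only [p1, p3, c0] at e <;> first | rfl | exact absurd e ‹_› | exact absurd e.symm ‹_›
  · rw [adjoin_le_iff]
    rintro s (rfl | rfl)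
    · exact ⟨fun h => (hfix h.1 h.2).1, add_mem (add_mem m0 m1) (hm 2)⟩
    · exact ⟨fun h => (hfix h.1 h.2).2, add_mem (add_mem (mul_mem m0 m1) (mul_mem m0 (hm 2)))
        (mul_mem m1 (hm 2))⟩

theorem hex_fixGen_neg [Finite H] (htr : 3 ≤ Algebra.trdeg k L) (hprod : x 0 * x 1 * x 2 = 1)
    (hz : Spans k {z, x 0, x 1}) (hx : ∀ h ∈ H, ∃ w, ActInv x h w)
    {g : L ≃ₐ[k] L} (hg : g ∈ H) (hgx : ∀ i, g (x i) = (x i)⁻¹) :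
    FixGen H (adjoin k {x 0, x 1}) 2 := by
  have hi := hz.algebraicIndependent htr
  have hx0 := hex_ne_zero hprod
  have x0 := hex_ne_zero hprod 0
  have x1 := hex_ne_zero hprod 1
  have x2 := hex_ne_zero hprod 2
  have e2 : x 2 = (x 0 * x 1)⁻¹ := (inv_eq_of_mul_eq_one_right hprod).symm
  have m0 : x 0 ∈ adjoin k {x 0, x 1} := subset_adjoin _ _ (by simp)
  have m1 : x 1 ∈ adjoin k {x 0, x 1} := subset_adjoin _ _ (by simp)
  have hm := hex_two_mem (k := k) hprod m0 m1
  have q0 : x 0 - 1 ≠ 0 := by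
    have := aeval_ne_zero hi (X 1 - 1) (![0, 0, 0] : Fin 3 → k) (by simp)
    simpa using this
  have q1 : x 1 - 1 ≠ 0 := by
    have := aeval_ne_zero hi (X 2 - 1) (![0, 0, 0] : Fin 3 → k) (by simp)
    simpa using this
  have q2 : x 0 * x 1 - 1 ≠ 0 := by
    have := aeval_ne_zero hi (X 1 * X 2 - 1) (![0, 0, 0] : Fin 3 → k) (by simp)
    simpa using this
  have q01 : x 0 ^ 2 - 1 ≠ 0 := by
    have := aeval_ne_zero hi (X 1 ^ 2 - 1) (![0, 0, 0] : Fin 3 → k) (by simp)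
    simpa using this
  have q3 : x 0 * x 1 ^ 2 - 1 ≠ 0 := by
    have := aeval_ne_zero hi (X 1 * X 2 ^ 2 - 1) (![0, 0, 0] : Fin 3 → k) (by simp)
    simpa using this
  set a : Fin 3 → L := fun i => x i + (x i)⁻¹ - 2 with ha
  have ham : ∀ i, a i ∈ adjoin k {x 0, x 1} := fun i =>
    sub_mem (add_mem (hm i) (inv_mem (hm i))) (ofNat_mem _ 2)
  have a0' : a 0 = (x 0 - 1) ^ 2 / x 0 := by simp only [ha]; field_simp; ring
  have a1' : a 1 = (x 1 - 1) ^ 2 / x 1 := by simp only [ha]; field_simp; ring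
  have a2' : a 2 = (x 0 * x 1 - 1) ^ 2 / (x 0 * x 1) := by
    simp only [ha, e2]; field_simp; ring
  have n0 : a 0 ≠ 0 := by
    rw [a0']; exact div_ne_zero (pow_ne_zero 2 q0) x0
  have n1 : a 1 ≠ 0 := by
    rw [a1']; exact div_ne_zero (pow_ne_zero 2 q1) x1
  have n2 : a 2 ≠ 0 := by
    rw [a2']; exact div_ne_zero (pow_ne_zero 2 q2) (mul_ne_zero x0 x1)
  have n12 : a 1 - a 2 ≠ 0 := by
    have : a 1 - a 2 = (1 - x 0) * (x 0 * x 1 ^ 2 - 1) / (x 0 * x 1) := by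
      rw [a1', a2']; field_simp; ring
    rw [this]
    refine div_ne_zero (mul_ne_zero ?_ q3) (mul_ne_zero x0 x1)
    rw [← neg_sub]; exact neg_ne_zero.mpr q0
  have rel : a 0 * a 1 * a 2 = a 0 ^ 2 + a 1 ^ 2 + a 2 ^ 2 -
      2 * (a 0 * a 1 + a 0 * a 2 + a 1 * a 2) := by
    rw [a0', a1', a2']; field_simp; ring
  have hga : ∀ i, g (a i) = a i := fun i => by
    simp only [ha, map_sub, map_add, map_inv₀, hgx, inv_inv, map_ofNat]; ring
  refine fixGen_two_of_projective htr hz (hex_stable hprod hx) n12 n2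
    (div_mem (ham 0) (ham 2)) (div_mem (ham 1) (ham 2)) ?_ fun h hh => ?_
  · rintro b ⟨hb, hbK⟩
    set E := adjoin k {a 0 / a 2, a 1 / a 2} with hE
    have r0 : a 0 / a 2 ∈ E := subset_adjoin _ _ (by simp)
    have r1 : a 1 / a 2 ∈ E := subset_adjoin _ _ (by simp)
    have r2 : a 2 ∈ E := by
      have : a 2 = ((a 0 / a 2) ^ 2 + (a 1 / a 2) ^ 2 + 1 -
          2 * ((a 0 / a 2) * (a 1 / a 2) + (a 0 / a 2) + (a 1 / a 2))) /
          ((a 0 / a 2) * (a 1 / a 2)) := by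
        field_simp
        linear_combination rel
      rw [this]
      exact div_mem (sub_mem (add_mem (add_mem (pow_mem r0 2) (pow_mem r1 2)) (one_mem _))
        (mul_mem (ofNat_mem _ 2) (add_mem (add_mem (mul_mem r0 r1) r0) r1))) (mul_mem r0 r1)
    have r0' : a 0 ∈ E := by have := mul_mem r0 r2; rwa [div_mul_cancel₀ _ n2] at this
    have r1' : a 1 ∈ E := by have := mul_mem r1 r2; rwa [div_mul_cancel₀ _ n2] at this
    refine mem_of_fixed_quadratic (h := g) (α := x 0) (c := a 0 + 2) (d := -1) ?_
      (add_mem r0' (ofNat_mem _ 2)) (neg_mem (one_mem _)) ?_ ?_ ?_ (hb ⟨g, hg⟩)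
    · have s0 : x 0 ∈ adjoin k {x 0, a 0 / a 2, a 1 / a 2} := subset_adjoin _ _ (by simp)
      have hle : E ≤ adjoin k {x 0, a 0 / a 2, a 1 / a 2} :=
        adjoin.mono _ _ _ (Set.subset_insert _ _)
      refine (adjoin_le_iff.mpr ?_ : adjoin k {x 0, x 1} ≤ _) hbK
      rintro s (rfl | rfl)
      · exact s0
      · have hd : x 0 - (x 0)⁻¹ ≠ 0 := by
          rw [show x 0 - (x 0)⁻¹ = (x 0 ^ 2 - 1) / x 0 by field_simp]
          exact div_ne_zero q01 x0
        have : x 1 = (a 2 + 2 - (a 1 + 2) / x 0) / (x 0 - (x 0)⁻¹) := by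
          rw [eq_div_iff hd, a1', a2']; field_simp; ring
        rw [this]
        exact div_mem (sub_mem (add_mem (hle r2) (ofNat_mem _ 2))
          (div_mem (add_mem (hle r1') (ofNat_mem _ 2)) s0)) (sub_mem s0 (inv_mem s0))
    · simp only [ha]; field_simp; ring
    · rintro s (rfl | rfl) <;> rw [map_div₀, hga, hga]
    · rw [hgx]
      intro h
      apply q01
      field_simp at h
      linear_combination -h
  · obtain ⟨w, hw⟩ := hx h hh
    refine ⟨w.1, 1, one_ne_zero, fun i => ?_⟩
    simp only [ha, map_sub, map_add, map_inv₀, hw i, map_ofNat, one_mul]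
    rcases Int.units_eq_one_or w.2 with h | h <;> rw [h] <;> simp
    ring

theorem hex_fixGen [Finite H] (htr : 3 ≤ Algebra.trdeg k L) (hprod : x 0 * x 1 * x 2 = 1)
    (hz : fixedField H ≤ adjoin k {z, x 0, x 1}) (hx : ∀ h ∈ H, ∃ w, ActInv x h w)
    (hzr : ∀ h ∈ H, ∃ e, h z = refl e z) : FixGen H ⊤ 3 := by
  have hs := spans_of_fixedField_le hz
  have hi := hs.algebraicIndependent htr
  have e2 : x 2 = (x 0 * x 1)⁻¹ := (inv_eq_of_mul_eq_one_right hprod).symm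
  have x0 := hex_ne_zero hprod 0
  have x1 := hex_ne_zero hprod 1
  have x2 := hex_ne_zero hprod 2
  have p0 : 1 + x 0 ≠ 0 := by
    have := aeval_ne_zero hi (1 + X 1) (![0, 0, 0] : Fin 3 → k) (by simp)
    simpa using this
  have p1 : 1 + x 1 ≠ 0 := by
    have := aeval_ne_zero hi (1 + X 2) (![0, 0, 0] : Fin 3 → k) (by simp)
    simpa using this
  have p2 : 1 + x 2 ≠ 0 := by
    have := aeval_ne_zero hi (1 + X 1 * X 2) (![0, 0, 0] : Fin 3 → k) (by simp)
    rw [e2, show 1 + (x 0 * x 1)⁻¹ = (1 + x 0 * x 1) / (x 0 * x 1) by field_simp; ring]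
    exact div_ne_zero (by simpa using this) (mul_ne_zero x0 x1)
  have n01 : x 0 ≠ x 1 := by
    have := aeval_ne_zero hi (X 1 - X 2) (![0, 0, 1] : Fin 3 → k) (by simp)
    exact sub_ne_zero.mp (by simpa using this)
  have n02 : x 0 ≠ x 2 := by
    have := aeval_ne_zero hi (X 1 ^ 2 * X 2 - 1) (![0, 0, 0] : Fin 3 → k) (by simp)
    intro h
    rw [← h] at hprod
    have h' : x 0 ^ 2 * x 1 - 1 ≠ 0 := by simpa using this
    exact h' (by linear_combination hprod)
  have n12 : x 1 ≠ x 2 := by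
    have := aeval_ne_zero hi (X 1 * X 2 ^ 2 - 1) (![0, 0, 0] : Fin 3 → k) (by simp)
    intro h
    rw [← h] at hprod
    have h' : x 0 * x 1 ^ 2 - 1 ≠ 0 := by simpa using this
    exact h' (by linear_combination hprod)
  have hx0 := hex_ne_zero hprod
  have hp : ∀ i, 1 + x i ≠ 0 := by
    intro i; fin_cases i <;> assumption
  have hcay : ∀ h w, ActInv (k := k) x h w → ∀ i, ∃ e, h (cay (x i)) = refl e (cay (x (w.1 i))) := by
    intro h w hw i
    rw [map_cay, hw i]
    exact cay_zpow (hx0 _) (hp _) _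
  by_cases hfix : ∃ i, ∀ w ∈ invGroup H x, w.1 i = i
  · obtain ⟨i, hi⟩ := hfix
    have key : ∀ p q : Fin 3, (∀ a : Equiv.Perm (Fin 3), a i = i →
        a p = p ∧ a q = q ∨ a p = q ∧ a q = p) →
        (∀ K : IntermediateField k L, x p ∈ K → x q ∈ K → x 0 ∈ K ∧ x 1 ∈ K) →
        FixGen H ⊤ 3 := by
      intro p q hpq hK
      refine fixGen_of_fixed_coord htr (x := z) (p := cay (x p)) (q := cay (x q)) ?_ hzr ?_
      · refine hz.trans (adjoin_le_iff.mpr ?_)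
        obtain ⟨t0, t1, t2⟩ := mem_adjoin_triple (k := k) (x := z) (y := cay (x p))
          (z := cay (x q))
        obtain ⟨h1, h2⟩ := hK _ (cay_mem.mp t1) (cay_mem.mp t2)
        rintro s (rfl | rfl | rfl) <;> assumption
      · intro h hh
        obtain ⟨w, hw⟩ := hx h hh
        obtain ⟨e, he⟩ := hcay h w hw p
        obtain ⟨e', he'⟩ := hcay h w hw q
        refine ⟨e, e', ?_⟩
        rw [he, he']
        rcases hpq w.1 (hi w ⟨h, hh, hw⟩) with ⟨h1, h2⟩ | ⟨h1, h2⟩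
        · left; rw [h1, h2]; exact ⟨rfl, rfl⟩
        · right; rw [h1, h2]; exact ⟨rfl, rfl⟩
    fin_cases i
    · refine key 1 2 (fun a => (perm_three a).1) fun K h1 h2 => ⟨?_, h1⟩
      rw [eq_inv_of_mul_eq_one_left ((mul_assoc _ _ _).symm.trans hprod)]
      exact inv_mem (mul_mem h1 h2)
    · refine key 0 2 (fun a => (perm_three a).2.1) fun K h1 h2 => ⟨h1, ?_⟩
      rw [show x 1 = (x 0 * x 2)⁻¹ by rw [e2]; field_simp]
      exact inv_mem (mul_mem h1 h2)
    · exact key 0 1 (fun a => (perm_three a).2.2) fun K h1 h2 => ⟨h1, h2⟩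
  · push Not at hfix
    obtain ⟨c, hcS, hc⟩ : ∃ c ∈ invGroup H x, ∀ i, c.1 i ≠ i := by
      obtain ⟨a, ha, ha'⟩ := hfix 0
      obtain ⟨b, hb, hb'⟩ := hfix 1
      obtain ⟨c, hc, hc'⟩ := hfix 2
      obtain ⟨w, hw, hw'⟩ := exists_three_cycle a.1 b.1 c.1 ha' hb' hc'
      simp only [List.mem_cons, List.not_mem_nil, or_false] at hw
      rcases hw with rfl | rfl | rfl | rfl | rfl | rfl
      · exact ⟨a, ha, hw'⟩
      · exact ⟨b, hb, hw'⟩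
      · exact ⟨c, hc, hw'⟩
      · exact ⟨_, mul_mem ha hb, hw'⟩
      · exact ⟨_, mul_mem ha hc, hw'⟩
      · exact ⟨_, mul_mem hb hc, hw'⟩
    have h2 : FixGen H (adjoin k {x 0, x 1}) 2 := by
      by_cases hsg : ∀ w ∈ invGroup H x, w.2 = Equiv.Perm.sign w.1
      · refine hex_fixGen_sign htr hprod hs fun h hh => ?_
        obtain ⟨w, hw⟩ := hx h hh
        exact ⟨w, hw, hsg w ⟨h, hh, hw⟩⟩
      push Not at hsg
      obtain ⟨w, hwS, hw⟩ := hsg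
      by_cases hpos : ∀ v ∈ invGroup H x, v.2 = 1
      · obtain ⟨f, hfS, hf0, hf1⟩ : ∃ f ∈ invGroup H x, f.1 0 = 0 ∧ f.1 1 = 2 := by
          have hw2 := hpos w hwS
          have : ∀ c w : Equiv.Perm (Fin 3), (∀ i, c i ≠ i) → 1 ≠ Equiv.Perm.sign w →
              ∃ i < 3, (w * c ^ i) 0 = 0 ∧ (w * c ^ i) 1 = 2 := by decide +kernel
          obtain ⟨i, -, hi⟩ := this c.1 w.1 hc (hw2 ▸ hw)
          exact ⟨w * c ^ i, mul_mem hwS (pow_mem hcS i), hi⟩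
        obtain ⟨r, hrS, hr0, hr1⟩ : ∃ f ∈ invGroup H x, f.1 0 = 1 ∧ f.1 1 = 2 := by
          have : ∀ c : Equiv.Perm (Fin 3), (∀ i, c i ≠ i) →
              ∃ i < 3, (c ^ i) 0 = 1 ∧ (c ^ i) 1 = 2 := by decide +kernel
          obtain ⟨i, -, hi⟩ := this c.1 hc
          exact ⟨c ^ i, pow_mem hcS i, hi⟩
        have h1 := hpos f hfS
        have h2 := hpos r hrS
        obtain ⟨d, hd, hd'⟩ := hfS
        obtain ⟨c', hc', hcc⟩ := hrS
        refine hex_fixGen_perm hprod n01 n02 n12 (fun h hh => ?_) hc' hd ?_ ?_ ?_ ?_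
        · obtain ⟨w, hw⟩ := hx h hh
          exact ⟨w, hw, hpos w ⟨h, hh, hw⟩⟩
        · rw [hcc, hr0, h2]; simp
        · rw [hcc, hr1, h2]; simp
        · rw [hd', hf0, h1]; simp
        · rw [hd', hf1, h1]; simp
      push Not at hpos
      obtain ⟨v, hvS, hv⟩ := hpos
      obtain ⟨a, b, i, e⟩ := sign_dichotomy c v w hc hv hw
      have := mul_mem (mul_mem (pow_mem hvS a.val) (pow_mem hwS b.val)) (pow_mem hcS i.val)
      rw [e] at this
      obtain ⟨g, hg, hg'⟩ := this
      exact hex_fixGen_neg htr hprod hs hx hg fun i => by rw [hg' i]; simp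
    refine fixGen_step htr hz (hex_stable hprod hx) h2 fun h hh => ?_
    obtain ⟨e, he⟩ := hzr h hh
    cases e
    · exact ⟨1, one_mem _, 0, zero_mem _, by rw [he]; simp [refl]⟩
    · exact ⟨-1, neg_mem (one_mem _), 1, one_mem _, by rw [he]; simp [refl]; ring⟩

end

/-- The values of a function of four arguments at the three partitions of
`{0, 1, 2, 3}` into two pairs. -/
def ptn {α β : Type*} (f : α → α → α → α → β) (x : Fin 4 → α) : Fin 3 → β :=
  ![f (x 0) (x 1) (x 2) (x 3), f (x 0) (x 2) (x 1) (x 3), f (x 0) (x 3) (x 1) (x 2)]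

/-- A function of a partition of four arguments into two pairs. -/
def PairSymm {α β : Type*} (f : α → α → α → α → β) : Prop :=
  ∀ a b c d, f b a c d = f a b c d ∧ f c d a b = f a b c d

theorem PairSymm.all {α β : Type*} {f : α → α → α → α → β} (hf : PairSymm f) (a b c d : α) :
    f b a c d = f a b c d ∧ f c d a b = f a b c d ∧ f d c a b = f a b c d ∧
      f a b d c = f a b c d ∧ f b a d c = f a b c d ∧ f c d b a = f a b c d ∧
      f d c b a = f a b c d := by
  have h := fun a b c d => (hf a b c d).1
  have h' := fun a b c d => (hf a b c d).2
  have h3 : f a b d c = f a b c d := by rw [← h', h, h']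
  have h4 : f c d b a = f a b c d := by rw [← h', h, ← h', h']
  exact ⟨h _ _ _ _, h' _ _ _ _, by rw [h, h'], h3, by rw [h, h3], h4, by rw [h, h4]⟩

theorem perm_four_ptn (w : Equiv.Perm (Fin 4)) : ∃ σ : Equiv.Perm (Fin 3),
    Equiv.Perm.sign σ = Equiv.Perm.sign w ∧ ∀ i, ∃ g ∈ [![0, 1, 2, 3], ![1, 0, 2, 3],
      ![2, 3, 0, 1], ![3, 2, 0, 1], ![0, 1, 3, 2], ![1, 0, 3, 2], ![2, 3, 1, 0], (![3, 2, 1, 0] : Fin 4 → Fin 4)],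
      ∀ j, w ((![![0, 1, 2, 3], ![0, 2, 1, 3], ![0, 3, 1, 2]] : Fin 3 → Fin 4 → Fin 4) i j) =
        (![![0, 1, 2, 3], ![0, 2, 1, 3], ![0, 3, 1, 2]] : Fin 3 → Fin 4 → Fin 4) (σ i) (g j) := by
  revert w
  decide +kernel

/-- The action of a permutation on the partitions into pairs. -/
def ptnPerm (w : Equiv.Perm (Fin 4)) : Equiv.Perm (Fin 3) := (perm_four_ptn w).choose

theorem sign_ptnPerm (w : Equiv.Perm (Fin 4)) :
    Equiv.Perm.sign (ptnPerm w) = Equiv.Perm.sign w := (perm_four_ptn w).choose_spec.1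

theorem ptn_perm (w : Equiv.Perm (Fin 4)) {α β : Type*} (f : α → α → α → α → β) (hf : PairSymm f)
    (x : Fin 4 → α) (i : Fin 3) : ptn f (fun j => x (w j)) i = ptn f x (ptnPerm w i) := by
  let T : Fin 3 → Fin 4 → Fin 4 := ![![0, 1, 2, 3], ![0, 2, 1, 3], ![0, 3, 1, 2]]
  have e : ∀ (x : Fin 4 → α) i, ptn f x i = f (x (T i 0)) (x (T i 1)) (x (T i 2)) (x (T i 3)) := by
    intro x i
    fin_cases i <;> rfl
  obtain ⟨g, hg, h⟩ := (perm_four_ptn w).choose_spec.2 i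
  change ∀ j, w (T i j) = T (ptnPerm w i) (g j) at h
  obtain ⟨s1, s2, s3, s4, s5, s6, s7⟩ :=
    hf.all (x (T (ptnPerm w i) 0)) (x (T (ptnPerm w i) 1)) (x (T (ptnPerm w i) 2))
      (x (T (ptnPerm w i) 3))
  rw [e, e]
  simp only [h]
  simp only [List.mem_cons, List.not_mem_nil, or_false] at hg
  rcases hg with rfl | rfl | rfl | rfl | rfl | rfl | rfl | rfl
  · rfl
  · exact s1
  · exact s2
  · exact s3
  · exact s4
  · exact s5
  · exact s6
  · exact s7

section
variable {x : Fin 4 → L} {g₁ g₂ : L ≃ₐ[k] L}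

theorem prod_four_mem {K : IntermediateField k L} (hprod : x 0 * x 1 * x 2 * x 3 = 1)
    (h0 : x 0 ∈ K) (h1 : x 1 ∈ K) (h2 : x 2 ∈ K) : ∀ i, x i ∈ K := by
  have e : x 3 = (x 0 * x 1 * x 2)⁻¹ := (inv_eq_of_mul_eq_one_right hprod).symm
  intro i
  fin_cases i
  · exact h0
  · exact h1
  · exact h2
  · exact e ▸ inv_mem (mul_mem (mul_mem h0 h1) h2)

theorem prod_four_ne_zero (hprod : x 0 * x 1 * x 2 * x 3 = 1) (i : Fin 4) : x i ≠ 0 := by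
  intro h
  fin_cases i <;> simp_all

/-- The Klein four-group acts on the `x i` by double transpositions. -/
structure Klein (x : Fin 4 → L) (g₁ g₂ : L ≃ₐ[k] L) : Prop where
  p0 : g₁ (x 0) = x 1
  p1 : g₁ (x 1) = x 0
  p2 : g₁ (x 2) = x 3
  p3 : g₁ (x 3) = x 2
  q0 : g₂ (x 0) = x 2
  q1 : g₂ (x 1) = x 3
  q2 : g₂ (x 2) = x 0
  q3 : g₂ (x 3) = x 1

theorem Klein.mem_symm (hK : Klein x g₁ g₂) (n : x 0 * x 1 ≠ x 2 * x 3) (n01 : x 0 ≠ x 1) {y : L}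
    (hy : y ∈ adjoin k (Set.range x)) (h1 : g₁ y = y) (h2 : g₂ y = y) :
    y ∈ adjoin k {x 0 * x 1 + x 2 * x 3, x 0 * x 2 + x 1 * x 3, x 0 * x 3 + x 1 * x 2,
      x 0 + x 1 + x 2 + x 3, x 0 * x 1 * (x 2 + x 3) + x 2 * x 3 * (x 0 + x 1),
      x 0 * x 1 * x 2 * x 3} := by
  set A := x 0 * x 1 + x 2 * x 3 with hA
  set B := x 0 * x 2 + x 1 * x 3 with hB
  set C := x 0 * x 3 + x 1 * x 2 with hC
  set e1 := x 0 + x 1 + x 2 + x 3 with he1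
  set e3 := x 0 * x 1 * (x 2 + x 3) + x 2 * x 3 * (x 0 + x 1) with he3
  set e4 := x 0 * x 1 * x 2 * x 3 with he4
  have f1 : ∀ s ∈ ({A, B, C, e1, e3, e4} : Set L), g₁ s = s := by
    rintro s (rfl | rfl | rfl | rfl | rfl | rfl) <;>
      simp only [hA, hB, hC, he1, he3, he4, map_add, map_mul, hK.p0, hK.p1, hK.p2, hK.p3] <;> ring
  have f2 : ∀ s ∈ ({A, B, C, e1, e3, e4} : Set L), g₂ s = s := by
    rintro s (rfl | rfl | rfl | rfl | rfl | rfl) <;>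
      simp only [hA, hB, hC, he1, he3, he4, map_add, map_mul, hK.q0, hK.q1, hK.q2, hK.q3] <;> ring
  refine mem_of_fixed_quadratic (h := g₂) (α := x 0 * x 1) (c := A) (d := -e4) ?_
    (subset_adjoin _ _ (by simp)) (neg_mem (subset_adjoin _ _ (by simp))) ?_ f2 ?_ h2
  rotate_left
  · rw [hA, he4]; ring
  · rw [map_mul, hK.q0, hK.q1]; exact n.symm
  set M := adjoin k (insert (x 0 * x 1) {A, B, C, e1, e3, e4}) with hM
  have ma : x 0 * x 1 ∈ M := subset_adjoin _ _ (by simp)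
  have mA : A ∈ M := subset_adjoin _ _ (by simp)
  have mB : B ∈ M := subset_adjoin _ _ (by simp)
  have m1 : e1 ∈ M := subset_adjoin _ _ (by simp)
  have m3 : e3 ∈ M := subset_adjoin _ _ (by simp)
  have mE : x 0 + x 1 ∈ M := by
    have : x 0 + x 1 = (e3 - x 0 * x 1 * e1) / (A - x 0 * x 1 - x 0 * x 1) := by
      have : A - x 0 * x 1 - x 0 * x 1 ≠ 0 := by
        rw [hA]; intro h; apply n; linear_combination -h
      rw [eq_div_iff this, hA, he3, he1]; ring
    rw [this]
    exact div_mem (sub_mem m3 (mul_mem ma m1)) (sub_mem (sub_mem mA ma) ma)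
  refine mem_of_fixed_quadratic (h := g₁) (α := x 0) (c := x 0 + x 1) (d := -(x 0 * x 1)) ?_
    mE (neg_mem ma) (by ring) ?_ ?_ h1
  · have hle : M ≤ adjoin k (insert (x 0) (insert (x 0 * x 1) {A, B, C, e1, e3, e4})) :=
      adjoin.mono _ _ _ (Set.subset_insert _ _)
    set N := adjoin k (insert (x 0) (insert (x 0 * x 1) {A, B, C, e1, e3, e4}))
    have n0 : x 0 ∈ N := subset_adjoin _ _ (by simp)
    have n1 : x 1 ∈ N := by
      have := sub_mem (hle mE) n0
      rwa [add_sub_cancel_left] at this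
    have n2 : x 2 ∈ N := by
      have : x 2 = (B - x 1 * (e1 - (x 0 + x 1))) / (x 0 - x 1) := by
        rw [eq_div_iff (sub_ne_zero.mpr n01), hB, he1]; ring
      rw [this]
      exact div_mem (sub_mem (hle mB) (mul_mem n1 (sub_mem (hle m1) (hle mE)))) (sub_mem n0 n1)
    have n3 : x 3 ∈ N := by
      have := sub_mem (sub_mem (hle m1) (hle mE)) n2
      rwa [show e1 - (x 0 + x 1) - x 2 = x 3 by rw [he1]; ring] at this
    refine (adjoin_le_iff.mpr ?_ : adjoin k (Set.range x) ≤ N) hy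
    rintro _ ⟨i, rfl⟩
    fin_cases i <;> assumption
  · rintro s (rfl | hs)
    · rw [map_mul, hK.p0, hK.p1, mul_comm]
    · exact f1 s hs
  · rw [hK.p0]; exact n01.symm

theorem Klein.mem (hK : Klein x g₁ g₂) (hprod : x 0 * x 1 * x 2 * x 3 = 1)
    (n : x 0 * x 1 ≠ x 2 * x 3) (n01 : x 0 ≠ x 1) {y : L} (hy : y ∈ adjoin k {x 0, x 1, x 2})
    (h1 : g₁ y = y) (h2 : g₂ y = y) :
    y ∈ adjoin k {x 0 * x 1 + x 2 * x 3, x 0 * x 2 + x 1 * x 3, x 0 * x 3 + x 1 * x 2,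
      x 0 + x 1 + x 2 + x 3, x 0 * x 1 * (x 2 + x 3) + x 2 * x 3 * (x 0 + x 1)} := by
  have h := hK.mem_symm n n01 (adjoin.mono k {x 0, x 1, x 2} (Set.range x)
    (by rintro s (rfl | rfl | rfl) <;> exact ⟨_, rfl⟩) hy) h1 h2
  refine (adjoin_le_iff.mpr ?_ : adjoin k _ ≤ _) h
  rintro s (rfl | rfl | rfl | rfl | rfl | rfl)
  iterate 5 exact subset_adjoin _ _ (by simp)
  rw [hprod]
  exact one_mem _

end

/-- `(a + b - c - d) / (a * b - c * d)` -/
def pairQuot (a b c d : L) : L := (a + b - c - d) / (a * b - c * d)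

theorem pairSymm_pairQuot : PairSymm (pairQuot (L := L)) := fun a b c d => by
  refine ⟨?_, ?_⟩
  · rw [pairQuot, pairQuot, add_comm b a, mul_comm b a]
  · rw [pairQuot, pairQuot, ← neg_sub (a * b), ← neg_div_neg_eq, neg_neg]; congr 1; ring

theorem pairSymm_pairSum : PairSymm fun a b c d : L => a * b + c * d := fun a b c d => by
  constructor <;> ring

section
variable {x : Fin 4 → L}

theorem ptn_map {h : L ≃ₐ[k] L} {f : L → L → L → L → L}
    (hf : ∀ a b c d, h (f a b c d) = f (h a) (h b) (h c) (h d)) (i : Fin 3) :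
    h (ptn f x i) = ptn f (fun j => h (x j)) i := by
  fin_cases i <;> exact hf _ _ _ _

omit [Field L] in
theorem ptn_congr {f : L → L → L → L → L} {y : Fin 4 → L}
    (h : ∀ i, x i = y i) : ptn f x = ptn f y := by
  rw [show x = y from funext h]

/-- Nonvanishing facts for four independent elements with product one. -/
structure ProdGeneric (x : Fin 4 → L) : Prop where
  d0 : x 0 * x 1 - x 2 * x 3 ≠ 0
  d1 : x 0 * x 2 - x 1 * x 3 ≠ 0
  d2 : x 0 * x 3 - x 1 * x 2 ≠ 0
  s0 : x 0 + x 1 - x 2 - x 3 ≠ 0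
  s1 : x 0 + x 2 - x 1 - x 3 ≠ 0
  s2 : x 0 + x 3 - x 1 - x 2 ≠ 0
  n01 : x 0 ≠ x 1
  n02 : x 0 ≠ x 2
  ne13 : x 0 + x 1 + x 2 + x 3 ≠ x 0 * x 1 * (x 2 + x 3) + x 2 * x 3 * (x 0 + x 1)
  add13 : x 0 + x 1 + x 2 + x 3 + (x 0 * x 1 * (x 2 + x 3) + x 2 * x 3 * (x 0 + x 1)) ≠ 0
  a0 : x 0 * x 1 + x 2 * x 3 + 2 ≠ 0
  a1 : x 0 * x 2 + x 1 * x 3 + 2 ≠ 0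
  a2 : x 0 * x 3 + x 1 * x 2 + 2 ≠ 0

theorem prodGeneric (hprod : x 0 * x 1 * x 2 * x 3 = 1)
    (hi : AlgebraicIndependent k ![x 0, x 1, x 2]) : ProdGeneric x := by
  have c0 := prod_four_ne_zero hprod 0
  have c1 := prod_four_ne_zero hprod 1
  have c2 := prod_four_ne_zero hprod 2
  have e : x 3 = (x 0 * x 1 * x 2)⁻¹ := (inv_eq_of_mul_eq_one_right hprod).symm
  have key : ∀ (p : MvPolynomial (Fin 3) k) (pt : Fin 3 → k) (q y : L),
      MvPolynomial.aeval pt p ≠ 0 → MvPolynomial.aeval ![x 0, x 1, x 2] p = q →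
      (y = 0 → q = 0) → y ≠ 0 := by
    rintro p pt q y h rfl hy h0
    exact aeval_ne_zero hi p pt h (hy h0)
  constructor
  · refine key ((X 0 * X 1) ^ 2 - 1) ![0, 0, 0] _ _ (by simp) rfl fun h => ?_
    simp; rw [e] at h; field_simp at h; linear_combination h
  · refine key ((X 0 * X 2) ^ 2 - 1) ![0, 0, 0] _ _ (by simp) rfl fun h => ?_
    simp; rw [e] at h; field_simp at h; linear_combination h
  · refine key ((X 1 * X 2) ^ 2 - 1) ![0, 0, 0] _ _ (by simp) rfl fun h => ?_
    simp; rw [e] at h; field_simp at h; linear_combination -h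
  · refine key ((X 0 * X 1 * X 2) * (X 0 + X 1 - X 2) - 1) ![0, 0, 0] _ _ (by simp) rfl fun h => ?_
    simp; rw [e] at h; field_simp at h; linear_combination h
  · refine key ((X 0 * X 1 * X 2) * (X 0 + X 2 - X 1) - 1) ![0, 0, 0] _ _ (by simp) rfl fun h => ?_
    simp; rw [e] at h; field_simp at h; linear_combination h
  · refine key ((X 0 * X 1 * X 2) * (X 0 - X 1 - X 2) + 1) ![0, 0, 0] _ _ (by simp) rfl fun h => ?_
    simp; rw [e] at h; field_simp at h; linear_combination h
  · refine sub_ne_zero.mp (key (X 0 - X 1) ![1, 0, 0] _ _ (by simp) rfl fun h => ?_)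
    simp; exact h
  · refine sub_ne_zero.mp (key (X 0 - X 2) ![1, 0, 0] _ _ (by simp) rfl fun h => ?_)
    simp; exact h
  · refine sub_ne_zero.mp (key ((X 0 * X 1 * X 2) * (X 0 + X 1 + X 2) + 1 -
      (X 0 * X 1 + X 1 * X 2 + X 0 * X 2 + (X 0 * X 1 * X 2) ^ 2)) ![0, 0, 0] _ _ (by simp)
      rfl fun h => ?_)
    simp; rw [e] at h; field_simp at h; linear_combination h
  · refine key ((X 0 * X 1 * X 2) * (X 0 + X 1 + X 2) + 1 +
      (X 0 * X 1 + X 1 * X 2 + X 0 * X 2 + (X 0 * X 1 * X 2) ^ 2)) ![0, 0, 0] _ _ (by simp)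
      rfl fun h => ?_
    simp; rw [e] at h; field_simp at h; linear_combination h
  · refine key ((X 0 * X 1) ^ 2 + 1 + 2 * (X 0 * X 1)) ![0, 0, 0] _ _ (by simp) rfl fun h => ?_
    simp; rw [e] at h; field_simp at h; linear_combination h
  · refine key ((X 0 * X 2) ^ 2 + 1 + 2 * (X 0 * X 2)) ![0, 0, 0] _ _ (by simp) rfl fun h => ?_
    simp; rw [e] at h; field_simp at h; linear_combination h
  · refine key ((X 1 * X 2) ^ 2 + 1 + 2 * (X 1 * X 2)) ![0, 0, 0] _ _ (by simp) rfl fun h => ?_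
    simp; rw [e] at h; field_simp at h; linear_combination h

theorem pairQuot_inv {a b c d : L} (ha : a ≠ 0) (hb : b ≠ 0) (hc : c ≠ 0) (hd : d ≠ 0) :
    pairQuot a⁻¹ b⁻¹ c⁻¹ d⁻¹ = (a * b * (c + d) - c * d * (a + b)) / (a * b - c * d) := by
  rw [pairQuot, show a⁻¹ + b⁻¹ - c⁻¹ - d⁻¹ =
      -(a * b * (c + d) - c * d * (a + b)) / (a * b * c * d) by field_simp; ring,
    show a⁻¹ * b⁻¹ - c⁻¹ * d⁻¹ = -(a * b - c * d) / (a * b * c * d) by field_simp; ring,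
    div_div_div_cancel_right₀ (by positivity), neg_div_neg_eq]

theorem ProdGeneric.pairQuot_identities (hx : ProdGeneric x) (hprod : x 0 * x 1 * x 2 * x 3 = 1) :
    let v := ptn pairQuot x
    v 0 * v 1 * v 2 * (x 0 + x 1 + x 2 + x 3) = (v 0 * v 1 * v 2) ^ 2 +
      4 * (v 0 * v 1 + v 0 * v 2 + v 1 * v 2) - (v 0 + v 1 + v 2) ^ 2 ∧
    ∀ i, ptn pairQuot (fun i => (x i)⁻¹) i * (v 0 * v 1 * v 2) = v i * (v 0 + v 1 + v 2 - 2 * v i) := by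
  have c0 := prod_four_ne_zero hprod 0
  have c1 := prod_four_ne_zero hprod 1
  have c2 := prod_four_ne_zero hprod 2
  have c3 := prod_four_ne_zero hprod 3
  obtain ⟨d0, d1, d2, s0, s1, s2, -⟩ := hx
  intro v
  have v0 : v 0 = (x 0 + x 1 - x 2 - x 3) / (x 0 * x 1 - x 2 * x 3) := rfl
  have v1 : v 1 = (x 0 + x 2 - x 1 - x 3) / (x 0 * x 2 - x 1 * x 3) := rfl
  have v2 : v 2 = (x 0 + x 3 - x 1 - x 2) / (x 0 * x 3 - x 1 * x 2) := rfl
  refine ⟨?_, fun i => ?_⟩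
  · have key : (x 0 + x 1 - x 2 - x 3) * (x 0 + x 2 - x 1 - x 3) * (x 0 + x 3 - x 1 - x 2) *
        ((x 0 * x 1 - x 2 * x 3) * (x 0 * x 2 - x 1 * x 3) * (x 0 * x 3 - x 1 * x 2)) *
        (x 0 + x 1 + x 2 + x 3) =
        ((x 0 + x 1 - x 2 - x 3) * (x 0 + x 2 - x 1 - x 3) * (x 0 + x 3 - x 1 - x 2)) ^ 2 * 1 +
        4 * (x 0 * x 1 - x 2 * x 3) * (x 0 * x 2 - x 1 * x 3) * (x 0 * x 3 - x 1 * x 2) *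
        ((x 0 + x 1 - x 2 - x 3) * (x 0 + x 2 - x 1 - x 3) * (x 0 * x 3 - x 1 * x 2) +
        (x 0 + x 1 - x 2 - x 3) * (x 0 + x 3 - x 1 - x 2) * (x 0 * x 2 - x 1 * x 3) +
        (x 0 + x 2 - x 1 - x 3) * (x 0 + x 3 - x 1 - x 2) * (x 0 * x 1 - x 2 * x 3)) -
        ((x 0 + x 1 - x 2 - x 3) * (x 0 * x 2 - x 1 * x 3) * (x 0 * x 3 - x 1 * x 2) +
        (x 0 + x 2 - x 1 - x 3) * (x 0 * x 1 - x 2 * x 3) * (x 0 * x 3 - x 1 * x 2) +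
        (x 0 + x 3 - x 1 - x 2) * (x 0 * x 1 - x 2 * x 3) * (x 0 * x 2 - x 1 * x 3)) ^ 2 := by
      rw [← hprod]
      ring
    rw [v0, v1, v2]
    generalize x 0 + x 1 - x 2 - x 3 = E0 at *
    generalize x 0 + x 2 - x 1 - x 3 = E1 at *
    generalize x 0 + x 3 - x 1 - x 2 = E2 at *
    generalize x 0 * x 1 - x 2 * x 3 = D0 at *
    generalize x 0 * x 2 - x 1 * x 3 = D1 at *
    generalize x 0 * x 3 - x 1 * x 2 = D2 at *
    field_simp
    linear_combination key
  · have h0 := pairQuot_inv c0 c1 c2 c3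
    have h1 := pairQuot_inv c0 c2 c1 c3
    have h2 := pairQuot_inv c0 c3 c1 c2
    fin_cases i
    · change pairQuot (x 0)⁻¹ (x 1)⁻¹ (x 2)⁻¹ (x 3)⁻¹ * _ = v 0 * (_ - 2 * v 0)
      rw [h0, v0, v1, v2]
      clear_value v
      generalize hD0 : x 0 * x 1 - x 2 * x 3 = D0 at *
      generalize hD1 : x 0 * x 2 - x 1 * x 3 = D1 at *
      generalize hD2 : x 0 * x 3 - x 1 * x 2 = D2 at *
      field_simp
      rw [← hD0, ← hD1, ← hD2]
      ring
    · change pairQuot (x 0)⁻¹ (x 2)⁻¹ (x 1)⁻¹ (x 3)⁻¹ * _ = v 1 * (_ - 2 * v 1)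
      rw [h1, v0, v1, v2]
      clear_value v
      generalize hD0 : x 0 * x 1 - x 2 * x 3 = D0 at *
      generalize hD1 : x 0 * x 2 - x 1 * x 3 = D1 at *
      generalize hD2 : x 0 * x 3 - x 1 * x 2 = D2 at *
      field_simp
      rw [← hD0, ← hD1, ← hD2]
      ring
    · change pairQuot (x 0)⁻¹ (x 3)⁻¹ (x 1)⁻¹ (x 2)⁻¹ * _ = v 2 * (_ - 2 * v 2)
      rw [h2, v0, v1, v2]
      clear_value v
      generalize hD0 : x 0 * x 1 - x 2 * x 3 = D0 at *
      generalize hD1 : x 0 * x 2 - x 1 * x 3 = D1 at *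
      generalize hD2 : x 0 * x 3 - x 1 * x 2 = D2 at *
      field_simp
      rw [← hD0, ← hD1, ← hD2]
      ring

/-- Three generators of the field fixed by the Klein four-group. -/
theorem Klein.mem_pairQuot {g₁ g₂ : L ≃ₐ[k] L} (hK : Klein x g₁ g₂) (hx : ProdGeneric x)
    (hprod : x 0 * x 1 * x 2 * x 3 = 1) {y : L} (hy : y ∈ adjoin k {x 0, x 1, x 2})
    (h1 : g₁ y = y) (h2 : g₂ y = y) :
    y ∈ adjoin k {ptn pairQuot x 0, ptn pairQuot x 1, ptn pairQuot x 2} := by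
  have hm := hK.mem hprod (sub_ne_zero.mp hx.d0) hx.n01 hy h1 h2
  obtain ⟨i1, i2⟩ := hx.pairQuot_identities hprod
  obtain ⟨m0, m1, m2⟩ := mem_adjoin_triple (k := k) (x := ptn pairQuot x 0)
    (y := ptn pairQuot x 1) (z := ptn pairQuot x 2)
  set E := adjoin k {ptn pairQuot x 0, ptn pairQuot x 1, ptn pairQuot x 2}
  set v := ptn pairQuot x with hv
  have c0 := prod_four_ne_zero hprod 0
  have c1 := prod_four_ne_zero hprod 1
  have c2 := prod_four_ne_zero hprod 2
  have c3 := prod_four_ne_zero hprod 3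
  obtain ⟨d0, d1, d2, s0, s1, s2, -⟩ := hx
  have n0 : v 0 ≠ 0 := div_ne_zero s0 d0
  have n1 : v 1 ≠ 0 := div_ne_zero s1 d1
  have n2 : v 2 ≠ 0 := div_ne_zero s2 d2
  have nv : v 0 * v 1 * v 2 ≠ 0 := mul_ne_zero (mul_ne_zero n0 n1) n2
  have mv : v 0 * v 1 * v 2 ∈ E := mul_mem (mul_mem m0 m1) m2
  have ms : v 0 + v 1 + v 2 ∈ E := add_mem (add_mem m0 m1) m2
  have mi : ∀ i, v i ∈ E := by intro i; fin_cases i <;> assumption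
  have m' : ∀ i, ptn pairQuot (fun i => (x i)⁻¹) i ∈ E := by
    intro i
    rw [eq_div_of_mul_eq nv (i2 i)]
    exact div_mem (mul_mem (mi i) (sub_mem ms (mul_mem (ofNat_mem E 2) (mi i)))) mv
  have me1 : x 0 + x 1 + x 2 + x 3 ∈ E := by
    rw [eq_div_of_mul_eq nv ((mul_comm _ _).trans i1)]
    exact div_mem (sub_mem (add_mem (pow_mem mv 2) (mul_mem (ofNat_mem E 4)
      (add_mem (add_mem (mul_mem m0 m1) (mul_mem m0 m2)) (mul_mem m1 m2)))) (pow_mem ms 2)) mv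
  have v0 : v 0 = (x 0 + x 1 - x 2 - x 3) / (x 0 * x 1 - x 2 * x 3) := rfl
  have v1 : v 1 = (x 0 + x 2 - x 1 - x 3) / (x 0 * x 2 - x 1 * x 3) := rfl
  have v2 : v 2 = (x 0 + x 3 - x 1 - x 2) / (x 0 * x 3 - x 1 * x 2) := rfl
  have w0 := pairQuot_inv c0 c1 c2 c3
  have w1 := pairQuot_inv c0 c2 c1 c3
  have w2 := pairQuot_inv c0 c3 c1 c2
  have key : ∀ {a b c d e : L}, pairQuot a b c d = e → e ≠ 0 → e ∈ E →
      a * b - c * d ≠ 0 → a + b + c + d ∈ E →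
      (a * b * (c + d) - c * d * (a + b)) / (a * b - c * d) ∈ E →
      a * b + c * d ∈ E := by
    rintro a b c d e he hn m hd h1 hw
    have : a * b + c * d = (a + b + c + d -
        2 * ((a * b * (c + d) - c * d * (a + b)) / (a * b - c * d))) / e := by
      rw [eq_div_iff hn, ← he, pairQuot]
      field_simp
      ring
    rw [this]
    exact div_mem (sub_mem h1 (mul_mem (ofNat_mem E 2) hw)) m
  have mA := key rfl n0 m0 d0 me1 (w0 ▸ m' 0)
  have mB := key rfl n1 m1 d1 (by convert me1 using 1; ring) (w1 ▸ m' 1)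
  have mC := key rfl n2 m2 d2 (by convert me1 using 1; ring) (w2 ▸ m' 2)
  have me3 : x 0 * x 1 * (x 2 + x 3) + x 2 * x 3 * (x 0 + x 1) ∈ E := by
    have : x 0 * x 1 * (x 2 + x 3) + x 2 * x 3 * (x 0 + x 1) = 2 * v 0 +
        (x 0 * x 1 + x 2 * x 3) * ((x 0 * x 1 * (x 2 + x 3) - x 2 * x 3 * (x 0 + x 1)) /
        (x 0 * x 1 - x 2 * x 3)) := by
      rw [v0]
      field_simp
      linear_combination (2 * (x 0 + x 1 - x 2 - x 3)) * hprod
    rw [this]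
    exact add_mem (mul_mem (ofNat_mem E 2) m0) (mul_mem mA (w0 ▸ m' 0))
  refine (adjoin_le_iff.mpr ?_ : _ ≤ E) hm
  rintro s (rfl | rfl | rfl | rfl | rfl) <;> assumption

theorem pairQuot_map (h : L ≃ₐ[k] L) (a b c d : L) :
    h (pairQuot a b c d) = pairQuot (h a) (h b) (h c) (h d) := by
  simp [pairQuot]

end

section
variable {H : Subgroup (L ≃ₐ[k] L)} {x : Fin 4 → L} {g₁ g₂ g : L ≃ₐ[k] L}

theorem prodGeneric_of_le [Finite H] (htr : 3 ≤ Algebra.trdeg k L)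
    (hprod : x 0 * x 1 * x 2 * x 3 = 1) (hz : fixedField H ≤ adjoin k {x 0, x 1, x 2}) :
    ProdGeneric x :=
  prodGeneric hprod ((spans_of_fixedField_le hz).algebraicIndependent htr)

theorem Klein.fixedField_le (hK : Klein x g₁ g₂) (hx : ProdGeneric x)
    (hprod : x 0 * x 1 * x 2 * x 3 = 1) (hz : fixedField H ≤ adjoin k {x 0, x 1, x 2})
    (h1 : g₁ ∈ H) (h2 : g₂ ∈ H) :
    fixedField H ≤ adjoin k {ptn pairQuot x 0, ptn pairQuot x 1, ptn pairQuot x 2} :=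
  fun _ hy => hK.mem_pairQuot hx hprod (hz hy) (hy ⟨g₁, h1⟩) (hy ⟨g₂, h2⟩)

theorem exists_map_ptn {h : L ≃ₐ[k] L} {w : Equiv.Perm (Fin 4) × ℤˣ} (hw : ActInv x h w)
    (h1 : w.2 = 1) : ∃ σ : Equiv.Perm (Fin 3), ∀ {f : L → L → L → L → L}, PairSymm f →
      (∀ a b c d, h (f a b c d) = f (h a) (h b) (h c) (h d)) →
      ∀ i, h (ptn f x i) = ptn f x (σ i) := by
  refine ⟨ptnPerm w.1, fun {f} hf hh i => ?_⟩
  rw [ptn_map hh, ← ptn_perm w.1 f hf x i, ptn_congr]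
  intro j
  rw [hw, h1]
  simp

theorem inv_fixGen_of_pos [Finite H] (htr : 3 ≤ Algebra.trdeg k L)
    (hprod : x 0 * x 1 * x 2 * x 3 = 1) (hz : fixedField H ≤ adjoin k {x 0, x 1, x 2})
    (hx : ∀ h ∈ H, ∃ w, ActInv x h w ∧ w.2 = 1) (hK : Klein x g₁ g₂) (h1 : g₁ ∈ H)
    (h2 : g₂ ∈ H) : FixGen H ⊤ 3 := by
  have hg := prodGeneric_of_le htr hprod hz
  refine fixGen_of_perm_affine htr (hK.fixedField_le hg hprod hz h1 h2) fun h hh => ?_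
  obtain ⟨w, hw, hw1⟩ := hx h hh
  obtain ⟨σ, hσ⟩ := exists_map_ptn hw hw1
  exact ⟨σ, 1, 0, fun i => by simpa using hσ pairSymm_pairQuot (pairQuot_map h) i⟩

theorem inv_pairSum (hprod : x 0 * x 1 * x 2 * x 3 = 1) (i : Fin 3) :
    ptn (fun a b c d => a * b + c * d) (fun j => (x j)⁻¹) i =
      ptn (fun a b c d => a * b + c * d) x i := by
  have c0 := prod_four_ne_zero hprod 0
  have c1 := prod_four_ne_zero hprod 1
  have c2 := prod_four_ne_zero hprod 2
  have c3 := prod_four_ne_zero hprod 3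
  have key : ∀ {a b c d : L}, a ≠ 0 → b ≠ 0 → c ≠ 0 → d ≠ 0 → a * b * c * d = 1 →
      a⁻¹ * b⁻¹ + c⁻¹ * d⁻¹ = a * b + c * d := by
    intro a b c d ha hb hc hd h
    rw [show a⁻¹ * b⁻¹ + c⁻¹ * d⁻¹ = (a * b + c * d) / (a * b * c * d) by field_simp; ring, h,
      div_one]
  fin_cases i
  · exact key c0 c1 c2 c3 hprod
  · exact key c0 c2 c1 c3 (by rw [← hprod]; ring)
  · exact key c0 c3 c1 c2 (by rw [← hprod]; ring)

theorem inv_fixGen_of_neg [Finite H] (htr : 3 ≤ Algebra.trdeg k L)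
    (hprod : x 0 * x 1 * x 2 * x 3 = 1) (hz : fixedField H ≤ adjoin k {x 0, x 1, x 2})
    (hx : ∀ h ∈ H, ∃ w, ActInv x h w) (hK : Klein x g₁ g₂) (h1 : g₁ ∈ H)
    (h2 : g₂ ∈ H) (hg : g ∈ H) (hgx : ∀ i, g (x i) = (x i)⁻¹) : FixGen H ⊤ 3 := by
  have hG := prodGeneric_of_le htr hprod hz
  have c0 := prod_four_ne_zero hprod 0
  have c1 := prod_four_ne_zero hprod 1
  have c2 := prod_four_ne_zero hprod 2
  have c3 := prod_four_ne_zero hprod 3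
  set A := ptn (fun a b c d => a * b + c * d) x with hA
  set e1 := x 0 + x 1 + x 2 + x 3 with he1
  set e3 := x 0 * x 1 * (x 2 + x 3) + x 2 * x 3 * (x 0 + x 1) with he3
  have he3' : e3 = (x 0)⁻¹ + (x 1)⁻¹ + (x 2)⁻¹ + (x 3)⁻¹ := by
    rw [show (x 0)⁻¹ + (x 1)⁻¹ + (x 2)⁻¹ + (x 3)⁻¹ = e3 / (x 0 * x 1 * x 2 * x 3) by
      rw [he3]; field_simp; ring, hprod, div_one]
  have n0 : A 0 + 2 ≠ 0 := hG.a0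
  have n1 : A 1 + 2 ≠ 0 := hG.a1
  have n2 : A 2 + 2 ≠ 0 := hG.a2
  have nU : e1 + e3 ≠ 0 := hG.add13
  have a0 : A 0 = x 0 * x 1 + x 2 * x 3 := rfl
  have a1 : A 1 = x 0 * x 2 + x 1 * x 3 := rfl
  have a2 : A 2 = x 0 * x 3 + x 1 * x 2 := rfl
  have hU : (e1 + e3) ^ 2 = (A 0 + 2) * (A 1 + 2) * (A 2 + 2) := by
    rw [a0, a1, a2, he1, he3]
    linear_combination (-(x 0 ^ 2 + x 1 ^ 2 + x 2 ^ 2 + x 3 ^ 2) + 2 * (x 0 * x 1 + x 0 * x 2 +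
      x 0 * x 3 + x 1 * x 2 + x 1 * x 3 + x 2 * x 3) + 8) * hprod
  have h13 : e1 * e3 = A 0 * A 1 + A 0 * A 2 + A 1 * A 2 + 4 := by
    rw [a0, a1, a2, he1, he3]
    linear_combination 4 * hprod
  have hact : ∀ h ∈ H, ∃ σ : Equiv.Perm (Fin 3), h (e1 + e3) = e1 + e3 ∧
      ∀ i, h (A i) = A (σ i) := by
    intro h hh
    obtain ⟨w, hw⟩ := hx h hh
    have hsum : ∀ y : Fin 4 → L, y 0 + y 1 + y 2 + y 3 = ∑ i, y i := fun y => by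
      rw [Fin.sum_univ_four]
    refine ⟨ptnPerm w.1, ?_, fun i => ?_⟩
    · rw [he3', he1, hsum, hsum (fun i => (x i)⁻¹)]
      rw [map_add, map_sum, map_sum]
      simp only [map_inv₀, hw _]
      have p1 : ∑ i, x (w.1 i) = ∑ i, x i := Equiv.sum_comp w.1 x
      have p2 : ∑ i, (x (w.1 i))⁻¹ = ∑ i, (x i)⁻¹ := Equiv.sum_comp w.1 fun i => (x i)⁻¹
      rcases Int.units_eq_one_or w.2 with e | e <;> rw [e] <;> simp [p1, p2]
      ring
    · rw [hA, ptn_map (by intros; simp), ← ptn_perm w.1 _ pairSymm_pairSum]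
      rcases Int.units_eq_one_or w.2 with e | e
      · rw [ptn_congr]
        intro j; rw [hw, e]; simp
      · rw [← inv_pairSum, ptn_congr]
        · intro j; rw [hw, e]; simp
        · rw [← map_mul, ← map_mul, ← map_mul, hprod, map_one]
  set q : Fin 3 → L := fun i => (e1 + e3) / (A i + 2) with hq
  refine fixGen_of_perm_affine htr (y := q) (fun y hy => ?_) fun h hh => ?_
  · have hm := hK.mem hprod (sub_ne_zero.mp hG.d0) hG.n01 (hz hy) (hy ⟨g₁, h1⟩) (hy ⟨g₂, h2⟩)
    obtain ⟨m0, m1, m2⟩ := mem_adjoin_triple (k := k) (x := q 0) (y := q 1) (z := q 2)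
    set E := adjoin k {q 0, q 1, q 2}
    have e0 : A 0 = q 1 * q 2 - 2 := by
      simp only [hq]; field_simp; rw [hU]; ring
    have e1' : A 1 = q 0 * q 2 - 2 := by
      simp only [hq]; field_simp; rw [hU]; ring
    have e2' : A 2 = q 0 * q 1 - 2 := by
      simp only [hq]; field_simp; rw [hU]; ring
    have eU : e1 + e3 = q 0 * q 1 * q 2 := by
      simp only [hq]; field_simp; rw [hU]
    have r0 : A 0 ∈ E := e0 ▸ sub_mem (mul_mem m1 m2) (ofNat_mem _ 2)
    have r1 : A 1 ∈ E := e1' ▸ sub_mem (mul_mem m0 m2) (ofNat_mem _ 2)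
    have r2 : A 2 ∈ E := e2' ▸ sub_mem (mul_mem m0 m1) (ofNat_mem _ 2)
    have rU : e1 + e3 ∈ E := eU ▸ mul_mem (mul_mem m0 m1) m2
    have g1 : g e1 = e3 := by
      rw [he3', he1]; simp [hgx]
    have gA : ∀ i, g (A i) = A i := fun i => by
      rw [hA, ptn_map (by intros; simp), ← inv_pairSum hprod, ptn_congr]
      exact hgx
    have g3 : g e3 = e1 := by
      rw [he3', he1]; simp [hgx]
    refine mem_of_fixed_quadratic (h := g) (α := e1) (c := e1 + e3) (d := -(e1 * e3)) ?_ rU ?_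
      (by ring) ?_ ?_ (hy ⟨g, hg⟩)
    · have hle : E ≤ adjoin k (insert e1 {q 0, q 1, q 2}) := adjoin.mono _ _ _ (Set.subset_insert _ _)
      set N := adjoin k (insert e1 {q 0, q 1, q 2})
      have me : e1 ∈ N := subset_adjoin _ _ (by simp)
      refine (adjoin_le_iff.mpr ?_ : _ ≤ N) hm
      rintro s (rfl | rfl | rfl | rfl | rfl)
      · exact hle r0
      · exact hle r1
      · exact hle r2
      · exact me
      · have := sub_mem (hle rU) me
        rwa [add_sub_cancel_left] at this
    · rw [h13]
      exact neg_mem (add_mem (add_mem (add_mem (mul_mem r0 r1) (mul_mem r0 r2)) (mul_mem r1 r2))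
        (ofNat_mem _ 4))
    · rintro s (rfl | rfl | rfl) <;> simp only [hq, map_div₀, map_add, map_ofNat, gA, g1, g3] <;>
        rw [add_comm e3]
    · rw [g1]; exact hG.ne13.symm
  · obtain ⟨σ, hU, hA⟩ := hact h hh
    exact ⟨σ, 1, 0, fun i => by simp only [hq, map_div₀, hU, map_add, hA, map_ofNat]; simp⟩

end

theorem mem_of_fixed_cubic {S : Set L} {α y a b d : L} {c : L ≃ₐ[k] L}
    (hy : y ∈ adjoin k (insert α S)) (ha : a ∈ adjoin k S) (hb : b ∈ adjoin k S)
    (hd : d ∈ adjoin k S) (hα : α ^ 3 = a * α ^ 2 + b * α + d) (hS : ∀ s ∈ S, c s = s)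
    (n01 : α ≠ c α) (n02 : α ≠ c (c α)) (n12 : c α ≠ c (c α)) (hcy : c y = y) :
    y ∈ adjoin k S := by
  classical
  have hE := fixes_adjoin hS
  rw [← adjoin_insert_adjoin] at hy
  have q12 : (1 : L ≃ₐ[k] L) ≠ c := by rintro rfl; exact n01 rfl
  have q13 : (1 : L ≃ₐ[k] L) ≠ c * c := fun h => n02 (DFunLike.congr_fun h α)
  have q23 : c ≠ c * c := fun h => n12 (DFunLike.congr_fun h α)
  have hdeg : ((Polynomial.X ^ 3 - Polynomial.C (⟨a, ha⟩ : adjoin k S) * Polynomial.X ^ 2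
      - Polynomial.C (⟨b, hb⟩ : adjoin k S) * Polynomial.X
      - Polynomial.C (⟨d, hd⟩ : adjoin k S)) : (adjoin k S)[X]).natDegree = 3 := by
    compute_degree!
  refine mem_of_fixed hy (Polynomial.X ^ 3 - Polynomial.C (⟨a, ha⟩ : adjoin k S) *
    Polynomial.X ^ 2 - Polynomial.C (⟨b, hb⟩ : adjoin k S) * Polynomial.X
      - Polynomial.C (⟨d, hd⟩ : adjoin k S)) ?_ ?_ {1, c, c * c} ?_ ?_ ?_ ?_
  · intro h0
    rw [h0, Polynomial.natDegree_zero] at hdeg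
    omega
  · simp only [map_sub, map_pow, map_mul, Polynomial.aeval_X, Polynomial.aeval_C]
    change α ^ 3 - a * α ^ 2 - b * α - d = 0
    rw [hα]; ring
  · rw [hdeg, Finset.card_eq_three.mpr ⟨1, c, c * c, q12, q13, q23, rfl⟩]
  · intro g hg e he
    simp only [Finset.mem_insert, Finset.mem_singleton] at hg
    rcases hg with rfl | rfl | rfl
    · rfl
    · exact hE e he
    · rw [AlgEquiv.mul_apply, hE e he, hE e he]
  · intro g hg
    simp only [Finset.mem_insert, Finset.mem_singleton] at hg
    rcases hg with rfl | rfl | rfl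
    · rfl
    · exact hcy
    · rw [AlgEquiv.mul_apply, hcy, hcy]
  · intro g hg g' hg' e
    simp only [Finset.mem_insert, Finset.mem_singleton] at hg hg'
    rcases hg with rfl | rfl | rfl <;> rcases hg' with rfl | rfl | rfl <;>
      simp only [AlgEquiv.mul_apply, AlgEquiv.one_apply] at e <;>
      first | rfl | exact absurd e ‹_› | exact absurd e.symm ‹_›

/-- `h` permutes the `y i` by a permutation `σ`, and swaps `s` and `s'` when `σ` is odd. -/
def ActSign (y : Fin 3 → L) (s s' : L) (h : L ≃ₐ[k] L) (σ : Equiv.Perm (Fin 3)) : Prop :=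
  (∀ i, h (y i) = y (σ i)) ∧ (Equiv.Perm.sign σ = 1 → h s = s ∧ h s' = s') ∧
    (Equiv.Perm.sign σ = -1 → h s = s' ∧ h s' = s)

/-- Generators of the field of invariants of a twisted action of the symmetric group. -/
def signInv (y : Fin 3 → L) (s s' : L) : Set L :=
  {y 0 + y 1 + y 2, y 0 * y 1 + y 0 * y 2 + y 1 * y 2, y 0 * y 1 * y 2, s + s',
    s * (y 0 ^ 2 * y 1 + y 1 ^ 2 * y 2 + y 2 ^ 2 * y 0) +
      s' * (y 1 ^ 2 * y 0 + y 2 ^ 2 * y 1 + y 0 ^ 2 * y 2)}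

theorem ActSign.fixes {y : Fin 3 → L} {s s' : L} {h : L ≃ₐ[k] L} {σ : Equiv.Perm (Fin 3)}
    (hh : ActSign y s s' h σ) : ∀ a ∈ signInv y s s', h a = a := by
  obtain ⟨hy, h1, h2⟩ := hh
  rcases perm_three_cases σ with ⟨sg, hc⟩ | ⟨sg, hc⟩
  · obtain ⟨e1, e2⟩ := h1 sg
    rcases hc with ⟨c0, c1, c2⟩ | ⟨c0, c1, c2⟩ | ⟨c0, c1, c2⟩ <;>
      rintro a (rfl | rfl | rfl | rfl | rfl) <;>
      simp only [map_add, map_mul, map_pow, hy, c0, c1, c2, e1, e2] <;> ring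
  · obtain ⟨e1, e2⟩ := h2 sg
    rcases hc with ⟨c0, c1, c2⟩ | ⟨c0, c1, c2⟩ | ⟨c0, c1, c2⟩ <;>
      rintro a (rfl | rfl | rfl | rfl | rfl) <;>
      simp only [map_add, map_mul, map_pow, hy, c0, c1, c2, e1, e2] <;> ring

theorem mem_signInv {y : Fin 3 → L} {s s' a : L} {c d : L ≃ₐ[k] L} {σ τ : Equiv.Perm (Fin 3)}
    (ha : a ∈ adjoin k {y 0, y 1, y 2, s}) (n01 : y 0 ≠ y 1) (n02 : y 0 ≠ y 2) (n12 : y 1 ≠ y 2)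
    (hc : ActSign y s s' c σ) (hd : ActSign y s s' d τ) (s0 : σ 0 = 1) (s1 : σ 1 = 2)
    (t0 : τ 0 = 0) (t1 : τ 1 = 2) (hca : c a = a) (hda : d a = a) :
    a ∈ adjoin k (signInv y s s') := by
  set α := y 0 ^ 2 * y 1 + y 1 ^ 2 * y 2 + y 2 ^ 2 * y 0 with hα
  set α' := y 1 ^ 2 * y 0 + y 2 ^ 2 * y 1 + y 0 ^ 2 * y 2 with hα'
  set S := signInv y s s' with hS
  have mS : ∀ a ∈ S, a ∈ adjoin k S := fun a h => subset_adjoin k S h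
  have me1 : y 0 + y 1 + y 2 ∈ S := by simp [hS, signInv]
  have me2 : y 0 * y 1 + y 0 * y 2 + y 1 * y 2 ∈ S := by simp [hS, signInv]
  have me3 : y 0 * y 1 * y 2 ∈ S := by simp [hS, signInv]
  have mT : s + s' ∈ S := by simp [hS, signInv]
  have mQ : s * α + s' * α' ∈ S := by simp [hS, signInv, hα, hα']
  have c0 : c (y 0) = y 1 := by rw [hc.1, s0]
  have c1 : c (y 1) = y 2 := by rw [hc.1, s1]
  refine mem_of_fixed_cubic (α := y 0) (c := c) ?_ (mS _ me1) (neg_mem (mS _ me2)) (mS _ me3)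
    (by ring) hc.fixes ?_ ?_ ?_ hca
  rotate_left
  · rwa [c0]
  · rwa [c0, c1]
  · rwa [c0, c1]
  have hle1 : adjoin k S ≤ adjoin k (insert (y 0) S) := adjoin.mono _ _ _ (Set.subset_insert _ _)
  have m0 : y 0 ∈ adjoin k (insert (y 0) S) := subset_adjoin _ _ (by simp)
  refine mem_of_fixed_quadratic (h := d) (α := y 1) (c := y 0 + y 1 + y 2 - y 0)
    (d := -(y 0 * y 1 + y 0 * y 2 + y 1 * y 2 - y 0 * (y 0 + y 1 + y 2 - y 0))) ?_
    (sub_mem (hle1 (mS _ me1)) m0) (neg_mem (sub_mem (hle1 (mS _ me2)) (mul_mem m0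
      (sub_mem (hle1 (mS _ me1)) m0)))) (by ring) ?_ ?_ hda
  · have hle2 : adjoin k (insert (y 0) S) ≤ adjoin k (insert (y 1) (insert (y 0) S)) :=
      adjoin.mono _ _ _ (Set.subset_insert _ _)
    set N := adjoin k (insert (y 1) (insert (y 0) S))
    have r0 := hle2 m0
    have r1 : y 1 ∈ N := subset_adjoin _ _ (by simp)
    have rS := fun b hb => hle2 (hle1 (mS b hb))
    have r2 : y 2 ∈ N := by
      have : y 2 = y 0 + y 1 + y 2 - y 0 - y 1 := by ring
      rw [this]
      exact sub_mem (sub_mem (rS _ me1) r0) r1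
    refine (adjoin_le_iff.mpr ?_ : adjoin k {y 0, y 1, y 2, s} ≤ N) ha
    have ne : α - α' ≠ 0 := by
      have : α - α' = (y 0 - y 1) * (y 0 - y 2) * (y 1 - y 2) := by rw [hα, hα']; ring
      rw [this]
      exact mul_ne_zero (mul_ne_zero (sub_ne_zero.mpr n01) (sub_ne_zero.mpr n02))
        (sub_ne_zero.mpr n12)
    have rα : α ∈ N := add_mem (add_mem (mul_mem (pow_mem r0 _) r1) (mul_mem (pow_mem r1 _) r2))
      (mul_mem (pow_mem r2 _) r0)
    have rα' : α' ∈ N := add_mem (add_mem (mul_mem (pow_mem r1 _) r0) (mul_mem (pow_mem r2 _) r1))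
      (mul_mem (pow_mem r0 _) r2)
    rintro b (rfl | rfl | rfl | rfl)
    · exact r0
    · exact r1
    · exact r2
    · have : b = (b * α + s' * α' - α' * (b + s')) / (α - α') := by
        rw [eq_div_iff ne]; ring
      rw [this]
      exact div_mem (sub_mem (rS _ mQ) (mul_mem rα' (rS _ mT))) (sub_mem rα rα')
  · rintro b (rfl | hb)
    · rw [hd.1, t0]
    · exact hd.fixes b hb
  · rw [hd.1, t1]; exact n12.symm

/-- A relation that is linear in one of four generators makes the others generate. -/
theorem fixGen_of_linear {H : Subgroup (L ≃ₐ[k] L)} [Finite H] (htr : 3 ≤ Algebra.trdeg k L)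
    {l t b z A B : L} (hle : fixedField H ≤ adjoin k {l, t, b, z})
    (hfix : ∀ h ∈ H, h t = t ∧ h b = b ∧ h z = z) (hl : l * A = B)
    (hA : A ∈ adjoin k {t, b, z}) (hB : B ∈ adjoin k {t, b, z})
    (hdeg : A = 0 → IsAlgebraic (adjoin k {l, t}) b ∧ IsAlgebraic (adjoin k {l, t}) z) :
    FixGen H ⊤ 3 := by
  have hA0 : A ≠ 0 := fun h0 => by
    obtain ⟨hb, hz⟩ := hdeg h0
    refine not_spans_pair htr l t ((spans_of_fixedField_le hle).trans ?_)
    rintro s (rfl | rfl | rfl | rfl)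
    · exact isAlgebraic_of_mem (subset_adjoin _ _ (by simp))
    · exact isAlgebraic_of_mem (subset_adjoin _ _ (by simp))
    · exact hb
    · exact hz
  refine ⟨![t, b, z], ?_⟩
  rw [range_vec3, inf_top_eq]
  obtain ⟨m0, m1, m2⟩ := mem_adjoin_triple (k := k) (x := t) (y := b) (z := z)
  refine le_antisymm (hle.trans (adjoin_le_iff.mpr ?_)) (adjoin_le_iff.mpr ?_)
  · rintro s (rfl | rfl | rfl | rfl)
    · exact (eq_div_of_mul_eq hA0 hl) ▸ div_mem hB hA
    · exact m0
    · exact m1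
    · exact m2
  · rintro s (rfl | rfl | rfl)
    · exact fun h => (hfix h.1 h.2).1
    · exact fun h => (hfix h.1 h.2).2.1
    · exact fun h => (hfix h.1 h.2).2.2

section
variable {H : Subgroup (L ≃ₐ[k] L)}

theorem fixGen_of_conic [Finite H] (htr : 3 ≤ Algebra.trdeg k L) (h2 : (2 : L) ≠ 0)
    {l D T q d u : L} (hle : fixedField H ≤ adjoin k {l, D, T, q})
    (hfix : ∀ h ∈ H, ∀ s ∈ ({l, D, T, q} : Set L), h s = s) (hl : l ≠ 0) (hl4 : l - 4 ≠ 0)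
    (hc : 2 * l + 1 ≠ 0) (hd : d = D ^ 4 - 2 * (l ^ 2 + 10 * l - 2) * D ^ 2 + l * (l - 4) ^ 3)
    (hu : u = D ^ 2 - l ^ 2 - 10 * l + 2) (hW : T - q * u ≠ 0)
    (hrel : l * (T ^ 2 - d * q ^ 2) = 16 * (2 * l + 1)) : FixGen H ⊤ 3 := by
  have hud : u ^ 2 - d = 4 * (2 * l + 1) ^ 3 := by rw [hu, hd]; ring
  set W := T - q * u with hWdef
  set τ := D / (l - 4) with hτ
  set x := (T * u - q * d) / W / (l - 4) with hx
  set z := 8 * (2 * l + 1) ^ 2 / (l * W) / (l - 4) with hz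
  set b := x - (τ ^ 2 - 1) * l with hb
  have hD : D = τ * (l - 4) := by rw [hτ]; field_simp
  have hz0 : z ≠ 0 := by
    rw [hz]
    refine div_ne_zero (div_ne_zero (mul_ne_zero ?_ (pow_ne_zero _ hc)) (mul_ne_zero hl hW)) hl4
    rw [show (8 : L) = 2 ^ 3 by norm_num]
    exact pow_ne_zero _ h2
  have hWz : W = 8 * (2 * l + 1) ^ 2 / (l * (z * (l - 4))) := by
    have : z * (l - 4) * (l * W) = 8 * (2 * l + 1) ^ 2 := by rw [hz]; field_simp
    rw [eq_div_iff (mul_ne_zero hl (mul_ne_zero hz0 hl4))]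
    linear_combination this
  have hconic : (x ^ 2 - l * z ^ 2) * (l - 4) ^ 2 = d := by
    have e1 : x * (l - 4) * W = T * u - q * d := by rw [hx]; field_simp
    have e2 : z * (l - 4) * (l * W) = 8 * (2 * l + 1) ^ 2 := by rw [hz]; field_simp
    have : l * W ^ 2 * ((x ^ 2 - l * z ^ 2) * (l - 4) ^ 2 - d) = 0 := by
      have e3 : l * W ^ 2 * ((x ^ 2 - l * z ^ 2) * (l - 4) ^ 2 - d) =
          l * (x * (l - 4) * W) ^ 2 - (z * (l - 4) * (l * W)) ^ 2 - l * W ^ 2 * d := by ring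
      rw [e3, e1, e2, hWdef]
      linear_combination (u ^ 2 - d) * hrel + 16 * (2 * l + 1) * hud
    exact sub_eq_zero.mp ((mul_eq_zero.mp this).resolve_left (mul_ne_zero hl (pow_ne_zero _ hW)))
  have hlin : l * (2 * b * (τ ^ 2 - 1) - z ^ 2 + 8 * τ ^ 4 + 20 * τ ^ 2 + 4) =
      16 * τ ^ 4 + 4 * τ ^ 2 - b ^ 2 := by
    have : (l - 4) ^ 2 * (x ^ 2 - l * z ^ 2 - (τ ^ 4 * (l - 4) ^ 2 - 2 * (l ^ 2 + 10 * l - 2) * τ ^ 2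
        + l * (l - 4))) = 0 := by
      rw [hd, hD] at hconic
      linear_combination hconic
    have := (mul_eq_zero.mp this).resolve_left (pow_ne_zero _ hl4)
    rw [hb]
    linear_combination this
  obtain ⟨m0, m1, m2⟩ := mem_adjoin_triple (k := k) (x := τ) (y := b) (z := z)
  refine fixGen_of_linear htr (l := l) (t := τ) (b := b) (z := z) (hle.trans ?_) ?_ hlin ?_ ?_ ?_
  · set N := adjoin k {l, τ, b, z}
    have nl : l ∈ N := subset_adjoin _ _ (by simp)
    have nτ : τ ∈ N := subset_adjoin _ _ (by simp)
    have nb : b ∈ N := subset_adjoin _ _ (by simp)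
    have nz : z ∈ N := subset_adjoin _ _ (by simp)
    have nl4 : l - 4 ∈ N := sub_mem nl (ofNat_mem _ 4)
    have nD : D ∈ N := hD ▸ mul_mem nτ nl4
    have nc : 2 * l + 1 ∈ N := add_mem (mul_mem (ofNat_mem _ 2) nl) (one_mem _)
    have nu : u ∈ N := hu ▸ add_mem (sub_mem (sub_mem (pow_mem nD _) (pow_mem nl _))
      (mul_mem (ofNat_mem _ 10) nl)) (ofNat_mem _ 2)
    have nW : W ∈ N := hWz ▸ div_mem (mul_mem (ofNat_mem _ 8) (pow_mem nc _))
      (mul_mem nl (mul_mem nz nl4))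
    have nx : x ∈ N := by
      have : x = b + (τ ^ 2 - 1) * l := by rw [hb]; ring
      rw [this]
      exact add_mem nb (mul_mem (sub_mem (pow_mem nτ _) (one_mem _)) nl)
    have hq : q = W * (x * (l - 4) - u) / (4 * (2 * l + 1) ^ 3) := by
      have e1 : x * (l - 4) * W = T * u - q * d := by rw [hx]; field_simp
      have h4 : (4 : L) ≠ 0 := by rw [show (4 : L) = 2 ^ 2 by norm_num]; exact pow_ne_zero _ h2
      rw [eq_div_iff (mul_ne_zero h4 (pow_ne_zero _ hc)), ← hud]
      linear_combination -e1 + u * hWdef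
    have nq : q ∈ N := hq ▸ div_mem (mul_mem nW (sub_mem (mul_mem nx nl4) nu))
      (mul_mem (ofNat_mem _ 4) (pow_mem nc _))
    have nT : T ∈ N := by
      have : T = W + q * u := by rw [hWdef]; ring
      rw [this]
      exact add_mem nW (mul_mem nq nu)
    rw [adjoin_le_iff]
    rintro s (rfl | rfl | rfl | rfl)
    exacts [nl, nD, nT, nq]
  · intro h hh
    have fl : h l = l := hfix h hh l (by simp)
    have fD : h D = D := hfix h hh D (by simp)
    have fT : h T = T := hfix h hh T (by simp)
    have fq : h q = q := hfix h hh q (by simp)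
    have fτ : h τ = τ := by rw [hτ]; simp [fl, fD, map_ofNat]
    have fu : h u = u := by rw [hu]; simp [fl, fD, map_ofNat]
    have fd : h d = d := by rw [hd]; simp [fl, fD, map_ofNat]
    have fW : h W = W := by rw [hWdef]; simp [fq, fu, fT]
    have fx : h x = x := by rw [hx]; simp [fq, fu, fT, fl, fd, fW, map_ofNat]
    exact ⟨fτ, by rw [hb]; simp [fx, fτ, fl], by rw [hz]; simp [fl, fW, map_ofNat]⟩
  · exact add_mem (add_mem (add_mem (sub_mem (mul_mem (mul_mem (ofNat_mem _ 2) m1)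
      (sub_mem (pow_mem m0 _) (one_mem _))) (pow_mem m2 _)) (mul_mem (ofNat_mem _ 8) (pow_mem m0 _)))
      (mul_mem (ofNat_mem _ 20) (pow_mem m0 _))) (ofNat_mem _ 4)
  · exact sub_mem (add_mem (mul_mem (ofNat_mem _ 16) (pow_mem m0 _))
      (mul_mem (ofNat_mem _ 4) (pow_mem m0 _))) (pow_mem m1 _)
  · intro h0
    rw [h0, mul_zero] at hlin
    have nτ : τ ∈ adjoin k {l, τ} := subset_adjoin _ _ (by simp)
    have ab : IsAlgebraic (adjoin k {l, τ}) b := by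
      refine IsAlgebraic.of_pow two_pos (isAlgebraic_of_mem ?_)
      rw [show b ^ 2 = 16 * τ ^ 4 + 4 * τ ^ 2 by linear_combination hlin]
      exact add_mem (mul_mem (ofNat_mem _ 16) (pow_mem nτ _))
        (mul_mem (ofNat_mem _ 4) (pow_mem nτ _))
    refine ⟨ab, IsAlgebraic.of_pow two_pos ?_⟩
    rw [show z ^ 2 = 2 * (τ ^ 2 - 1) * b + (8 * τ ^ 4 + 20 * τ ^ 2 + 4) by linear_combination -h0]
    refine ((isAlgebraic_of_mem ?_).mul ab).add (isAlgebraic_of_mem ?_)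
    · exact mul_mem (ofNat_mem _ 2) (sub_mem (pow_mem nτ _) (one_mem _))
    · exact add_mem (add_mem (mul_mem (ofNat_mem _ 8) (pow_mem nτ _))
        (mul_mem (ofNat_mem _ 20) (pow_mem nτ _))) (ofNat_mem _ 4)

/-- The ratios of three elements. -/
def ratios (p : Fin 3 → L) : Fin 3 → L := ![p 1 / p 2, p 2 / p 0, p 0 / p 1]

/-- `8 p₀ p₁ p₂ / ((p₀ + p₁) (p₀ + p₂) (p₁ + p₂))` -/
def twist (p : Fin 3 → L) : L := 8 * (p 0 * p 1 * p 2) / ((p 0 + p 1) * (p 0 + p 2) * (p 1 + p 2))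

/-- `h` permutes the `p i`, composed with `p ↦ twist p / p` when the permutation is odd. -/
def ActTwist (p : Fin 3 → L) (h : L ≃ₐ[k] L) (σ : Equiv.Perm (Fin 3)) : Prop :=
  (Equiv.Perm.sign σ = 1 → ∀ i, h (p i) = p (σ i)) ∧
    (Equiv.Perm.sign σ = -1 → ∀ i, h (p i) = twist p / p (σ i))

theorem ActTwist.actSign {p : Fin 3 → L} {h : L ≃ₐ[k] L} {σ : Equiv.Perm (Fin 3)}
    (hp : ActTwist p h σ) (p0 : p 0 ≠ 0) (p1 : p 1 ≠ 0) (p2 : p 2 ≠ 0) (p01 : p 0 + p 1 ≠ 0)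
    (p02 : p 0 + p 2 ≠ 0) (p12 : p 1 + p 2 ≠ 0) (h2 : (2 : L) ≠ 0) :
    ActSign (ratios p) (p 0 + p 1 + p 2) (twist p * ((p 0)⁻¹ + (p 1)⁻¹ + (p 2)⁻¹)) h σ := by
  have h8 : (8 : L) ≠ 0 := by rw [show (8 : L) = 2 ^ 3 by norm_num]; exact pow_ne_zero _ h2
  have p10 : p 1 + p 0 ≠ 0 := by rwa [add_comm]
  have p20 : p 2 + p 0 ≠ 0 := by rwa [add_comm]
  have p21 : p 2 + p 1 ≠ 0 := by rwa [add_comm]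
  have ht0 : twist p ≠ 0 := by
    rw [twist]; positivity
  have ht : h (twist p) = twist p := by
    rcases perm_three_cases σ with ⟨sg, hc⟩ | ⟨sg, hc⟩
    · have e := hp.1 sg
      rcases hc with ⟨c0, c1, c2⟩ | ⟨c0, c1, c2⟩ | ⟨c0, c1, c2⟩ <;>
        simp only [twist, map_div₀, map_mul, map_add, map_ofNat, e, c0, c1, c2] <;> ring
    · have e := hp.2 sg
      have key : ∀ {t a b c : L}, t ≠ 0 → a ≠ 0 → b ≠ 0 → c ≠ 0 → a + b ≠ 0 → a + c ≠ 0 →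
          b + c ≠ 0 → 8 * (t / a * (t / b) * (t / c)) / ((t / a + t / b) * (t / a + t / c) *
            (t / b + t / c)) = 8 * (a * b * c) / ((a + b) * (a + c) * (b + c)) := by
        intro t a b c ht ha hb hc hab hac hbc
        rw [show t / a + t / b = t * (a + b) / (a * b) by field_simp; ring,
          show t / a + t / c = t * (a + c) / (a * c) by field_simp; ring,
          show t / b + t / c = t * (b + c) / (b * c) by field_simp; ring]
        field_simp
      have hm : h (twist p) = 8 * (h (p 0) * h (p 1) * h (p 2)) /
          ((h (p 0) + h (p 1)) * (h (p 0) + h (p 2)) * (h (p 1) + h (p 2))) := by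
        rw [twist]
        simp only [map_div₀, map_mul, map_add, map_ofNat]
      rcases hc with ⟨c0, c1, c2⟩ | ⟨c0, c1, c2⟩ | ⟨c0, c1, c2⟩ <;>
        rw [hm, e, e, e, c0, c1, c2, key] <;> first | assumption | (rw [twist]; ring)
  refine ⟨fun i => ?_, fun sg => ?_, fun sg => ?_⟩
  · rcases perm_three_cases σ with ⟨sg, hc⟩ | ⟨sg, hc⟩
    · have e := hp.1 sg
      rcases hc with ⟨c0, c1, c2⟩ | ⟨c0, c1, c2⟩ | ⟨c0, c1, c2⟩ <;> fin_cases i <;>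
        simp [ratios, e, c0, c1, c2]
    · have e := hp.2 sg
      generalize twist p = t at *
      rcases hc with ⟨c0, c1, c2⟩ | ⟨c0, c1, c2⟩ | ⟨c0, c1, c2⟩ <;> fin_cases i <;>
        simp [ratios, e, c0, c1, c2] <;> field_simp
  · have e := hp.1 sg
    rcases perm_three_cases σ with ⟨-, hc⟩ | ⟨sg', -⟩
    · rcases hc with ⟨c0, c1, c2⟩ | ⟨c0, c1, c2⟩ | ⟨c0, c1, c2⟩ <;>
        simp only [map_mul, map_add, map_inv₀, ht, e, c0, c1, c2] <;> constructor <;>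
        first | trivial | ring
    · rw [sg] at sg'; exact absurd sg' (by decide)
  · have e := hp.2 sg
    rcases perm_three_cases σ with ⟨sg', -⟩ | ⟨-, hc⟩
    · rw [sg] at sg'; exact absurd sg' (by decide)
    · generalize twist p = t at *
      rcases hc with ⟨c0, c1, c2⟩ | ⟨c0, c1, c2⟩ | ⟨c0, c1, c2⟩ <;>
        simp only [map_mul, map_add, map_inv₀, ht, e, c0, c1, c2] <;> constructor <;>
        field_simp <;> ring

theorem mem_adjoin_ratios {p : Fin 3 → L} (p0 : p 0 ≠ 0)
    (hs : p 0 + p 1 + p 2 ≠ 0) :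
    adjoin k {p 0, p 1, p 2} ≤ adjoin k {ratios p 0, ratios p 1, ratios p 2, p 0 + p 1 + p 2} := by
  set N := adjoin k {ratios p 0, ratios p 1, ratios p 2, p 0 + p 1 + p 2}
  have m1 : p 2 / p 0 ∈ N := subset_adjoin _ _ (by simp [ratios])
  have m2 : p 0 / p 1 ∈ N := subset_adjoin _ _ (by simp [ratios])
  have ms : p 0 + p 1 + p 2 ∈ N := subset_adjoin _ _ (by simp)
  have e0 : p 0 = (p 0 + p 1 + p 2) / (1 + (p 0 / p 1)⁻¹ + p 2 / p 0) := by
    rw [show 1 + (p 0 / p 1)⁻¹ + p 2 / p 0 = (p 0 + p 1 + p 2) / p 0 by field_simp]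
    field_simp
  have n0 : p 0 ∈ N := e0 ▸ div_mem ms (add_mem (add_mem (one_mem _) (inv_mem m2)) m1)
  rw [adjoin_le_iff]
  rintro b (rfl | rfl | rfl)
  · exact n0
  · have := div_mem n0 m2
    rwa [div_div_cancel₀ p0] at this
  · have := mul_mem n0 m1
    rwa [mul_div_cancel₀ _ p0] at this

theorem twist_conic_ne_zero (h2 : (2 : L) ≠ 0) {l D T Δ s s' M P E : L}
    (hd : Δ ^ 2 = D ^ 4 - 2 * (l ^ 2 + 10 * l - 2) * D ^ 2 + l * (l - 4) ^ 3)
    (hrel : l * (T ^ 2 - Δ ^ 2 * ((s - s') / Δ) ^ 2) = 16 * (2 * l + 1)) (hT : T = s + s')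
    (hss : s * s' = 8 * (M + P) / M) (hlP : l = M / (2 * P)) (hDP : D = E / -(2 * P))
    (hM : M ≠ 0) (hP : P ≠ 0) (rc : M + P ≠ 0)
    (rW : ((E ^ 2 - M ^ 2 - 20 * M * P + 8 * P ^ 2) * s * M) ^ 2 -
      P * (2 * M * (M + P) ^ 2 * (s ^ 2 * M + 8 * (M + P)) ^ 2) ≠ 0) :
    T - (s - s') / Δ * (D ^ 2 - l ^ 2 - 10 * l + 2) ≠ 0 := by
  intro hW
  set q := (s - s') / Δ
  set u := D ^ 2 - l ^ 2 - 10 * l + 2 with hu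
  have hc0 : 2 * l + 1 ≠ 0 := by
    rw [hlP, show 2 * (M / (2 * P)) + 1 = (M + P) / P by field_simp]
    exact div_ne_zero rc hP
  have hTu : T = q * u := sub_eq_zero.mp hW
  have hud : u ^ 2 - Δ ^ 2 = 4 * (2 * l + 1) ^ 3 := by rw [hu, hd]; ring
  have h4 : (4 : L) ≠ 0 := by rw [show (4 : L) = 2 ^ 2 by norm_num]; exact pow_ne_zero _ h2
  have hlq : l * (2 * l + 1) ^ 2 * q ^ 2 = 4 := by
    have : 4 * (2 * l + 1) * (l * (2 * l + 1) ^ 2 * q ^ 2 - 4) = 0 := by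
      rw [hTu] at hrel
      linear_combination hrel - l * q ^ 2 * hud
    exact sub_eq_zero.mp ((mul_eq_zero.mp this).resolve_left (mul_ne_zero h4 hc0))
  have hfin : l * (2 * l + 1) ^ 2 * (s ^ 2 + s * s') ^ 2 = 4 * (u * s) ^ 2 := by
    rw [show s ^ 2 + s * s' = s * (q * u) by rw [← hTu, hT]; ring]
    linear_combination u ^ 2 * s ^ 2 * hlq
  have hu' : u = (E ^ 2 - M ^ 2 - 20 * M * P + 8 * P ^ 2) / (4 * P ^ 2) := by
    rw [hu, hlP, hDP]; field_simp; ring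
  rw [hss, hlP, hu'] at hfin
  apply rW
  field_simp at hfin
  refine (mul_eq_zero.mp (?_ : 2 * _ = (0 : L))).resolve_left h2
  linear_combination -M * hfin

set_option maxHeartbeats 1600000 in
theorem fixGen_of_actTwist [Finite H] (htr : 3 ≤ Algebra.trdeg k L) (h2k : (2 : k) ≠ 0)
    {p : Fin 3 → L} (hle : fixedField H ≤ adjoin k {p 0, p 1, p 2})
    (hp : ∀ h ∈ H, ∃ σ, ActTwist p h σ) {c d : L ≃ₐ[k] L} {σ τ : Equiv.Perm (Fin 3)} (hc : c ∈ H)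
    (hd : d ∈ H) (hcσ : ActTwist p c σ) (hdτ : ActTwist p d τ) (s0 : σ 0 = 1) (s1 : σ 1 = 2)
    (t0 : τ 0 = 0) (t1 : τ 1 = 2) : FixGen H ⊤ 3 := by
  have h2 : (2 : L) ≠ 0 := by
    rw [← map_ofNat (algebraMap k L) 2]
    exact (_root_.map_ne_zero _).mpr h2k
  have hi := (spans_of_fixedField_le hle).algebraicIndependent htr
  have p0 : p 0 ≠ 0 := by
    have := aeval_ne_zero hi (X 0) (![1, 1, 0] : Fin 3 → k) (by simp)
    simpa using this
  have p1 : p 1 ≠ 0 := by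
    have := aeval_ne_zero hi (X 1) (![1, 1, 0] : Fin 3 → k) (by simp)
    simpa using this
  have p2 : p 2 ≠ 0 := by
    have := aeval_ne_zero hi (X 2) (![1, 1, 1] : Fin 3 → k) (by simp)
    simpa using this
  have p01 : p 0 + p 1 ≠ 0 := by
    have := aeval_ne_zero hi (X 0 + X 1) (![1, 0, 0] : Fin 3 → k) (by simp)
    simpa using this
  have p02 : p 0 + p 2 ≠ 0 := by
    have := aeval_ne_zero hi (X 0 + X 2) (![1, 0, 0] : Fin 3 → k) (by simp)
    simpa using this
  have p12 : p 1 + p 2 ≠ 0 := by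
    have := aeval_ne_zero hi (X 1 + X 2) (![0, 1, 0] : Fin 3 → k) (by simp)
    simpa using this
  have ps : p 0 + p 1 + p 2 ≠ 0 := by
    have := aeval_ne_zero hi (X 0 + X 1 + X 2) (![0, 1, 0] : Fin 3 → k) (by simp)
    simpa using this
  have q0 : p 0 * p 1 - p 2 ^ 2 ≠ 0 := by
    have := aeval_ne_zero hi (X 0 * X 1 - X 2 ^ 2) (![1, 1, 0] : Fin 3 → k) (by simp)
    simpa using this
  have q1 : p 0 * p 2 - p 1 ^ 2 ≠ 0 := by
    have := aeval_ne_zero hi (X 0 * X 2 - X 1 ^ 2) (![1, 0, 1] : Fin 3 → k) (by simp)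
    simpa using this
  have q2 : p 1 * p 2 - p 0 ^ 2 ≠ 0 := by
    have := aeval_ne_zero hi (X 1 * X 2 - X 0 ^ 2) (![0, 1, 1] : Fin 3 → k) (by simp)
    simpa using this
  have r4 : (p 0 + p 1) * (p 0 + p 2) * (p 1 + p 2) - 8 * (p 0 * p 1 * p 2) ≠ 0 := by
    have := aeval_ne_zero hi ((X 0 + X 1) * (X 0 + X 2) * (X 1 + X 2) -
      8 * (X 0 * X 1 * X 2)) (![1, 1, 0] : Fin 3 → k) (by simp [one_add_one_eq_two, h2k])
    simpa using this
  have rc : (p 0 + p 1) * (p 0 + p 2) * (p 1 + p 2) + p 0 * p 1 * p 2 ≠ 0 := by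
    have := aeval_ne_zero hi ((X 0 + X 1) * (X 0 + X 2) * (X 1 + X 2) +
      X 0 * X 1 * X 2) (![1, 1, 0] : Fin 3 → k) (by simp [one_add_one_eq_two, h2k])
    simpa using this
  have rW : (((p 0 ^ 2 * p 1 + p 1 ^ 2 * p 2 + p 2 ^ 2 * p 0 -
      (p 0 ^ 2 * p 2 + p 1 ^ 2 * p 0 + p 2 ^ 2 * p 1)) ^ 2 -
      ((p 0 + p 1) * (p 0 + p 2) * (p 1 + p 2)) ^ 2 -
      20 * ((p 0 + p 1) * (p 0 + p 2) * (p 1 + p 2)) * (p 0 * p 1 * p 2) +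
      8 * (p 0 * p 1 * p 2) ^ 2) * (p 0 + p 1 + p 2) * ((p 0 + p 1) * (p 0 + p 2) * (p 1 + p 2))) ^ 2
      - p 0 * p 1 * p 2 * (2 * ((p 0 + p 1) * (p 0 + p 2) * (p 1 + p 2)) *
        ((p 0 + p 1) * (p 0 + p 2) * (p 1 + p 2) + p 0 * p 1 * p 2) ^ 2 *
        ((p 0 + p 1 + p 2) ^ 2 * ((p 0 + p 1) * (p 0 + p 2) * (p 1 + p 2)) +
          8 * ((p 0 + p 1) * (p 0 + p 2) * (p 1 + p 2) + p 0 * p 1 * p 2)) ^ 2) ≠ 0 := by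
    have := aeval_ne_zero hi ((((X 0 ^ 2 * X 1 + X 1 ^ 2 * X 2 + X 2 ^ 2 * X 0 -
      (X 0 ^ 2 * X 2 + X 1 ^ 2 * X 0 + X 2 ^ 2 * X 1)) ^ 2 -
      ((X 0 + X 1) * (X 0 + X 2) * (X 1 + X 2)) ^ 2 -
      20 * ((X 0 + X 1) * (X 0 + X 2) * (X 1 + X 2)) * (X 0 * X 1 * X 2) +
      8 * (X 0 * X 1 * X 2) ^ 2) * (X 0 + X 1 + X 2) * ((X 0 + X 1) * (X 0 + X 2) * (X 1 + X 2))) ^ 2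
      - X 0 * X 1 * X 2 * (2 * ((X 0 + X 1) * (X 0 + X 2) * (X 1 + X 2)) *
        ((X 0 + X 1) * (X 0 + X 2) * (X 1 + X 2) + X 0 * X 1 * X 2) ^ 2 *
        ((X 0 + X 1 + X 2) ^ 2 * ((X 0 + X 1) * (X 0 + X 2) * (X 1 + X 2)) +
          8 * ((X 0 + X 1) * (X 0 + X 2) * (X 1 + X 2) + X 0 * X 1 * X 2)) ^ 2))
      (![1, 1, 0] : Fin 3 → k) (by simp [one_add_one_eq_two, h2k])
    simpa using this
  have act := fun {h : L ≃ₐ[k] L} {σ} (hh : ActTwist p h σ) => hh.actSign p0 p1 p2 p01 p02 p12 h2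
  set y := ratios p with hy
  set s := p 0 + p 1 + p 2 with hs
  set s' := twist p * ((p 0)⁻¹ + (p 1)⁻¹ + (p 2)⁻¹) with hs'
  have y0 : y 0 = p 1 / p 2 := rfl
  have y1 : y 1 = p 2 / p 0 := rfl
  have y2 : y 2 = p 0 / p 1 := rfl
  have hy1 : y 0 * y 1 * y 2 = 1 := by rw [y0, y1, y2]; field_simp
  have n01 : y 0 - y 1 ≠ 0 := by
    rw [y0, y1, show p 1 / p 2 - p 2 / p 0 = (p 0 * p 1 - p 2 ^ 2) / (p 0 * p 2) by
      field_simp]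
    positivity
  have n02 : y 0 - y 2 ≠ 0 := by
    rw [y0, y2, show p 1 / p 2 - p 0 / p 1 = -(p 0 * p 2 - p 1 ^ 2) / (p 1 * p 2) by
      field_simp; ring]
    exact div_ne_zero (neg_ne_zero.mpr q1) (mul_ne_zero p1 p2)
  have n12 : y 1 - y 2 ≠ 0 := by
    rw [y1, y2, show p 2 / p 0 - p 0 / p 1 = (p 1 * p 2 - p 0 ^ 2) / (p 0 * p 1) by
      field_simp]
    positivity
  have hsig : fixedField H ≤ adjoin k (signInv y s s') := fun a ha =>
    mem_signInv (mem_adjoin_ratios p0 ps (hle ha)) (sub_ne_zero.mp n01) (sub_ne_zero.mp n02)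
      (sub_ne_zero.mp n12) (act hcσ) (act hdτ) s0 s1 t0 t1 (ha ⟨c, hc⟩) (ha ⟨d, hd⟩)
  set Δ := (y 0 - y 1) * (y 0 - y 2) * (y 1 - y 2) with hΔ
  have hΔ0 : Δ ≠ 0 := mul_ne_zero (mul_ne_zero n01 n02) n12
  set ε₁ := y 0 + y 1 + y 2 with hε₁
  set ε₂ := y 0 * y 1 + y 0 * y 2 + y 1 * y 2 with hε₂
  set l := (ε₁ + ε₂ + 2) / 2 with hl
  set D := (ε₁ - ε₂) / 2 with hD
  set T := s + s' with hT
  set Q := s * (y 0 ^ 2 * y 1 + y 1 ^ 2 * y 2 + y 2 ^ 2 * y 0) +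
      s' * (y 1 ^ 2 * y 0 + y 2 ^ 2 * y 1 + y 0 ^ 2 * y 2) with hQ
  have e1 : ε₁ = l - 1 + D := by rw [hl, hD]; field_simp; ring
  have e2 : ε₂ = l - 1 - D := by rw [hl, hD]; field_simp; ring
  have hd : Δ ^ 2 = D ^ 4 - 2 * (l ^ 2 + 10 * l - 2) * D ^ 2 + l * (l - 4) ^ 3 := by
    have : Δ ^ 2 = ε₁ ^ 2 * ε₂ ^ 2 - 4 * ε₂ ^ 3 - 4 * ε₁ ^ 3 * (y 0 * y 1 * y 2) +
      18 * ε₁ * ε₂ * (y 0 * y 1 * y 2) - 27 * (y 0 * y 1 * y 2) ^ 2 := by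
      rw [hΔ, hε₁, hε₂]; ring
    rw [this, hy1, e1, e2]; ring
  have hq : 2 * Q - T * (ε₁ * ε₂ - 3) = (s - s') * Δ := by
    rw [hQ, hT, hε₁, hε₂, hΔ]
    linear_combination -3 * (s + s') * hy1
  have hle' : fixedField H ≤ adjoin k {l, D, T, (s - s') / Δ} := by
    refine hsig.trans (adjoin_le_iff.mpr ?_)
    set N := adjoin k {l, D, T, (s - s') / Δ}
    have nl : l ∈ N := subset_adjoin _ _ (by simp)
    have nD : D ∈ N := subset_adjoin _ _ (by simp)
    have nT : T ∈ N := subset_adjoin _ _ (by simp)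
    have nq : (s - s') / Δ ∈ N := subset_adjoin _ _ (by simp)
    have n1 : ε₁ ∈ N := e1 ▸ add_mem (sub_mem nl (one_mem _)) nD
    have n2 : ε₂ ∈ N := e2 ▸ sub_mem (sub_mem nl (one_mem _)) nD
    rintro a (rfl | rfl | rfl | rfl | rfl)
    · exact n1
    · exact n2
    · rw [hy1]; exact one_mem _
    · exact nT
    · have : Q = ((s - s') / Δ * Δ ^ 2 + T * (ε₁ * ε₂ - 3)) / 2 := by
        rw [eq_div_iff h2, show (s - s') / Δ * Δ ^ 2 = (s - s') * Δ by field_simp, ← hq]; ring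
      change Q ∈ N
      rw [this, hd]
      exact div_mem (add_mem (mul_mem nq (add_mem (sub_mem (pow_mem nD _) (mul_mem (mul_mem
        (ofNat_mem _ 2) (sub_mem (add_mem (pow_mem nl _) (mul_mem (ofNat_mem _ 10) nl))
        (ofNat_mem _ 2))) (pow_mem nD _))) (mul_mem nl (pow_mem (sub_mem nl (ofNat_mem _ 4)) _))))
        (mul_mem nT (sub_mem (mul_mem n1 n2) (ofNat_mem _ 3)))) (ofNat_mem _ 2)
  have hfix : ∀ h ∈ H, ∀ a ∈ ({l, D, T, (s - s') / Δ} : Set L), h a = a := by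
    intro h hh
    obtain ⟨σ, hσ⟩ := hp h hh
    have fS := (act hσ).fixes
    have f1 : h ε₁ = ε₁ := fS _ (by simp [signInv, hε₁])
    have f2 : h ε₂ = ε₂ := fS _ (by simp [signInv, hε₂])
    have fT : h T = T := fS _ (by simp [signInv, hT])
    have fQ : h Q = Q := fS _ (by simp [signInv, hQ])
    have fl : h l = l := by rw [hl]; simp [f1, f2, map_ofNat]
    have fD : h D = D := by rw [hD]; simp [f1, f2, map_ofNat]
    have hq' : (s - s') / Δ = (2 * Q - T * (ε₁ * ε₂ - 3)) / Δ ^ 2 := by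
      rw [hq]; field_simp
    rintro a (rfl | rfl | rfl | rfl)
    · exact fl
    · exact fD
    · exact fT
    · rw [hq', hd]; simp [f1, f2, fT, fQ, fl, fD, map_ofNat]
  have hlP : l = ((p 0 + p 1) * (p 0 + p 2) * (p 1 + p 2)) / (2 * (p 0 * p 1 * p 2)) := by
    rw [hl, hε₁, hε₂, y0, y1, y2]; field_simp; ring
  have hDP : D = (p 0 ^ 2 * p 1 + p 1 ^ 2 * p 2 + p 2 ^ 2 * p 0 -
      (p 0 ^ 2 * p 2 + p 1 ^ 2 * p 0 + p 2 ^ 2 * p 1)) / -(2 * (p 0 * p 1 * p 2)) := by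
    rw [hD, hε₁, hε₂, y0, y1, y2]; field_simp; ring
  have hss : s * s' = 8 * ((p 0 + p 1) * (p 0 + p 2) * (p 1 + p 2) + p 0 * p 1 * p 2) /
      ((p 0 + p 1) * (p 0 + p 2) * (p 1 + p 2)) := by
    rw [hs, hs', twist]; field_simp; ring
  have hP : p 0 * p 1 * p 2 ≠ 0 := mul_ne_zero (mul_ne_zero p0 p1) p2
  have hM : (p 0 + p 1) * (p 0 + p 2) * (p 1 + p 2) ≠ 0 := mul_ne_zero (mul_ne_zero p01 p02) p12
  clear_value s' T Q Δ l D
  generalize p 0 * p 1 * p 2 = P at *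
  generalize (p 0 + p 1) * (p 0 + p 2) * (p 1 + p 2) = M at *
  generalize p 0 ^ 2 * p 1 + p 1 ^ 2 * p 2 + p 2 ^ 2 * p 0 -
      (p 0 ^ 2 * p 2 + p 1 ^ 2 * p 0 + p 2 ^ 2 * p 1) = E at *
  have hrel : l * (T ^ 2 - Δ ^ 2 * ((s - s') / Δ) ^ 2) = 16 * (2 * l + 1) := by
    rw [show l * (T ^ 2 - Δ ^ 2 * ((s - s') / Δ) ^ 2) = 4 * l * (s * s') by
      rw [hT]; field_simp; ring, hss, hlP]
    field_simp
    ring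
  refine fixGen_of_conic htr h2 (u := D ^ 2 - l ^ 2 - 10 * l + 2) hle' hfix ?_ ?_ ?_ hd rfl ?_ hrel
  · rw [hlP]; exact div_ne_zero hM (mul_ne_zero h2 hP)
  · rw [hlP, show M / (2 * P) - 4 = (M - 8 * P) / (2 * P) by field_simp; ring]
    exact div_ne_zero r4 (mul_ne_zero h2 hP)
  · rw [hlP, show 2 * (M / (2 * P)) + 1 = (M + P) / P by field_simp]
    exact div_ne_zero rc hP
  · exact twist_conic_ne_zero h2 hd hrel hT hss hlP hDP hM hP rc rW

end

section
variable {H : Subgroup (L ≃ₐ[k] L)}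

/-- In characteristic two, `h` permutes the `v i`, up to the factor `(∑ v) / ∏ v` when the
permutation is odd. -/
def ActScale (v : Fin 3 → L) (h : L ≃ₐ[k] L) (σ : Equiv.Perm (Fin 3)) : Prop :=
  (Equiv.Perm.sign σ = 1 → ∀ i, h (v i) = v (σ i)) ∧
    (Equiv.Perm.sign σ = -1 → ∀ i, h (v i) = v (σ i) * (v 0 + v 1 + v 2) / (v 0 * v 1 * v 2))

theorem ActScale.actSign {v : Fin 3 → L} {h : L ≃ₐ[k] L} {σ : Equiv.Perm (Fin 3)}
    (hv : ActScale v h σ) (hs : v 0 + v 1 + v 2 ≠ 0) (hP : v 0 * v 1 * v 2 ≠ 0) :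
    ActSign (fun i => v i / (v 0 + v 1 + v 2)) (v 0 + v 1 + v 2)
      ((v 0 + v 1 + v 2) ^ 2 / (v 0 * v 1 * v 2)) h σ := by
  have hs3 : v (σ 0) + v (σ 1) + v (σ 2) = v 0 + v 1 + v 2 := by
    have := Equiv.sum_comp σ v
    simpa only [Fin.sum_univ_three] using this
  have hP3 : v (σ 0) * v (σ 1) * v (σ 2) = v 0 * v 1 * v 2 := by
    have := Equiv.prod_comp σ v
    simpa only [Fin.prod_univ_three] using this
  rcases Int.units_eq_one_or (Equiv.Perm.sign σ) with sg | sg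
  · have e := hv.1 sg
    have es : h (v 0 + v 1 + v 2) = v 0 + v 1 + v 2 := by rw [map_add, map_add, e, e, e, hs3]
    have eP : h (v 0 * v 1 * v 2) = v 0 * v 1 * v 2 := by rw [map_mul, map_mul, e, e, e, hP3]
    refine ⟨fun i => by rw [map_div₀, es, e], fun _ => ⟨es, ?_⟩, fun sg' => ?_⟩
    · rw [map_div₀, map_pow, es, eP]
    · rw [sg] at sg'; exact absurd sg' (by decide)
  · have e := hv.2 sg
    have es : h (v 0 + v 1 + v 2) = (v 0 + v 1 + v 2) ^ 2 / (v 0 * v 1 * v 2) := by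
      rw [map_add, map_add, e, e, e, ← add_div, ← add_div, ← add_mul, ← add_mul, hs3, sq]
    have eP : h (v 0 * v 1 * v 2) = (v 0 + v 1 + v 2) ^ 3 / (v 0 * v 1 * v 2) ^ 2 := by
      rw [map_mul, map_mul, e, e, e, div_mul_div_comm, div_mul_div_comm]
      rw [div_eq_div_iff (mul_ne_zero (mul_ne_zero hP hP) hP) (pow_ne_zero _ hP)]
      linear_combination (v 0 + v 1 + v 2) ^ 3 * (v 0 * v 1 * v 2) ^ 2 * hP3
    generalize v 0 + v 1 + v 2 = s at *
    generalize v 0 * v 1 * v 2 = P at *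
    refine ⟨fun i => ?_, fun sg' => ?_, fun _ => ⟨es, ?_⟩⟩
    · rw [map_div₀, es, e]; field_simp
    · rw [sg] at sg'; exact absurd sg' (by decide)
    · rw [map_div₀, map_pow, es, eP]; field_simp

theorem fixGen_of_artinSchreier [Finite H] (htr : 3 ≤ Algebra.trdeg k L) (h2 : (2 : L) = 0)
    {B C T Q : L} (hle : fixedField H ≤ adjoin k {B, C, T, Q})
    (hfix : ∀ h ∈ H, ∀ s ∈ ({B, C, T, Q} : Set L), h s = s) (hC : C ≠ 0) (hT : T ≠ 0)
    (hu : B + C ≠ 0) (hC1 : C + 1 ≠ 0)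
    (hrel : C * (Q ^ 2 + (B + C) * Q * T + (C + B ^ 3 + C ^ 2) * T ^ 2) = (B + C) ^ 2) :
    FixGen H ⊤ 3 := by
  set τ := (B + C) / (C + 1) with hτ
  set q := (Q / T + C) / (B + C) with hq
  set r := (C * T)⁻¹ with hr
  have hτ0 : τ ≠ 0 := div_ne_zero hu hC1
  have hB : B = τ * (C + 1) - C := by rw [hτ]; field_simp; ring
  have hTr : T = (C * r)⁻¹ := by rw [hr]; field_simp
  have hr0 : r ≠ 0 := inv_ne_zero (mul_ne_zero hC hT)
  have hQ : Q = T * (q * (B + C) - C) := by rw [hq]; field_simp; ring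
  have hlin : C * (r ^ 2 + τ + 1 + τ⁻¹ + τ⁻¹ ^ 2) = q ^ 2 + q + τ := by
    have hu' : B + C = τ * (C + 1) := by rw [hB]; ring
    rw [hQ, hu', hB, hTr] at hrel
    field_simp at hrel ⊢
    refine sub_eq_zero.mp ((mul_eq_zero.mp (?_ : (C + 1) ^ 2 * _ = (0 : L))).resolve_left
      (pow_ne_zero _ hC1))
    linear_combination -hrel + (C * (τ * (C + 1)) ^ 2 * τ - C * (τ * (C + 1)) ^ 2 +
      2 * (τ * (C + 1)) * C ^ 2 + 2 * C ^ 2 + C - C * q * (τ * (C + 1))) * h2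
  obtain ⟨m0, m1, m2⟩ := mem_adjoin_triple (k := k) (x := τ) (y := q) (z := r)
  refine fixGen_of_linear htr (l := C) (t := τ) (b := q) (z := r) (hle.trans ?_) ?_ hlin ?_ ?_ ?_
  · set N := adjoin k {C, τ, q, r}
    have nC : C ∈ N := subset_adjoin _ _ (by simp)
    have nτ : τ ∈ N := subset_adjoin _ _ (by simp)
    have nq : q ∈ N := subset_adjoin _ _ (by simp)
    have nr : r ∈ N := subset_adjoin _ _ (by simp)
    have nB : B ∈ N := hB ▸ sub_mem (mul_mem nτ (add_mem nC (one_mem _))) nC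
    have nT : T ∈ N := hTr ▸ inv_mem (mul_mem nC nr)
    have nQ : Q ∈ N := hQ ▸ mul_mem nT (sub_mem (mul_mem nq (add_mem nB nC)) nC)
    rw [adjoin_le_iff]
    rintro s (rfl | rfl | rfl | rfl)
    exacts [nB, nC, nT, nQ]
  · intro h hh
    have fB : h B = B := hfix h hh B (by simp)
    have fC : h C = C := hfix h hh C (by simp)
    have fT : h T = T := hfix h hh T (by simp)
    have fQ : h Q = Q := hfix h hh Q (by simp)
    exact ⟨by rw [hτ]; simp [fB, fC], by rw [hq]; simp [fB, fC, fT, fQ],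
      by rw [hr]; simp [fC, fT]⟩
  · exact add_mem (add_mem (add_mem (add_mem (pow_mem m2 _) m0) (one_mem _)) (inv_mem m0))
      (pow_mem (inv_mem m0) _)
  · exact add_mem (add_mem (pow_mem m1 _) m1) m0
  · intro h0
    rw [h0, mul_zero] at hlin
    have nτ : τ ∈ adjoin k {C, τ} := subset_adjoin _ _ (by simp)
    constructor
    · refine ⟨Polynomial.X ^ 2 + Polynomial.X + Polynomial.C ⟨τ, nτ⟩, fun h => ?_, ?_⟩
      · have := congrArg (fun p => Polynomial.coeff p 2) h
        simp [Polynomial.coeff_X] at this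
      · simp only [map_add, map_pow, Polynomial.aeval_X, Polynomial.aeval_C]
        exact hlin.symm
    · refine IsAlgebraic.of_pow two_pos (isAlgebraic_of_mem ?_)
      rw [show r ^ 2 = -(τ + 1 + τ⁻¹ + τ⁻¹ ^ 2) by linear_combination h0]
      exact neg_mem (add_mem (add_mem (add_mem nτ (one_mem _)) (inv_mem nτ))
        (pow_mem (inv_mem nτ) _))

theorem fixGen_of_actScale [Finite H] (htr : 3 ≤ Algebra.trdeg k L) (h2k : (2 : k) = 0)
    {v : Fin 3 → L} (hle : fixedField H ≤ adjoin k {v 0, v 1, v 2})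
    (hv : ∀ h ∈ H, ∃ σ, ActScale v h σ) {c d : L ≃ₐ[k] L} {σ τ : Equiv.Perm (Fin 3)} (hc : c ∈ H)
    (hd : d ∈ H) (hcσ : ActScale v c σ) (hdτ : ActScale v d τ) (s0 : σ 0 = 1) (s1 : σ 1 = 2)
    (t0 : τ 0 = 0) (t1 : τ 1 = 2) : FixGen H ⊤ 3 := by
  have h2 : (2 : L) = 0 := by
    rw [← map_ofNat (algebraMap k L) 2, h2k, map_zero]
  have hi := (spans_of_fixedField_le hle).algebraicIndependent htr
  have v0 : v 0 ≠ 0 := by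
    have := aeval_ne_zero hi (X 0) (![1, 1, 1] : Fin 3 → k) (by simp)
    simpa using this
  have v1 : v 1 ≠ 0 := by
    have := aeval_ne_zero hi (X 1) (![1, 1, 1] : Fin 3 → k) (by simp)
    simpa using this
  have v2 : v 2 ≠ 0 := by
    have := aeval_ne_zero hi (X 2) (![1, 1, 1] : Fin 3 → k) (by simp)
    simpa using this
  have v01 : v 0 - v 1 ≠ 0 := by
    have := aeval_ne_zero hi (X 0 - X 1) (![1, 0, 0] : Fin 3 → k) (by simp)
    simpa using this
  have v02 : v 0 - v 2 ≠ 0 := by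
    have := aeval_ne_zero hi (X 0 - X 2) (![1, 0, 0] : Fin 3 → k) (by simp)
    simpa using this
  have v12 : v 1 - v 2 ≠ 0 := by
    have := aeval_ne_zero hi (X 1 - X 2) (![0, 1, 0] : Fin 3 → k) (by simp)
    simpa using this
  have vs : v 0 + v 1 + v 2 ≠ 0 := by
    have := aeval_ne_zero hi (X 0 + X 1 + X 2) (![0, 1, 0] : Fin 3 → k) (by simp)
    simpa using this
  have vT : v 0 * v 1 * v 2 + (v 0 + v 1 + v 2) ≠ 0 := by
    have := aeval_ne_zero hi (X 0 * X 1 * X 2 + (X 0 + X 1 + X 2)) (![0, 1, 0] : Fin 3 → k)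
      (by simp)
    simpa using this
  have vC : v 0 * v 1 * v 2 + (v 0 + v 1 + v 2) ^ 3 ≠ 0 := by
    have := aeval_ne_zero hi (X 0 * X 1 * X 2 + (X 0 + X 1 + X 2) ^ 3) (![0, 1, 0] : Fin 3 → k)
      (by simp)
    simpa using this
  have vu : (v 0 * v 1 + v 0 * v 2 + v 1 * v 2) * (v 0 + v 1 + v 2) + v 0 * v 1 * v 2 ≠ 0 := by
    rw [show (v 0 * v 1 + v 0 * v 2 + v 1 * v 2) * (v 0 + v 1 + v 2) + v 0 * v 1 * v 2 =
      (v 0 - v 1) * (v 0 - v 2) * (v 1 - v 2) by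
        linear_combination (v 0 ^ 2 * v 2 + v 0 * v 1 ^ 2 + v 1 * v 2 ^ 2 +
          2 * (v 0 * v 1 * v 2)) * h2]
    exact mul_ne_zero (mul_ne_zero v01 v02) v12
  have hP : v 0 * v 1 * v 2 ≠ 0 := mul_ne_zero (mul_ne_zero v0 v1) v2
  have act := fun {h : L ≃ₐ[k] L} {σ} (hh : ActScale v h σ) => hh.actSign vs hP
  set s := v 0 + v 1 + v 2 with hs
  set y : Fin 3 → L := fun i => v i / s with hy
  set s' := s ^ 2 / (v 0 * v 1 * v 2) with hs'
  have hinj : ∀ i j, v i - v j ≠ 0 → y i ≠ y j := fun i j hij h =>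
    hij (sub_eq_zero.mpr ((div_left_inj' vs).mp h))
  have hsig : fixedField H ≤ adjoin k (signInv y s s') := fun a ha => by
    refine mem_signInv (?_ : a ∈ adjoin k {y 0, y 1, y 2, s}) (hinj _ _ v01) (hinj _ _ v02)
      (hinj _ _ v12) (act hcσ) (act hdτ) s0 s1 t0 t1 (ha ⟨c, hc⟩) (ha ⟨d, hd⟩)
    refine (adjoin_le_iff.mpr ?_ : adjoin k {v 0, v 1, v 2} ≤ _) (hle ha)
    have key : ∀ i, y i ∈ adjoin k {y 0, y 1, y 2, s} → v i ∈ adjoin k {y 0, y 1, y 2, s} :=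
      fun i hi => by
        rw [← div_mul_cancel₀ (v i) vs]
        exact mul_mem hi (subset_adjoin _ _ (by simp))
    rintro b (rfl | rfl | rfl) <;> exact key _ (subset_adjoin _ _ (by simp))
  have fS := fun {h : L ≃ₐ[k] L} {σ} (hh : ActScale v h σ) => (act hh).fixes
  have e1 : y 0 + y 1 + y 2 = 1 := by
    simp only [hy]
    rw [← add_div, ← add_div]
    exact div_self vs
  have eB : y 0 * y 1 + y 0 * y 2 + y 1 * y 2 = (v 0 * v 1 + v 0 * v 2 + v 1 * v 2) / s ^ 2 := by
    simp only [hy]; field_simp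
  have eC : y 0 * y 1 * y 2 = v 0 * v 1 * v 2 / s ^ 3 := by
    simp only [hy]; field_simp
  have eT : s + s' = s * (v 0 * v 1 * v 2 + s) / (v 0 * v 1 * v 2) := by
    rw [hs']; field_simp
  have ess : s * s' * (y 0 * y 1 * y 2) = 1 := by rw [eC, hs']; field_simp
  refine fixGen_of_artinSchreier htr h2 (B := y 0 * y 1 + y 0 * y 2 + y 1 * y 2)
    (C := y 0 * y 1 * y 2) (T := s + s')
    (Q := s * (y 0 ^ 2 * y 1 + y 1 ^ 2 * y 2 + y 2 ^ 2 * y 0) +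
      s' * (y 1 ^ 2 * y 0 + y 2 ^ 2 * y 1 + y 0 ^ 2 * y 2)) (hsig.trans ?_) ?_ ?_ ?_ ?_ ?_ ?_
  · refine adjoin_le_iff.mpr ?_
    rintro b (rfl | rfl | rfl | rfl | rfl)
    · rw [e1]; exact one_mem _
    all_goals exact subset_adjoin _ _ (by simp)
  · intro h hh a ha
    obtain ⟨σ, hσ⟩ := hv h hh
    exact fS hσ a (Or.inr ha)
  · rw [eC]; exact div_ne_zero hP (pow_ne_zero _ vs)
  · rw [eT]; exact div_ne_zero (mul_ne_zero vs vT) hP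
  · rw [eB, eC, show (v 0 * v 1 + v 0 * v 2 + v 1 * v 2) / s ^ 2 + v 0 * v 1 * v 2 / s ^ 3 =
      ((v 0 * v 1 + v 0 * v 2 + v 1 * v 2) * s + v 0 * v 1 * v 2) / s ^ 3 by field_simp]
    exact div_ne_zero vu (pow_ne_zero _ vs)
  · rw [eC, show v 0 * v 1 * v 2 / s ^ 3 + 1 = (v 0 * v 1 * v 2 + s ^ 3) / s ^ 3 by field_simp]
    exact div_ne_zero vC (pow_ne_zero _ vs)
  · generalize y 0 = a at *
    generalize y 1 = b at *
    generalize y 2 = c at *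
    set B := a * b + a * c + b * c
    set C := a * b * c
    have hN : a ^ 2 * b + b ^ 2 * c + c ^ 2 * a + (b ^ 2 * a + c ^ 2 * b + a ^ 2 * c) = B + C := by
      linear_combination B * e1 - 2 * C * h2
    have hM : (a ^ 2 * b + b ^ 2 * c + c ^ 2 * a) * (b ^ 2 * a + c ^ 2 * b + a ^ 2 * c) =
        C + B ^ 3 + C ^ 2 := by
      linear_combination (((a + b + c) ^ 2 + (a + b + c) + 1) * C - 6 * B * C) * e1 +
        (4 * C ^ 2 - 3 * B * C) * h2
    rw [← hM, ← hN]
    generalize a ^ 2 * b + b ^ 2 * c + c ^ 2 * a = α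
    generalize b ^ 2 * a + c ^ 2 * b + a ^ 2 * c = β
    linear_combination (α + β) ^ 2 * ess +
      C * ((α + β) * (α * s ^ 2 + β * s' ^ 2) + 2 * α * β * s * s') * h2

end

section
variable {H : Subgroup (L ≃ₐ[k] L)} {x : Fin 4 → L} {g₁ g₂ : L ≃ₐ[k] L}

theorem ActInv.ptn_pos {h : L ≃ₐ[k] L} {w : Equiv.Perm (Fin 4) × ℤˣ} (hw : ActInv x h w)
    (h1 : w.2 = 1) (i : Fin 3) : h (ptn pairQuot x i) = ptn pairQuot x (ptnPerm w.1 i) := by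
  rw [ptn_map (pairQuot_map h), ← ptn_perm w.1 _ pairSymm_pairQuot x i,
    ptn_congr (y := fun j => x (w.1 j)) fun j => by simpa [h1] using hw j]

theorem ActInv.ptn_neg {h : L ≃ₐ[k] L} {w : Equiv.Perm (Fin 4) × ℤˣ} (hw : ActInv x h w)
    (h1 : w.2 = -1) (i : Fin 3) :
    h (ptn pairQuot x i) = ptn pairQuot (fun j => (x j)⁻¹) (ptnPerm w.1 i) := by
  rw [ptn_map (pairQuot_map h), ← ptn_perm w.1 _ pairSymm_pairQuot (fun j => (x j)⁻¹) i,
    ptn_congr (y := fun j => (x (w.1 j))⁻¹) fun j => by simpa [h1] using hw j]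

theorem inv_fixGen_of_sign [Finite H] (htr : 3 ≤ Algebra.trdeg k L)
    (hprod : x 0 * x 1 * x 2 * x 3 = 1) (hz : fixedField H ≤ adjoin k {x 0, x 1, x 2})
    (hx : ∀ h ∈ H, ∃ w, ActInv x h w ∧ w.2 = Equiv.Perm.sign w.1) (hK : Klein x g₁ g₂)
    (h1 : g₁ ∈ H) (h2 : g₂ ∈ H) {c d : L ≃ₐ[k] L} {a b : Equiv.Perm (Fin 4)} (hc : c ∈ H)
    (hd : d ∈ H) (hca : ActInv x c (a, 1)) (hdb : ActInv x d (b, -1))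
    (ha : ∀ i, a i = ![0, 2, 3, 1] i) (hb : ∀ i, b i = ![0, 1, 3, 2] i) : FixGen H ⊤ 3 := by
  have hG := prodGeneric_of_le htr hprod hz
  have hle := hK.fixedField_le hG hprod hz h1 h2
  obtain ⟨-, hinv⟩ := hG.pairQuot_identities hprod
  have sa : Equiv.Perm.sign a = 1 := by
    have : ∀ a : Equiv.Perm (Fin 4), (∀ i, a i = ![0, 2, 3, 1] i) → Equiv.Perm.sign a = 1 := by
      decide +kernel
    exact this a ha
  have sb : Equiv.Perm.sign b = -1 := by
    have : ∀ a : Equiv.Perm (Fin 4), (∀ i, a i = ![0, 1, 3, 2] i) → Equiv.Perm.sign a = -1 := by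
      decide +kernel
    exact this b hb
  have sσ := sign_ptnPerm a
  have sτ := sign_ptnPerm b
  have cσ := hca.ptn_pos rfl
  have dτ := hdb.ptn_neg rfl
  have loc : ∀ i j : Fin 3, ptn (fun a b c d : ℚ => a * b + c * d) ![0, 1, 2, 4] i =
      ptn (fun a b c d : ℚ => a * b + c * d) ![0, 1, 2, 4] j → i = j := by
    intro i j
    fin_cases i <;> fin_cases j <;> norm_num [ptn, show ![(0 : ℚ), 1, 2, 4] 2 = 2 from rfl,
      show ![(0 : ℚ), 1, 2, 4] 3 = 4 from rfl]
  have s0 : ptnPerm a 0 = 1 := loc _ _ (by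
    rw [← ptn_perm _ _ pairSymm_pairSum]; simp [ptn, ha])
  have s1 : ptnPerm a 1 = 2 := loc _ _ (by
    rw [← ptn_perm _ _ pairSymm_pairSum]; simp [ptn, ha])
  have t0 : ptnPerm b 0 = 0 := loc _ _ (by
    rw [← ptn_perm _ _ pairSymm_pairSum]; simp [ptn, hb]; norm_num)
  have t1 : ptnPerm b 1 = 2 := loc _ _ (by
    rw [← ptn_perm _ _ pairSymm_pairSum]; simp [ptn, hb])
  generalize ptnPerm a = σ at *
  generalize ptnPerm b = τ at *
  set v := ptn pairQuot x
  have hi := (spans_of_fixedField_le hle).algebraicIndependent htr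
  have v0 : v 0 ≠ 0 := by
    have := aeval_ne_zero hi (X 0) (![1, 1, 1] : Fin 3 → k) (by simp)
    simpa using this
  have v1 : v 1 ≠ 0 := by
    have := aeval_ne_zero hi (X 1) (![1, 1, 1] : Fin 3 → k) (by simp)
    simpa using this
  have v2 : v 2 ≠ 0 := by
    have := aeval_ne_zero hi (X 2) (![1, 1, 1] : Fin 3 → k) (by simp)
    simpa using this
  have hP : v 0 * v 1 * v 2 ≠ 0 := mul_ne_zero (mul_ne_zero v0 v1) v2
  have hodd : ∀ {h : L ≃ₐ[k] L} {σ : Equiv.Perm (Fin 3)},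
      (∀ i, h (v i) = ptn pairQuot (fun j => (x j)⁻¹) (σ i)) →
      ∀ i, h (v i) = v (σ i) * (v 0 + v 1 + v 2 - 2 * v (σ i)) / (v 0 * v 1 * v 2) :=
    fun hh i => by rw [hh, eq_div_iff hP, hinv]
  have hv : ∀ h ∈ H, ∃ σ : Equiv.Perm (Fin 3),
      (Equiv.Perm.sign σ = 1 → ∀ i, h (v i) = v (σ i)) ∧ (Equiv.Perm.sign σ = -1 →
        ∀ i, h (v i) = v (σ i) * (v 0 + v 1 + v 2 - 2 * v (σ i)) / (v 0 * v 1 * v 2)) := by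
    intro h hh
    obtain ⟨w, hw, hsw⟩ := hx h hh
    have sw := sign_ptnPerm w.1
    exact ⟨ptnPerm w.1, fun s => hw.ptn_pos (by rw [hsw, ← sw, s]),
      fun s => hodd (hw.ptn_neg (by rw [hsw, ← sw, s]))⟩
  have hcv : (Equiv.Perm.sign σ = 1 → ∀ i, c (v i) = v (σ i)) ∧ (Equiv.Perm.sign σ = -1 →
      ∀ i, c (v i) = v (σ i) * (v 0 + v 1 + v 2 - 2 * v (σ i)) / (v 0 * v 1 * v 2)) :=
    ⟨fun _ => cσ, fun s => by rw [sσ, sa] at s; exact absurd s (by decide)⟩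
  have hdv : (Equiv.Perm.sign τ = 1 → ∀ i, d (v i) = v (τ i)) ∧ (Equiv.Perm.sign τ = -1 →
      ∀ i, d (v i) = v (τ i) * (v 0 + v 1 + v 2 - 2 * v (τ i)) / (v 0 * v 1 * v 2)) :=
    ⟨fun s => by rw [sτ, sb] at s; exact absurd s (by decide), fun _ => hodd dτ⟩
  by_cases h2k : (2 : k) = 0
  · have h2L : (2 : L) = 0 := by
      rw [← map_ofNat (algebraMap k L) 2, h2k, map_zero]
    have conv : ∀ {h : L ≃ₐ[k] L} {σ : Equiv.Perm (Fin 3)},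
        ((Equiv.Perm.sign σ = 1 → ∀ i, h (v i) = v (σ i)) ∧ (Equiv.Perm.sign σ = -1 →
          ∀ i, h (v i) = v (σ i) * (v 0 + v 1 + v 2 - 2 * v (σ i)) / (v 0 * v 1 * v 2))) →
        ActScale v h σ := fun hh => by
      simp only [h2L, zero_mul, sub_zero] at hh
      exact hh
    exact fixGen_of_actScale htr h2k hle (fun h hh => (hv h hh).imp fun _ => conv) hc hd
      (conv hcv) (conv hdv) s0 s1 t0 t1
  · have h2L : (2 : L) ≠ 0 := by
      rw [← map_ofNat (algebraMap k L) 2]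
      exact (_root_.map_ne_zero _).mpr h2k
    have h8L : (8 : L) ≠ 0 := by rw [show (8 : L) = 2 ^ 3 by norm_num]; exact pow_ne_zero _ h2L
    set p : Fin 3 → L := fun i => v 0 + v 1 + v 2 - 2 * v i with hp
    have q0 : v 0 = (p 1 + p 2) / 2 := by rw [eq_div_iff h2L]; simp only [hp]; ring
    have q1 : v 1 = (p 0 + p 2) / 2 := by rw [eq_div_iff h2L]; simp only [hp]; ring
    have q2 : v 2 = (p 0 + p 1) / 2 := by rw [eq_div_iff h2L]; simp only [hp]; ring
    have hle' : fixedField H ≤ adjoin k {p 0, p 1, p 2} := by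
      obtain ⟨m0, m1, m2⟩ := mem_adjoin_triple (k := k) (x := p 0) (y := p 1) (z := p 2)
      refine hle.trans (adjoin_le_iff.mpr ?_)
      rintro a (rfl | rfl | rfl)
      · rw [q0]; exact div_mem (add_mem m1 m2) (ofNat_mem _ 2)
      · rw [q1]; exact div_mem (add_mem m0 m2) (ofNat_mem _ 2)
      · rw [q2]; exact div_mem (add_mem m0 m1) (ofNat_mem _ 2)
    have hi := (spans_of_fixedField_le hle').algebraicIndependent htr
    have hp0 : ∀ i, p i ≠ 0 := by
      intro i
      have := hi.ne_zero i
      fin_cases i <;> exact this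
    have htw : ∀ i, (v 0 * p 0 + v 1 * p 1 + v 2 * p 2) / (v 0 * v 1 * v 2) -
        2 * (v i * p i / (v 0 * v 1 * v 2)) = twist p / p i := by
      have e : (p 0 + p 1) * (p 0 + p 2) * (p 1 + p 2) = 8 * (v 0 * v 1 * v 2) := by
        simp only [hp]; ring
      have p0 := hp0 0
      have p1 := hp0 1
      have p2 := hp0 2
      intro i
      rw [twist, e, mul_div_mul_left _ _ h8L, eq_div_iff (hp0 i)]
      fin_cases i <;> simp only [Fin.zero_eta, Fin.mk_one, Fin.reduceFinMk] <;> field_simp <;>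
        simp only [hp] <;> ring
    have conv : ∀ {h : L ≃ₐ[k] L} {σ : Equiv.Perm (Fin 3)},
        ((Equiv.Perm.sign σ = 1 → ∀ i, h (v i) = v (σ i)) ∧ (Equiv.Perm.sign σ = -1 →
          ∀ i, h (v i) = v (σ i) * (v 0 + v 1 + v 2 - 2 * v (σ i)) / (v 0 * v 1 * v 2))) →
        ActTwist p h σ := fun {h σ} hh => by
      have sum3 : ∀ f : Fin 3 → L, f (σ 0) + f (σ 1) + f (σ 2) = f 0 + f 1 + f 2 := fun f => by
        have := Equiv.sum_comp σ f
        simpa only [Fin.sum_univ_three] using this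
      refine ⟨fun s i => ?_, fun s i => ?_⟩
      · have e := hh.1 s
        simp only [hp, map_sub, map_add, map_mul, map_ofNat, e, sum3 v]
      · have e := hh.2 s
        rw [← htw, ← sum3 fun i => v i * p i]
        simp only [hp, map_sub, map_add, map_mul, map_ofNat, e]
        ring
    exact fixGen_of_actTwist htr h2k hle' (fun h hh => (hv h hh).imp fun _ => conv) hc hd
      (conv hcv) (conv hdv) s0 s1 t0 t1

end

/-- The ratios of the `y i` are permuted by `w`, up to inversion. -/
def ActProj {n : ℕ} (y : Fin n → L) (h : L ≃ₐ[k] L) (w : Equiv.Perm (Fin n) × ℤˣ) : Prop :=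
  ∀ i j, h (y i / y j) = (y (w.1 i) / y (w.1 j)) ^ (w.2 : ℤ)

section
variable {H : Subgroup (L ≃ₐ[k] L)} {t : Fin 4 → L} {g₁ g₂ : L ≃ₐ[k] L}

theorem ActProj.of_sum_eq_one {n : ℕ} {t : Fin n → L} {h : L ≃ₐ[k] L}
    {w : Equiv.Perm (Fin n) × ℤˣ} (hw : ActProj t h w) (h1 : ∑ i, t i = 1)
    (i : Fin n) : h (t i) = t (w.1 i) ^ (w.2 : ℤ) / ∑ j, t j ^ (w.2 : ℤ) := by
  have e : (t i)⁻¹ = ∑ j, t j / t i := by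
    rw [← Finset.sum_div, h1, one_div]
  have e' : (h (t i))⁻¹ = (∑ j, t j ^ (w.2 : ℤ)) / t (w.1 i) ^ (w.2 : ℤ) := by
    rw [← map_inv₀, e, map_sum, ← Equiv.sum_comp w.1 fun j => t j ^ (w.2 : ℤ), Finset.sum_div]
    exact Finset.sum_congr rfl fun j _ => by rw [hw, div_zpow]
  rw [← inv_inv (h (t i)), e', inv_div]

/-- Nonvanishing facts for four elements with sum one, three of which are independent. -/
structure SumGeneric (t : Fin 4 → L) : Prop where
  ne : ∀ i, t i ≠ 0
  d0 : t 0 * t 1 ≠ t 2 * t 3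
  n01 : t 0 ≠ t 1
  s0 : t 0 + t 1 - t 2 - t 3 ≠ 0
  s1 : t 0 + t 2 - t 1 - t 3 ≠ 0
  s2 : t 0 + t 3 - t 1 - t 2 ≠ 0
  disc : 1 - 4 * (t 0 * t 1 + t 2 * t 3 + (t 0 * t 2 + t 1 * t 3) + (t 0 * t 3 + t 1 * t 2)) ≠ 0

theorem sumGeneric (hsum : t 0 + t 1 + t 2 + t 3 = 1)
    (hi : AlgebraicIndependent k ![t 0, t 1, t 2]) : SumGeneric t := by
  have e : t 3 = 1 - t 0 - t 1 - t 2 := by linear_combination hsum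
  have key : ∀ (p : MvPolynomial (Fin 3) k) (pt : Fin 3 → k) (y : L),
      MvPolynomial.aeval pt p ≠ 0 → MvPolynomial.aeval ![t 0, t 1, t 2] p = y → y ≠ 0 := by
    rintro p pt y h rfl
    exact aeval_ne_zero hi p pt h
  constructor
  · intro i
    fin_cases i
    · exact key (X 0) ![1, 0, 0] _ (by simp) (by simp)
    · exact key (X 1) ![0, 1, 0] _ (by simp) (by simp)
    · exact key (X 2) ![0, 0, 1] _ (by simp) (by simp)
    · exact key (1 - X 0 - X 1 - X 2) ![0, 0, 0] _ (by simp) (by simp [e])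
  · exact sub_ne_zero.mp (key (X 0 * X 1 - X 2 * (1 - X 0 - X 1 - X 2)) ![1, 1, 0] _ (by simp)
      (by simp [e]))
  · exact sub_ne_zero.mp (key (X 0 - X 1) ![1, 0, 0] _ (by simp) (by simp))
  · exact key (X 0 + X 1 - X 2 - (1 - X 0 - X 1 - X 2)) ![0, 0, 0] _ (by simp) (by simp [e])
  · exact key (X 0 + X 2 - X 1 - (1 - X 0 - X 1 - X 2)) ![0, 0, 0] _ (by simp) (by simp [e])
  · exact key (X 0 + (1 - X 0 - X 1 - X 2) - X 1 - X 2) ![0, 0, 0] _ (by simp) (by simp [e])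
  · exact key (1 - 4 * (X 0 * X 1 + X 2 * (1 - X 0 - X 1 - X 2) +
      (X 0 * X 2 + X 1 * (1 - X 0 - X 1 - X 2)) + (X 0 * (1 - X 0 - X 1 - X 2) + X 1 * X 2)))
      ![0, 0, 0] _ (by simp) (by simp [e])

theorem Klein.mem_of_sum_eq_one (hK : Klein t g₁ g₂) (hG : SumGeneric t)
    (hsum : t 0 + t 1 + t 2 + t 3 = 1) {y : L}
    (hy : y ∈ adjoin k {t 0, t 1, t 2}) (h1 : g₁ y = y) (h2 : g₂ y = y) {E : IntermediateField k L}
    (m0 : t 0 * t 1 + t 2 * t 3 ∈ E) (m1 : t 0 * t 2 + t 1 * t 3 ∈ E)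
    (m2 : t 0 * t 3 + t 1 * t 2 ∈ E) (m3 : t 0 * t 1 * (t 2 + t 3) + t 2 * t 3 * (t 0 + t 1) ∈ E) :
    y ∈ E := by
  have h := hK.mem_symm hG.d0 hG.n01 (adjoin.mono k {t 0, t 1, t 2} (Set.range t)
    (by rintro s (rfl | rfl | rfl) <;> exact ⟨_, rfl⟩) hy) h1 h2
  refine (adjoin_le_iff.mpr ?_ : adjoin k _ ≤ E) h
  rintro s (rfl | rfl | rfl | rfl | rfl | rfl)
  · exact m0
  · exact m1
  · exact m2
  · rw [hsum]; exact one_mem _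
  · exact m3
  · have : t 0 * t 1 * t 2 * t 3 = ((t 0 * t 1 + t 2 * t 3) * (t 0 * t 2 + t 1 * t 3) *
        (t 0 * t 3 + t 1 * t 2) - (t 0 * t 1 * (t 2 + t 3) + t 2 * t 3 * (t 0 + t 1)) ^ 2) /
        (1 - 4 * (t 0 * t 1 + t 2 * t 3 + (t 0 * t 2 + t 1 * t 3) + (t 0 * t 3 + t 1 * t 2))) := by
      rw [eq_div_iff hG.disc]
      linear_combination -(t 0 * t 1 * t 2 * t 3 * (t 0 + t 1 + t 2 + t 3 + 1)) * hsum
    rw [this]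
    exact div_mem (sub_mem (mul_mem (mul_mem m0 m1) m2) (pow_mem m3 2)) (sub_mem (one_mem _)
      (mul_mem (ofNat_mem _ 4) (add_mem (add_mem m0 m1) m2)))

theorem pairSum_inv_div {a b c d s : L} (ha : a ≠ 0) (hb : b ≠ 0) (hc : c ≠ 0) (hd : d ≠ 0) :
    a⁻¹ / s * (b⁻¹ / s) + c⁻¹ / s * (d⁻¹ / s) = 1 / (a * b * c * d * s ^ 2) * (a * b + c * d) := by
  rcases eq_or_ne s 0 with rfl | hs
  · simp
  · field_simp
    ring

theorem sum_fixGen_two [Finite H] (htr : 3 ≤ Algebra.trdeg k L) (h2 : (2 : L) = 0)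
    (hsum : t 0 + t 1 + t 2 + t 3 = 1) (hz : fixedField H ≤ adjoin k {t 0, t 1, t 2})
    (ht : ∀ h ∈ H, ∃ w, ActProj t h w) (hK : Klein t g₁ g₂) (hg₁ : g₁ ∈ H) (hg₂ : g₂ ∈ H) :
    FixGen H ⊤ 3 := by
  have hG := sumGeneric hsum ((spans_of_fixedField_le hz).algebraicIndependent htr)
  set n := ptn (fun a b c d => a * b + c * d) t with hn
  have n0 : n 0 = t 0 * t 1 + t 2 * t 3 := rfl
  have n1 : n 1 = t 0 * t 2 + t 1 * t 3 := rfl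
  have n2 : n 2 = t 0 * t 3 + t 1 * t 2 := rfl
  have he3 : t 0 * t 1 * (t 2 + t 3) + t 2 * t 3 * (t 0 + t 1) = n 0 * n 1 + n 0 * n 2 + n 1 * n 2 := by
    rw [n0, n1, n2]
    linear_combination -(t 0 * t 1 * (t 2 + t 3) + t 2 * t 3 * (t 0 + t 1)) * hsum +
      2 * (t 0 * t 1 * t 2 * t 3) * h2
  have he4 : t 0 * t 1 * t 2 * t 3 = n 0 * n 1 * n 2 + (n 0 * n 1 + n 0 * n 2 + n 1 * n 2) ^ 2 := by
    rw [← he3, n0, n1, n2]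
    linear_combination -(t 0 * t 1 * t 2 * t 3 * (t 0 + t 1 + t 2 + t 3 + 1)) * hsum +
      (2 * (t 0 * t 1 * t 2 * t 3) * (t 0 * t 1 + t 2 * t 3 + (t 0 * t 2 + t 1 * t 3) + (t 0 * t 3 + t 1 * t 2)) - (t 0 * t 1 * (t 2 + t 3) + t 2 * t 3 * (t 0 + t 1)) ^ 2) * h2
  have hle : fixedField H ≤ adjoin k {n 0, n 1, n 2} := fun y hy => by
    obtain ⟨m0, m1, m2⟩ := mem_adjoin_triple (k := k) (x := n 0) (y := n 1) (z := n 2)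
    refine hK.mem_of_sum_eq_one hG hsum (hz hy) (hy ⟨g₁, hg₁⟩) (hy ⟨g₂, hg₂⟩) m0 m1 m2 ?_
    rw [he3]
    exact add_mem (add_mem (mul_mem m0 m1) (mul_mem m0 m2)) (mul_mem m1 m2)
  have hi := (spans_of_fixedField_le hle).algebraicIndependent htr
  have ne : ∀ i, n i ≠ 0 := by
    intro i
    fin_cases i
    · have := aeval_ne_zero hi (X 0) (![1, 0, 0] : Fin 3 → k) (by simp); simpa using this
    · have := aeval_ne_zero hi (X 1) (![0, 1, 0] : Fin 3 → k) (by simp); simpa using this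
    · have := aeval_ne_zero hi (X 2) (![0, 0, 1] : Fin 3 → k) (by simp); simpa using this
  have nd : n 1 - n 2 ≠ 0 := by
    have := aeval_ne_zero hi (X 1 - X 2) (![0, 1, 0] : Fin 3 → k) (by simp); simpa using this
  have nq : n 0 * n 1 + n 0 * n 2 + n 1 * n 2 ≠ 0 := by
    have := aeval_ne_zero hi (X 0 * X 1 + X 0 * X 2 + X 1 * X 2) (![1, 1, 0] : Fin 3 → k) (by simp)
    simpa using this
  set q := n 0 * n 1 + n 0 * n 2 + n 1 * n 2 with hq
  have hact : ∀ h ∈ H, ∃ σ : Equiv.Perm (Fin 3), ∃ ρ : L,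
      (ρ = 1 ∨ ρ = 1 + n 0 * n 1 * n 2 / q ^ 2) ∧ ∀ i, h (n i) = ρ * n (σ i) := by
    intro h hh
    obtain ⟨w, hw⟩ := ht h hh
    have hw' := hw.of_sum_eq_one (by rw [Fin.sum_univ_four, hsum])
    rcases Int.units_eq_one_or w.2 with e | e
    · refine ⟨ptnPerm w.1, 1, Or.inl rfl, fun i => ?_⟩
      rw [hn, ptn_map (by intros; simp), ← ptn_perm w.1 _ pairSymm_pairSum, one_mul, ptn_congr]
      intro j
      rw [hw', e]
      simp [Fin.sum_univ_four, hsum]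
    · refine ⟨ptnPerm w.1, 1 / (t 0 * t 1 * t 2 * t 3 * (∑ j, (t j)⁻¹) ^ 2), Or.inr ?_,
        fun i => ?_⟩
      · have := hG.ne 0
        have := hG.ne 1
        have := hG.ne 2
        have := hG.ne 3
        have e3 : ∑ j, (t j)⁻¹ = q / (t 0 * t 1 * t 2 * t 3) := by
          rw [← he3, Fin.sum_univ_four]
          field_simp
          ring
        rw [e3, show 1 / (t 0 * t 1 * t 2 * t 3 * (q / (t 0 * t 1 * t 2 * t 3)) ^ 2) =
          t 0 * t 1 * t 2 * t 3 / q ^ 2 by field_simp, he4, add_div, div_self (pow_ne_zero 2 nq),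
          add_comm]
      · have e2 : ∀ i, ptn (fun a b c d => a * b + c * d) (fun j => (t j)⁻¹ / ∑ j, (t j)⁻¹) i =
            1 / (t 0 * t 1 * t 2 * t 3 * (∑ j, (t j)⁻¹) ^ 2) * n i := by
          intro i
          fin_cases i
          · exact pairSum_inv_div (hG.ne 0) (hG.ne 1) (hG.ne 2) (hG.ne 3)
          · rw [show t 0 * t 1 * t 2 * t 3 = t 0 * t 2 * t 1 * t 3 by ring]
            exact pairSum_inv_div (hG.ne 0) (hG.ne 2) (hG.ne 1) (hG.ne 3)
          · rw [show t 0 * t 1 * t 2 * t 3 = t 0 * t 3 * t 1 * t 2 by ring]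
            exact pairSum_inv_div (hG.ne 0) (hG.ne 3) (hG.ne 1) (hG.ne 2)
        rw [← e2, ← ptn_perm w.1 _ pairSymm_pairSum, hn, ptn_map (by intros; simp), ptn_congr]
        intro j
        rw [hw', e]
        simp
  set d := n 1 - n 2 with hd
  set r := (n 0 - n 2) / d with hr
  have hfull : fixedField H ≤ adjoin k {d, n 2 / d, r} := fun y hy => by
    obtain ⟨m0, m1, m2⟩ := mem_adjoin_triple (k := k) (x := d) (y := n 2 / d) (z := r)
    refine (adjoin_le_iff.mpr ?_ : _ ≤ adjoin k {d, n 2 / d, r}) (hle hy)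
    have e2 : n 2 = n 2 / d * d := by field_simp
    have e1 : n 1 = n 2 / d * d + d := by rw [← e2, hd]; ring
    have e0 : n 0 = n 2 / d * d + r * d := by rw [← e2, hr]; field_simp; ring
    rintro s (rfl | rfl | rfl)
    · have := add_mem (mul_mem m1 m0) (mul_mem m2 m0)
      rwa [← e0] at this
    · have := add_mem (mul_mem m1 m0) m0
      rwa [← e1] at this
    · have := mul_mem m1 m0
      rwa [← e2] at this
  have main : ∀ h ∈ H, h r ∈ adjoin k {r} ∧ Affine h {r} (n 2 / d) ∧ Affine h {n 2 / d, r} d := by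
    intro h hh
    obtain ⟨σ, ρ, hρ, hσ⟩ := hact h hh
    have hρ0 : ρ ≠ 0 := fun h0 => ne 0 (by
      have := hσ 0
      rw [h0, zero_mul] at this
      exact (map_eq_zero h).mp this)
    obtain ⟨hr', ⟨v, hv, hvd⟩, hu⟩ := diff_mem nd (h := h) (σ := σ) hρ0 fun i j => by
      rw [map_sub, hσ, hσ]; ring
    change h d = v * (ρ * d) at hvd
    have hv0 : v ≠ 0 := fun h0 => nd (by
      rw [h0, zero_mul] at hvd
      exact (map_eq_zero h).mp hvd)
    refine ⟨hr', ?_, ?_⟩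
    · obtain ⟨u, hu1, hu2⟩ := hu (σ 2) 2
      change n (σ 2) - n 2 = u * d at hu2
      refine ⟨v⁻¹, inv_mem hv, v⁻¹ * u, mul_mem (inv_mem hv) hu1, ?_⟩
      rw [map_div₀, hvd, hσ, eq_add_of_sub_eq hu2]
      field_simp
      ring
    · have hle2 : adjoin k {r} ≤ adjoin k {n 2 / d, r} := adjoin.mono _ _ _ (by simp)
      have mr : r ∈ adjoin k {n 2 / d, r} := subset_adjoin _ _ (by simp)
      have mv : n 2 / d ∈ adjoin k {n 2 / d, r} := subset_adjoin _ _ (by simp)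
      have m2 : n 2 / d ∈ adjoin k {n 2 / d, r} := mv
      have m1 : n 1 / d ∈ adjoin k {n 2 / d, r} := by
        rw [show n 1 / d = n 2 / d + 1 by rw [← div_self nd, ← add_div, add_sub_cancel]]
        exact add_mem mv (one_mem _)
      have m0 : n 0 / d ∈ adjoin k {n 2 / d, r} := by
        rw [show n 0 / d = n 2 / d + r by rw [hr, ← add_div, add_sub_cancel]]
        exact add_mem mv mr
      rcases hρ with rfl | rfl
      · refine ⟨v, hle2 hv, 0, zero_mem _, ?_⟩
        rw [hvd]; ring
      · refine ⟨v, hle2 hv, v * (n 0 / d * (n 1 / d) * (n 2 / d) /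
          (n 0 / d * (n 1 / d) + n 0 / d * (n 2 / d) + n 1 / d * (n 2 / d)) ^ 2), mul_mem (hle2 hv)
          (div_mem (mul_mem (mul_mem m0 m1) m2) (pow_mem (add_mem (add_mem (mul_mem m0 m1)
          (mul_mem m0 m2)) (mul_mem m1 m2)) 2)), ?_⟩
        rw [hvd, show n 0 / d * (n 1 / d) + n 0 / d * (n 2 / d) + n 1 / d * (n 2 / d) = q / d ^ 2 by
          rw [hq]; field_simp]
        field_simp
  exact fixGen_three htr hfull (fun h hh => (main h hh).1) (fun h hh => (main h hh).2.1)
    fun h hh => (main h hh).2.2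

end

/-- An invariant of the partition `{{a, b}, {c, d}}` which is homogeneous of degree zero, and
which is inverted when its arguments are. -/
def pairRatio (a b c d : L) : L :=
  a * b * c * d * ((a + c - b - d) * (a + d - b - c)) /
    (((a + c) * (b * d) - (b + d) * (a * c)) * ((a + d) * (b * c) - (b + c) * (a * d)))

theorem pairSymm_pairRatio : PairSymm (pairRatio (L := L)) := fun a b c d => by
  refine ⟨?_, ?_⟩
  · unfold pairRatio
    congr 1 <;> ring
  · unfold pairRatio
    rw [← neg_div_neg_eq]
    congr 1 <;> ring

theorem pairRatio_div (a b c d : L) {e : L} (he : e ≠ 0) :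
    pairRatio (a / e) (b / e) (c / e) (d / e) = pairRatio a b c d := by
  unfold pairRatio
  rw [← div_div_div_cancel_right₀ (pow_ne_zero 6 he) (a * b * c * d * _)]
  congr 1
  · field_simp
  · field_simp

theorem pairRatio_inv {a b c d : L} (ha : a ≠ 0) (hb : b ≠ 0) (hc : c ≠ 0) (hd : d ≠ 0) :
    pairRatio a⁻¹ b⁻¹ c⁻¹ d⁻¹ = (pairRatio a b c d)⁻¹ := by
  have h6 : (a * b * c * d) ^ 3 ≠ 0 := by positivity
  unfold pairRatio
  rw [inv_div, ← div_div_div_cancel_right₀ h6 (((a + c) * (b * d) - (b + d) * (a * c)) * _)]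
  congr 1
  · field_simp
    ring
  · field_simp
    ring

theorem pairRatio_map (h : L ≃ₐ[k] L) (a b c d : L) :
    h (pairRatio a b c d) = pairRatio (h a) (h b) (h c) (h d) := by
  simp [pairRatio]

theorem exists_map_pairRatio {t : Fin 4 → L} (h0 : ∀ i, t i ≠ 0) {h : L ≃ₐ[k] L}
    {w : Equiv.Perm (Fin 4) × ℤˣ} (hw : ActProj t h w) (i : Fin 3) :
    h (ptn pairRatio t i) = ptn pairRatio t (ptnPerm w.1 i) ^ (w.2 : ℤ) := by
  have e : ∀ s : Fin 4 → L, ∀ c, c ≠ 0 → ptn pairRatio (fun j => s j / c) = ptn pairRatio s := by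
    intro s c hc
    ext i
    fin_cases i <;> exact pairRatio_div _ _ _ _ hc
  rw [← e t (t 0) (h0 0), ptn_map (pairRatio_map h)]
  simp only [hw _ _, div_zpow]
  rw [e (fun j => t (w.1 j) ^ (w.2 : ℤ)) _ (zpow_ne_zero _ (h0 _)), e t _ (h0 0),
    ptn_perm w.1 pairRatio pairSymm_pairRatio fun j => t j ^ (w.2 : ℤ)]
  rcases Int.units_eq_one_or w.2 with e | e
  · simp [e]
  · simp only [e, Units.val_neg, Units.val_one, zpow_neg_one]
    generalize ptnPerm w.1 i = i
    fin_cases i <;> exact pairRatio_inv (h0 _) (h0 _) (h0 _) (h0 _)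

/-- The numerator in `pairRatio`, in terms of the variables `b * c / a`, `a * c / b`, `a * b / c`,
where `a`, `b`, `c` are the three sums with signs. -/
def pairNum {R : Type*} [CommRing R] (u v w : R) : R := v * w - 1 - u * w - u * v + 2 * u

/-- The product of four elements with sum one, in the variables of `pairNum`. -/
def quadProd {R : Type*} [CommRing R] (u v w : R) : R :=
  (1 - v * w) ^ 2 - 2 * (1 + v * w) * (u * w + u * v) + 8 * (u * v * w) + (u * w - u * v) ^ 2

theorem pairNum_identity (u v w : L) :
    u * (pairNum u v w * pairNum v w u + pairNum u v w * pairNum w u v +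
      pairNum v w u * pairNum w u v + quadProd u v w) =
      quadProd u v w - pairNum u v w ^ 2 := by
  unfold pairNum quadProd
  ring

section
variable {H : Subgroup (L ≃ₐ[k] L)} {t : Fin 4 → L} {g₁ g₂ : L ≃ₐ[k] L}

theorem sum_fixGen_of_two_ne_zero [Finite H] (htr : 3 ≤ Algebra.trdeg k L) (h2 : (2 : L) ≠ 0)
    (hsum : t 0 + t 1 + t 2 + t 3 = 1) (hz : fixedField H ≤ adjoin k {t 0, t 1, t 2})
    (ht : ∀ h ∈ H, ∃ w, ActProj t h w) (hK : Klein t g₁ g₂) (hg₁ : g₁ ∈ H) (hg₂ : g₂ ∈ H) :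
    FixGen H ⊤ 3 := by
  have hG := sumGeneric hsum ((spans_of_fixedField_le hz).algebraicIndependent htr)
  have hk2 : (2 : k) ≠ 0 := fun h => h2 (by rw [← map_ofNat (algebraMap k L) 2, h, map_zero])
  set a := t 0 + t 1 - t 2 - t 3 with ha
  set b := t 0 + t 2 - t 1 - t 3 with hb
  set c := t 0 + t 3 - t 1 - t 2 with hc
  have na : a ≠ 0 := hG.s0
  have nb : b ≠ 0 := hG.s1
  have nc : c ≠ 0 := hG.s2
  have h4 : (4 : L) ≠ 0 := by rw [show (4 : L) = 2 * 2 by norm_num]; exact mul_ne_zero h2 h2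
  have e0 : 4 * t 0 = 1 + a + b + c := by rw [ha, hb, hc]; linear_combination hsum
  have e1 : 4 * t 1 = 1 + a - b - c := by rw [ha, hb, hc]; linear_combination hsum
  have e2 : 4 * t 2 = 1 - a + b - c := by rw [ha, hb, hc]; linear_combination hsum
  have e3 : 4 * t 3 = 1 - a - b + c := by rw [ha, hb, hc]; linear_combination hsum
  have p0 : t 0 = (1 + a + b + c) / 4 := by rw [← e0]; field_simp
  have p1 : t 1 = (1 + a - b - c) / 4 := by rw [← e1]; field_simp
  have p2 : t 2 = (1 - a + b - c) / 4 := by rw [← e2]; field_simp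
  have p3 : t 3 = (1 - a - b + c) / 4 := by rw [← e3]; field_simp
  set u := b * c / a with hu
  set v := a * c / b with hv
  set w := a * b / c with hw
  have qa : a ^ 2 = v * w := by rw [hv, hw]; field_simp
  have qb : b ^ 2 = u * w := by rw [hu, hw]; field_simp
  have qc : c ^ 2 = u * v := by rw [hu, hv]; field_simp
  have qabc : a * b * c = u * v * w := by rw [hu, hv, hw]; field_simp
  clear_value a b c
  have hleU : fixedField H ≤ adjoin k {u, v, w} := fun y hy => by
    obtain ⟨mu, mv, mw⟩ := mem_adjoin_triple (k := k) (x := u) (y := v) (z := w)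
    have ma : a ^ 2 ∈ adjoin k {u, v, w} := qa ▸ mul_mem mv mw
    have mb : b ^ 2 ∈ adjoin k {u, v, w} := qb ▸ mul_mem mu mw
    have mc : c ^ 2 ∈ adjoin k {u, v, w} := qc ▸ mul_mem mu mv
    have mabc : a * b * c ∈ adjoin k {u, v, w} := qabc ▸ mul_mem (mul_mem mu mv) mw
    have m1 := one_mem (adjoin k {u, v, w})
    have m8 := ofNat_mem (adjoin k {u, v, w}) 8
    refine hK.mem_of_sum_eq_one hG hsum (hz hy) (hy ⟨g₁, hg₁⟩) (hy ⟨g₂, hg₂⟩) ?_ ?_ ?_ ?_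
    · rw [show t 0 * t 1 + t 2 * t 3 = (1 + a ^ 2 - b ^ 2 - c ^ 2) / 8 by
        rw [p0, p1, p2, p3, show (8 : L) = 4 * 2 by norm_num]; field_simp; ring]
      exact div_mem (sub_mem (sub_mem (add_mem m1 ma) mb) mc) m8
    · rw [show t 0 * t 2 + t 1 * t 3 = (1 + b ^ 2 - a ^ 2 - c ^ 2) / 8 by
        rw [p0, p1, p2, p3, show (8 : L) = 4 * 2 by norm_num]; field_simp; ring]
      exact div_mem (sub_mem (sub_mem (add_mem m1 mb) ma) mc) m8
    · rw [show t 0 * t 3 + t 1 * t 2 = (1 + c ^ 2 - a ^ 2 - b ^ 2) / 8 by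
        rw [p0, p1, p2, p3, show (8 : L) = 4 * 2 by norm_num]; field_simp; ring]
      exact div_mem (sub_mem (sub_mem (add_mem m1 mc) ma) mb) m8
    · rw [show t 0 * t 1 * (t 2 + t 3) + t 2 * t 3 * (t 0 + t 1) =
        (1 - a ^ 2 - b ^ 2 - c ^ 2 + (a * b * c + a * b * c)) / (8 + 8) by
        rw [p0, p1, p2, p3, show (8 + 8 : L) = 4 * 4 by norm_num]; field_simp; ring]
      exact div_mem (add_mem (sub_mem (sub_mem (sub_mem m1 ma) mb) mc) (add_mem mabc mabc))
        (add_mem m8 m8)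
  have hi := (spans_of_fixedField_le hleU).algebraicIndependent htr
  have key : ∀ (p : MvPolynomial (Fin 3) k) (y : L),
      MvPolynomial.aeval (![0, 0, 0] : Fin 3 → k) p ≠ 0 → MvPolynomial.aeval ![u, v, w] p = y →
      y ≠ 0 := by
    rintro p y h rfl
    exact aeval_ne_zero hi p _ h
  have uv' : b * v = a * c := by rw [hv]; field_simp
  have uu : a * u = b * c := by rw [hu]; field_simp
  have uw' : c * w = a * b := by rw [hw]; field_simp
  clear_value u v w
  have hk4 : (1 + 1 + 1 + 1 : k) ≠ 0 := by
    rw [show (1 + 1 + 1 + 1 : k) = 2 * 2 by norm_num]; exact mul_ne_zero hk2 hk2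
  have h11 : (1 + 1 : k) ≠ 0 := by rw [one_add_one_eq_two]; exact hk2
  obtain ⟨E, hE⟩ : ∃ E, E = quadProd u v w := ⟨_, rfl⟩
  obtain ⟨N0, hN0⟩ : ∃ N, N = pairNum u v w := ⟨_, rfl⟩
  obtain ⟨N1, hN1⟩ : ∃ N, N = pairNum v w u := ⟨_, rfl⟩
  obtain ⟨N2, hN2⟩ : ∃ N, N = pairNum w u v := ⟨_, rfl⟩
  set M0 : MvPolynomial (Fin 3) k := pairNum (X 0) (X 1) (X 2) with hM0
  set M1 : MvPolynomial (Fin 3) k := pairNum (X 1) (X 2) (X 0) with hM1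
  set M2 : MvPolynomial (Fin 3) k := pairNum (X 2) (X 0) (X 1) with hM2
  set F : MvPolynomial (Fin 3) k := quadProd (X 0) (X 1) (X 2) with hF
  have ev : ∀ M ∈ ({M0, M1, M2} : Set (MvPolynomial (Fin 3) k)),
      MvPolynomial.aeval (![0, 0, 0] : Fin 3 → k) M = -1 := by
    rintro M (rfl | rfl | rfl) <;> simp [hM0, hM1, hM2, pairNum]
  have ev0 := ev M0 (by simp)
  have ev1 := ev M1 (by simp)
  have ev2 := ev M2 (by simp)
  have evF : MvPolynomial.aeval (![0, 0, 0] : Fin 3 → k) F = 1 := by simp [hF, quadProd]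
  have a0 : MvPolynomial.aeval ![u, v, w] M0 = N0 := by simp [hM0, hN0, pairNum]
  have a1 : MvPolynomial.aeval ![u, v, w] M1 = N1 := by simp [hM1, hN1, pairNum]
  have a2 : MvPolynomial.aeval ![u, v, w] M2 = N2 := by simp [hM2, hN2, pairNum]
  have aF : MvPolynomial.aeval ![u, v, w] F = E := by simp [hF, hE, quadProd]
  clear_value M0 M1 M2 F
  have nN0 : N0 ≠ 0 := key M0 _ (by rw [ev0]; simp) a0
  have nN1 : N1 ≠ 0 := key M1 _ (by rw [ev1]; simp) a1
  have nN2 : N2 ≠ 0 := key M2 _ (by rw [ev2]; simp) a2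
  have nE : E ≠ 0 := key F _ (by rw [evF]; simp) aF
  have k0 : N1 * N2 + E ≠ 0 := key (M1 * M2 + F) _
    (by simp only [map_add, map_mul, ev1, ev2, evF, neg_mul_neg, one_mul]; exact h11)
    (by simp only [map_add, map_mul, a1, a2, aF])
  have k1 : N2 * N0 + E ≠ 0 := key (M2 * M0 + F) _
    (by simp only [map_add, map_mul, ev2, ev0, evF, neg_mul_neg, one_mul]; exact h11)
    (by simp only [map_add, map_mul, a2, a0, aF])
  have k2 : N0 * N1 + E ≠ 0 := key (M0 * M1 + F) _
    (by simp only [map_add, map_mul, ev0, ev1, evF, neg_mul_neg, one_mul]; exact h11)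
    (by simp only [map_add, map_mul, a0, a1, aF])
  have kZ : N0 * N1 + N0 * N2 + N1 * N2 + E ≠ 0 := key (M0 * M1 + M0 * M2 + M1 * M2 + F) _
    (by simp only [map_add, map_mul, ev0, ev1, ev2, evF, neg_mul_neg, one_mul]; exact hk4)
    (by simp only [map_add, map_mul, a0, a1, a2, aF])
  have iu := pairNum_identity u v w
  have iv := pairNum_identity v w u
  have iw := pairNum_identity w u v
  have Ev : quadProd v w u = E := by rw [hE]; unfold quadProd; ring
  have Ew : quadProd w u v = E := by rw [hE]; unfold quadProd; ring
  rw [Ev] at iv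
  rw [Ew] at iw
  rw [← hE] at iu
  rw [← hN0, ← hN1, ← hN2] at iu iv iw
  have h16 : (16 : L) = 4 * 4 := by norm_num
  have D0 : 16 * ((t 0 + t 1) * (t 2 * t 3) - (t 2 + t 3) * (t 0 * t 1)) = a * N0 := by
    rw [hN0, pairNum, ← qa, ← qb, ← qc, p0, p1, p2, p3, h16]
    field_simp
    linear_combination -8 * uu
  have D1 : 16 * ((t 0 + t 2) * (t 1 * t 3) - (t 1 + t 3) * (t 0 * t 2)) = b * N1 := by
    rw [hN1, pairNum, mul_comm w u, mul_comm v u, mul_comm v w, mul_comm w v, ← qa, ← qb, ← qc,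
      p0, p1, p2, p3, h16]
    field_simp
    linear_combination -8 * uv'
  have D2 : 16 * ((t 0 + t 3) * (t 1 * t 2) - (t 1 + t 2) * (t 0 * t 3)) = c * N2 := by
    rw [hN2, pairNum, mul_comm w u, mul_comm w v, ← qa, ← qb, ← qc, p0, p1, p2, p3, h16]
    field_simp
    linear_combination -8 * uw'
  have h256 : 256 * (t 0 * t 1 * t 2 * t 3) = E := by
    rw [hE, quadProd, ← qabc, ← qa, ← qb, ← qc, p0, p1, p2, p3,
      show (256 : L) = 4 * 4 * (4 * 4) by norm_num]
    field_simp
    ring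
  set x := ptn pairRatio t with hx
  have h256' : (256 : L) ≠ 0 := by
    rw [show (256 : L) = 4 * 4 * (4 * 4) by norm_num]
    exact mul_ne_zero (mul_ne_zero h4 h4) (mul_ne_zero h4 h4)
  have kx : ∀ {e p q P Q N M : L}, p ≠ 0 → q ≠ 0 → N ≠ 0 → M ≠ 0 → 256 * e = E → 16 * P = p * N →
      16 * Q = q * M → e * (p * q) / (P * Q) = E / (N * M) := by
    intro e p q P Q N M hp hq hN hM he hP hQ
    rw [← mul_div_mul_left _ (P * Q) h256', show 256 * (e * (p * q)) = 256 * e * (p * q) by ring,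
      show 256 * (P * Q) = 16 * P * (16 * Q) by ring, he, hP, hQ]
    field_simp
  have x0 : x 0 = E / (N1 * N2) :=
    kx (by rwa [← hb]) (by rwa [← hc]) nN1 nN2 h256 (by rw [← hb]; exact D1) (by rw [← hc]; exact D2)
  have x1 : x 1 = E / (N2 * N0) := by
    rw [mul_comm N2]
    exact kx (p := t 0 + t 1 - t 2 - t 3) (q := t 0 + t 3 - t 2 - t 1)
      (by rwa [← ha]) (by rwa [sub_right_comm, ← hc]) nN0 nN2
      (by rw [← h256]; ring) (by rw [← ha]; exact D0)
      (by rw [sub_right_comm, ← hc, ← D2]; ring)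
  have x2 : x 2 = E / (N0 * N1) :=
    kx (p := t 0 + t 1 - t 3 - t 2) (q := t 0 + t 2 - t 3 - t 1)
      (by rwa [sub_right_comm, ← ha]) (by rwa [sub_right_comm, ← hb]) nN0 nN1
      (by rw [← h256]; ring) (by rw [sub_right_comm, ← ha, ← D0]; ring)
      (by rw [sub_right_comm, ← hb, ← D1]; ring)
  have hleX : fixedField H ≤ adjoin k {x 0, x 1, x 2} := fun y hy => by
    obtain ⟨m0, m1, m2⟩ := mem_adjoin_triple (k := k) (x := x 0) (y := x 1) (z := x 2)
    have mp : x 0 * x 1 * x 2 ∈ adjoin k {x 0, x 1, x 2} := mul_mem (mul_mem m0 m1) m2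
    have mz : x 0 * x 1 + x 0 * x 2 + x 1 * x 2 + x 0 * x 1 * x 2 ∈ adjoin k {x 0, x 1, x 2} :=
      add_mem (add_mem (add_mem (mul_mem m0 m1) (mul_mem m0 m2)) (mul_mem m1 m2)) mp
    have hZ : x 0 * x 1 + x 0 * x 2 + x 1 * x 2 + x 0 * x 1 * x 2 =
        (N0 * N1 + N0 * N2 + N1 * N2 + E) * (E / (N0 * N1 * N2)) ^ 2 := by
      rw [x0, x1, x2]; field_simp
    have nZ : x 0 * x 1 + x 0 * x 2 + x 1 * x 2 + x 0 * x 1 * x 2 ≠ 0 := by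
      rw [hZ]; positivity
    refine (adjoin_le_iff.mpr ?_ : _ ≤ adjoin k {x 0, x 1, x 2}) (hleU hy)
    rintro s (rfl | rfl | rfl)
    · have : s * (x 0 * x 1 + x 0 * x 2 + x 1 * x 2 + x 0 * x 1 * x 2) =
          x 0 * x 1 * x 2 - x 0 ^ 2 := by
        rw [hZ, ← mul_assoc, iu, x0, x1, x2]; field_simp
      rw [eq_div_of_mul_eq nZ this]
      exact div_mem (sub_mem mp (pow_mem m0 2)) mz
    · have : s * (x 0 * x 1 + x 0 * x 2 + x 1 * x 2 + x 0 * x 1 * x 2) =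
          x 0 * x 1 * x 2 - x 1 ^ 2 := by
        rw [hZ, ← mul_assoc, show N0 * N1 + N0 * N2 + N1 * N2 + E =
          N1 * N2 + N1 * N0 + N2 * N0 + E by ring, iv, x0, x1, x2]; field_simp
      rw [eq_div_of_mul_eq nZ this]
      exact div_mem (sub_mem mp (pow_mem m1 2)) mz
    · have : s * (x 0 * x 1 + x 0 * x 2 + x 1 * x 2 + x 0 * x 1 * x 2) =
          x 0 * x 1 * x 2 - x 2 ^ 2 := by
        rw [hZ, ← mul_assoc, show N0 * N1 + N0 * N2 + N1 * N2 + E =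
          N2 * N0 + N2 * N1 + N0 * N1 + E by ring, iw, x0, x1, x2]; field_simp
      rw [eq_div_of_mul_eq nZ this]
      exact div_mem (sub_mem mp (pow_mem m2 2)) mz
  have nx : ∀ i, x i ≠ 0 ∧ 1 + x i ≠ 0 := by
    intro i
    fin_cases i
    · refine ⟨by simp only [Fin.zero_eta]; rw [x0]; positivity, ?_⟩
      simp only [Fin.zero_eta]
      rw [x0, show 1 + E / (N1 * N2) = (N1 * N2 + E) / (N1 * N2) by field_simp]
      positivity
    · refine ⟨by simp only [Fin.mk_one]; rw [x1]; positivity, ?_⟩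
      simp only [Fin.mk_one]
      rw [x1, show 1 + E / (N2 * N0) = (N2 * N0 + E) / (N2 * N0) by field_simp]
      positivity
    · refine ⟨by simp only [Fin.reduceFinMk]; rw [x2]; positivity, ?_⟩
      simp only [Fin.reduceFinMk]
      rw [x2, show 1 + E / (N0 * N1) = (N0 * N1 + E) / (N0 * N1) by field_simp]
      positivity
  refine fixGen_of_perm_affine htr (y := fun i => cay (x i)) (fun y hy => ?_) fun h hh => ?_
  · obtain ⟨m0, m1, m2⟩ := mem_adjoin_triple (k := k) (x := cay (x 0)) (y := cay (x 1))
      (z := cay (x 2))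
    refine (adjoin_le_iff.mpr ?_ : _ ≤ adjoin k {cay (x 0), cay (x 1), cay (x 2)}) (hleX hy)
    rintro s (rfl | rfl | rfl)
    exacts [cay_mem.mp m0, cay_mem.mp m1, cay_mem.mp m2]
  · obtain ⟨w, hw⟩ := ht h hh
    have hm := exists_map_pairRatio hG.ne hw
    rcases Int.units_eq_one_or w.2 with e | e
    · exact ⟨ptnPerm w.1, 1, 0, fun i => by simp [map_cay, hx, hm, e]⟩
    · refine ⟨ptnPerm w.1, -1, 1, fun i => ?_⟩
      rw [map_cay, hx, hm, e, Units.val_neg, Units.val_one, zpow_neg_one, ← hx,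
        cay_inv (nx _).1 (nx _).2, map_neg, map_one]
      ring

/-- Projective actions containing the Klein four-group. -/
theorem proj_fixGen_of_klein [Finite H] (htr : 3 ≤ Algebra.trdeg k L) {y : Fin 4 → L}
    (h0 : ∀ i, y i ≠ 0) (hz : fixedField H ≤ adjoin k {y 0 / y 3, y 1 / y 3, y 2 / y 3})
    (hy : ∀ h ∈ H, ∃ w, ActProj y h w) {a b : Equiv.Perm (Fin 4)} (hg₁ : g₁ ∈ H) (hg₂ : g₂ ∈ H)
    (h1 : ActProj y g₁ (a, 1)) (h2 : ActProj y g₂ (b, 1)) (ha : ∀ i, a i = ![1, 0, 3, 2] i)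
    (hb : ∀ i, b i = ![2, 3, 0, 1] i) : FixGen H ⊤ 3 := by
  have hi := (spans_of_fixedField_le hz).algebraicIndependent htr
  have hs : y 0 + y 1 + y 2 + y 3 ≠ 0 := by
    have := aeval_ne_zero hi (X 0 + X 1 + X 2 + 1) (![0, 0, 0] : Fin 3 → k) (by simp)
    have e : y 0 / y 3 + y 1 / y 3 + y 2 / y 3 + 1 ≠ 0 := by simpa using this
    intro h
    apply e
    rw [← add_div, ← add_div, ← div_self (h0 3), ← add_div, h, zero_div]
  set t : Fin 4 → L := fun i => y i / (y 0 + y 1 + y 2 + y 3) with ht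
  have hsum : t 0 + t 1 + t 2 + t 3 = 1 := by
    rw [ht]; field_simp
  have hsum' : ∑ i, t i = 1 := by rw [Fin.sum_univ_four, hsum]
  have hdiv : ∀ i j, t i / t j = y i / y j := fun i j => div_div_div_cancel_right₀ hs _ _
  have hact : ∀ {h : L ≃ₐ[k] L} {w}, ActProj y h w → ActProj t h w := fun hw i j => by
    rw [hdiv, hdiv, hw]
  have hzt : fixedField H ≤ adjoin k {t 0, t 1, t 2} := fun s hs => by
    obtain ⟨m0, m1, m2⟩ := mem_adjoin_triple (k := k) (x := t 0) (y := t 1) (z := t 2)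
    have m3 : t 3 ∈ adjoin k {t 0, t 1, t 2} := by
      rw [show t 3 = 1 - t 0 - t 1 - t 2 by linear_combination hsum]
      exact sub_mem (sub_mem (sub_mem (one_mem _) m0) m1) m2
    refine (adjoin_le_iff.mpr ?_ : _ ≤ adjoin k {t 0, t 1, t 2}) (hz hs)
    rintro s (rfl | rfl | rfl) <;> rw [← hdiv]
    exacts [div_mem m0 m3, div_mem m1 m3, div_mem m2 m3]
  have hg : ∀ {g : L ≃ₐ[k] L} {c}, ActProj y g (c, 1) → ∀ i, g (t i) = t (c i) := fun hg i => by
    rw [(hact hg).of_sum_eq_one hsum']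
    simp [hsum']
  have hK : Klein t g₁ g₂ := by
    constructor <;> simp [hg h1, hg h2, ha, hb]
  have ht : ∀ h ∈ H, ∃ w, ActProj t h w := fun h hh => (hy h hh).imp fun _ => hact
  by_cases h2 : (2 : L) = 0
  · exact sum_fixGen_two htr h2 hsum hzt ht hK hg₁ hg₂
  · exact sum_fixGen_of_two_ne_zero htr h2 hsum hzt ht hK hg₁ hg₂

end

theorem adjoin_ratios {y : Fin 4 → L} (h0 : ∀ i, y i ≠ 0) :
    adjoin k {y 0 / y 3, y 1 / y 3, y 2 / y 3} =
      adjoin k (Set.range fun p : Fin 4 × Fin 4 => y p.1 / y p.2) := by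
  refine adjoin_congr ?_ ?_
  · rintro s (rfl | rfl | rfl)
    · exact subset_adjoin _ _ ⟨(0, 3), rfl⟩
    · exact subset_adjoin _ _ ⟨(1, 3), rfl⟩
    · exact subset_adjoin _ _ ⟨(2, 3), rfl⟩
  · rintro s ⟨⟨i, j⟩, rfl⟩
    have key : ∀ i, y i / y 3 ∈ adjoin k {y 0 / y 3, y 1 / y 3, y 2 / y 3} := by
      obtain ⟨m0, m1, m2⟩ := mem_adjoin_triple (k := k) (x := y 0 / y 3) (y := y 1 / y 3)
        (z := y 2 / y 3)
      intro i
      fin_cases i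
      exacts [m0, m1, m2, by simp only [Fin.reduceFinMk]; rw [div_self (h0 3)]; exact one_mem _]
    have := div_mem (key i) (key j)
    rwa [div_div_div_cancel_right₀ (h0 3)] at this

theorem adjoin_ratios_comp (y : Fin 4 → L) (τ : Equiv.Perm (Fin 4)) :
    (adjoin k (Set.range fun p : Fin 4 × Fin 4 => y (τ p.1) / y (τ p.2))) =
      adjoin k (Set.range fun p : Fin 4 × Fin 4 => y p.1 / y p.2) := by
  congr 1
  exact (Equiv.prodCongr τ τ).surjective.range_comp fun p : Fin 4 × Fin 4 => y p.1 / y p.2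

theorem ActProj.comp {n : ℕ} {y : Fin n → L} {h : L ≃ₐ[k] L} {w : Equiv.Perm (Fin n) × ℤˣ}
    (hw : ActProj y h w) (τ : Equiv.Perm (Fin n)) :
    ActProj (fun i => y (τ i)) h (τ⁻¹ * w.1 * τ, w.2) := fun i j => by
  simpa using hw (τ i) (τ j)

theorem actProj_one {n : ℕ} (y : Fin n → L) : ActProj (k := k) y 1 1 := fun i j => by simp

theorem actProj_mul {n : ℕ} (y : Fin n → L) (g h : L ≃ₐ[k] L) (a b : Equiv.Perm (Fin n) × ℤˣ)
    (hg : ActProj y g a) (hh : ActProj y h b) : ActProj y (g * h) (a * b) := fun i j => by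
  rw [AlgEquiv.mul_apply, hh i j, map_zpow₀, hg, ← zpow_mul]
  rfl

section
variable {H : Subgroup (L ≃ₐ[k] L)} {y : Fin 4 → L}

theorem add_ne_zero_of_ratios (htr : 3 ≤ Algebra.trdeg k L)
    (h0 : ∀ i, y i ≠ 0) (hz : Spans k {y 0 / y 3, y 1 / y 3, y 2 / y 3}) {i j : Fin 4}
    (hij : i ≠ j) : y i + y j ≠ 0 := by
  have hi := hz.algebraicIndependent htr
  have n0 := hi.ne_zero
  suffices ∀ i j : Fin 4, i < j → y i / y 3 + y j / y 3 ≠ 0 by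
    intro e
    rcases lt_or_gt_of_ne hij with hl | hl
    · exact this i j hl (by rw [← add_div, e, zero_div])
    · exact this j i hl (by rw [← add_div, add_comm, e, zero_div])
  have a01 := aeval_ne_zero hi (X 0 + X 1) (![1, 0, 0] : Fin 3 → k) (by simp)
  have a02 := aeval_ne_zero hi (X 0 + X 2) (![1, 0, 0] : Fin 3 → k) (by simp)
  have a12 := aeval_ne_zero hi (X 1 + X 2) (![0, 1, 0] : Fin 3 → k) (by simp)
  have a03 := aeval_ne_zero hi (X 0 + 1) (![0, 0, 0] : Fin 3 → k) (by simp)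
  have a13 := aeval_ne_zero hi (X 1 + 1) (![0, 0, 0] : Fin 3 → k) (by simp)
  have a23 := aeval_ne_zero hi (X 2 + 1) (![0, 0, 0] : Fin 3 → k) (by simp)
  have h33 : y 3 / y 3 = 1 := div_self (h0 3)
  intro i j hl
  fin_cases i <;> fin_cases j <;> first
    | (exfalso; revert hl; decide)
    | (simp only [Fin.zero_eta, Fin.mk_one, Fin.reduceFinMk, h33]
       first
        | simpa using a01 | simpa using a02 | simpa using a12
        | simpa using a03 | simpa using a13 | simpa using a23)

theorem perm_four_fixed : ∀ (c : Fin 4) (w : Equiv.Perm (Fin 4)), w c = c →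
    ∃ σ : Equiv.Perm (Fin 3), ∀ i, w (c.succAbove i) = c.succAbove (σ i) := by
  decide +kernel

/-- Projective actions fixing one of the four coordinates. -/
theorem proj_fixGen_of_fixed [Finite H] (htr : 3 ≤ Algebra.trdeg k L)
    (h0 : ∀ i, y i ≠ 0)
    (hz : fixedField H ≤ adjoin k (Set.range fun p : Fin 4 × Fin 4 => y p.1 / y p.2)) (c : Fin 4)
    (hy : ∀ h ∈ H, ∃ w, ActProj y h w ∧ w.1 c = c) : FixGen H ⊤ 3 := by
  have hs := spans_of_fixedField_le (hz.trans (adjoin_ratios h0).ge)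
  have nz : ∀ i : Fin 3, y (c.succAbove i) / y c ≠ 0 := fun i => div_ne_zero (h0 _) (h0 _)
  have n1 : ∀ i : Fin 3, 1 + y (c.succAbove i) / y c ≠ 0 := fun i => by
    rw [one_add_div (h0 c)]
    exact div_ne_zero (add_ne_zero_of_ratios htr h0 hs (Fin.succAbove_ne c i).symm) (h0 c)
  refine fixGen_of_actRefl htr (z := fun i => cay (y (c.succAbove i) / y c)) (hz.trans ?_)
    fun h hh => ?_
  · rw [adjoin_le_iff]
    rintro s ⟨⟨i, j⟩, rfl⟩
    set K := adjoin k {cay (y (c.succAbove 0) / y c), cay (y (c.succAbove 1) / y c),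
      cay (y (c.succAbove 2) / y c)} with hK
    have key : ∀ i, y i / y c ∈ K := by
      obtain ⟨m0, m1, m2⟩ := mem_adjoin_triple (k := k) (x := cay (y (c.succAbove 0) / y c))
        (y := cay (y (c.succAbove 1) / y c)) (z := cay (y (c.succAbove 2) / y c))
      intro i
      by_cases hi : i = c
      · rw [hi, div_self (h0 c)]; exact one_mem _
      · obtain ⟨j, rfl⟩ := Fin.exists_succAbove_eq hi
        fin_cases j
        exacts [cay_mem.mp m0, cay_mem.mp m1, cay_mem.mp m2]
    have := div_mem (key i) (key j)
    rwa [div_div_div_cancel_right₀ (h0 c)] at this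
  · obtain ⟨w, hw, hc⟩ := hy h hh
    obtain ⟨σ, hσ⟩ := perm_four_fixed c w.1 hc
    choose e he using fun i => cay_zpow (nz i) (n1 i) w.2
    refine ⟨(σ, fun i => e (σ i)), fun i => ?_⟩
    change h (cay _) = _
    rw [map_cay, hw, hc, hσ, he]

end

/-- The code `(i, j, k, s)` of a signed permutation of the square with diagonals `{0, 1}` and
`{2, 3}`. -/
abbrev DihCode := Bool × Bool × Bool × Bool

/-- The permutation `(01)^i (23)^j ((02)(13))^k` with the sign `s`. -/
def dih (e : DihCode) : Equiv.Perm (Fin 4) × ℤˣ :=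
  ((if e.1 then Equiv.swap 0 1 else 1) * (if e.2.1 then Equiv.swap 2 3 else 1) *
    (if e.2.2.1 then Equiv.swap 0 2 * Equiv.swap 1 3 else 1), if e.2.2.2 then -1 else 1)

/-- The product of codes. -/
def dmul (a b : DihCode) : DihCode :=
  (xor a.1 (if a.2.2.1 then b.2.1 else b.1), xor a.2.1 (if a.2.2.1 then b.1 else b.2.1),
    xor a.2.2.1 b.2.2.1, xor a.2.2.2 b.2.2.2)

theorem dih_dmul : ∀ a b, dih (dmul a b) = dih a * dih b := by
  decide +kernel

/-- The action of the permutation with code `e`, without its sign. -/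
def dpt (e : DihCode) : Fin 4 → Fin 4 := fun i =>
  (![if e.2.2.1 then (if e.2.1 then 3 else 2) else (if e.1 then 1 else 0),
    if e.2.2.1 then (if e.2.1 then 2 else 3) else (if e.1 then 0 else 1),
    if e.2.2.1 then (if e.1 then 1 else 0) else (if e.2.1 then 3 else 2),
    if e.2.2.1 then (if e.1 then 0 else 1) else (if e.2.1 then 2 else 3)] : Fin 4 → Fin 4) i

theorem dih_apply : ∀ e i, (dih e).1 i = dpt e i := by
  decide +kernel

/-- A coordinate on the square with diagonals `{0, 1}` and `{2, 3}`. -/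
def dihR (y : Fin 4 → L) : L := (y 0 + y 1) * (y 2 + y 3) / (y 2 * y 3)

/-- The conjugate of `dihR` under inversion. -/
def dihR' (y : Fin 4 → L) : L := (y 0 + y 1) * (y 2 + y 3) / (y 0 * y 1)

/-- The quotient of `dihR` by the coordinate `(y 0 + y 1) ^ 2 / (y 0 * y 1)`. -/
def dihQ (y : Fin 4 → L) : L := (y 2 + y 3) * (y 0 * y 1) / ((y 0 + y 1) * (y 2 * y 3))

section
variable {H : Subgroup (L ≃ₐ[k] L)} {y : Fin 4 → L} {h : L ≃ₐ[k] L} {e : DihCode}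

theorem ActProj.dih_apply (hw : ActProj y h (dih e)) (i j : Fin 4) :
    h (y i / y j) = (y (dpt e i) / y (dpt e j)) ^ ((dih e).2 : ℤ) := by
  rw [hw, Monomial3.dih_apply, Monomial3.dih_apply]

theorem ActProj.map_dihR (h0 : ∀ i, y i ≠ 0) (hw : ActProj y h (dih e)) :
    h (dihR y) = if xor e.2.2.1 e.2.2.2 then dihR' y else dihR y := by
  have n0 := h0 0
  have n1 := h0 1
  have n2 := h0 2
  have n3 := h0 3
  rw [show dihR y = (y 0 / y 3 + y 1 / y 3) * (1 + y 3 / y 2) by unfold dihR; field_simp]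
  simp only [map_mul, map_add, map_one, hw.dih_apply]
  obtain ⟨i, j, k, s⟩ := e
  rcases i <;> rcases j <;> rcases k <;> rcases s <;> simp [dpt, dih, dihR'] <;> field_simp <;>
    first | ring1 | (left; ring1)

theorem ActProj.map_dihQ (h0 : ∀ i, y i ≠ 0) (n01 : y 0 + y 1 ≠ 0) (n23 : y 2 + y 3 ≠ 0)
    (hw : ActProj y h (dih e)) (hs : e.2.2.2 = false) :
    h (dihQ y) = if e.2.2.1 then (dihQ y)⁻¹ else dihQ y := by
  have n0 := h0 0
  have n1 := h0 1
  have n2 := h0 2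
  have n3 := h0 3
  have n01' := add_comm (y 0) (y 1) ▸ n01
  have n23' := add_comm (y 2) (y 3) ▸ n23
  have e1 : y 1 / y 0 + 1 ≠ 0 := by rw [div_add_one n0]; exact div_ne_zero n01' n0
  rw [show dihQ y = (1 + y 3 / y 2) / (y 3 / y 0 + y 3 / y 1) by unfold dihQ; field_simp; ring]
  simp only [map_div₀ h (_ + _), map_add, map_one, hw.dih_apply]
  obtain ⟨i, j, k, s⟩ := e
  subst hs
  rcases i <;> rcases j <;> rcases k <;> simp [dpt, dih] <;> field_simp <;>
    ring

theorem ActProj.map_cay_dih (h0 : ∀ i, y i ≠ 0) (n01 : y 0 + y 1 ≠ 0) (n23 : y 2 + y 3 ≠ 0)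
    (hw : ActProj y h (dih e)) : ∃ r r' : Bool,
      (h (cay (y 0 / y 1)) = refl r (cay (y 0 / y 1)) ∧
        h (cay (y 2 / y 3)) = refl r' (cay (y 2 / y 3))) ∨
      (h (cay (y 0 / y 1)) = refl r (cay (y 2 / y 3)) ∧
        h (cay (y 2 / y 3)) = refl r' (cay (y 0 / y 1))) := by
  have ea : cay (y 1 / y 0) = 1 - cay (y 0 / y 1) := by
    rw [← cay_inv (div_ne_zero (h0 0) (h0 1)), inv_div]
    rw [one_add_div (h0 1), add_comm]
    exact div_ne_zero n01 (h0 1)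
  have eb : cay (y 3 / y 2) = 1 - cay (y 2 / y 3) := by
    rw [← cay_inv (div_ne_zero (h0 2) (h0 3)), inv_div]
    rw [one_add_div (h0 3), add_comm]
    exact div_ne_zero n23 (h0 3)
  simp only [map_cay, hw.dih_apply]
  obtain ⟨i, j, k, s⟩ := e
  refine ⟨xor s (if k then j else i), xor s (if k then i else j), ?_⟩
  rcases i <;> rcases j <;> rcases k <;> rcases s <;> simp [dpt, dih, refl, ea, eb]

theorem ratios_le_dihR (h0 : ∀ i, y i ≠ 0) (n01 : y 0 + y 1 ≠ 0) (n23 : y 2 + y 3 ≠ 0)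
    {K : IntermediateField k L} (ha : y 0 / y 1 ∈ K) (hb : y 2 / y 3 ∈ K) (hR : dihR y ∈ K) :
    adjoin k {y 0 / y 3, y 1 / y 3, y 2 / y 3} ≤ K := by
  have n0 := h0 0
  have n1 := h0 1
  have n2 := h0 2
  have n3 := h0 3
  have h13 : y 1 / y 3 ∈ K := by
    have : y 1 / y 3 = dihR y * (y 2 / y 3) / ((1 + y 0 / y 1) * (1 + y 2 / y 3)) := by
      unfold dihR
      rw [one_add_div n1, one_add_div n3, add_comm (y 1), add_comm (y 3)]
      field_simp
    rw [this]
    exact div_mem (mul_mem hR hb) (mul_mem (add_mem (one_mem _) ha) (add_mem (one_mem _) hb))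
  rw [adjoin_le_iff]
  rintro s (rfl | rfl | rfl)
  · rw [show y 0 / y 3 = y 0 / y 1 * (y 1 / y 3) by field_simp]
    exact mul_mem ha h13
  · exact h13
  · exact hb

theorem dihQ_ne_zero (htr : 3 ≤ Algebra.trdeg k L) (h0 : ∀ i, y i ≠ 0)
    (hz : Spans k {y 0 / y 3, y 1 / y 3, y 2 / y 3}) : 1 + dihQ y ≠ 0 := by
  have hi := hz.algebraicIndependent htr
  have n01 := add_ne_zero_of_ratios htr h0 hz (i := 0) (j := 1) (by decide)
  have n0 := h0 0
  have n1 := h0 1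
  have n2 := h0 2
  have n3 := h0 3
  have := aeval_ne_zero hi ((X 0 + X 1) * X 2 + (X 2 + 1) * (X 0 * X 1)) (![1, 0, 1] : Fin 3 → k)
    (by simp)
  have h : (y 0 / y 3 + y 1 / y 3) * (y 2 / y 3) + (y 2 / y 3 + 1) * (y 0 / y 3 * (y 1 / y 3)) ≠ 0 :=
    by simpa using this
  contrapose! h
  unfold dihQ at h
  field_simp at h ⊢
  linear_combination h

/-- The case where the action on the coordinate `dihR` is trivial. -/
theorem proj_fixGen_of_dihR [Finite H] (htr : 3 ≤ Algebra.trdeg k L) (h0 : ∀ i, y i ≠ 0)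
    (hz : fixedField H ≤ adjoin k (Set.range fun p : Fin 4 × Fin 4 => y p.1 / y p.2))
    (hy : ∀ h ∈ H, ∃ e, ActProj y h (dih e) ∧ xor e.2.2.1 e.2.2.2 = false) :
    FixGen H ⊤ 3 := by
  rw [← adjoin_ratios h0] at hz
  have n01 := add_ne_zero_of_ratios htr h0 (spans_of_fixedField_le hz) (i := 0) (j := 1) (by decide)
  have n23 := add_ne_zero_of_ratios htr h0 (spans_of_fixedField_le hz) (i := 2) (j := 3) (by decide)
  obtain ⟨m0, m1, m2⟩ := mem_adjoin_triple (k := k) (x := dihR y) (y := cay (y 0 / y 1))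
    (z := cay (y 2 / y 3))
  refine fixGen_of_fixed_coord htr (x := dihR y) (p := cay (y 0 / y 1)) (q := cay (y 2 / y 3))
    (hz.trans (ratios_le_dihR h0 n01 n23 (cay_mem.mp m1) (cay_mem.mp m2) m0)) (fun h hh => ?_)
    fun h hh => ?_
  · obtain ⟨e, hw, he⟩ := hy h hh
    exact ⟨false, by simp [hw.map_dihR h0, he, refl]⟩
  · obtain ⟨e, hw, -⟩ := hy h hh
    exact hw.map_cay_dih h0 n01 n23

/-- The case without inversions. -/
theorem proj_fixGen_of_dih_pos [Finite H] (htr : 3 ≤ Algebra.trdeg k L) (h0 : ∀ i, y i ≠ 0)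
    (hz : fixedField H ≤ adjoin k (Set.range fun p : Fin 4 × Fin 4 => y p.1 / y p.2))
    (hy : ∀ h ∈ H, ∃ e, ActProj y h (dih e) ∧ e.2.2.2 = false) :
    FixGen H ⊤ 3 := by
  rw [← adjoin_ratios h0] at hz
  have hs := spans_of_fixedField_le hz
  have n01 := add_ne_zero_of_ratios htr h0 hs (i := 0) (j := 1) (by decide)
  have n23 := add_ne_zero_of_ratios htr h0 hs (i := 2) (j := 3) (by decide)
  have n0 := h0 0
  have n1 := h0 1
  have n2 := h0 2
  have n3 := h0 3
  have nQ : dihQ y ≠ 0 := by unfold dihQ; positivity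
  obtain ⟨m0, m1, m2⟩ := mem_adjoin_triple (k := k) (x := cay (dihQ y)) (y := cay (y 0 / y 1))
    (z := cay (y 2 / y 3))
  refine fixGen_of_fixed_coord htr (x := cay (dihQ y)) (p := cay (y 0 / y 1))
    (q := cay (y 2 / y 3)) (hz.trans (ratios_le_dihR h0 n01 n23 (cay_mem.mp m1) (cay_mem.mp m2) ?_))
    (fun h hh => ?_) fun h hh => ?_
  · have : dihR y = dihQ y * ((1 + y 0 / y 1) ^ 2 / (y 0 / y 1)) := by
      unfold dihR dihQ
      field_simp
      ring
    rw [this]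
    have ma := cay_mem.mp m1
    exact mul_mem (cay_mem.mp m0) (div_mem (pow_mem (add_mem (one_mem _) ma) 2) ma)
  · obtain ⟨e, hw, he⟩ := hy h hh
    refine ⟨e.2.2.1, ?_⟩
    rw [map_cay, hw.map_dihQ h0 n01 n23 he]
    cases e.2.2.1
    · simp [refl]
    · simp [refl, cay_inv nQ (dihQ_ne_zero htr h0 hs)]
  · obtain ⟨e, hw, -⟩ := hy h hh
    exact hw.map_cay_dih h0 n01 n23

/-- The case where the inverse of the permutation `(01)(23)` occurs. -/
theorem proj_fixGen_of_dih_neg [Finite H] (htr : 3 ≤ Algebra.trdeg k L) (h0 : ∀ i, y i ≠ 0)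
    (hz : fixedField H ≤ adjoin k (Set.range fun p : Fin 4 × Fin 4 => y p.1 / y p.2))
    (hy : ∀ h ∈ H, ∃ e, ActProj y h (dih e)) {g : L ≃ₐ[k] L} (hg : g ∈ H)
    (hgy : ActProj y g (dih (true, true, false, true))) : FixGen H ⊤ 3 := by
  rw [← adjoin_ratios h0] at hz
  have hs := spans_of_fixedField_le hz
  have n01 := add_ne_zero_of_ratios htr h0 hs (i := 0) (j := 1) (by decide)
  have n23 := add_ne_zero_of_ratios htr h0 hs (i := 2) (j := 3) (by decide)
  have n0 := h0 0
  have n1 := h0 1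
  have n2 := h0 2
  have n3 := h0 3
  have hR : ∀ h ∈ H, h (dihR y + dihR' y) = dihR y + dihR' y := fun h hh => by
    obtain ⟨e, hw⟩ := hy h hh
    have hgR := hgy.map_dihR h0
    have hw3 := actProj_mul y h g _ _ hw hgy
    rw [← dih_dmul] at hw3
    have hw4 := hw3.map_dihR h0
    rw [AlgEquiv.mul_apply, hgR] at hw4
    simp only [dmul, Bool.xor_false, Bool.xor_true, Bool.not_false, if_true] at hw4
    rw [map_add, hw.map_dihR h0, hw4]
    cases e.2.2.1 <;> cases e.2.2.2 <;> simp [add_comm]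
  obtain ⟨m0, m1, m2⟩ := mem_adjoin_triple (k := k) (x := dihR y) (y := cay (y 0 / y 1))
    (z := cay (y 2 / y 3))
  obtain ⟨mT, mU, mV⟩ := mem_adjoin_triple (k := k) (x := dihR y + dihR' y) (y := cay (y 0 / y 1))
    (z := cay (y 2 / y 3))
  refine fixGen_of_fixed_coord htr (x := dihR y + dihR' y) (p := cay (y 0 / y 1))
    (q := cay (y 2 / y 3)) (fun s hsf => ?_) (fun h hh => ⟨false, by simpa [refl] using hR h hh⟩)
    fun h hh => ?_
  · have hsm := hz.trans (ratios_le_dihR h0 n01 n23 (cay_mem.mp m1) (cay_mem.mp m2) m0) hsf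
    have ma := cay_mem.mp mU
    have mb := cay_mem.mp mV
    have hga : g (y 0 / y 1) = y 0 / y 1 := by rw [hgy.dih_apply]; simp [dpt, dih]
    have hgb : g (y 2 / y 3) = y 2 / y 3 := by rw [hgy.dih_apply]; simp [dpt, dih]
    refine mem_of_fixed_quadratic (α := dihR y) (c := dihR y + dihR' y)
      (d := -((1 + y 0 / y 1) ^ 2 / (y 0 / y 1) * ((1 + y 2 / y 3) ^ 2 / (y 2 / y 3)))) (h := g)
      (adjoin.mono k _ _ ?_ hsm) mT ?_ ?_ ?_ ?_ (hsf ⟨g, hg⟩)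
    · rintro s (rfl | hs)
      exacts [by simp, by simp [hs]]
    · exact neg_mem (mul_mem (div_mem (pow_mem (add_mem (one_mem _) ma) 2) ma)
        (div_mem (pow_mem (add_mem (one_mem _) mb) 2) mb))
    · unfold dihR dihR'
      field_simp
      ring
    · rintro s (rfl | rfl | rfl)
      exacts [hR g hg, by rw [map_cay, hga], by rw [map_cay, hgb]]
    · rw [hgy.map_dihR h0]
      have hi := hs.algebraicIndependent htr
      have := aeval_ne_zero hi (X 0 * X 1 - X 2) (![0, 0, 1] : Fin 3 → k) (by simp)
      have h : y 0 / y 3 * (y 1 / y 3) - y 2 / y 3 ≠ 0 := by simpa using this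
      contrapose! h
      simp only [Bool.xor_true, Bool.not_false, reduceIte] at h
      unfold dihR dihR' at h
      field_simp at h ⊢
      linear_combination -h
  · obtain ⟨e, hw⟩ := hy h hh
    exact hw.map_cay_dih h0 n01 n23

end

/-- A set of codes closed under products contains one of the patterns used to construct
generators of the fixed field. -/
def DihPattern (l : List DihCode) : Prop :=
  (true, true, false, true) ∈ l ∨ ((true, true, false, false) ∈ l ∧ (false, false, true, false) ∈ l)

instance (l : List DihCode) : Decidable (DihPattern l) := by unfold DihPattern; infer_instance

theorem dihPattern_of_swap : ∀ g a b : DihCode, g.2.2.1 = true → xor a.2.2.1 a.2.2.2 = true →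
    b.2.2.2 = true →
    let l := [a, b, dmul g g, dmul g a, dmul g b, dmul a g, dmul a b, dmul b g,
      dmul (dmul g b) g, dmul (dmul a g) b, dmul (dmul b g) g, dmul (dmul b a) g,
      dmul (dmul b b) a, dmul (dmul (dmul b b) b) a]
    DihPattern (g :: l) ∨ ((true, false, false, true) ∈ l ∧ (false, true, false, true) ∈ l) ∨
      ((false, false, false, true) ∈ l ∧ g.1 = g.2.1) := by
  decide +kernel

theorem dihPattern_of_not_swap : ∀ b c d : DihCode, b.2.2.1 = false → c.2.2.1 = false →
    d.2.2.1 = false → b.2.2.2 = true → c.1 = true → d.2.1 = true →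
    let l := [b, c, d, dmul b c, dmul b d, dmul c d, dmul (dmul b c) d]
    (true, true, false, true) ∈ l ∨ ((true, false, false, true) ∈ l ∧
      (false, true, false, true) ∈ l) := by
  decide +kernel

theorem dihPattern_of_two_reflections : ∀ e : DihCode,
    xor e.2.2.2 (xor e.1 (xor e.2.1 e.2.2.1)) = true →
    DihPattern [e, dmul e (true, false, false, true), dmul e (false, true, false, true),
      dmul (dmul e (true, false, false, true)) (false, true, false, true),
      dmul (true, false, false, true) (false, true, false, true)] := by
  decide +kernel

theorem dihPattern_of_neg_one : ∀ e g : DihCode, g.2.2.1 = true → g.1 = g.2.1 →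
    (e.1 = false ∧ e.2.1 = false ∧ e.2.2.1 = false) ∨
    (e.1 = g.1 ∧ e.2.1 = g.1 ∧ e.2.2.1 = true) ∨
    DihPattern [e, dmul (false, false, false, true) e, dmul (dmul (dmul g e) g) e,
      dmul (false, false, false, true) (dmul (dmul (dmul g e) g) e), dmul g e,
      dmul (false, false, false, true) (dmul g e),
      dmul (dmul (dmul g (dmul g e)) g) (dmul g e),
      dmul (false, false, false, true) (dmul (dmul (dmul g (dmul g e)) g) (dmul g e))] := by
  decide +kernel

/-- The oriented edges of the square with diagonals `{0, 1}` and `{2, 3}`. -/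
def edge (i : Fin 4) : Fin 4 × Fin 4 := ![(0, 2), (1, 3), (2, 1), (3, 0)] i

theorem dih_edge : ∀ e : DihCode, xor e.2.2.2 (xor e.1 (xor e.2.1 e.2.2.1)) = false →
    ∃ w : Equiv.Perm (Fin 4), ∀ i, edge (w i) = if e.2.2.2 then
      (dpt e (edge i).2, dpt e (edge i).1) else (dpt e (edge i).1, dpt e (edge i).2) := by
  decide +kernel

section
variable {H : Subgroup (L ≃ₐ[k] L)} {y : Fin 4 → L}

theorem edge_fixGen_of_pos [Finite H] (htr : 3 ≤ Algebra.trdeg k L) (h0 : ∀ i, y i ≠ 0)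
    (hz : fixedField H ≤ adjoin k (Set.range fun p : Fin 4 × Fin 4 => y p.1 / y p.2))
    (hy : ∀ h ∈ H, ∃ e, ActProj y h (dih e) ∧ xor e.2.2.2 (xor e.1 (xor e.2.1 e.2.2.1)) = false)
    {g₁ g₂ : L ≃ₐ[k] L} (h1 : g₁ ∈ H) (h2 : g₂ ∈ H)
    (hg₁ : ActProj y g₁ (dih (true, true, false, false)))
    (hg₂ : ActProj y g₂ (dih (true, false, false, true))) : FixGen H ⊤ 3 := by
  have n0 := h0 0
  have n1 := h0 1
  have n2 := h0 2
  have n3 := h0 3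
  set x : Fin 4 → L := fun i => y (edge i).1 / y (edge i).2 with hx
  have x0 : x 0 = y 0 / y 2 := rfl
  have x1 : x 1 = y 1 / y 3 := rfl
  have x2 : x 2 = y 2 / y 1 := rfl
  have x3 : x 3 = y 3 / y 0 := rfl
  rw [← adjoin_ratios h0] at hz
  refine inv_fixGen_of_pos htr (x := x) (g₁ := g₁) (g₂ := g₂) ?_ (hz.trans ?_) (fun h hh => ?_)
    ?_ h1 h2
  · rw [x0, x1, x2, x3]; field_simp
  · obtain ⟨m0, m1, m2⟩ := mem_adjoin_triple (k := k) (x := x 0) (y := x 1) (z := x 2)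
    rw [adjoin_le_iff]
    rintro s (rfl | rfl | rfl)
    · rw [show y 0 / y 3 = x 0 * x 2 * x 1 by rw [x0, x1, x2]; field_simp]
      exact mul_mem (mul_mem m0 m2) m1
    · exact m1
    · rw [show y 2 / y 3 = x 2 * x 1 by rw [x1, x2]; field_simp]
      exact mul_mem m2 m1
  · obtain ⟨e, hw, he⟩ := hy h hh
    obtain ⟨w, hwe⟩ := dih_edge e he
    refine ⟨(w, 1), fun i => ?_, rfl⟩
    simp only [hx, hw.dih_apply, hwe]
    rcases hs : e.2.2.2 <;> simp [dih, hs]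
  · constructor <;> simp [x0, x1, x2, x3, hg₁.dih_apply, hg₂.dih_apply, dpt, dih]

theorem dih_fixGen_of_neg_one [Finite H] (htr : 3 ≤ Algebra.trdeg k L) (h0 : ∀ i, y i ≠ 0)
    (hz : fixedField H ≤ adjoin k (Set.range fun p : Fin 4 × Fin 4 => y p.1 / y p.2)) (c : Bool)
    (hy : ∀ h ∈ H, ∃ e, ActProj y h (dih e) ∧ ((e.1 = false ∧ e.2.1 = false ∧ e.2.2.1 = false) ∨
      (e.1 = c ∧ e.2.1 = c ∧ e.2.2.1 = true)))
    {g : L ≃ₐ[k] L} (hg : g ∈ H) (hgy : ActProj y g (dih (c, c, true, true))) : FixGen H ⊤ 3 := by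
  have key : ∃ τ : Equiv.Perm (Fin 4),
      (∀ e : DihCode, ((e.1 = false ∧ e.2.1 = false ∧ e.2.2.1 = false) ∨
        (e.1 = c ∧ e.2.1 = c ∧ e.2.2.1 = true)) →
        ∃ e', ((τ⁻¹ * (dih e).1 * τ, (dih e).2) : Equiv.Perm (Fin 4) × ℤˣ) = dih e') ∧
      ((τ⁻¹ * (dih (c, c, true, true)).1 * τ, (dih (c, c, true, true)).2) :
        Equiv.Perm (Fin 4) × ℤˣ) = dih (true, true, false, true) := by
    cases c
    · exact ⟨Equiv.swap 1 2, by decide +kernel, by decide +kernel⟩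
    · exact ⟨Equiv.swap 1 3, by decide +kernel, by decide +kernel⟩
  obtain ⟨τ, h1, h2⟩ := key
  refine proj_fixGen_of_dih_neg htr (y := fun i => y (τ i)) (fun i => h0 _)
    (by rwa [adjoin_ratios_comp]) (fun h hh => ?_) hg (h2 ▸ hgy.comp τ)
  obtain ⟨e, hw, he⟩ := hy h hh
  obtain ⟨e', he'⟩ := h1 e he
  exact ⟨e', he' ▸ hw.comp τ⟩

theorem dih_code_dpt : ∀ e : DihCode, e.2.2.1 = false → (e.1 = false → dpt e 0 = 0) ∧
    (e.2.1 = false → dpt e 2 = 2) := by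
  decide +kernel

/-- Projective actions preserving the partition `{{0, 1}, {2, 3}}`. -/
theorem proj_fixGen_of_dih [Finite H] (htr : 3 ≤ Algebra.trdeg k L) (h0 : ∀ i, y i ≠ 0)
    (hz : fixedField H ≤ adjoin k (Set.range fun p : Fin 4 × Fin 4 => y p.1 / y p.2))
    (hy : ∀ h ∈ H, ∃ e, ActProj y h (dih e)) : FixGen H ⊤ 3 := by
  obtain ⟨T, hT⟩ : ∃ T : Set DihCode, T = {e | ∃ h ∈ H, ActProj y h (dih e)} := ⟨_, rfl⟩
  have mem : ∀ {e}, e ∈ T ↔ ∃ h ∈ H, ActProj y h (dih e) := fun {e} => by rw [hT]; rfl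
  have mul : ∀ {a b}, a ∈ T → b ∈ T → dmul a b ∈ T := fun {a b} ha hb => by
    obtain ⟨g, hg, hga⟩ := mem.mp ha
    obtain ⟨h, hh, hhb⟩ := mem.mp hb
    exact mem.mpr ⟨g * h, mul_mem hg hh, dih_dmul a b ▸ actProj_mul y g h _ _ hga hhb⟩
  have act : ∀ {P : DihCode → Prop}, (∀ e ∈ T, P e) → ∀ h ∈ H, ∃ e, ActProj y h (dih e) ∧ P e :=
    fun hP h hh => (hy h hh).imp fun e he => ⟨he, hP e (mem.mpr ⟨h, hh, he⟩)⟩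
  have pattern : ∀ l, DihPattern l → (∀ e ∈ l, e ∈ T) → FixGen H ⊤ 3 := by
    rintro l (h | ⟨h, h'⟩) hl
    · obtain ⟨g, hg, hgy⟩ := mem.mp (hl _ h)
      exact proj_fixGen_of_dih_neg htr h0 hz hy hg hgy
    · obtain ⟨g, hg, hgy⟩ := mem.mp (hl _ h)
      obtain ⟨g', hg', hgy'⟩ := mem.mp (hl _ h')
      exact proj_fixGen_of_klein htr h0 (hz.trans (adjoin_ratios h0).ge)
        (fun h hh => (hy h hh).imp' _ fun e he => he) hg hg' hgy hgy'
        (by decide +kernel) (by decide +kernel)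
  have refls : (true, false, false, true) ∈ T → (false, true, false, true) ∈ T →
      FixGen H ⊤ 3 := by
    intro h1 h2
    by_cases hs : ∀ e ∈ T, xor e.2.2.2 (xor e.1 (xor e.2.1 e.2.2.1)) = false
    · obtain ⟨g₁, hg₁, ha⟩ := mem.mp (mul h1 h2)
      obtain ⟨g₂, hg₂, hb⟩ := mem.mp h1
      exact edge_fixGen_of_pos htr h0 hz (act hs) hg₁ hg₂ ha hb
    · push Not at hs
      obtain ⟨e, he, hes⟩ := hs
      refine pattern _ (dihPattern_of_two_reflections e (by simpa using hes)) ?_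
      simp only [List.mem_cons, List.not_mem_nil, or_false, forall_eq_or_imp, forall_eq]
      exact ⟨he, mul he h1, mul he h2, mul (mul he h1) h2, mul h1 h2⟩
  by_cases hpos : ∀ e ∈ T, e.2.2.2 = false
  · exact proj_fixGen_of_dih_pos htr h0 hz (act hpos)
  push Not at hpos
  obtain ⟨b, hb, hbs⟩ := hpos
  rw [ne_eq, Bool.not_eq_false] at hbs
  by_cases hsw : ∀ e ∈ T, e.2.2.1 = false
  · by_cases hi : ∀ e ∈ T, e.1 = false
    · refine proj_fixGen_of_fixed htr h0 hz 0 fun h hh => ?_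
      obtain ⟨e, he, h1, h2⟩ := act (P := fun e => e.2.2.1 = false ∧ e.1 = false)
        (fun e he => ⟨hsw e he, hi e he⟩) h hh
      exact ⟨dih e, he, by rw [dih_apply, (dih_code_dpt e h1).1 h2]⟩
    by_cases hj : ∀ e ∈ T, e.2.1 = false
    · refine proj_fixGen_of_fixed htr h0 hz 2 fun h hh => ?_
      obtain ⟨e, he, h1, h2⟩ := act (P := fun e => e.2.2.1 = false ∧ e.2.1 = false)
        (fun e he => ⟨hsw e he, hj e he⟩) h hh
      exact ⟨dih e, he, by rw [dih_apply, (dih_code_dpt e h1).2 h2]⟩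
    push Not at hi hj
    obtain ⟨c, hc, hci⟩ := hi
    obtain ⟨d, hd, hdj⟩ := hj
    have hl : ∀ e ∈ [b, c, d, dmul b c, dmul b d, dmul c d, dmul (dmul b c) d], e ∈ T := by
      simp only [List.mem_cons, List.not_mem_nil, or_false, forall_eq_or_imp, forall_eq]
      exact ⟨hb, hc, hd, mul hb hc, mul hb hd, mul hc hd, mul (mul hb hc) hd⟩
    rcases dihPattern_of_not_swap b c d (hsw b hb) (hsw c hc) (hsw d hd) hbs (by simpa using hci)
      (by simpa using hdj) with h | ⟨h, h'⟩
    · exact pattern _ (Or.inl h) hl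
    · exact refls (hl _ h) (hl _ h')
  push Not at hsw
  obtain ⟨g, hg, hgs⟩ := hsw
  rw [ne_eq, Bool.not_eq_false] at hgs
  by_cases hchi : ∀ e ∈ T, xor e.2.2.1 e.2.2.2 = false
  · exact proj_fixGen_of_dihR htr h0 hz (act hchi)
  push Not at hchi
  obtain ⟨a, ha, has⟩ := hchi
  rw [ne_eq, Bool.not_eq_false] at has
  have hl : ∀ e ∈ [a, b, dmul g g, dmul g a, dmul g b, dmul a g, dmul a b, dmul b g,
      dmul (dmul g b) g, dmul (dmul a g) b, dmul (dmul b g) g, dmul (dmul b a) g,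
      dmul (dmul b b) a, dmul (dmul (dmul b b) b) a], e ∈ T := by
    simp only [List.mem_cons, List.not_mem_nil, or_false, forall_eq_or_imp, forall_eq]
    exact ⟨ha, hb, mul hg hg, mul hg ha, mul hg hb, mul ha hg, mul ha hb, mul hb hg,
      mul (mul hg hb) hg, mul (mul ha hg) hb, mul (mul hb hg) hg, mul (mul hb ha) hg,
      mul (mul hb hb) ha, mul (mul (mul hb hb) hb) ha⟩
  rcases dihPattern_of_swap g a b hgs has hbs with h | ⟨h, h'⟩ | ⟨h, h'⟩
  · exact pattern _ h (List.forall_mem_cons.mpr ⟨hg, hl⟩)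
  · exact refls (hl _ h) (hl _ h')
  have hn := hl _ h
  by_cases hsub : ∀ e ∈ T, (e.1 = false ∧ e.2.1 = false ∧ e.2.2.1 = false) ∨
      (e.1 = g.1 ∧ e.2.1 = g.1 ∧ e.2.2.1 = true)
  · have hm : (g.1, g.1, true, true) ∈ T := by
      have h2 := mul hn hg
      obtain ⟨i, j, r, s⟩ := g
      simp only at hgs h'
      subst hgs h'
      cases s
      · simpa [dmul] using h2
      · exact hg
    obtain ⟨γ, hγ, hγy⟩ := mem.mp hm
    exact dih_fixGen_of_neg_one htr h0 hz g.1 (act hsub) hγ hγy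
  · push Not at hsub
    obtain ⟨e, he, h1, h2⟩ := hsub
    rcases dihPattern_of_neg_one e g hgs h' with h3 | h3 | h3
    · exact absurd h3.2.2 (by simpa using h1 h3.1 h3.2.1)
    · exact absurd h3.2.2 (by simpa using h2 h3.1 h3.2.1)
    · refine pattern _ h3 ?_
      have hge := mul hg he
      have hf : ∀ {f}, f ∈ T → dmul (dmul (dmul g f) g) f ∈ T := fun hf =>
        mul (mul (mul hg hf) hg) hf
      simp only [List.mem_cons, List.not_mem_nil, or_false, forall_eq_or_imp, forall_eq]
      exact ⟨he, mul hn he, hf he, mul hn (hf he), hge, mul hn hge, hf hge, mul hn (hf hge)⟩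

end

/-- A number identifying the image under `w` of a partition into pairs. -/
def ptnCode (w : Fin 4 → Fin 4) : Fin 3 → ℕ :=
  ptn (fun a b c d : ℕ => a * b + c * d) fun j => (w j : ℕ)

theorem ptnCode_perm (v w : Equiv.Perm (Fin 4)) (i : Fin 3) :
    ptnCode (fun j => v (w j)) i = ptnCode v (ptnPerm w i) :=
  ptn_perm w (fun a b c d : ℕ => a * b + c * d)
    (fun a b c d => ⟨congrArg (· + c * d) (mul_comm b a), add_comm _ _⟩) (fun j => (v j : ℕ)) i

theorem ptnCode_injective : Function.Injective (ptnCode fun j => j) := by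
  decide +kernel

theorem ptnPerm_mul (v w : Equiv.Perm (Fin 4)) : ptnPerm (v * w) = ptnPerm v * ptnPerm w := by
  ext1 i
  apply ptnCode_injective
  exact (ptnCode_perm 1 (v * w) i).symm.trans
    ((ptnCode_perm v w i).trans (ptnCode_perm 1 v (ptnPerm w i)))

theorem exists_conj_dih : ∀ i : Fin 3, ∃ τ : Equiv.Perm (Fin 4), ∀ w : Equiv.Perm (Fin 4),
    ptnCode w i = ptnCode (fun j => j) i → ∀ s : ℤˣ, ∃ e,
      ((τ⁻¹ * w * τ, s) : Equiv.Perm (Fin 4) × ℤˣ) = dih e := by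
  decide +kernel

theorem three_cycle_of_ptnCode : ∀ w : Equiv.Perm (Fin 4),
    (∀ i, ptnCode w i ≠ ptnCode (fun j => j) i) →
    (w * w * w * w = w ∧ Equiv.Perm.sign w = 1 ∧ ∃ c, w c = c ∧ ∀ v : Equiv.Perm (Fin 4), v c ≠ c →
      ∀ u : Equiv.Perm (Fin 4), Equiv.Perm.sign u = 1 →
      let d := v * w * v⁻¹
      u ∈ [1, w, d, w * w, w * d, d * w, d * d, w * w * d, w * d * d, d * w * d, d * d * w,
        d * w * w * d, d * d * w * w, d * d * w * d]) := by
  decide +kernel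

theorem ptnCode_eq_iff (w : Equiv.Perm (Fin 4)) (i : Fin 3) :
    ptnCode w i = ptnCode (fun j => j) i ↔ ptnPerm w i = i := by
  rw [show ptnCode w i = ptnCode (fun j => j) (ptnPerm w i) from ptnCode_perm 1 w i]
  exact ptnCode_injective.eq_iff

/-- Signed permutation groups on four letters have a fixed letter, or preserve a partition into
pairs, or contain the alternating group. -/
theorem signedPerm_cases (P : Subgroup (Equiv.Perm (Fin 4) × ℤˣ)) :
    (∃ c, ∀ w ∈ P, w.1 c = c) ∨
    (∃ τ : Equiv.Perm (Fin 4), ∀ w ∈ P, ∃ e, (τ⁻¹ * w.1 * τ, w.2) = dih e) ∨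
    ∀ u, Equiv.Perm.sign u = 1 → (u, 1) ∈ P := by
  by_cases hp : ∃ i, ∀ w ∈ P, ptnPerm w.1 i = i
  · obtain ⟨i, hi⟩ := hp
    obtain ⟨τ, hτ⟩ := exists_conj_dih i
    exact Or.inr (Or.inl ⟨τ, fun w hw => hτ w.1 ((ptnCode_eq_iff _ _).mpr (hi w hw)) w.2⟩)
  by_cases hf : ∃ c, ∀ w ∈ P, w.1 c = c
  · exact Or.inl hf
  push Not at hp hf
  obtain ⟨a, ha, ha0⟩ := hp 0
  obtain ⟨b, hb, hb1⟩ := hp 1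
  obtain ⟨c, hc, hc2⟩ := hp 2
  obtain ⟨w, hw, hw3⟩ : ∃ w ∈ P, ∀ i, ptnPerm w.1 i ≠ i := by
    obtain ⟨σ, hσ, h⟩ := exists_three_cycle _ _ _ ha0 hb1 hc2
    simp only [List.mem_cons, List.not_mem_nil, or_false, ← ptnPerm_mul] at hσ
    rcases hσ with rfl | rfl | rfl | rfl | rfl | rfl
    exacts [⟨a, ha, h⟩, ⟨b, hb, h⟩, ⟨c, hc, h⟩, ⟨a * b, mul_mem ha hb, h⟩,
      ⟨a * c, mul_mem ha hc, h⟩, ⟨b * c, mul_mem hb hc, h⟩]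
  obtain ⟨h4, -, c, -, hall⟩ := three_cycle_of_ptnCode w.1
    fun i => (ptnCode_eq_iff _ _).not.mpr (hw3 i)
  have hw1 : (w.1, (1 : ℤˣ)) ∈ P := by
    have := mul_mem (mul_mem (mul_mem hw hw) hw) hw
    have e : w * w * w * w = (w.1, 1) := by
      refine Prod.ext h4 ?_
      rcases Int.units_eq_one_or w.2 with e | e <;> simp [e]
    rwa [e] at this
  obtain ⟨v, hv, hvc⟩ := hf c
  have hd : (v.1 * w.1 * v.1⁻¹, (1 : ℤˣ)) ∈ P := by
    have := mul_mem (mul_mem hv hw1) (inv_mem hv)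
    have e : v * (w.1, 1) * v⁻¹ = (v.1 * w.1 * v.1⁻¹, 1) := Prod.ext rfl (by simp)
    rwa [e] at this
  refine Or.inr (Or.inr fun u hu => ?_)
  have key : ∀ {p q : Equiv.Perm (Fin 4)}, (p, (1 : ℤˣ)) ∈ P → (q, (1 : ℤˣ)) ∈ P →
      (p * q, (1 : ℤˣ)) ∈ P := fun hp hq => mul_mem hp hq
  have := hall v.1 hvc u hu
  generalize v.1 * w.1 * v.1⁻¹ = d at this hd
  simp only [List.mem_cons, List.not_mem_nil, or_false] at this
  rcases this with h | h | h | h | h | h | h | h | h | h | h | h | h | h <;> rw [h]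
  · exact one_mem _
  all_goals first
    | assumption
    | exact key ‹_› ‹_›
    | exact key (key ‹_› ‹_›) ‹_›
    | exact key (key (key ‹_› ‹_›) ‹_›) ‹_›

section
variable {H : Subgroup (L ≃ₐ[k] L)} {x y : Fin 4 → L}

/-- All projective actions by signed permutations of four elements. -/
theorem proj_fixGen [Finite H] (htr : 3 ≤ Algebra.trdeg k L) (h0 : ∀ i, y i ≠ 0)
    (hz : fixedField H ≤ adjoin k (Set.range fun p : Fin 4 × Fin 4 => y p.1 / y p.2))
    (hy : ∀ h ∈ H, ∃ w, ActProj y h w) : FixGen H ⊤ 3 := by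
  have mem : ∀ {w}, w ∈ realized H (ActProj y) (actProj_one y) (actProj_mul y) ↔
    ∃ h ∈ H, ActProj y h w := Iff.rfl
  rcases signedPerm_cases (realized H (ActProj y) (actProj_one y) (actProj_mul y)) with
    ⟨c, hc⟩ | ⟨τ, hτ⟩ | hA
  · exact proj_fixGen_of_fixed htr h0 hz c fun h hh =>
      (hy h hh).imp fun w hw => ⟨hw, hc w (mem.mpr ⟨h, hh, hw⟩)⟩
  · refine proj_fixGen_of_dih htr (y := fun i => y (τ i)) (fun i => h0 _)
      (by rwa [adjoin_ratios_comp]) fun h hh => ?_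
    obtain ⟨w, hw⟩ := hy h hh
    obtain ⟨e, he⟩ := hτ w (mem.mpr ⟨h, hh, hw⟩)
    exact ⟨e, he ▸ hw.comp τ⟩
  · obtain ⟨g₁, hg₁, h1⟩ := mem.mp (hA (Equiv.swap 0 1 * Equiv.swap 2 3) (by decide +kernel))
    obtain ⟨g₂, hg₂, h2⟩ := mem.mp (hA (Equiv.swap 0 2 * Equiv.swap 1 3) (by decide +kernel))
    exact proj_fixGen_of_klein htr h0 (hz.trans (adjoin_ratios h0).ge) hy hg₁ hg₂ h1 h2
      (by decide +kernel) (by decide +kernel)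

theorem edge_dih : ∀ e : DihCode, ∃ e' : DihCode, ∀ i, edge (dpt e i) =
    if xor e.2.2.2 e'.2.2.2 then (dpt e' (edge i).2, dpt e' (edge i).1)
      else (dpt e' (edge i).1, dpt e' (edge i).2) := by
  decide +kernel

/-- Signed permutations of the edges of a square come from signed permutations of its vertices. -/
theorem inv_fixGen_of_dih [Finite H] (htr : 3 ≤ Algebra.trdeg k L)
    (hprod : x 0 * x 1 * x 2 * x 3 = 1) (hz : fixedField H ≤ adjoin k (Set.range x))
    (hx : ∀ h ∈ H, ∃ e, ActInv x h (dih e)) : FixGen H ⊤ 3 := by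
  have hne := prod_four_ne_zero hprod
  have n1 := hne 1
  have n2 := hne 2
  have n3 := hne 3
  set y : Fin 4 → L := ![(x 3)⁻¹, x 1, x 1 * x 2, 1] with hy
  have y0 : y 0 = (x 3)⁻¹ := rfl
  have y1 : y 1 = x 1 := rfl
  have y2 : y 2 = x 1 * x 2 := rfl
  have y3 : y 3 = 1 := rfl
  have h0 : ∀ i, y i ≠ 0 := by
    intro i
    fin_cases i
    exacts [inv_ne_zero n3, n1, mul_ne_zero n1 n2, one_ne_zero]
  have hxy : ∀ i, x i = y (edge i).1 / y (edge i).2 := by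
    intro i
    fin_cases i
    · change x 0 = y 0 / y 2
      rw [y0, y2]
      field_simp
      linear_combination hprod
    · change x 1 = y 1 / y 3
      rw [y1, y3, div_one]
    · change x 2 = y 2 / y 1
      rw [y2, y1]
      field_simp
    · change x 3 = y 3 / y 0
      rw [y3, y0]
      simp
  refine proj_fixGen htr h0 (hz.trans (adjoin_le_iff.mpr ?_)) fun h hh => ?_
  · rintro s ⟨i, rfl⟩
    exact subset_adjoin _ _ ⟨edge i, (hxy i).symm⟩
  · obtain ⟨e, hw⟩ := hx h hh
    obtain ⟨e', he⟩ := edge_dih e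
    set s : ℤ := ((dih e').2 : ℤ) with hs
    let E : Fin 4 → Fin 4 → Prop := fun i j => h (y i / y j) = (y (dpt e' i) / y (dpt e' j)) ^ s
    have edges : ∀ i, E (edge i).1 (edge i).2 := by
      intro i
      have h1 := hw i
      rw [dih_apply, hxy, hxy (dpt e i), he i] at h1
      change h _ = _
      rw [h1]
      rcases h2 : e.2.2.2 <;> rcases h3 : e'.2.2.2 <;> simp [hs, dih, h2, h3]
    have symm : ∀ {i j}, E i j → E j i := fun {i j} hE => by
      change h _ = _
      rw [← inv_div, map_inv₀, hE, ← inv_zpow, inv_div]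
    have trans : ∀ {i j l}, E i j → E j l → E i l := fun {i j l} h1 h2 => by
      change h _ = _
      rw [← div_mul_div_cancel₀ (h0 j), map_mul, h1, h2, ← mul_zpow,
        div_mul_div_cancel₀ (h0 _)]
    have e02 : E 0 2 := edges 0
    have e13 : E 1 3 := edges 1
    have e21 : E 2 1 := edges 2
    have e30 : E 3 0 := edges 3
    have base : ∀ i, E i 0 := by
      intro i
      fin_cases i
      exacts [trans e02 (symm e02), trans e13 e30, symm e02, e30]
    refine ⟨dih e', fun i j => ?_⟩
    rw [dih_apply, dih_apply]
    exact trans (base i) (symm (base j))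

theorem ActInv.comp {n : ℕ} {x : Fin n → L} {h : L ≃ₐ[k] L} {w : Equiv.Perm (Fin n) × ℤˣ}
    (hw : ActInv x h w) (τ : Equiv.Perm (Fin n)) :
    ActInv (fun i => x (τ i)) h (τ⁻¹ * w.1 * τ, w.2) := fun i => by
  simpa using hw (τ i)

theorem adjoin_range_four (hprod : x 0 * x 1 * x 2 * x 3 = 1) :
    adjoin k (Set.range x) ≤ adjoin k {x 0, x 1, x 2} := by
  obtain ⟨m0, m1, m2⟩ := mem_adjoin_triple (k := k) (x := x 0) (y := x 1) (z := x 2)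
  rw [adjoin_le_iff]
  rintro s ⟨i, rfl⟩
  fin_cases i
  exacts [m0, m1, m2, prod_four_mem hprod m0 m1 m2 3]

/-- All actions by signed permutations of four elements with product one. -/
theorem inv_fixGen [Finite H] (htr : 3 ≤ Algebra.trdeg k L)
    (hprod : x 0 * x 1 * x 2 * x 3 = 1) (hz : fixedField H ≤ adjoin k (Set.range x))
    (hx : ∀ h ∈ H, ∃ w, ActInv x h w) : FixGen H ⊤ 3 := by
  have hne := prod_four_ne_zero hprod
  have hz3 := hz.trans (adjoin_range_four hprod)
  rcases signedPerm_cases (invGroup H x) with ⟨c, hc⟩ | ⟨τ, hτ⟩ | hA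
  · have hcx : ∀ h ∈ H, ∃ w, ActInv x h w ∧ w.1 c = c := fun h hh =>
      (hx h hh).imp fun w hw => ⟨hw, hc w ⟨h, hh, hw⟩⟩
    have n1 : ∀ i, 1 + x i ≠ 0 := by
      have hi := (spans_of_fixedField_le hz3).algebraicIndependent htr
      have a0 := aeval_ne_zero hi (1 + X 0) (![0, 0, 0] : Fin 3 → k) (by simp)
      have a1 := aeval_ne_zero hi (1 + X 1) (![0, 0, 0] : Fin 3 → k) (by simp)
      have a2 := aeval_ne_zero hi (1 + X 2) (![0, 0, 0] : Fin 3 → k) (by simp)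
      have a3 := aeval_ne_zero hi (X 0 * X 1 * X 2 + 1) (![0, 0, 0] : Fin 3 → k) (by simp)
      intro i
      fin_cases i
      · simpa using a0
      · simpa using a1
      · simpa using a2
      · have h : x 0 * x 1 * x 2 + 1 ≠ 0 := by simpa using a3
        simp only [Fin.reduceFinMk]
        contrapose! h
        linear_combination x 0 * x 1 * x 2 * h - hprod
    refine fixGen_of_actRefl htr (z := fun i => cay (x (c.succAbove i))) (hz.trans ?_)
      fun h hh => ?_
    · rw [adjoin_le_iff]
      obtain ⟨m0, m1, m2⟩ := mem_adjoin_triple (k := k) (x := cay (x (c.succAbove 0)))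
        (y := cay (x (c.succAbove 1))) (z := cay (x (c.succAbove 2)))
      have h3 : ∀ i : Fin 3, x (c.succAbove i) ∈ adjoin k {cay (x (c.succAbove 0)),
          cay (x (c.succAbove 1)), cay (x (c.succAbove 2))} := by
        intro i
        fin_cases i
        exacts [cay_mem.mp m0, cay_mem.mp m1, cay_mem.mp m2]
      rintro s ⟨i, rfl⟩
      by_cases hi : i = c
      · have hp : x c * ∏ j, x (c.succAbove j) = 1 := by
          rw [← Fin.prod_univ_succAbove x c, Fin.prod_univ_four, hprod]
        rw [hi, eq_inv_of_mul_eq_one_left hp]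
        exact inv_mem (prod_mem fun j _ => h3 j)
      · obtain ⟨j, rfl⟩ := Fin.exists_succAbove_eq hi
        exact h3 j
    · obtain ⟨w, hw, hcw⟩ := hcx h hh
      obtain ⟨σ, hσ⟩ := perm_four_fixed c w.1 hcw
      choose e he using fun i : Fin 3 => cay_zpow (hne (c.succAbove i)) (n1 (c.succAbove i)) w.2
      refine ⟨(σ, fun i => e (σ i)), fun i => ?_⟩
      change h (cay _) = _
      rw [map_cay, hw, hσ, he]
  · refine inv_fixGen_of_dih htr (x := fun i => x (τ i)) ?_ ?_ fun h hh => ?_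
    · have := Equiv.prod_comp τ x
      rw [Fin.prod_univ_four, Fin.prod_univ_four] at this
      exact this.trans hprod
    · rwa [show (Set.range fun i => x (τ i)) = Set.range x from τ.surjective.range_comp x]
    · obtain ⟨w, hw⟩ := hx h hh
      obtain ⟨e, he⟩ := hτ w ⟨h, hh, hw⟩
      exact ⟨e, he ▸ hw.comp τ⟩
  · obtain ⟨g₁, hg₁, h1⟩ := hA (Equiv.swap 0 1 * Equiv.swap 2 3) (by decide +kernel)
    obtain ⟨g₂, hg₂, h2⟩ := hA (Equiv.swap 0 2 * Equiv.swap 1 3) (by decide +kernel)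
    have e1 : ∀ i, g₁ (x i) = x (![1, 0, 3, 2] i) := fun i => by
      rw [h1 i, Units.val_one, zpow_one]
      congr 1
      revert i
      decide
    have e2 : ∀ i, g₂ (x i) = x (![2, 3, 0, 1] i) := fun i => by
      rw [h2 i, Units.val_one, zpow_one]
      congr 1
      revert i
      decide
    have hK : Klein x g₁ g₂ := by constructor <;> simp [e1, e2]
    by_cases hpos : ∀ w ∈ invGroup H x, w.2 = 1
    · exact inv_fixGen_of_pos htr hprod hz3
        (fun h hh => (hx h hh).imp fun w hw => ⟨hw, hpos w ⟨h, hh, hw⟩⟩) hK hg₁ hg₂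
    push Not at hpos
    obtain ⟨v, hv, hv1⟩ := hpos
    replace hv1 := (Int.units_eq_one_or v.2).resolve_left hv1
    by_cases hsign : ∀ w ∈ invGroup H x, w.2 = Equiv.Perm.sign w.1
    · obtain ⟨c, hc, hca⟩ := hA (Equiv.swap 1 3 * Equiv.swap 1 2) (by decide +kernel)
      have hd : ((Equiv.swap 2 3 : Equiv.Perm (Fin 4)), (-1 : ℤˣ)) ∈ invGroup H x := by
        have hs : Equiv.Perm.sign (Equiv.swap (2 : Fin 4) 3 * v.1⁻¹) = 1 := by
          rw [Equiv.Perm.sign_mul, Equiv.Perm.sign_inv, ← hsign v hv, hv1]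
          decide +kernel
        have := mul_mem (hA _ hs) hv
        have e : (Equiv.swap (2 : Fin 4) 3 * v.1⁻¹, (1 : ℤˣ)) * v = (Equiv.swap 2 3, -1) :=
          Prod.ext (by simp) (by simp [hv1])
        rwa [e] at this
      obtain ⟨d, hd, hdb⟩ := hd
      exact inv_fixGen_of_sign htr hprod hz3
        (fun h hh => (hx h hh).imp fun w hw => ⟨hw, hsign w ⟨h, hh, hw⟩⟩) hK hg₁ hg₂ hc hd hca hdb
        (by decide +kernel) (by decide +kernel)
    · push Not at hsign
      obtain ⟨w, hw, hws⟩ := hsign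
      obtain ⟨u, hu, hus, hu1⟩ : ∃ u ∈ invGroup H x, Equiv.Perm.sign u.1 = 1 ∧ u.2 = -1 := by
        rcases Int.units_eq_one_or (Equiv.Perm.sign v.1) with h | h
        · exact ⟨v, hv, h, hv1⟩
        rcases Int.units_eq_one_or (Equiv.Perm.sign w.1) with h' | h'
        · exact ⟨w, hw, h', (Int.units_eq_one_or w.2).resolve_left (h' ▸ hws)⟩
        · refine ⟨v * w, mul_mem hv hw, by simp [h, h'], ?_⟩
          have : w.2 = 1 := (Int.units_eq_one_or w.2).resolve_right (h' ▸ hws)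
          simp [hv1, this]
      have hm : ((1 : Equiv.Perm (Fin 4)), (-1 : ℤˣ)) ∈ invGroup H x := by
        have hs : Equiv.Perm.sign u.1⁻¹ = 1 := by rw [Equiv.Perm.sign_inv, hus]
        have := mul_mem (hA _ hs) hu
        have e : (u.1⁻¹, (1 : ℤˣ)) * u = (1, -1) := Prod.ext (by simp) (by simp [hu1])
        rwa [e] at this
      obtain ⟨g, hg, hgx⟩ := hm
      exact inv_fixGen_of_neg htr hprod hz3 hx hK hg₁ hg₂ hg fun i => by simpa using hgx i

end

/-- The Laurent monomial with exponent vector `v`. -/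
def mon (x : Fin 3 → L) (v : Fin 3 → ℤ) : L := ∏ i, x i ^ v i

section Mon

variable {x : Fin 3 → L}

theorem mon_zero : mon x 0 = 1 := by simp [mon]

theorem mon_single (j : Fin 3) : mon x (Pi.single j 1) = x j := by
  fin_cases j <;> simp [mon, Fin.prod_univ_three]

theorem mon_ne_zero (hx : ∀ i, x i ≠ 0) (v : Fin 3 → ℤ) : mon x v ≠ 0 :=
  Finset.prod_ne_zero_iff.mpr fun i _ => zpow_ne_zero _ (hx i)

theorem mon_add (hx : ∀ i, x i ≠ 0) (v w : Fin 3 → ℤ) : mon x (v + w) = mon x v * mon x w := by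
  simp [mon, zpow_add₀ (hx _), Finset.prod_mul_distrib]

theorem mon_zsmul (n : ℤ) (v : Fin 3 → ℤ) : mon x (n • v) = mon x v ^ n := by
  simp only [mon, Pi.smul_apply, smul_eq_mul, ← Finset.prod_zpow]
  exact Finset.prod_congr rfl fun i _ => by rw [mul_comm, zpow_mul]

theorem mon_sub (hx : ∀ i, x i ≠ 0) (v w : Fin 3 → ℤ) : mon x (v - w) = mon x v / mon x w := by
  rw [sub_eq_add_neg, mon_add hx, ← neg_one_zsmul, mon_zsmul, zpow_neg_one, div_eq_mul_inv]

theorem mon_sum (hx : ∀ i, x i ≠ 0) (c : Fin 3 → ℤ) (u : Fin 3 → Fin 3 → ℤ) :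
    mon x (∑ i, c i • u i) = mon (fun i => mon x (u i)) c := by
  simp only [Fin.sum_univ_three, mon_add hx, mon_zsmul]
  simp only [mon, Fin.prod_univ_three]

theorem map_mon (h : L ≃ₐ[k] L) (v : Fin 3 → ℤ) : h (mon x v) = mon (fun i => h (x i)) v := by
  simp [mon]

theorem mon_mem {K : IntermediateField k L} (hx : ∀ i, x i ∈ K) (v : Fin 3 → ℤ) : mon x v ∈ K :=
  prod_mem fun i _ => zpow_mem (hx i) _

theorem mon_injective (hx : AlgebraicIndependent k x) : Function.Injective (mon x) := by
  have h0 : ∀ i, x i ≠ 0 := hx.ne_zero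
  have key : ∀ v, mon x v = 1 → v = 0 := fun v hv => by
    let s : Fin 3 →₀ ℕ := Finsupp.equivFunOnFinite.symm fun i => (v i).toNat
    let t : Fin 3 →₀ ℕ := Finsupp.equivFunOnFinite.symm fun i => (-v i).toNat
    have hst : (∏ i, x i ^ s i) = ∏ i, x i ^ t i := by
      have h1 : mon x v * ∏ i, x i ^ t i = ∏ i, x i ^ s i := by
        rw [mon, ← Finset.prod_mul_distrib]
        refine Finset.prod_congr rfl fun i _ => ?_
        rw [← zpow_natCast, ← zpow_natCast, ← zpow_add₀ (h0 i)]
        congr 1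
        simp only [s, t, Finsupp.equivFunOnFinite_symm_apply_apply]
        omega
      rw [← h1, hv, one_mul]
    have h2 : MvPolynomial.monomial s (1 : k) = MvPolynomial.monomial t 1 := by
      apply hx
      simpa [MvPolynomial.aeval_monomial, Finsupp.prod_fintype] using hst
    have h3 : s = t := MvPolynomial.monomial_left_injective one_ne_zero h2
    funext i
    have := DFunLike.congr_fun h3 i
    simp only [s, t, Finsupp.equivFunOnFinite_symm_apply_apply] at this
    simp only [Pi.zero_apply]
    omega
  intro v w hvw
  refine sub_eq_zero.mp (key _ ?_)
  rw [mon_sub h0, hvw, div_self (mon_ne_zero h0 w)]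

theorem one_add_mon_ne_zero (hx : AlgebraicIndependent k x) {v : Fin 3 → ℤ} (hv : v ≠ 0) :
    1 + mon x v ≠ 0 := fun h => by
  have h1 : mon x v = -1 := by linear_combination h
  have h2 : mon x ((2 : ℤ) • v) = mon x 0 := by rw [mon_zsmul, h1, mon_zero]; norm_num
  exact hv ((smul_eq_zero.mp (mon_injective hx h2)).resolve_left two_ne_zero)

end Mon

/-- `h` acts on the monomials in `x` through the integral matrix `A`. -/
def MonAct (x : Fin 3 → L) (h : L ≃ₐ[k] L) (A : Matrix (Fin 3) (Fin 3) ℤ) : Prop :=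
  ∀ v, h (mon x v) = mon x (A.mulVec v)

theorem MonAct.of_vars {x : Fin 3 → L} (hx : ∀ i, x i ≠ 0) {h : L ≃ₐ[k] L}
    {A : Matrix (Fin 3) (Fin 3) ℤ} (hA : ∀ j, h (x j) = mon x (fun i => A i j)) :
    MonAct x h A := fun v => by
  rw [map_mon, funext hA, ← mon_sum hx]
  congr 1
  funext i
  simp [Matrix.mulVec, dotProduct, mul_comm]

theorem MonAct.mul_eq_one {x : Fin 3 → L} (hx : AlgebraicIndependent k x) {h : L ≃ₐ[k] L}
    {A A' : Matrix (Fin 3) (Fin 3) ℤ} (hA : MonAct x h A) (hA' : MonAct x h⁻¹ A') :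
    A * A' = 1 := by
  refine Matrix.mulVec_injective (funext fun v => mon_injective hx ?_)
  rw [← Matrix.mulVec_mulVec, ← hA, ← hA', Matrix.one_mulVec]
  exact h.apply_symm_apply _

/-- A finite group acting by monomials preserves a positive definite integral form. -/
theorem exists_invariant_form {x : Fin 3 → L} (hx : AlgebraicIndependent k x)
    {H : Subgroup (L ≃ₐ[k] L)} [Finite H] (hH : ∀ h ∈ H, ∃ A, MonAct x h A) :
    ∃ B : LinearMap.BilinForm ℤ (Fin 3 → ℤ), (∀ v w, B v w = B w v) ∧ (∀ v, v ≠ 0 → 0 < B v v) ∧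
      ∀ h ∈ H, ∀ A, MonAct x h A → ∀ v w, B (A.mulVec v) (A.mulVec w) = B v w := by
  classical
  have := Fintype.ofFinite H
  choose! A hA using hH
  have hinj := mon_injective hx
  have hmul : ∀ g ∈ H, ∀ h ∈ H, ∀ A', MonAct x h A' → A (g * h) = A g * A' :=
    fun g hg h hh A' hA' => by
    refine Matrix.mulVec_injective (funext fun v => hinj ?_)
    rw [← hA _ (mul_mem hg hh), ← Matrix.mulVec_mulVec, ← hA _ hg, ← hA', AlgEquiv.mul_apply]
  have hone : A 1 = 1 := by
    refine Matrix.mulVec_injective (funext fun v => hinj ?_)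
    rw [← hA _ (one_mem H), Matrix.one_mulVec, AlgEquiv.one_apply]
  let B : LinearMap.BilinForm ℤ (Fin 3 → ℤ) :=
    LinearMap.mk₂ ℤ (fun v w => ∑ h : H, (A h).mulVec v ⬝ᵥ (A h).mulVec w)
      (fun _ _ _ => by simp [Matrix.mulVec_add, Finset.sum_add_distrib])
      (fun _ _ _ => by simp only [Matrix.mulVec_smul, smul_dotProduct, Finset.smul_sum])
      (fun _ _ _ => by simp [Matrix.mulVec_add, Finset.sum_add_distrib])
      (fun _ _ _ => by simp only [Matrix.mulVec_smul, dotProduct_smul, Finset.smul_sum])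
  have hB : ∀ v w, B v w = ∑ h : H, (A h).mulVec v ⬝ᵥ (A h).mulVec w := fun _ _ => rfl
  have hnn : ∀ v : Fin 3 → ℤ, 0 ≤ v ⬝ᵥ v := fun v =>
    Finset.sum_nonneg fun i _ => mul_self_nonneg _
  refine ⟨B, fun v w => ?_, fun v hv => ?_, fun h hh A' hA' v w => ?_⟩
  · simp only [hB, dotProduct_comm]
  · rw [hB]
    refine Finset.sum_pos' (fun h _ => hnn _) ⟨1, Finset.mem_univ _, ?_⟩
    rw [OneMemClass.coe_one, hone, Matrix.one_mulVec]
    exact lt_of_le_of_ne (hnn v) fun h => hv (dotProduct_self_eq_zero.mp h.symm)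
  · simp only [hB]
    refine Fintype.sum_equiv (Equiv.mulRight (⟨h, hh⟩ : H)) _ _ fun g => ?_
    simp [hmul g g.2 h hh A' hA']

/-- Four vectors with sum zero that span. -/
def IsSuperbase {M : Type*} [AddCommGroup M] (u : Fin 4 → M) : Prop :=
  u 0 + u 1 + u 2 + u 3 = 0 ∧ ∀ m, ∃ c : Fin 4 → ℤ, m = ∑ i, c i • u i

theorem IsSuperbase.comp {M : Type*} [AddCommGroup M] {u : Fin 4 → M} (hu : IsSuperbase u)
    (σ : Equiv.Perm (Fin 4)) : IsSuperbase fun i => u (σ i) := by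
  refine ⟨?_, fun m => ?_⟩
  · have := Equiv.sum_comp σ u
    rw [Fin.sum_univ_four, Fin.sum_univ_four] at this
    exact this.trans hu.1
  · obtain ⟨c, hc⟩ := hu.2 m
    exact ⟨fun i => c (σ i), hc.trans (Equiv.sum_comp σ fun i => c i • u i).symm⟩

theorem IsSuperbase.span_three {M : Type*} [AddCommGroup M] {u : Fin 4 → M} (hu : IsSuperbase u)
    (m : M) : ∃ c : Fin 3 → ℤ, m = ∑ i, c i • u i.castSucc := by
  obtain ⟨c, hc⟩ := hu.2 m
  have h3 : u 3 = -(u 0 + u 1 + u 2) := (neg_eq_of_add_eq_zero_right hu.1).symm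
  refine ⟨![c 0 - c 3, c 1 - c 3, c 2 - c 3], ?_⟩
  rw [hc, Fin.sum_univ_four, Fin.sum_univ_three, h3]
  simp only [Matrix.cons_val, Fin.castSucc_zero, Fin.reduceCastSucc]
  module

theorem exists_perm_four {i j : Fin 4} (hij : i ≠ j) :
    ∃ σ : Equiv.Perm (Fin 4), σ 0 = i ∧ σ 1 = j := by
  revert i j
  decide +kernel

/-- Selling's reduction: every positive definite integral ternary form has an obtuse superbase. -/
theorem exists_obtuse_superbase {M : Type*} [AddCommGroup M] (B : LinearMap.BilinForm ℤ M)
    (hs : ∀ v w, B v w = B w v) (hp : ∀ v, 0 ≤ B v v) (hne : ∃ u : Fin 4 → M, IsSuperbase u) :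
    ∃ u : Fin 4 → M, IsSuperbase u ∧ ∀ i j, i ≠ j → B (u i) (u j) ≤ 0 := by
  let f : (Fin 4 → M) → ℕ := fun u => (∑ i, B (u i) (u i)).toNat
  obtain ⟨u, hu, hmin⟩ := WellFounded.has_min (measure f).wf {u | IsSuperbase u} hne
  refine ⟨u, hu, fun i j hij => ?_⟩
  by_contra! hpos
  obtain ⟨σ, rfl, rfl⟩ := exists_perm_four hij
  have hv := hu.comp σ
  refine hmin (![-u (σ 0), u (σ 1), u (σ 2) + u (σ 0), u (σ 3) + u (σ 0)]) ⟨?_, fun m => ?_⟩ ?_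
  · simp only [Matrix.cons_val]
    rw [← hv.1]
    abel
  · obtain ⟨c, hc⟩ := hv.2 m
    refine ⟨![c 2 + c 3 - c 0, c 1, c 2, c 3], ?_⟩
    rw [hc, Fin.sum_univ_four, Fin.sum_univ_four]
    simp only [Matrix.cons_val]
    module
  · change f _ < f u
    have hsum : ∑ i, B (u i) (u i) = ∑ i, B (u (σ i)) (u (σ i)) :=
      (Equiv.sum_comp σ fun i => B (u i) (u i)).symm
    have h1 : B (u (σ 0) + u (σ 1) + u (σ 2) + u (σ 3)) (u (σ 0)) = 0 := by rw [hv.1]; simp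
    have h2 := hs (u (σ 0)) (u (σ 1))
    have h3 := hs (u (σ 0)) (u (σ 2))
    have h4 := hs (u (σ 0)) (u (σ 3))
    set w := ![-u (σ 0), u (σ 1), u (σ 2) + u (σ 0), u (σ 3) + u (σ 0)] with hw
    have h5 : 0 ≤ ∑ i, B (w i) (w i) := Finset.sum_nonneg fun i _ => hp _
    have h6 : ∑ i, B (w i) (w i) < ∑ i, B (u i) (u i) := by
      rw [hsum]
      simp only [hw, Fin.sum_univ_four, Matrix.cons_val, map_add, map_neg, LinearMap.add_apply,
        LinearMap.neg_apply] at h1 ⊢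
      linarith
    exact (Int.toNat_lt_toNat (h5.trans_lt h6)).mpr h6

/-- The form with Selling parameters `p` for the pairs `01, 02, 12, 03, 13, 23`. -/
def selling (p : Fin 6 → ℤ) (v w : Fin 3 → ℤ) : ℤ :=
  p 0 * ((v 0 - v 1) * (w 0 - w 1)) + p 1 * ((v 0 - v 2) * (w 0 - w 2)) +
  p 2 * ((v 1 - v 2) * (w 1 - w 2)) + p 3 * (v 0 * w 0) + p 4 * (v 1 * w 1) + p 5 * (v 2 * w 2)

/-- The strict Voronoi vectors of a form. -/
def Relevant (p : Fin 6 → ℤ) (v : Fin 3 → ℤ) : Prop :=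
  v ≠ 0 ∧ ∀ w, w ≠ 0 → w ≠ v → 0 < selling p w (w - v)

theorem Relevant.neg {p : Fin 6 → ℤ} {v : Fin 3 → ℤ} (hv : Relevant p v) : Relevant p (-v) := by
  refine ⟨neg_ne_zero.mpr hv.1, fun w hw hwv => ?_⟩
  have := hv.2 (-w) (neg_ne_zero.mpr hw) fun h => hwv (by rw [← h, neg_neg])
  refine this.trans_eq ?_
  simp only [selling, Pi.neg_apply, Pi.sub_apply]
  ring

theorem Relevant.mulVec {p : Fin 6 → ℤ} {v : Fin 3 → ℤ} (hv : Relevant p v)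
    {A A' : Matrix (Fin 3) (Fin 3) ℤ} (hA : A * A' = 1)
    (hB : ∀ v w, selling p (A.mulVec v) (A.mulVec w) = selling p v w) :
    Relevant p (A.mulVec v) := by
  have h1 : ∀ w, A.mulVec (A'.mulVec w) = w := fun w => by
    rw [Matrix.mulVec_mulVec, hA, Matrix.one_mulVec]
  have h2 : ∀ w, A'.mulVec (A.mulVec w) = w := fun w => by
    rw [Matrix.mulVec_mulVec, mul_eq_one_comm.mp hA, Matrix.one_mulVec]
  refine ⟨fun h => hv.1 ?_, fun w hw hwv => ?_⟩
  · rw [← h2 v, h, Matrix.mulVec_zero]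
  · have := hv.2 (A'.mulVec w) (fun h => hw ?_) fun h => hwv ?_
    · rwa [← hB, Matrix.mulVec_sub, h1] at this
    · rw [← h1 w, h, Matrix.mulVec_zero]
    · rw [← h1 w, h]

theorem mul_half_nonneg {p : ℤ} (hp : 0 ≤ p) (a b : ℤ) :
    p * ((a / 2 - b / 2) * ((a / 2 - a) - (b / 2 - b))) ≤ 0 := by
  refine mul_nonpos_of_nonneg_of_nonpos hp ?_
  rcases le_total a b with h | h
  · exact mul_nonpos_of_nonpos_of_nonneg (by omega) (by omega)
  · exact mul_nonpos_of_nonneg_of_nonpos (by omega) (by omega)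

theorem Relevant.bounds {p : Fin 6 → ℤ} (hp : ∀ i, 0 ≤ p i) {v : Fin 3 → ℤ}
    (hv : Relevant p v) : (∀ i, v i = 0 ∨ v i = 1) ∨ ∀ i, v i = 0 ∨ v i = -1 := by
  by_contra! h
  obtain ⟨⟨i, hi⟩, j, hj⟩ := h
  have := hv.2 (fun i => v i / 2) (fun h => ?_) fun h => ?_
  · refine this.not_ge ?_
    have h0 := mul_half_nonneg (hp 0) (v 0) (v 1)
    have h1 := mul_half_nonneg (hp 1) (v 0) (v 2)
    have h2 := mul_half_nonneg (hp 2) (v 1) (v 2)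
    have h3 := mul_half_nonneg (hp 3) (v 0) 0
    have h4 := mul_half_nonneg (hp 4) (v 1) 0
    have h5 := mul_half_nonneg (hp 5) (v 2) 0
    simp only [Int.zero_ediv, sub_zero] at h3 h4 h5
    simp only [selling, Pi.sub_apply]
    linarith
  · have := congrFun h i
    simp only [Pi.zero_apply] at this
    omega
  · have := congrFun h j
    change v j / 2 = v j at this
    omega

theorem mul_sub_nonneg {e : ℤ} (h1 : -1 ≤ e) (h2 : e ≤ 1) (d : ℤ) : 0 ≤ d * (d - e) := by
  rcases le_or_gt d 0 with h | h
  · rcases h.eq_or_lt with rfl | h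
    · simp
    · exact mul_nonneg_of_nonpos_of_nonpos h.le (by omega)
  · exact mul_nonneg h.le (by omega)

/-- Criterion for a vector to be relevant. -/
theorem relevant_of {p : Fin 6 → ℤ} (hp : ∀ i, 0 ≤ p i) {v : Fin 3 → ℤ} (hv : v ≠ 0)
    (hb : (∀ i, v i = 0 ∨ v i = 1) ∨ ∀ i, v i = 0 ∨ v i = -1)
    (h : ∀ a b c : ℤ, (0 < p 0 → a - b = 0 ∨ a - b = v 0 - v 1) →
      (0 < p 1 → a - c = 0 ∨ a - c = v 0 - v 2) → (0 < p 2 → b - c = 0 ∨ b - c = v 1 - v 2) →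
      (0 < p 3 → a = 0 ∨ a = v 0) → (0 < p 4 → b = 0 ∨ b = v 1) → (0 < p 5 → c = 0 ∨ c = v 2) →
      (a = 0 ∧ b = 0 ∧ c = 0) ∨ (a = v 0 ∧ b = v 1 ∧ c = v 2)) : Relevant p v := by
  refine ⟨hv, fun w hw hwv => ?_⟩
  have key : ∀ i : Fin 6, ∀ d e : ℤ, -1 ≤ e → e ≤ 1 → 0 ≤ p i * (d * (d - e)) :=
    fun i d e h1 h2 => mul_nonneg (hp i) (mul_sub_nonneg h1 h2 d)
  have hd : ∀ i j, -1 ≤ v i - v j ∧ v i - v j ≤ 1 ∧ -1 ≤ v i ∧ v i ≤ 1 := fun i j => by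
    rcases hb with hb | hb <;> · have := hb i; have := hb j; omega
  have k0 := key 0 (w 0 - w 1) _ (hd 0 1).1 (hd 0 1).2.1
  have k1 := key 1 (w 0 - w 2) _ (hd 0 2).1 (hd 0 2).2.1
  have k2 := key 2 (w 1 - w 2) _ (hd 1 2).1 (hd 1 2).2.1
  have k3 := key 3 (w 0) _ (hd 0 0).2.2.1 (hd 0 0).2.2.2
  have k4 := key 4 (w 1) _ (hd 1 0).2.2.1 (hd 1 0).2.2.2
  have k5 := key 5 (w 2) _ (hd 2 0).2.2.1 (hd 2 0).2.2.2
  have hs : selling p w (w - v) = p 0 * ((w 0 - w 1) * (w 0 - w 1 - (v 0 - v 1))) +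
      p 1 * ((w 0 - w 2) * (w 0 - w 2 - (v 0 - v 2))) +
      p 2 * ((w 1 - w 2) * (w 1 - w 2 - (v 1 - v 2))) + p 3 * (w 0 * (w 0 - v 0)) +
      p 4 * (w 1 * (w 1 - v 1)) + p 5 * (w 2 * (w 2 - v 2)) := by
    simp only [selling, Pi.sub_apply]
    ring
  by_contra! hle
  have hz : ∀ i : Fin 6, ∀ d e : ℤ, p i * (d * (d - e)) = 0 → 0 < p i → d = 0 ∨ d = e :=
    fun i d e h1 h2 => by
      rcases mul_eq_zero.mp ((mul_eq_zero.mp h1).resolve_left h2.ne') with h | h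
      exacts [Or.inl h, Or.inr (sub_eq_zero.mp h)]
  rcases h (w 0) (w 1) (w 2) (hz 0 _ _ (by linarith)) (hz 1 _ _ (by linarith))
    (hz 2 _ _ (by linarith)) (hz 3 _ _ (by linarith)) (hz 4 _ _ (by linarith))
    (hz 5 _ _ (by linarith)) with ⟨h0, h1, h2⟩ | ⟨h0, h1, h2⟩
  · exact hw (funext fun i => by fin_cases i <;> assumption)
  · exact hwv (funext fun i => by fin_cases i <;> assumption)

theorem not_relevant {p : Fin 6 → ℤ} {v : Fin 3 → ℤ} (w : Fin 3 → ℤ) (hw : w ≠ 0) (hwv : w ≠ v)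
    (h : selling p w (w - v) = 0) : ¬ Relevant p v := fun hv => (hv.2 w hw hwv).ne' h

/-- Vectors with all entries in `{0, 1}` or all entries in `{0, -1}`, up to sign. -/
theorem bounded_cases {v : Fin 3 → ℤ} (h0 : v ≠ 0)
    (h : (∀ i, v i = 0 ∨ v i = 1) ∨ ∀ i, v i = 0 ∨ v i = -1) :
    ∃ u ∈ ([![1, 0, 0], ![0, 1, 0], ![0, 0, 1], ![1, 1, 1], ![1, 0, 1], ![0, 1, 1],
      ![1, 1, 0]] : List (Fin 3 → ℤ)), v = u ∨ v = -u := by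
  have hv : v = ![v 0, v 1, v 2] := by funext i; fin_cases i <;> rfl
  rcases h with h | h <;> rcases h 0 with h1 | h1 <;> rcases h 1 with h2 | h2 <;>
    rcases h 2 with h3 | h3 <;> rw [h1, h2, h3] at hv <;> rw [hv] at h0 ⊢ <;>
    first | exact absurd (by decide) h0 | decide

section

/-- Membership up to sign in a list of vectors. -/
def PM (R : List (Fin 3 → ℤ)) (v : Fin 3 → ℤ) : Prop := v ∈ R ∨ -v ∈ R

instance (R : List (Fin 3 → ℤ)) (v : Fin 3 → ℤ) : Decidable (PM R v) :=
  inferInstanceAs (Decidable (_ ∨ _))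

def rootsI : List (Fin 3 → ℤ) :=
  [![1, 0, 0], ![0, 1, 0], ![0, 0, 1], ![1, 1, 1], ![1, 0, 1], ![0, 1, 1], ![1, 1, 0]]

def rootsF : List (Fin 3 → ℤ) :=
  [![1, 0, 0], ![0, 1, 0], ![0, 0, 1], ![1, 1, 1], ![1, 0, 1], ![0, 1, 1]]

def rootsS : List (Fin 3 → ℤ) := [![1, 0, 0], ![0, 1, 0], ![0, 0, 1], ![0, 1, 1]]

def rootsP : List (Fin 3 → ℤ) := [![1, 0, 0], ![0, 1, 0], ![0, 0, 1]]

variable {p : Fin 6 → ℤ}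

theorem Relevant.pm {R S : List (Fin 3 → ℤ)} {v : Fin 3 → ℤ} (hv : Relevant p v)
    (hR : PM R v) (hS : ∀ u ∈ R, u ∉ S → ¬ Relevant p u) : PM S v := by
  rcases hR with h | h
  · exact Or.inl (by_contra fun h' => hS _ h h' hv)
  · exact Or.inr (by_contra fun h' => hS _ h h' hv.neg)

theorem Relevant.pm_rootsI (hp : ∀ i, 0 ≤ p i) {v : Fin 3 → ℤ} (hv : Relevant p v) :
    PM rootsI v := by
  obtain ⟨u, hu, rfl | rfl⟩ := bounded_cases hv.1 (hv.bounds hp)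
  · exact Or.inl hu
  · exact Or.inr (by rwa [neg_neg])

theorem Relevant.pm_rootsF (hp : ∀ i, 0 ≤ p i) (h0 : p 0 = 0) {v : Fin 3 → ℤ}
    (hv : Relevant p v) : PM rootsF v := by
  refine hv.pm (hv.pm_rootsI hp) fun u hu hu' => ?_
  simp only [rootsI, List.mem_cons, List.not_mem_nil, or_false] at hu
  rcases hu with rfl | rfl | rfl | rfl | rfl | rfl | rfl
  all_goals first | exact absurd (by decide) hu' | skip
  exact not_relevant ![1, 0, 0] (by decide) (by decide) (by simp [selling, h0])

theorem Relevant.pm_rootsS (hp : ∀ i, 0 ≤ p i) (h0 : p 0 = 0) (h1 : p 1 = 0) {v : Fin 3 → ℤ}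
    (hv : Relevant p v) : PM rootsS v := by
  refine hv.pm (hv.pm_rootsF hp h0) fun u hu hu' => ?_
  simp only [rootsF, List.mem_cons, List.not_mem_nil, or_false] at hu
  rcases hu with rfl | rfl | rfl | rfl | rfl | rfl
  all_goals first
    | exact absurd (by decide) hu'
    | exact not_relevant ![1, 0, 0] (by decide) (by decide) (by simp [selling, h0, h1])

theorem Relevant.pm_rootsP (hp : ∀ i, 0 ≤ p i) (h0 : p 0 = 0) (h1 : p 1 = 0) (h2 : p 2 = 0)
    {v : Fin 3 → ℤ} (hv : Relevant p v) : PM rootsP v := by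
  refine hv.pm (hv.pm_rootsS hp h0 h1) fun u hu hu' => ?_
  simp only [rootsS, List.mem_cons, List.not_mem_nil, or_false] at hu
  rcases hu with rfl | rfl | rfl | rfl
  all_goals first
    | exact absurd (by decide) hu'
    | exact not_relevant ![0, 1, 0] (by decide) (by decide) (by simp [selling, h0, h1, h2])

theorem relevant_rootsF (hp : ∀ i, 0 ≤ p i) (h1 : 0 < p 1) (h2 : 0 < p 2) (h3 : 0 < p 3)
    (h4 : 0 < p 4) : ∀ u ∈ rootsF, Relevant p u := by
  intro u hu
  simp only [rootsF, List.mem_cons, List.not_mem_nil, or_false] at hu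
  rcases hu with rfl | rfl | rfl | rfl | rfl | rfl <;>
  · refine relevant_of hp (by decide) (by decide) fun a b c k0 k1 k2 k3 k4 k5 => ?_
    have := k1 h1
    have := k2 h2
    have := k3 h3
    have := k4 h4
    simp only [Matrix.cons_val] at *
    omega

theorem relevant_rootsI (hp : ∀ i, 0 < p i) : ∀ u ∈ rootsI, Relevant p u := by
  intro u hu
  simp only [rootsI, List.mem_cons, List.not_mem_nil, or_false] at hu
  rcases hu with rfl | rfl | rfl | rfl | rfl | rfl | rfl <;>
  · refine relevant_of (fun i => (hp i).le) (by decide) (by decide)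
      fun a b c k0 k1 k2 k3 k4 k5 => ?_
    have := k0 (hp 0)
    have := k1 (hp 1)
    have := k2 (hp 2)
    have := k3 (hp 3)
    have := k4 (hp 4)
    have := k5 (hp 5)
    simp only [Matrix.cons_val] at *
    omega

theorem relevant_rootsS (hp : ∀ i, 0 ≤ p i) (h2 : 0 < p 2) (h3 : 0 < p 3)
    (h4 : 0 < p 4) (h5 : 0 < p 5) : ∀ u ∈ rootsS, Relevant p u := by
  intro u hu
  simp only [rootsS, List.mem_cons, List.not_mem_nil, or_false] at hu
  rcases hu with rfl | rfl | rfl | rfl <;>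
  · refine relevant_of hp (by decide) (by decide) fun a b c k0 k1 k2 k3 k4 k5 => ?_
    have := k2 h2
    have := k3 h3
    have := k4 h4
    have := k5 h5
    simp only [Matrix.cons_val] at *
    omega

theorem relevant_rootsP (hp : ∀ i, 0 ≤ p i) (h3 : 0 < p 3)
    (h4 : 0 < p 4) (h5 : 0 < p 5) : ∀ u ∈ rootsP, Relevant p u := by
  intro u hu
  simp only [rootsP, List.mem_cons, List.not_mem_nil, or_false] at hu
  rcases hu with rfl | rfl | rfl <;>
  · refine relevant_of hp (by decide) (by decide) fun a b c k0 k1 k2 k3 k4 k5 => ?_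
    have := k3 h3
    have := k4 h4
    have := k5 h5
    simp only [Matrix.cons_val] at *
    omega

end

/-- The determinant with columns `a`, `b`, `c`. -/
def det3 (a b c : Fin 3 → ℤ) : ℤ :=
  a 0 * (b 1 * c 2 - b 2 * c 1) - b 0 * (a 1 * c 2 - a 2 * c 1) + c 0 * (a 1 * b 2 - a 2 * b 1)

/-- A list of vectors together with their negatives. -/
def pmList (R : List (Fin 3 → ℤ)) : List (Fin 3 → ℤ) := R ++ R.map fun v => -v

theorem PM.mem {R : List (Fin 3 → ℤ)} {v : Fin 3 → ℤ} (h : PM R v) : v ∈ pmList R := by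
  rcases h with h | h
  · exact List.mem_append_left _ h
  · exact List.mem_append_right _ (List.mem_map.mpr ⟨_, h, neg_neg v⟩)

theorem aut_rootsP : ∀ a ∈ pmList rootsP, ∀ b ∈ pmList rootsP, ∀ c ∈ pmList rootsP,
    det3 a b c ≠ 0 → ∃ σ : Equiv.Perm (Fin 3), ∃ s : Fin 3 → ℤˣ,
      ∀ i, ![a, b, c] i = (s i : ℤ) • Pi.single (σ i) 1 := by
  decide +kernel

theorem aut_rootsS : ∀ a ∈ pmList rootsS, ∀ b ∈ pmList rootsS, ∀ c ∈ pmList rootsS,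
    PM rootsS (b + c) → det3 a b c ≠ 0 →
      (∃ s : ℤˣ, a = (s : ℤ) • ![1, 0, 0]) ∧ ∃ w : Equiv.Perm (Fin 3) × ℤˣ,
      ∀ i, ![b, c, -(b + c)] i = (w.2 : ℤ) •
        (![![0, 1, 0], ![0, 0, 1], ![0, -1, -1]] : Fin 3 → Fin 3 → ℤ) (w.1 i) := by
  decide +kernel

theorem aut_rootsI : ∀ a ∈ pmList rootsI, ∀ b ∈ pmList rootsI, PM rootsI (a + b) →
    ∀ c ∈ pmList rootsI, PM rootsI (a + c) → PM rootsI (b + c) → PM rootsI (a + b + c) →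
      det3 a b c ≠ 0 → ∃ w : Equiv.Perm (Fin 4) × ℤˣ,
      ∀ i, ![a, b, c, -(a + b + c)] i = (w.2 : ℤ) •
        (![![1, 0, 0], ![0, 1, 0], ![0, 0, 1], ![-1, -1, -1]] : Fin 4 → Fin 3 → ℤ) (w.1 i) := by
  decide +kernel

theorem aut_rootsF : ∀ a ∈ pmList rootsF, ∀ c ∈ pmList rootsF, PM rootsF (a + c) →
    ∀ b ∈ pmList rootsF, PM rootsF (b + c) → PM rootsF (a + b + c) →
      det3 a b c ≠ 0 → ∃ w : Equiv.Perm (Fin 4) × ℤˣ,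
      ∀ i j, (![0, c, b + c, -a] : Fin 4 → Fin 3 → ℤ) i - ![0, c, b + c, -a] j = (w.2 : ℤ) •
        ((![![0, 0, 0], ![0, 0, 1], ![0, 1, 1], ![-1, 0, 0]] : Fin 4 → Fin 3 → ℤ) (w.1 i) -
        ![![0, 0, 0], ![0, 0, 1], ![0, 1, 1], ![-1, 0, 0]] (w.1 j)) := by
  decide +kernel

section

/-- `H` acts on the monomials in `x` through isometries of the form with parameters `p`. -/
def Isometric (H : Subgroup (L ≃ₐ[k] L)) (x : Fin 3 → L) (p : Fin 6 → ℤ) : Prop :=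
  ∀ h ∈ H, ∃ A A' : Matrix (Fin 3) (Fin 3) ℤ, MonAct x h A ∧ A * A' = 1 ∧
    ∀ v w, selling p (A.mulVec v) (A.mulVec w) = selling p v w

variable {H : Subgroup (L ≃ₐ[k] L)} {x : Fin 3 → L} {p : Fin 6 → ℤ}

theorem Isometric.exists_columns (hp : Isometric H x p) {R : List (Fin 3 → ℤ)}
    (h1 : ∀ u ∈ R, Relevant p u) (h2 : ∀ v, Relevant p v → PM R v) {h : L ≃ₐ[k] L} (hh : h ∈ H) :
    ∃ a b c, det3 a b c ≠ 0 ∧ (∀ v, h (mon x v) = mon x (v 0 • a + v 1 • b + v 2 • c)) ∧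
      ∀ u ∈ R, PM R (u 0 • a + u 1 • b + u 2 • c) := by
  obtain ⟨A, A', hA, hAA, hB⟩ := hp h hh
  have hv : ∀ v : Fin 3 → ℤ, A.mulVec v =
      v 0 • (fun i => A i 0) + v 1 • (fun i => A i 1) + v 2 • (fun i => A i 2) := fun v => by
    funext i
    simp [Matrix.mulVec, dotProduct, Fin.sum_univ_three, mul_comm]
  refine ⟨fun i => A i 0, fun i => A i 1, fun i => A i 2, ?_, fun v => ?_, fun u hu => ?_⟩
  · have : A.det ≠ 0 := fun h0 => by
      have := congrArg Matrix.det hAA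
      simp [h0] at this
    rw [Matrix.det_fin_three] at this
    contrapose! this
    rw [← this, det3]
    ring
  · rw [← hv]
    exact hA v
  · rw [← hv]
    exact h2 _ ((h1 u hu).mulVec hAA hB)

theorem adjoin_range_le {n : ℕ} {y : Fin n → L} {K : IntermediateField k L} (h : ∀ i, y i ∈ K) :
    adjoin k (Set.range y) ≤ K :=
  adjoin_le_iff.mpr (Set.range_subset_iff.mpr h)

theorem fixGen_of_rootsP [Finite H] (htr : 3 ≤ Algebra.trdeg k L) (hx : AlgebraicIndependent k x)
    (hz : fixedField H ≤ adjoin k (Set.range x)) (hp : Isometric H x p)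
    (h1 : ∀ u ∈ rootsP, Relevant p u) (h2 : ∀ v, Relevant p v → PM rootsP v) :
    FixGen H ⊤ 3 := by
  have h0 := hx.ne_zero
  have hc : ∀ i, 1 + x i ≠ 0 := fun i => by
    have := one_add_mon_ne_zero hx (v := Pi.single i 1) (by simp)
    rwa [mon_single] at this
  refine fixGen_of_actRefl htr (z := fun i => cay (x i)) (hz.trans (adjoin_range_le fun i => ?_))
    fun h hh => ?_
  · obtain ⟨m0, m1, m2⟩ := mem_adjoin_triple (k := k) (x := cay (x 0)) (y := cay (x 1))
      (z := cay (x 2))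
    fin_cases i
    exacts [cay_mem.mp m0, cay_mem.mp m1, cay_mem.mp m2]
  · obtain ⟨a, b, c, hd, hm, hR⟩ := hp.exists_columns h1 h2 hh
    simp only [rootsP, List.forall_mem_cons, Matrix.cons_val, one_smul, zero_smul, add_zero,
      zero_add] at hR
    obtain ⟨ha, hb, hc', -⟩ := hR
    obtain ⟨σ, s, hs⟩ := aut_rootsP a ha.mem b hb.mem c hc'.mem hd
    choose e he using fun i => cay_zpow (h0 (σ i)) (hc (σ i)) (s i)
    refine ⟨(σ, e), fun i => ?_⟩
    have : h (x i) = x (σ i) ^ (s i : ℤ) := by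
      rw [← mon_single (x := x) (σ i), ← mon_zsmul, ← hs, ← mon_single (x := x) i, hm]
      congr 1
      fin_cases i <;> simp
    change h (cay _) = _
    rw [map_cay, this, he]

theorem fixGen_of_rootsS [Finite H] (htr : 3 ≤ Algebra.trdeg k L) (hx : AlgebraicIndependent k x)
    (hz : fixedField H ≤ adjoin k (Set.range x)) (hp : Isometric H x p)
    (h1 : ∀ u ∈ rootsS, Relevant p u) (h2 : ∀ v, Relevant p v → PM rootsS v) :
    FixGen H ⊤ 3 := by
  have h0 := hx.ne_zero
  let y : Fin 3 → Fin 3 → ℤ := ![![0, 1, 0], ![0, 0, 1], ![0, -1, -1]]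
  have e0 : mon x ![1, 0, 0] = x 0 := by simp [mon, Fin.prod_univ_three]
  have e1 : mon x (y 0) = x 1 := by simp [mon, y, Fin.prod_univ_three]
  have e2 : mon x (y 1) = x 2 := by simp [mon, y, Fin.prod_univ_three]
  refine hex_fixGen htr (x := fun i => mon x (y i)) (z := cay (x 0)) ?_
    (hz.trans (adjoin_range_le fun i => ?_)) (fun h hh => ?_) fun h hh => ?_
  · rw [← mon_add h0, ← mon_add h0, ← mon_zero (x := x)]
    congr 1
    decide
  · obtain ⟨m0, m1, m2⟩ := mem_adjoin_triple (k := k) (x := cay (x 0)) (y := mon x (y 0))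
      (z := mon x (y 1))
    fin_cases i
    exacts [cay_mem.mp m0, e1 ▸ m1, e2 ▸ m2]
  all_goals
    obtain ⟨a, b, c, hd, hm, hR⟩ := hp.exists_columns h1 h2 hh
    simp only [rootsS, List.forall_mem_cons, Matrix.cons_val, one_smul, zero_smul, add_zero,
      zero_add] at hR
    obtain ⟨ha, hb, hc, hbc, -⟩ := hR
    obtain ⟨⟨s, hs⟩, w, hw⟩ := aut_rootsS a ha.mem b hb.mem c hc.mem hbc hd
  · refine ⟨w, fun i => ?_⟩
    change h (mon x (y i)) = mon x (y (w.1 i)) ^ _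
    rw [← mon_zsmul, ← hw, hm]
    congr 1
    fin_cases i <;> simp [y]
    abel
  · have hc : 1 + x 0 ≠ 0 := e0 ▸ one_add_mon_ne_zero hx (by decide)
    have : h (x 0) = x 0 ^ (s : ℤ) := by
      rw [← e0, ← mon_zsmul, ← hs, hm]
      simp
    rw [map_cay, this]
    exact cay_zpow (h0 0) hc s

theorem fixGen_of_rootsI [Finite H] (htr : 3 ≤ Algebra.trdeg k L) (hx : AlgebraicIndependent k x)
    (hz : fixedField H ≤ adjoin k (Set.range x)) (hp : Isometric H x p)
    (h1 : ∀ u ∈ rootsI, Relevant p u) (h2 : ∀ v, Relevant p v → PM rootsI v) :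
    FixGen H ⊤ 3 := by
  have h0 := hx.ne_zero
  let y : Fin 4 → Fin 3 → ℤ := ![![1, 0, 0], ![0, 1, 0], ![0, 0, 1], ![-1, -1, -1]]
  have e : ∀ i : Fin 3, mon x (y i.castSucc) = x i := fun i => by
    fin_cases i <;> simp [mon, y, Fin.prod_univ_three]
  refine inv_fixGen htr (x := fun i => mon x (y i)) ?_
    (hz.trans (adjoin_range_le fun i => ?_)) (fun h hh => ?_)
  · rw [← mon_add h0, ← mon_add h0, ← mon_add h0, ← mon_zero (x := x)]
    congr 1
    decide
  · rw [← e i]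
    exact subset_adjoin k _ ⟨i.castSucc, rfl⟩
  · obtain ⟨a, b, c, hd, hm, hR⟩ := hp.exists_columns h1 h2 hh
    simp only [rootsI, List.forall_mem_cons, Matrix.cons_val, one_smul, zero_smul, add_zero,
      zero_add] at hR
    obtain ⟨ha, hb, hc, habc, hac, hbc, hab, -⟩ := hR
    obtain ⟨w, hw⟩ := aut_rootsI a ha.mem b hb.mem hab c hc.mem hac hbc habc hd
    refine ⟨w, fun i => ?_⟩
    change h (mon x (y i)) = mon x (y (w.1 i)) ^ _
    rw [← mon_zsmul, ← hw, hm]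
    congr 1
    fin_cases i <;> simp [y]
    abel

theorem fixGen_of_rootsF [Finite H] (htr : 3 ≤ Algebra.trdeg k L) (hx : AlgebraicIndependent k x)
    (hz : fixedField H ≤ adjoin k (Set.range x)) (hp : Isometric H x p)
    (h1 : ∀ u ∈ rootsF, Relevant p u) (h2 : ∀ v, Relevant p v → PM rootsF v) :
    FixGen H ⊤ 3 := by
  have h0 := hx.ne_zero
  let y : Fin 4 → Fin 3 → ℤ := ![![0, 0, 0], ![0, 0, 1], ![0, 1, 1], ![-1, 0, 0]]
  have e : ∀ i : Fin 3, x i = mon x (y (![0, 2, 1] i)) / mon x (y (![3, 1, 0] i)) := fun i => by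
    rw [← mon_sub h0]
    refine (mon_single i).symm.trans (congrArg _ ?_)
    revert i
    decide
  refine proj_fixGen htr (y := fun i => mon x (y i)) (fun i => mon_ne_zero h0 _)
    (hz.trans (adjoin_range_le fun i => ?_)) (fun h hh => ?_)
  · rw [e i]
    exact subset_adjoin k _ ⟨(_, _), rfl⟩
  · obtain ⟨a, b, c, hd, hm, hR⟩ := hp.exists_columns h1 h2 hh
    simp only [rootsF, List.forall_mem_cons, Matrix.cons_val, one_smul, zero_smul, add_zero,
      zero_add] at hR
    obtain ⟨ha, hb, hc, habc, hac, hbc, -⟩ := hR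
    obtain ⟨w, hw⟩ := aut_rootsF a ha.mem c hc.mem hac b hb.mem hbc habc hd
    have hy : ∀ i, h (mon x (y i)) = mon x ((![0, c, b + c, -a] : Fin 4 → Fin 3 → ℤ) i) :=
      fun i => by
      rw [hm]
      congr 1
      fin_cases i <;> simp [y]
    refine ⟨w, fun i j => ?_⟩
    change h (mon x (y i) / mon x (y j)) = (mon x (y (w.1 i)) / mon x (y (w.1 j))) ^ _
    rw [map_div₀, hy, hy, ← mon_sub h0, ← mon_sub h0, ← mon_zsmul, hw]

end

/-- The Selling parameters of a quadruple of vectors. -/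
def sellingParam {M : Type*} [AddCommGroup M] (B : LinearMap.BilinForm ℤ M) (u : Fin 4 → M) :
    Fin 6 → ℤ :=
  ![-B (u 0) (u 1), -B (u 0) (u 2), -B (u 1) (u 2), -B (u 0) (u 3), -B (u 1) (u 3), -B (u 2) (u 3)]

theorem IsSuperbase.selling_eq {M : Type*} [AddCommGroup M] {B : LinearMap.BilinForm ℤ M}
    (hs : ∀ v w, B v w = B w v) {u : Fin 4 → M} (hu : IsSuperbase u) (v w : Fin 3 → ℤ) :
    B (∑ i, v i • u i.castSucc) (∑ i, w i • u i.castSucc) = selling (sellingParam B u) v w := by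
  have h3 : u 3 = -(u 0 + u 1 + u 2) := (neg_eq_of_add_eq_zero_right hu.1).symm
  simp only [Fin.sum_univ_three, selling, sellingParam, Matrix.cons_val, h3, map_add, map_neg,
    map_zsmul, LinearMap.add_apply, LinearMap.smul_apply, Fin.castSucc_zero, Fin.reduceCastSucc,
    smul_eq_mul, Fin.castSucc_one, hs (u 1) (u 0), hs (u 2) (u 0), hs (u 2) (u 1)]
  ring

theorem algebraicIndependent_of_fixedField_le {H : Subgroup (L ≃ₐ[k] L)} [Finite H]
    (htr : 3 ≤ Algebra.trdeg k L) {x : Fin 3 → L} (hz : fixedField H ≤ adjoin k (Set.range x)) :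
    AlgebraicIndependent k x := by
  have hx : x = ![x 0, x 1, x 2] := by funext i; fin_cases i <;> rfl
  rw [hx] at hz ⊢
  rw [range_vec3] at hz
  exact (spans_of_fixedField_le hz).algebraicIndependent htr

section Reduction

variable {H : Subgroup (L ≃ₐ[k] L)} {x : Fin 3 → L}
  {B : LinearMap.BilinForm ℤ (Fin 3 → ℤ)} {u : Fin 4 → Fin 3 → ℤ}

theorem IsSuperbase.fixedField_le (hu : IsSuperbase u) (hx : ∀ i, x i ≠ 0)
    (hz : fixedField H ≤ adjoin k (Set.range x)) :
    fixedField H ≤ adjoin k (Set.range fun i : Fin 3 => mon x (u i.castSucc)) := by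
  refine hz.trans (adjoin_range_le fun i => ?_)
  obtain ⟨c, hc⟩ := hu.span_three (Pi.single i 1)
  rw [← mon_single (x := x) i, hc, mon_sum hx]
  exact mon_mem (fun j => subset_adjoin k _ (Set.mem_range_self j)) c

theorem IsSuperbase.isometric [Finite H] (hu : IsSuperbase u) (htr : 3 ≤ Algebra.trdeg k L)
    (hz : fixedField H ≤ adjoin k (Set.range x)) (hs : ∀ v w, B v w = B w v)
    (hH : ∀ h ∈ H, ∃ A, MonAct x h A)
    (hB : ∀ h ∈ H, ∀ A, MonAct x h A → ∀ v w, B (A.mulVec v) (A.mulVec w) = B v w) :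
    Isometric H (fun i : Fin 3 => mon x (u i.castSucc)) (sellingParam B u) := by
  have hx := (algebraicIndependent_of_fixedField_le htr hz).ne_zero
  have hx' := algebraicIndependent_of_fixedField_le htr (hu.fixedField_le hx hz)
  have key : ∀ h ∈ H, ∃ A : Matrix (Fin 3) (Fin 3) ℤ,
      MonAct (fun i : Fin 3 => mon x (u i.castSucc)) h A ∧ ∀ v w,
        selling (sellingParam B u) (A.mulVec v) (A.mulVec w) = selling (sellingParam B u) v w := by
    intro h hh
    obtain ⟨A, hA⟩ := hH h hh
    choose c hc using fun j : Fin 3 => hu.span_three (A.mulVec (u j.castSucc))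
    have hv : ∀ v : Fin 3 → ℤ, A.mulVec (∑ i, v i • u i.castSucc) =
        ∑ i, (Matrix.of fun i j => c j i).mulVec v i • u i.castSucc := fun v => by
      simp only [Matrix.mulVec_sum, Matrix.mulVec_smul, hc]
      simp only [Matrix.mulVec, dotProduct, Matrix.of_apply, Fin.sum_univ_three]
      module
    refine ⟨Matrix.of fun i j => c j i, fun v => ?_, fun v w => ?_⟩
    · rw [← mon_sum hx, ← mon_sum hx, hA, hv]
    · rw [← hu.selling_eq hs, ← hu.selling_eq hs, ← hv, ← hv, hB h hh A hA]
  intro h hh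
  obtain ⟨A, hA, hAB⟩ := key h hh
  obtain ⟨A', hA', -⟩ := key h⁻¹ (inv_mem hh)
  exact ⟨A, A', hA, hA.mul_eq_one hx' hA', hAB⟩

theorem IsSuperbase.diag_pos [Finite H] (hu : IsSuperbase u) (hs : ∀ v w, B v w = B w v)
    (hp : ∀ v, v ≠ 0 → 0 < B v v) (htr : 3 ≤ Algebra.trdeg k L)
    (hz : fixedField H ≤ adjoin k (Set.range x)) (v : Fin 3 → ℤ) (hv : v ≠ 0) :
    0 < selling (sellingParam B u) v v := by
  have hx := (algebraicIndependent_of_fixedField_le htr hz).ne_zero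
  have hx' := algebraicIndependent_of_fixedField_le htr (hu.fixedField_le hx hz)
  rw [← hu.selling_eq hs]
  refine hp _ fun h => hv (mon_injective hx' ?_)
  rw [← mon_sum hx, h, mon_zero, mon_zero]

/-- Finite groups of monomial automorphisms have rational fixed fields. -/
theorem fixGen_of_monAct [Finite H] (htr : 3 ≤ Algebra.trdeg k L)
    (hz : fixedField H ≤ adjoin k (Set.range x)) (hH : ∀ h ∈ H, ∃ A, MonAct x h A) :
    FixGen H ⊤ 3 := by
  have hx := algebraicIndependent_of_fixedField_le htr hz
  obtain ⟨B, hs, hp, hB⟩ := exists_invariant_form hx hH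
  have hpp : ∀ v, 0 ≤ B v v := fun v => by
    rcases eq_or_ne v 0 with rfl | h
    · simp
    · exact (hp v h).le
  obtain ⟨u, hu, hneg⟩ := exists_obtuse_superbase B hs hpp
    ⟨![![1, 0, 0], ![0, 1, 0], ![0, 0, 1], ![-1, -1, -1]], by decide, fun m =>
      ⟨![m 0, m 1, m 2, 0], by funext i; fin_cases i <;> simp [Fin.sum_univ_four]⟩⟩
  have hind : ∀ {v : Fin 4 → Fin 3 → ℤ}, IsSuperbase v → _ := fun hv =>
    algebraicIndependent_of_fixedField_le htr (hv.fixedField_le hx.ne_zero hz)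
  have orth : ∀ v : Fin 4 → Fin 3 → ℤ, IsSuperbase v → B (v 0) (v 1) = 0 → B (v 0) (v 2) = 0 →
      B (v 1) (v 2) = 0 → FixGen H ⊤ 3 := by
    intro v hv h0 h1 h2
    have hd := hv.diag_pos hs hp htr hz
    have d0 := hd ![1, 0, 0] (by decide)
    have d1 := hd ![0, 1, 0] (by decide)
    have d2 := hd ![0, 0, 1] (by decide)
    simp [selling, sellingParam, h0, h1, h2] at d0 d1 d2
    have hnn : ∀ i, 0 ≤ sellingParam B v i := fun i => by
      fin_cases i <;> simp [sellingParam, h0, h1, h2] <;> omega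
    refine fixGen_of_rootsP htr (hind hv) (hv.fixedField_le hx.ne_zero hz)
      (hv.isometric htr hz hs hH hB)
      (relevant_rootsP hnn ?_ ?_ ?_) fun w hw => hw.pm_rootsP hnn ?_ ?_ ?_
    all_goals simpa [sellingParam]
  have hnn : ∀ σ : Equiv.Perm (Fin 4), ∀ i, 0 ≤ sellingParam B (fun i => u (σ i)) i :=
    fun σ i => by
    have h : ∀ i j, i ≠ j → 0 ≤ -B (u (σ i)) (u (σ j)) := fun i j hij =>
      neg_nonneg.mpr (hneg _ _ (σ.injective.ne hij))
    fin_cases i <;> exact h _ _ (by decide)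
  have lt : ∀ i j, i ≠ j → B (u i) (u j) ≠ 0 → 0 < -B (u i) (u j) := fun i j hij h =>
    neg_pos.mpr (lt_of_le_of_ne (hneg i j hij) h)
  by_cases hall : ∀ i j, i ≠ j → B (u i) (u j) ≠ 0
  · have hpos : ∀ i, 0 < sellingParam B u i := fun i => by
      fin_cases i <;> exact lt _ _ (by decide) (hall _ _ (by decide))
    exact fixGen_of_rootsI htr (hind hu) (hu.fixedField_le hx.ne_zero hz)
      (hu.isometric htr hz hs hH hB) (relevant_rootsI hpos)
      fun w hw => hw.pm_rootsI fun i => (hpos i).le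
  push Not at hall
  obtain ⟨i, j, hij, h01⟩ := hall
  by_cases hadj : ∃ σ : Equiv.Perm (Fin 4), B (u (σ 0)) (u (σ 1)) = 0 ∧ B (u (σ 0)) (u (σ 2)) = 0
  · obtain ⟨σ, h0, h1⟩ := hadj
    have hv := hu.comp σ
    have e3 := (neg_eq_of_add_eq_zero_right hv.1).symm
    by_cases h2 : B (u (σ 1)) (u (σ 2)) = 0
    · exact orth _ hv h0 h1 h2
    have skew : ∀ τ : Equiv.Perm (Fin 4), B (u (τ 0)) (u (τ 1)) = 0 → B (u (τ 0)) (u (τ 2)) = 0 →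
        B (u (τ 1)) (u (τ 3)) = 0 → FixGen H ⊤ 3 := by
      intro τ t0 t1 t2
      have hv := hu.comp τ
      refine orth ![u (τ 0), u (τ 1), u (τ 1) + u (τ 2), u (τ 3) - u (τ 1)] ⟨?_, fun m => ?_⟩ ?_ ?_ ?_
      · rw [← hv.1]
        simp only [Matrix.cons_val]
        abel
      · obtain ⟨c, hc⟩ := hv.2 m
        refine ⟨![c 0, c 1 - c 2 + c 3, c 2, c 3], ?_⟩
        rw [hc, Fin.sum_univ_four, Fin.sum_univ_four]
        simp only [Matrix.cons_val]
        module
      · simpa using t0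
      · simp [t0, t1]
      · have := congrArg (B (u (τ 1))) hv.1
        simp only [map_add, map_zero] at this
        simp only [Matrix.cons_val, map_add]
        linarith [hs (u (τ 0)) (u (τ 1))]
    by_cases h4 : B (u (σ 1)) (u (σ 3)) = 0
    · exact skew σ h0 h1 h4
    by_cases h5 : B (u (σ 2)) (u (σ 3)) = 0
    · exact skew (σ * Equiv.swap 1 2) h1 h0 h5
    have d0 := hv.diag_pos hs hp htr hz ![1, 0, 0] (by decide)
    simp [selling, sellingParam, h0, h1] at d0
    have ne := σ.injective.ne (a₁ := 1) (a₂ := 2) (by decide)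
    refine fixGen_of_rootsS htr (hind hv) (hv.fixedField_le hx.ne_zero hz)
      (hv.isometric htr hz hs hH hB) (relevant_rootsS (hnn σ) ?_ ?_ ?_ ?_)
      fun w hw => hw.pm_rootsS (hnn σ) ?_ ?_
    · exact lt _ _ (σ.injective.ne (by decide)) h2
    · simpa [sellingParam] using d0
    · exact lt _ _ (σ.injective.ne (by decide)) h4
    · exact lt _ _ (σ.injective.ne (by decide)) h5
    · exact neg_eq_zero.mpr h0
    · exact neg_eq_zero.mpr h1
  · push Not at hadj
    obtain ⟨σ, rfl, rfl⟩ := exists_perm_four hij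
    have hv := hu.comp σ
    have h02 := hadj σ h01
    have h03 := hadj (σ * Equiv.swap 2 3) h01
    have h12 := hadj (σ * Equiv.swap 0 1) ((hs _ _).trans h01)
    have h13 := hadj (σ * Equiv.swap 0 1 * Equiv.swap 2 3) ((hs _ _).trans h01)
    refine fixGen_of_rootsF htr (hind hv) (hv.fixedField_le hx.ne_zero hz)
      (hv.isometric htr hz hs hH hB) (relevant_rootsF (hnn σ) ?_ ?_ ?_ ?_)
      fun w hw => hw.pm_rootsF (hnn σ) (neg_eq_zero.mpr h01)
    · exact lt _ _ (σ.injective.ne (by decide)) h02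
    · exact lt _ _ (σ.injective.ne (by decide)) h12
    · exact lt _ _ (σ.injective.ne (by decide)) h03
    · exact lt _ _ (σ.injective.ne (by decide)) h13

end Reduction

end Monomial3

/-- **Hajja–Kang / Hoshi–Rikuna.** Let `k` be a field and `G` a finite group acting on the
rational function field `k(x₁,x₂,x₃)` by purely monomial `k`-automorphisms, i.e. via a
homomorphism `ρ : G →* Aut_k(k(x₁,x₂,x₃))` such that every `ρ σ` sends each variable `x_j`
to the monomial `x₁^{a₁ⱼ} x₂^{a₂ⱼ} x₃^{a₃ⱼ}` with `[a_{ij}] ∈ GL₃(ℤ)`.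
Then the fixed field `k(x₁,x₂,x₃)^G` is `k`-rational. -/
theorem purely_monomial_action_dim_three_rational
    (k : Type*) [Field k] (G : Type*) [Group G] [Finite G]
    (ρ : G →* (FractionRing (MvPolynomial (Fin 3) k) ≃ₐ[k] FractionRing (MvPolynomial (Fin 3) k)))
    (hmono : ∀ σ : G, ∃ A : Matrix (Fin 3) (Fin 3) ℤ, IsUnit A.det ∧
      ∀ j : Fin 3, ρ σ (algebraMap (MvPolynomial (Fin 3) k) _ (X j)) =
        ∏ i : Fin 3, (algebraMap (MvPolynomial (Fin 3) k) _ (X i)) ^ (A i j)) :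
    IsRational k (IntermediateField.fixedField ρ.range) := by
  let x : Fin 3 → FractionRing (MvPolynomial (Fin 3) k) :=
    fun i => algebraMap (MvPolynomial (Fin 3) k) _ (MvPolynomial.X i)
  have hind : AlgebraicIndependent k x := by
    refine (MvPolynomial.algebraicIndependent_X (Fin 3) k).map'
      (f := IsScalarTower.toAlgHom k _ (FractionRing (MvPolynomial (Fin 3) k))) ?_
    exact IsFractionRing.injective _ _
  have htr : 3 ≤ Algebra.trdeg k (FractionRing (MvPolynomial (Fin 3) k)) := by
    simpa using hind.lift_cardinalMk_le_trdeg
  have htop : ∀ y, y ∈ IntermediateField.adjoin k (Set.range x) := fun y => by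
    have hp : ∀ q : MvPolynomial (Fin 3) k,
        algebraMap _ (FractionRing (MvPolynomial (Fin 3) k)) q ∈ IntermediateField.adjoin k (Set.range x) := by
      intro q
      induction q using MvPolynomial.induction_on with
      | C a => exact _root_.algebraMap_mem (IntermediateField.adjoin k (Set.range x)) a
      | add p q hp hq => rw [map_add]; exact add_mem hp hq
      | mul_X p i hp => rw [map_mul]; exact mul_mem hp (IntermediateField.subset_adjoin k _ ⟨i, rfl⟩)
    obtain ⟨a, b, -, rfl⟩ := IsFractionRing.div_surjective (A := MvPolynomial (Fin 3) k) y
    exact div_mem (hp a) (hp b)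
  have : Finite ρ.range := Set.finite_range ρ
  refine Monomial3.isRational_of_fixGen htr
    (Monomial3.fixGen_of_monAct htr (x := x) (fun y _ => htop y) ?_)
  rintro _ ⟨σ, rfl⟩
  obtain ⟨A, -, hA⟩ := hmono σ
  exact ⟨A, Monomial3.MonAct.of_vars hind.ne_zero hA⟩
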